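/- Let γ = 4/15 + Σ_{a=2}^∞ Σ_{1 ≤ b < a, gcd(a,b)=1} 2(3+(−1)^{a+b}) f(a,b), where f(a,b) = (20a^6 + 25a^5 b − 7a^4 b^2 + 28a^3 b^3 − 20a^2 b^4 + 3ab^5 − b^6)/(240 a^5 (a+b)^2 (a^2+b^2)). For every ε > 0 there exist a constant C > 0 and N ∈ ℕ such that for all n ≥ N, the number Q(n) of 4-element subsets of [n]^2 that lie on a common circle satisfies |Q(n) − γ n^5| ≤ C · n^{4 + 18/29 + ε}. -/

import Mathlib

/-- The grid `[n]^2`: points of `ℝ^2` with both coordinates integers in `{1, …, n}`. -/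
def grid (n : ℕ) : Set (EuclideanSpace ℝ (Fin 2)) :=
  {x | ∀ i, ∃ m : ℕ, 1 ≤ m ∧ m ≤ n ∧ x i = (m : ℝ)}

/-- The rational function `f(a,b)` from the definition of `γ`. -/
noncomputable def fab (a b : ℕ) : ℝ :=
  (20 * (a : ℝ) ^ 6 + 25 * (a : ℝ) ^ 5 * (b : ℝ) - 7 * (a : ℝ) ^ 4 * (b : ℝ) ^ 2
      + 28 * (a : ℝ) ^ 3 * (b : ℝ) ^ 3 - 20 * (a : ℝ) ^ 2 * (b : ℝ) ^ 4
      + 3 * (a : ℝ) * (b : ℝ) ^ 5 - (b : ℝ) ^ 6) /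
    (240 * (a : ℝ) ^ 5 * ((a : ℝ) + (b : ℝ)) ^ 2 * ((a : ℝ) ^ 2 + (b : ℝ) ^ 2))

/-- The constant `γ = 4/15 + Σ_{a≥2} Σ_{1 ≤ b < a, gcd(a,b)=1} 2(3+(−1)^{a+b}) f(a,b)`.
(The summands with `a < 2` are empty sums, so the outer sum may run over all of `ℕ`.) -/
noncomputable def gammaConst : ℝ :=
  4 / 15 + ∑' a : ℕ, ∑ b ∈ (Finset.Ico 1 a).filter (fun b => Nat.gcd a b = 1),
    2 * (3 + (-1 : ℝ) ^ (a + b)) * fab a b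

/-- `Q(n)`: the number of 4-element subsets of `[n]^2` lying on a common circle. -/
noncomputable def concyclicCount (n : ℕ) : ℕ :=
  {Q : Set (EuclideanSpace ℝ (Fin 2)) | Q ⊆ grid n ∧ Q.ncard = 4 ∧
    ∃ (c : EuclideanSpace ℝ (Fin 2)) (ρ : ℝ), 0 < ρ ∧ Q ⊆ Metric.sphere c ρ}.ncard

section Proof

open Finset
local notation "𝔾" => GaussianInt
set_option linter.unusedSimpArgs false

/-! ### General counting lemmas -/

lemma card_fib {α β : Type*} [DecidableEq β] (S : Finset α) (f : α → β) (T : Finset β) (B : ℝ)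
    (hT : ∀ a ∈ S, f a ∈ T) (h : ∀ b ∈ T, ((S.filter (fun a => f a = b)).card : ℝ) ≤ B) :
    (S.card : ℝ) ≤ B * T.card := by
  rw [Finset.card_eq_sum_card_fiberwise (f := f) (t := T) hT]
  push_cast
  calc _ ≤ ∑ _b ∈ T, B := Finset.sum_le_sum h
    _ = _ := by simp [mul_comm]

lemma card_fib' {α β : Type*} [DecidableEq β] (S : Finset α) (f : α → β) (T : Finset β) (B : ℝ)
    (hB : 0 ≤ B)
    (hT : ∀ a ∈ S, f a ∈ T) (h : ∀ x ∈ S, ((S.filter (fun a => f a = f x)).card : ℝ) ≤ B) :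
    (S.card : ℝ) ≤ B * T.card := by
  apply card_fib S f T B hT
  intro b _
  by_cases hb : ∃ x ∈ S, f x = b
  · obtain ⟨x, hx, rfl⟩ := hb
    exact h x hx
  · have : S.filter (fun a => f a = b) = ∅ := by
      ext a; simp; intro ha h1; exact hb ⟨a, ha, h1⟩
    rw [this]; simpa using hB

lemma card_Icc_le (x y : ℤ) (B : ℝ) (hB : 0 ≤ B) (h : (y : ℝ) - x + 1 ≤ B) :
    ((Finset.Icc x y).card : ℝ) ≤ B := by
  rw [Int.card_Icc]
  have h2 : (((y + 1 - x).toNat : ℤ) : ℝ) ≤ B := by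
    rw [Int.toNat_eq_max]
    push_cast
    apply max_le
    · linarith
    · exact hB
  exact_mod_cast h2

lemma pack_real {ι : Type*} (S : Finset ι) (φ : ι → ℝ) (R s K : ℝ) (hs : 0 < s) (hK : 0 ≤ K)
    (hR : 0 ≤ R) (hφ : ∀ x ∈ S, |φ x| ≤ R)
    (hsep : ∀ x ∈ S, ((S.filter (fun y => |φ y - φ x| < s)).card : ℝ) ≤ K) :
    (S.card : ℝ) ≤ K * (2 * (R / s) + 2) := by
  have h1 : (S.card : ℝ) ≤ K * (Finset.Icc (⌊-(R / s)⌋) (⌊R / s⌋)).card := by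
    apply card_fib' S (fun x => ⌊φ x / s⌋) _ K hK
    · intro a ha
      have := abs_le.mp (hφ a ha)
      rw [Finset.mem_Icc]
      constructor
      · apply Int.floor_le_floor
        rw [← neg_div]; gcongr; linarith
      · apply Int.floor_le_floor
        gcongr; linarith
    · intro x hx
      refine le_trans ?_ (hsep x hx)
      norm_cast
      apply Finset.card_le_card
      intro y hy
      rw [Finset.mem_filter] at hy ⊢
      refine ⟨hy.1, ?_⟩
      have := Int.abs_sub_lt_one_of_floor_eq_floor hy.2
      rw [← sub_div, abs_div, abs_of_pos hs, div_lt_one hs] at this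
      exact this
  refine h1.trans ?_
  gcongr
  apply card_Icc_le
  · positivity
  · have a1 := Int.floor_le (R / s)
    have a2 := Int.lt_floor_add_one (-(R / s))
    linarith

lemma pack_complex {ι : Type*} (S : Finset ι) (φ : ι → ℂ) (R s K : ℝ) (hs : 0 < s) (hK : 0 ≤ K)
    (hR : 0 ≤ R) (hφ : ∀ x ∈ S, ‖φ x‖ ≤ R)
    (hsep : ∀ x ∈ S, ((S.filter (fun y => ‖φ y - φ x‖ < s)).card : ℝ) ≤ K) :
    (S.card : ℝ) ≤ K * (32 * (R / s) ^ 2 + 8) := by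
  set I := (Finset.Icc (⌊-(2 * R / s)⌋) (⌊2 * R / s⌋)) with hI
  have key : ∀ t : ℝ, |t| ≤ R → ⌊2 * t / s⌋ ∈ I := by
    intro t ht
    have := abs_le.mp ht
    rw [hI, Finset.mem_Icc]
    constructor
    · apply Int.floor_le_floor
      rw [← neg_div]; gcongr; linarith
    · apply Int.floor_le_floor
      gcongr; linarith
  have h1 : (S.card : ℝ) ≤ K * (I ×ˢ I).card := by
    apply card_fib' S (fun x => (⌊2 * (φ x).re / s⌋, ⌊2 * (φ x).im / s⌋)) _ K hK
    · intro a ha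
      rw [Finset.mem_product]
      exact ⟨key _ ((Complex.abs_re_le_norm _).trans (hφ a ha)),
        key _ ((Complex.abs_im_le_norm _).trans (hφ a ha))⟩
    · intro x hx
      refine le_trans ?_ (hsep x hx)
      norm_cast
      apply Finset.card_le_card
      intro y hy
      rw [Finset.mem_filter] at hy ⊢
      refine ⟨hy.1, ?_⟩
      obtain ⟨h1, h2⟩ := Prod.mk.inj hy.2
      have a1 := Int.abs_sub_lt_one_of_floor_eq_floor h1
      have a2 := Int.abs_sub_lt_one_of_floor_eq_floor h2
      rw [← sub_div, abs_div, abs_of_pos hs, div_lt_one hs, ← mul_sub, abs_mul] at a1 a2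
      have := Complex.norm_le_abs_re_add_abs_im (φ y - φ x)
      simp only [Complex.sub_re, Complex.sub_im, abs_two] at *
      linarith
  refine h1.trans ?_
  gcongr
  rw [Finset.card_product]
  push_cast
  have h2 : (I.card : ℝ) ≤ 2 * (2 * R / s) + 2 := by
    apply card_Icc_le
    · positivity
    · have a1 := Int.floor_le (2 * R / s)
      have a2 := Int.lt_floor_add_one (-(2 * R / s))
      linarith
  have h0 : (0 : ℝ) ≤ I.card := by positivity
  have h3 : 2 * (2 * R / s) + 2 = 4 * (R / s) + 2 := by ring
  rw [h3] at h2
  nlinarith [sq_nonneg (4 * (R / s) - 2)]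

/-- packing with determinants -/
lemma pack_det {ι : Type*} (S : Finset ι) (x y : ι → ℝ) (δ Δ K : ℝ) (hδ : 0 < δ) (hK : 0 ≤ K)
    (hΔ : 0 ≤ Δ)
    (hup : ∀ p ∈ S, ∀ q ∈ S, |x p * y q - x q * y p| ≤ Δ)
    (hsep : ∀ p ∈ S, ((S.filter (fun q => |x p * y q - x q * y p| < δ)).card : ℝ) ≤ K) :
    (S.card : ℝ) ≤ K * (4 * (Δ / δ) + 4) := by
  classical
  rcases S.eq_empty_or_nonempty with rfl | hne
  · simp; positivity
  obtain ⟨⟨p, q⟩, hpq, hmax⟩ := Finset.exists_max_image (S ×ˢ S)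
    (fun z => |x z.1 * y z.2 - x z.2 * y z.1|) (hne.product hne)
  rw [Finset.mem_product] at hpq
  set D := x p * y q - x q * y p with hD
  have hmax' : ∀ a ∈ S, ∀ b ∈ S, |x a * y b - x b * y a| ≤ |D| := fun a ha b hb =>
    hmax (a, b) (Finset.mem_product.mpr ⟨ha, hb⟩)
  have hDΔ : |D| ≤ Δ := hup p hpq.1 q hpq.2
  by_cases hDδ : |D| < δ
  · have : (S.card : ℝ) ≤ K := by
      refine le_trans ?_ (hsep p hpq.1)
      norm_cast
      apply Finset.card_le_card
      intro r hr
      rw [Finset.mem_filter]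
      exact ⟨hr, (hmax' p hpq.1 r hr).trans_lt hDδ⟩
    have : 0 ≤ Δ / δ := by positivity
    nlinarith
  push Not at hDδ
  have hD0 : 0 < |D| := hδ.trans_le hDδ
  have hDne : D ≠ 0 := abs_pos.mp hD0
  -- coordinates
  set X : ι → ℝ := fun r => (x r * y q - x q * y r) / D with hX
  set Y : ι → ℝ := fun r => (x p * y r - x r * y p) / D with hY
  have hX1 : ∀ r ∈ S, |X r| ≤ 1 := by
    intro r hr
    rw [hX]; simp only
    rw [abs_div, div_le_one hD0]; exact hmax' r hr q hpq.2
  have hY1 : ∀ r ∈ S, |Y r| ≤ 1 := by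
    intro r hr
    rw [hY]; simp only
    rw [abs_div, div_le_one hD0]; exact hmax' p hpq.1 r hr
  have hdet : ∀ r s, x r * y s - x s * y r = D * (X r * Y s - X s * Y r) := by
    intro r s
    simp only [hX, hY]
    field_simp
    rw [hD]; ring
  have gen : ∀ (U V : ι → ℝ), (∀ r ∈ S, |V r| ≤ 1) →
      (∀ r s, |x r * y s - x s * y r| = |D| * |U r * V s - U s * V r|) →
      ((S.filter (fun r => |U r| ≤ |V r|)).card : ℝ) ≤ K * (2 * (1 / (δ / |D|)) + 2) := by
    intro U V hV hUV
    apply pack_real _ (fun r => U r / V r) 1 (δ / |D|) K (by positivity) hK zero_le_one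
    · intro r hr
      rw [Finset.mem_filter] at hr
      rw [abs_div]
      exact div_le_one_of_le₀ hr.2 (abs_nonneg _)
    · intro r hr
      rw [Finset.mem_filter] at hr
      refine le_trans ?_ (hsep r hr.1)
      norm_cast
      apply Finset.card_le_card
      intro s hs
      rw [Finset.mem_filter, Finset.mem_filter] at hs
      rw [Finset.mem_filter]
      refine ⟨hs.1.1, ?_⟩
      rw [hUV]
      by_cases h0 : V r * V s = 0
      · have : U r * V s - U s * V r = 0 := by
          rcases mul_eq_zero.mp h0 with h | h
          · have : U r = 0 := by have := hr.2; rw [h] at this; simpa using this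
            rw [this, h]; ring
          · have : U s = 0 := by have := hs.1.2; rw [h] at this; simpa using this
            rw [this, h]; ring
        rw [this]; simpa using hδ
      · have hr0 : V r ≠ 0 := left_ne_zero_of_mul h0
        have hs0 : V s ≠ 0 := right_ne_zero_of_mul h0
        have h2 : U r * V s - U s * V r = -(U s / V s - U r / V r) * (V r * V s) := by
          field_simp; ring
        rw [h2, abs_mul, abs_neg, abs_mul]
        have b1 := hV r hr.1
        have b2 := hV s hs.1.1
        have b3 := hs.2
        rw [lt_div_iff₀ hD0] at b3
        have b4 : |V r| * |V s| ≤ 1 := mul_le_one₀ b1 (abs_nonneg _) b2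
        calc |D| * (|U s / V s - U r / V r| * (|V r| * |V s|))
            = (|U s / V s - U r / V r| * |D|) * (|V r| * |V s|) := by ring
          _ ≤ (|U s / V s - U r / V r| * |D|) * 1 := by gcongr
          _ < δ := by linarith
  have g1 := gen X Y hY1 (fun r s => by rw [hdet, abs_mul])
  have g2 := gen Y X hX1 (fun r s => by
    rw [hdet, abs_mul]; congr 1; rw [← abs_neg]; congr 1; ring)
  have hle : (S.card : ℝ) ≤ ((S.filter (fun r => |X r| ≤ |Y r|)).card : ℝ) +
      ((S.filter (fun r => |Y r| ≤ |X r|)).card : ℝ) := by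
    norm_cast
    refine le_trans (Finset.card_le_card ?_) (Finset.card_union_le _ _)
    intro r hr
    rw [Finset.mem_union, Finset.mem_filter, Finset.mem_filter]
    rcases le_total |X r| |Y r| with h | h
    · exact Or.inl ⟨hr, h⟩
    · exact Or.inr ⟨hr, h⟩
  have h5 : 1 / (δ / |D|) ≤ Δ / δ := by
    rw [one_div_div]; gcongr
  nlinarith

/-! ### Gaussian integers: balls and divisors -/


/-- the norm as a natural number -/
def gn (z : 𝔾) : ℕ := (Zsqrtd.norm z).natAbs

lemma gn_int (z : 𝔾) : (gn z : ℤ) = z.re * z.re + z.im * z.im := by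
  rw [gn, GaussianInt.abs_natCast_norm, Zsqrtd.norm_def]; ring

lemma gn_mul (z w : 𝔾) : gn (z * w) = gn z * gn w := by
  simp [gn, Zsqrtd.norm_mul, Int.natAbs_mul]

lemma gn_star (z : 𝔾) : gn (star z) = gn z := by
  zify; rw [gn_int, gn_int]; simp

lemma gn_eq_zero {z : 𝔾} : gn z = 0 ↔ z = 0 := by
  rw [gn, Int.natAbs_eq_zero, GaussianInt.norm_eq_zero]

lemma gn_pos {z : 𝔾} (h : z ≠ 0) : 1 ≤ gn z :=
  Nat.one_le_iff_ne_zero.mpr (fun h' => h (gn_eq_zero.mp h'))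

lemma gn_intCast (m : ℤ) : gn (m : 𝔾) = m.natAbs ^ 2 := by
  zify; rw [gn_int]; simp; ring

lemma gn_neg (z : 𝔾) : gn (-z) = gn z := by
  zify; rw [gn_int, gn_int]; simp

lemma gn_one : gn 1 = 1 := by simp [gn]

lemma gn_pow (z : 𝔾) (k : ℕ) : gn (z ^ k) = gn z ^ k := by
  induction k with
  | zero => simp [gn_one]
  | succ k ih => rw [pow_succ, gn_mul, pow_succ, ih]

lemma gn_unit {u : 𝔾} (hu : IsUnit u) : gn u = 1 := by
  obtain ⟨v, hv⟩ := hu.exists_right_inv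
  have := gn_mul u v
  rw [hv, gn_one] at this
  exact Nat.eq_one_of_mul_eq_one_right this.symm

lemma gn_real (z : 𝔾) : ((gn z : ℕ) : ℝ) = ‖(z : ℂ)‖ ^ 2 := by
  rw [← Complex.normSq_eq_norm_sq, ← GaussianInt.intCast_real_norm, ← GaussianInt.abs_natCast_norm]
  simp [gn]

/-- a finite set containing all Gaussian integers of norm `≤ R` -/
noncomputable def gball (R : ℕ) : Finset 𝔾 :=
  ((Finset.Icc (-(R.sqrt : ℤ)) R.sqrt) ×ˢ (Finset.Icc (-(R.sqrt : ℤ)) R.sqrt)).image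
    (fun p => (⟨p.1, p.2⟩ : 𝔾))

lemma abs_le_sqrt_of (R : ℕ) (x y : ℤ) (h : x * x + y * y ≤ R) : x ∈ Finset.Icc (-(R.sqrt : ℤ)) R.sqrt := by
  have h1 : x.natAbs ≤ R.sqrt := by
    rw [Nat.le_sqrt]; zify; rw [abs_mul_abs_self]; nlinarith [mul_self_nonneg y]
  rw [Finset.mem_Icc]; omega

lemma mem_gball {R : ℕ} {z : 𝔾} (h : gn z ≤ R) : z ∈ gball R := by
  rw [gball, Finset.mem_image]
  have h1 : z.re * z.re + z.im * z.im ≤ R := by rw [← gn_int]; exact_mod_cast h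
  refine ⟨(z.re, z.im), ?_, rfl⟩
  rw [Finset.mem_product]
  exact ⟨abs_le_sqrt_of R _ z.im h1, abs_le_sqrt_of R _ z.re (by linarith)⟩

lemma card_gball (R : ℕ) (hR : 1 ≤ R) : ((gball R).card : ℝ) ≤ 9 * R := by
  have h1 : (gball R).card ≤ (2 * R.sqrt + 1) ^ 2 := by
    refine Finset.card_image_le.trans ?_
    rw [Finset.card_product, Int.card_Icc]
    have : ((R.sqrt : ℤ) + 1 - -(R.sqrt : ℤ)).toNat = 2 * R.sqrt + 1 := by omega
    rw [this, sq]
  have h2 := Nat.sqrt_le' R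
  have h3 : 1 ≤ R.sqrt := by rw [Nat.le_sqrt]; omega
  have : (gball R).card ≤ 9 * R := by nlinarith
  exact_mod_cast this

lemma gunits_card (z : 𝔾) (S : Finset 𝔾) (h : ∀ w ∈ S, ∃ u : 𝔾, IsUnit u ∧ w = u * z) :
    S.card ≤ 9 := by
  have : S ⊆ (gball 1).image (fun u => u * z) := by
    intro w hw
    obtain ⟨u, hu, rfl⟩ := h w hw
    exact Finset.mem_image_of_mem _ (mem_gball (gn_unit hu).le)
  refine (Finset.card_le_card this).trans (Finset.card_image_le.trans ?_)
  have := card_gball 1 le_rfl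
  have : ((gball 1).card : ℝ) ≤ (9 : ℕ) := by norm_num at this ⊢; exact this
  exact_mod_cast this

open Classical in
lemma divisor_aux (ε : ℝ) (hε : 0 < ε) : ∃ (K : ℝ) (S : Finset 𝔾), 1 ≤ K ∧ ∀ z : 𝔾, z ≠ 0 →
    ∃ F : Finset 𝔾, (∀ d, d ∣ z → ∃ f ∈ F, Associated d f) ∧
      (F.card : ℝ) ≤ K ^ (S.filter (fun q => Prime q ∧ q ∣ z)).card * (gn z : ℝ) ^ ε := by
  classical
  obtain ⟨B, hB⟩ := exists_nat_gt ((2 : ℝ) ^ (1 / ε))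
  set K : ℝ := max 1 (1 / (ε * Real.log 2)) with hK
  have hl2 : 0 < Real.log 2 := Real.log_pos one_lt_two
  have hK1 : 1 ≤ K := le_max_left _ _
  have hK2 : 1 ≤ K * (ε * Real.log 2) := by
    have : 1 / (ε * Real.log 2) ≤ K := le_max_right _ _
    rwa [div_le_iff₀ (by positivity)] at this
  refine ⟨K, gball B, hK1, ?_⟩
  intro z hz
  revert hz
  apply UniqueFactorizationMonoid.induction_on_coprime (P := fun z : 𝔾 => z ≠ 0 →
    ∃ F : Finset 𝔾, (∀ d, d ∣ z → ∃ f ∈ F, Associated d f) ∧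
      (F.card : ℝ) ≤ K ^ ((gball B).filter (fun q => Prime q ∧ q ∣ z)).card * (gn z : ℝ) ^ ε) z
  · intro h; exact absurd rfl h
  · intro x hx _
    refine ⟨{1}, fun d hd => ⟨1, by simp, ?_⟩, ?_⟩
    · exact associated_one_iff_isUnit.mpr (isUnit_of_dvd_unit hd hx)
    · rw [gn_unit hx]; simp; exact one_le_pow₀ hK1
  · intro p k hp _
    refine ⟨(Finset.range (k + 1)).image (fun i => p ^ i), fun d hd => ?_, ?_⟩
    · obtain ⟨i, hi, h⟩ := (dvd_prime_pow hp k).mp hd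
      exact ⟨p ^ i, Finset.mem_image_of_mem _ (by simp; omega), h⟩
    · have hc : (((Finset.range (k + 1)).image (fun i => p ^ i)).card : ℝ) ≤ k + 1 := by
        have := Finset.card_image_le (s := Finset.range (k + 1)) (f := fun i => p ^ i)
        rw [Finset.card_range] at this
        exact_mod_cast this
      refine hc.trans ?_
      have hgn : gn (p ^ k) = gn p ^ k := gn_pow p k
      rcases Nat.eq_zero_or_pos k with rfl | hk
      · simp [gn_one]; exact one_le_pow₀ hK1
      have hp1 : gn p ≠ 1 := by
        intro h
        apply hp.not_isUnit
        rw [← Zsqrtd.norm_eq_one_iff]; exact h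
      have hp2 : 2 ≤ gn p := by
        have := gn_pos hp.ne_zero
        omega
      have hp2' : (2 : ℝ) ≤ gn p := by exact_mod_cast hp2
      rw [hgn]; push_cast
      have e1 : ((gn p : ℝ) ^ k) ^ ε = ((gn p : ℝ) ^ ε) ^ k := by
        rw [← Real.rpow_natCast, ← Real.rpow_natCast, ← Real.rpow_mul (by positivity),
          ← Real.rpow_mul (by positivity), mul_comm]
      rw [e1]
      by_cases hb : gn p ≤ B
      · have hcard : 1 ≤ ((gball B).filter (fun q => Prime q ∧ q ∣ p ^ k)).card := by
          rw [Nat.one_le_iff_ne_zero, Finset.card_ne_zero]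
          exact ⟨p, Finset.mem_filter.mpr ⟨mem_gball hb, hp, dvd_pow_self p hk.ne'⟩⟩
        have h3 : K ≤ K ^ ((gball B).filter (fun q => Prime q ∧ q ∣ p ^ k)).card := by
          calc K = K ^ 1 := (pow_one K).symm
            _ ≤ _ := pow_le_pow_right₀ hK1 hcard
        have h4 : (1 : ℝ) + k * (ε * Real.log 2) ≤ ((gn p : ℝ) ^ ε) ^ k := by
          calc (1 : ℝ) + k * (ε * Real.log 2) ≤ Real.exp (k * (ε * Real.log 2)) := by
                rw [add_comm]; exact Real.add_one_le_exp _
            _ = ((2 : ℝ) ^ ε) ^ k := by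
                rw [Real.rpow_def_of_pos two_pos, ← Real.exp_nat_mul]; congr 1; ring
            _ ≤ _ := by gcongr
        calc (k : ℝ) + 1 ≤ K * (1 + k * (ε * Real.log 2)) := by
              have : (k : ℝ) * 1 ≤ k * (K * (ε * Real.log 2)) := by gcongr
              nlinarith
          _ ≤ _ := by gcongr
      · push Not at hb
        have h5 : (2 : ℝ) ≤ (gn p : ℝ) ^ ε := by
          have : (2 : ℝ) ^ (1 / ε) ≤ gn p := hB.le.trans (by exact_mod_cast hb.le)
          calc (2 : ℝ) = ((2 : ℝ) ^ (1 / ε)) ^ ε := by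
                rw [← Real.rpow_mul (by norm_num)]; field_simp; simp
            _ ≤ _ := by gcongr
        calc (k : ℝ) + 1 ≤ 2 ^ k := by exact_mod_cast Nat.lt_two_pow_self
          _ ≤ ((gn p : ℝ) ^ ε) ^ k := by gcongr
          _ = 1 * ((gn p : ℝ) ^ ε) ^ k := (one_mul _).symm
          _ ≤ _ := by gcongr; exact one_le_pow₀ hK1
  · intro x y hxy hx hy hne
    have hx0 : x ≠ 0 := left_ne_zero_of_mul hne
    have hy0 : y ≠ 0 := right_ne_zero_of_mul hne
    obtain ⟨F1, a1, b1⟩ := hx hx0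
    obtain ⟨F2, a2, b2⟩ := hy hy0
    refine ⟨(F1 ×ˢ F2).image (fun p => p.1 * p.2), ?_, ?_⟩
    · intro d hd
      obtain ⟨d1, d2, h1, h2, rfl⟩ := exists_dvd_and_dvd_of_dvd_mul hd
      obtain ⟨f1, m1, e1⟩ := a1 d1 h1
      obtain ⟨f2, m2, e2⟩ := a2 d2 h2
      exact ⟨f1 * f2, Finset.mem_image.mpr ⟨(f1, f2), Finset.mem_product.mpr ⟨m1, m2⟩, rfl⟩,
        e1.mul_mul e2⟩
    · have hc : (((F1 ×ˢ F2).image (fun p => p.1 * p.2)).card : ℝ) ≤ F1.card * F2.card := by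
        have := Finset.card_image_le (s := F1 ×ˢ F2) (f := fun p => p.1 * p.2)
        rw [Finset.card_product] at this
        exact_mod_cast this
      have hdis : ((gball B).filter (fun q => Prime q ∧ q ∣ x)).card +
          ((gball B).filter (fun q => Prime q ∧ q ∣ y)).card ≤
          ((gball B).filter (fun q => Prime q ∧ q ∣ x * y)).card := by
        rw [← Finset.card_union_of_disjoint]
        · apply Finset.card_le_card
          intro q hq
          rw [Finset.mem_union, Finset.mem_filter, Finset.mem_filter] at hq
          rw [Finset.mem_filter]
          rcases hq with h | h
          · exact ⟨h.1, h.2.1, h.2.2.mul_right _⟩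
          · exact ⟨h.1, h.2.1, h.2.2.mul_left _⟩
        · rw [Finset.disjoint_left]
          intro q h1 h2
          rw [Finset.mem_filter] at h1 h2
          exact h1.2.1.not_isUnit (hxy h1.2.2 h2.2.2)
      calc _ ≤ (F1.card : ℝ) * F2.card := hc
        _ ≤ _ * _ := mul_le_mul b1 b2 (by positivity) (by positivity)
        _ = K ^ (((gball B).filter (fun q => Prime q ∧ q ∣ x)).card +
          ((gball B).filter (fun q => Prime q ∧ q ∣ y)).card) * (gn (x * y) : ℝ) ^ ε := by
            rw [gn_mul, pow_add]; push_cast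
            rw [Real.mul_rpow (by positivity) (by positivity)]; ring
        _ ≤ _ := by gcongr

/-- every finite family of divisors of a nonzero Gaussian integer of norm at most `B`
has at most `T` members -/
def DivB (B : ℕ) (T : ℝ) : Prop :=
  ∀ z : 𝔾, z ≠ 0 → gn z ≤ B → ∀ S : Finset 𝔾, (∀ d ∈ S, d ∣ z) → (S.card : ℝ) ≤ T

lemma divisor_bound (ε : ℝ) (hε : 0 < ε) : ∃ C : ℝ, 1 ≤ C ∧
    ∀ B : ℕ, 1 ≤ B → DivB B (C * (B : ℝ) ^ ε) := by
  classical
  obtain ⟨K, S, hK, h⟩ := divisor_aux ε hε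
  refine ⟨9 * K ^ S.card, ?_, ?_⟩
  · have := one_le_pow₀ (n := S.card) hK
    linarith
  intro B hB z hz hzB D hD
  obtain ⟨F, hF, hFc⟩ := h z hz
  have h1 : (D.card : ℝ) ≤ 9 * F.card := by
    choose! f hf1 hf2 using hF
    apply card_fib' D f F 9 (by norm_num) (fun a ha => hf1 a (hD a ha))
    intro x hx
    have : (D.filter (fun a => f a = f x)).card ≤ 9 := by
      apply gunits_card (f x)
      intro w hw
      rw [Finset.mem_filter] at hw
      have h1 := hf2 w (hD w hw.1)
      rw [hw.2] at h1
      obtain ⟨u, hu⟩ := h1.symm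
      exact ⟨u, u.isUnit, by rw [← hu, mul_comm]⟩
    exact_mod_cast this
  calc (D.card : ℝ) ≤ 9 * F.card := h1
    _ ≤ 9 * (K ^ (S.filter (fun q => Prime q ∧ q ∣ z)).card * (gn z : ℝ) ^ ε) := by gcongr
    _ ≤ 9 * (K ^ S.card * (B : ℝ) ^ ε) := by
        gcongr
        exact Finset.filter_subset _ _
    _ = _ := by ring

/-! ### Data attached to a primitive cyclic quadrilateral -/

@[ext] structure Dat where
  h : Fin 4 → GaussianInt
  m : Fin 4 → Fin 4 → ℤ
  e : Fin 4 → Fin 4 → GaussianInt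
  u : GaussianInt

def Dat.p (x : Dat) (i j : Fin 4) : GaussianInt := (x.m i j : GaussianInt) * x.e i j

def D4 (i j k l : Fin 4) : Prop := i ≠ j ∧ i ≠ k ∧ i ≠ l ∧ j ≠ k ∧ j ≠ l ∧ k ≠ l

instance (i j k l : Fin 4) : Decidable (D4 i j k l) := by unfold D4; infer_instance

lemma D4.cases {i j k l : Fin 4} (hd : D4 i j k l) (a : Fin 4) : a = i ∨ a = j ∨ a = k ∨ a = l := by
  revert i j k l a; decide

lemma D4.swap12 {i j k l : Fin 4} (h : D4 i j k l) : D4 j i k l := by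
  unfold D4 at *; tauto
lemma D4.swap23 {i j k l : Fin 4} (h : D4 i j k l) : D4 i k j l := by
  unfold D4 at *; refine ⟨?_, ?_, ?_, ?_, ?_, ?_⟩ <;> tauto
lemma D4.swap34 {i j k l : Fin 4} (h : D4 i j k l) : D4 i j l k := by
  unfold D4 at *; refine ⟨?_, ?_, ?_, ?_, ?_, ?_⟩ <;> tauto
lemma D4.rot {i j k l : Fin 4} (h : D4 i j k l) : D4 j k l i := h.swap12.swap23.swap34
lemma D4.opp {i j k l : Fin 4} (h : D4 i j k l) : D4 k l i j := h.rot.rot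
lemma D4.ij {i j k l : Fin 4} (h : D4 i j k l) : i ≠ j := h.1
lemma D4.ik {i j k l : Fin 4} (h : D4 i j k l) : i ≠ k := h.2.1
lemma D4.il {i j k l : Fin 4} (h : D4 i j k l) : i ≠ l := h.2.2.1
lemma D4.jk {i j k l : Fin 4} (h : D4 i j k l) : j ≠ k := h.2.2.2.1
lemma D4.jl {i j k l : Fin 4} (h : D4 i j k l) : j ≠ l := h.2.2.2.2.1
lemma D4.kl {i j k l : Fin 4} (h : D4 i j k l) : k ≠ l := h.2.2.2.2.2

structure Good (X : ℕ) (x : Dat) : Prop where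
  hne : ∀ i, x.h i ≠ 0
  mne : ∀ i j, i ≠ j → x.m i j ≠ 0
  ene : ∀ i j, i ≠ j → x.e i j ≠ 0
  mdiag : ∀ i, x.m i i = 0
  ediag : ∀ i, x.e i i = 0
  manti : ∀ i j, x.m i j = - x.m j i
  esym : ∀ i j, x.e i j = x.e j i
  prim : ∀ i j, i ≠ j → IsCoprime (x.e i j).re (x.e i j).im
  uu : IsUnit x.u
  econj : ∀ i j k l, D4 i j k l → x.e k l = x.u * star (x.e i j)
  rel : ∀ i j k l, D4 i j k l → x.h k * x.p i j + x.h i * x.p j k + x.h j * x.p k i = 0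
  cop : ∀ i j k l, D4 i j k l → IsCoprime (x.h k * x.p i j) (x.h i * x.p j k)
  size : ∀ i j k l, D4 i j k l → gn (x.h k) * gn (x.h l) * gn (x.p i j) ≤ X
  ntrap : ∀ i j k l, D4 i j k l → gn (x.h k * x.h l * x.p i j) ≠ gn (x.h i * x.h j * x.p k l)
  nbis : ∀ i j k l, D4 i j k l →
    gn (x.h j * x.h j * x.p i k * x.p i l) ≠ gn (x.h i * x.h i * x.p j k * x.p j l)
  ncol : ∀ i j k l, D4 i j k l → (x.h k * x.p i j * star (x.h i * x.p j k)).im ≠ 0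

structure Cls where
  H : Fin 4 → ℕ
  M : Fin 4 → Fin 4 → ℕ
  E : Fin 4 → Fin 4 → ℕ
  t : Fin 4 → Fin 4 → ℕ
  r : Fin 4 → Fin 4 → ℕ

structure InCls (c : Cls) (x : Dat) : Prop where
  Hl : ∀ i, 2 ^ c.H i ≤ gn (x.h i)
  Hu : ∀ i, gn (x.h i) < 2 ^ (c.H i + 1)
  Ml : ∀ i j, i ≠ j → 2 ^ c.M i j ≤ (x.m i j).natAbs
  Mu : ∀ i j, i ≠ j → (x.m i j).natAbs < 2 ^ (c.M i j + 1)
  El : ∀ i j, i ≠ j → 2 ^ c.E i j ≤ gn (x.e i j)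
  Eu : ∀ i j, i ≠ j → gn (x.e i j) < 2 ^ (c.E i j + 1)
  tl : ∀ i j k l, D4 i j k l → 2 ^ c.t i j ≤ Int.gcd (x.m i j) (x.m k l)
  tu : ∀ i j k l, D4 i j k l → Int.gcd (x.m i j) (x.m k l) < 2 ^ (c.t i j + 1)
  rl : ∀ i j, i ≠ j → 2 ^ c.r i j ≤ gn (EuclideanDomain.gcd (x.h i) (star (x.h j)))
  ru : ∀ i j, i ≠ j → gn (EuclideanDomain.gcd (x.h i) (star (x.h j))) < 2 ^ (c.r i j + 1)

lemma Good.pne {X : ℕ} {x : Dat} (g : Good X x) {i j : Fin 4} (h : i ≠ j) : x.p i j ≠ 0 := by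
  unfold Dat.p
  apply mul_ne_zero _ (g.ene i j h)
  exact_mod_cast g.mne i j h

lemma Good.panti {X : ℕ} {x : Dat} (g : Good X x) (i j : Fin 4) : x.p i j = - x.p j i := by
  unfold Dat.p
  rw [g.manti i j, g.esym i j]; push_cast; ring

lemma Good.cop_pp {X : ℕ} {x : Dat} (g : Good X x) {i j k l : Fin 4} (hd : D4 i j k l) :
    IsCoprime (x.p i j) (x.p j k) :=
  (g.cop i j k l hd).of_mul_left_right.of_mul_right_right

lemma Good.cop_hh {X : ℕ} {x : Dat} (g : Good X x) {i j k l : Fin 4} (hd : D4 i j k l) :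
    IsCoprime (x.h i) (x.h j) :=
  (g.cop j k i l hd.swap12.swap23).of_mul_left_left.of_mul_right_left

/-- `h i` is coprime to `p i j` -/
lemma Good.cop_hp {X : ℕ} {x : Dat} (g : Good X x) {i j k l : Fin 4} (hd : D4 i j k l) :
    IsCoprime (x.h i) (x.p i j) :=
  (g.cop i j k l hd).symm.of_mul_left_left.of_mul_right_right

lemma Good.ptolemy {X : ℕ} {x : Dat} (g : Good X x) {i j k l : Fin 4} (hd : D4 i j k l) :
    x.p i j * x.p k l + x.p i k * x.p l j + x.p i l * x.p j k = 0 := by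
  have h1 := g.rel i j k l hd
  have h2 := g.rel i j l k hd.swap34
  have h3 := g.rel i k l j hd.swap23.swap34
  apply mul_left_cancel₀ (g.hne i)
  have e1 := g.panti l j
  have e2 := g.panti k i
  have e3 := g.panti l i
  rw [e2] at h1
  rw [e3] at h2 h3
  rw [e1, mul_zero]
  linear_combination x.p i l * h1 - x.p i k * h2 + x.p i j * h3

lemma Dat.ext_of {X : ℕ} {x y : Dat} (gx : Good X x) (gy : Good X y) {i j k l : Fin 4}
    (hd : D4 i j k l) (hi : x.h i = y.h i) (hj : x.h j = y.h j) (hk : x.h k = y.h k)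
    (hl : x.h l = y.h l) (hu : x.u = y.u)
    (m1 : x.m i j = y.m i j) (m2 : x.m i k = y.m i k) (m3 : x.m i l = y.m i l)
    (m4 : x.m j k = y.m j k) (m5 : x.m j l = y.m j l) (m6 : x.m k l = y.m k l)
    (e1 : x.e i j = y.e i j) (e2 : x.e i k = y.e i k) (e3 : x.e i l = y.e i l) : x = y := by
  have e4 : x.e j k = y.e j k := by
    rw [gx.econj i l j k hd.swap34.swap23, gy.econj i l j k hd.swap34.swap23, hu, e3]
  have e5 : x.e j l = y.e j l := by
    rw [gx.econj i k j l hd.swap23, gy.econj i k j l hd.swap23, hu, e2]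
  have e6 : x.e k l = y.e k l := by
    rw [gx.econj i j k l hd, gy.econj i j k l hd, hu, e1]
  apply Dat.ext
  · funext a
    rcases hd.cases a with rfl | rfl | rfl | rfl <;> assumption
  · funext a b
    rcases hd.cases a with rfl | rfl | rfl | rfl <;> rcases hd.cases b with rfl | rfl | rfl | rfl <;>
    first
    | assumption
    | (rw [gx.mdiag, gy.mdiag])
    | (rw [gx.manti, gy.manti]; congr 1)
  · funext a b
    rcases hd.cases a with rfl | rfl | rfl | rfl <;> rcases hd.cases b with rfl | rfl | rfl | rfl <;>
    first
    | assumption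
    | (rw [gx.ediag, gy.ediag])
    | (rw [gx.esym, gy.esym]; assumption)
  · exact hu

/-! powers of two -/

noncomputable def pw (r : ℝ) : ℝ := (2 : ℝ) ^ r

lemma pw_pos (r : ℝ) : 0 < pw r := Real.rpow_pos_of_pos two_pos r
lemma pw_add (r s : ℝ) : pw (r + s) = pw r * pw s := Real.rpow_add two_pos r s
lemma pw_sub (r s : ℝ) : pw (r - s) = pw r / pw s := Real.rpow_sub two_pos r s
lemma pw_nat (n : ℕ) : pw n = 2 ^ n := Real.rpow_natCast 2 n
lemma pw_mono {r s : ℝ} (h : r ≤ s) : pw r ≤ pw s := Real.rpow_le_rpow_of_exponent_le one_le_two h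
lemma pw_lt {r s : ℝ} (h : r < s) : pw r < pw s := Real.rpow_lt_rpow_of_exponent_lt one_lt_two h
lemma pw_zero : pw 0 = 1 := Real.rpow_zero 2
lemma pw_one : pw 1 = 2 := Real.rpow_one 2
lemma pw_sq (r : ℝ) : pw r ^ 2 = pw (2 * r) := by rw [sq, ← pw_add]; congr 1; ring
lemma pw_half_sq (r : ℝ) : pw (r / 2) ^ 2 = pw r := by rw [pw_sq]; congr 1; ring

lemma lt_pw_half {a r : ℝ} (_ha : 0 ≤ a) (h : a ^ 2 < pw r) : a < pw (r / 2) := by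
  rw [← pw_half_sq] at h
  exact lt_of_pow_lt_pow_left₀ 2 (pw_pos _).le h
lemma pw_half_le {a r : ℝ} (ha : 0 ≤ a) (h : pw r ≤ a ^ 2) : pw (r / 2) ≤ a := by
  rw [← pw_half_sq] at h
  exact le_of_sq_le_sq h ha

lemma InCls.hu {c : Cls} {x : Dat} (k : InCls c x) (i : Fin 4) :
    ‖(x.h i : ℂ)‖ < pw ((c.H i + 1) / 2) := by
  apply lt_pw_half (norm_nonneg _)
  rw [← gn_real]
  have := k.Hu i
  have h2 : ((c.H i : ℝ) + 1) = ((c.H i + 1 : ℕ) : ℝ) := by push_cast; ring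
  rw [h2, pw_nat]; exact_mod_cast this
lemma InCls.hl {c : Cls} {x : Dat} (k : InCls c x) (i : Fin 4) :
    pw (c.H i / 2) ≤ ‖(x.h i : ℂ)‖ := by
  apply pw_half_le (norm_nonneg _)
  rw [← gn_real, pw_nat]
  exact_mod_cast k.Hl i
lemma InCls.eu {c : Cls} {x : Dat} (k : InCls c x) {i j : Fin 4} (h : i ≠ j) :
    ‖(x.e i j : ℂ)‖ < pw ((c.E i j + 1) / 2) := by
  apply lt_pw_half (norm_nonneg _)
  rw [← gn_real]
  have := k.Eu i j h
  have h2 : ((c.E i j : ℝ) + 1) = ((c.E i j + 1 : ℕ) : ℝ) := by push_cast; ring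
  rw [h2, pw_nat]; exact_mod_cast this
lemma InCls.el {c : Cls} {x : Dat} (k : InCls c x) {i j : Fin 4} (h : i ≠ j) :
    pw (c.E i j / 2) ≤ ‖(x.e i j : ℂ)‖ := by
  apply pw_half_le (norm_nonneg _)
  rw [← gn_real, pw_nat]
  exact_mod_cast k.El i j h
lemma InCls.mu {c : Cls} {x : Dat} (k : InCls c x) {i j : Fin 4} (h : i ≠ j) :
    |(x.m i j : ℝ)| < pw (c.M i j + 1) := by
  have := k.Mu i j h
  have h2 : ((c.M i j : ℝ) + 1) = ((c.M i j + 1 : ℕ) : ℝ) := by push_cast; ring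
  rw [h2, pw_nat, ← Int.cast_abs, Int.abs_eq_natAbs]
  exact_mod_cast this
lemma InCls.ml {c : Cls} {x : Dat} (k : InCls c x) {i j : Fin 4} (h : i ≠ j) :
    pw (c.M i j) ≤ |(x.m i j : ℝ)| := by
  have := k.Ml i j h
  rw [pw_nat, ← Int.cast_abs, Int.abs_eq_natAbs]
  exact_mod_cast this
lemma Dat.norm_p (x : Dat) (i j : Fin 4) : ‖(x.p i j : ℂ)‖ = |(x.m i j : ℝ)| * ‖(x.e i j : ℂ)‖ := by
  unfold Dat.p; rw [GaussianInt.toComplex_mul, norm_mul]; congr 1; simp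
lemma InCls.pl {c : Cls} {x : Dat} (k : InCls c x) {i j : Fin 4} (h : i ≠ j) :
    pw (c.M i j + c.E i j / 2) ≤ ‖(x.p i j : ℂ)‖ := by
  rw [Dat.norm_p, pw_add]
  exact mul_le_mul (k.ml h) (k.el h) (pw_pos _).le (abs_nonneg _)

/-! boxes -/
noncomputable def zset (M : ℕ) : Finset ℤ := Finset.Icc (-(2 ^ (M + 1) : ℤ)) (2 ^ (M + 1))
lemma card_zset (M : ℕ) : ((zset M).card : ℝ) ≤ 5 * pw M := by
  apply card_Icc_le
  · have := pw_pos M; positivity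
  · rw [pw_nat]; push_cast
    have : (1 : ℝ) ≤ 2 ^ M := one_le_pow₀ one_le_two
    rw [pow_succ]; linarith
lemma mem_zset {M : ℕ} {m : ℤ} (h : m.natAbs < 2 ^ (M + 1)) : m ∈ zset M := by
  rw [zset, Finset.mem_Icc]; zify at h; rw [abs_lt] at h; constructor <;> linarith
noncomputable def gset (E : ℕ) : Finset GaussianInt := gball (2 ^ (E + 1))
lemma card_gset (E : ℕ) : ((gset E).card : ℝ) ≤ 18 * pw E := by
  refine (card_gball _ Nat.one_le_two_pow).trans ?_
  rw [pw_nat]; push_cast; rw [pow_succ]; linarith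
lemma mem_gset {E : ℕ} {z : 𝔾} (h : gn z < 2 ^ (E + 1)) : z ∈ gset E := mem_gball h.le
noncomputable def uset : Finset GaussianInt := gball 1
lemma card_uset : ((uset).card : ℝ) ≤ 9 := by
  have := card_gball 1 le_rfl
  unfold uset
  simpa using this
lemma mem_uset {z : 𝔾} (h : IsUnit z) : z ∈ uset := mem_gball (gn_unit h).le

/-! ### Method alpha -/

lemma D4.exists_of_ne {a b : Fin 4} (h : a ≠ b) : ∃ k l, D4 a b k l := by
  revert a b; decide

lemma norm_lt_of_dvd {a b : 𝔾} (h : a ∣ b) (hlt : ‖(b : ℂ)‖ < ‖(a : ℂ)‖) : b = 0 := by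
  obtain ⟨d, rfl⟩ := h
  by_contra hne
  have hd : d ≠ 0 := right_ne_zero_of_mul hne
  have h1 : (1 : ℝ) ≤ ‖(d : ℂ)‖ := by
    have h2 : (1 : ℝ) ≤ ‖(d : ℂ)‖ ^ 2 := by rw [← gn_real]; exact_mod_cast gn_pos hd
    nlinarith [norm_nonneg (d : ℂ)]
  rw [GaussianInt.toComplex_mul, norm_mul] at hlt
  nlinarith [norm_nonneg (a : ℂ)]

lemma assoc_of_det {a b a' b' : 𝔾} (ha : a ≠ 0) (hc : IsCoprime a b) (hc' : IsCoprime a' b')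
    (h : a * b' = b * a') : ∃ v : 𝔾, IsUnit v ∧ a' = v * a ∧ b' = v * b := by
  have h1 : a ∣ a' := hc.dvd_of_dvd_mul_left ⟨b', h.symm⟩
  have h2 : a' ∣ a := hc'.dvd_of_dvd_mul_right ⟨b, by rw [h]; ring⟩
  obtain ⟨w, hw⟩ := associated_of_dvd_dvd h1 h2
  refine ⟨w, w.isUnit, by rw [← hw]; ring, ?_⟩
  apply mul_left_cancel₀ ha
  rw [h, ← hw]; ring

lemma hpack {X : ℕ} {c : Cls} (S : Finset Dat) (hS : ∀ x ∈ S, Good X x ∧ InCls c x)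
    (hm : ∀ x ∈ S, ∀ y ∈ S, x.m = y.m) (he : ∀ x ∈ S, ∀ y ∈ S, x.e = y.e)
    (hu : ∀ x ∈ S, ∀ y ∈ S, x.u = y.u) {i j : Fin 4} (hij : i ≠ j) :
    (S.card : ℝ) ≤ 2304 * (1 + pw (c.H i + c.H j - 2 * c.M i j - c.E i j)) := by
  classical
  obtain ⟨k, l, hd⟩ := D4.exists_of_ne hij
  have hp : ∀ x ∈ S, ∀ y ∈ S, ∀ a b, x.p a b = y.p a b := by
    intro x hx y hy a b
    unfold Dat.p; rw [hm x hx y hy, he x hx y hy]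
  set s : ℝ := pw ((2 * c.M i j + c.E i j) / 2 - c.H j - 1) with hs
  set R : ℝ := pw ((c.H i + 1 - c.H j) / 2) with hR
  have key := pack_complex S (fun x => (x.h i : ℂ) / (x.h j : ℂ)) R s 9 (pw_pos _) (by norm_num)
    (pw_pos _).le ?_ ?_
  · have e1 : (R / s) ^ 2 = 8 * pw (c.H i + c.H j - 2 * c.M i j - c.E i j) := by
      rw [hR, hs, ← pw_sub, pw_sq]
      have : (8 : ℝ) = pw 3 := by rw [show (3 : ℝ) = ((3 : ℕ) : ℝ) by norm_num, pw_nat]; norm_num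
      rw [this, ← pw_add]; congr 1; ring
    rw [e1] at key
    refine key.trans ?_
    have := pw_pos (c.H i + c.H j - 2 * c.M i j - c.E i j)
    nlinarith
  · intro x hx
    rw [norm_div]
    have a1 := ((hS x hx).2.hu i).le
    have a2 := (hS x hx).2.hl j
    have : R = pw ((c.H i + 1) / 2) / pw (c.H j / 2) := by
      rw [hR, ← pw_sub]; congr 1; ring
    rw [this]
    exact div_le_div₀ (pw_pos _).le a1 (pw_pos _) a2
  · intro x hx
    obtain ⟨gx, cx⟩ := hS x hx
    have hsub : S.filter (fun y => ‖(y.h i : ℂ) / (y.h j : ℂ) - (x.h i : ℂ) / (x.h j : ℂ)‖ < s) ⊆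
        uset.image (fun v => (⟨fun a => v * x.h a, x.m, x.e, x.u⟩ : Dat)) := by
      intro y hy
      rw [Finset.mem_filter] at hy
      obtain ⟨hyS, hy⟩ := hy
      obtain ⟨gy, cy⟩ := hS y hyS
      have hxj : (x.h j : ℂ) ≠ 0 := by
        rw [Ne, GaussianInt.toComplex_eq_zero]; exact gx.hne j
      have hyj : (y.h j : ℂ) ≠ 0 := by
        rw [Ne, GaussianInt.toComplex_eq_zero]; exact gy.hne j
      have hdet : x.p i j ∣ x.h i * y.h j - x.h j * y.h i := by
        apply (gx.cop_pp hd).dvd_of_dvd_mul_right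
        have r1 := gx.rel i j k l hd
        have r2 := gy.rel i j k l hd
        rw [hp y hyS x hx, hp y hyS x hx, hp y hyS x hx] at r2
        refine ⟨x.h j * y.h k - x.h k * y.h j, ?_⟩
        linear_combination y.h j * r1 - x.h j * r2
      have h0 : x.h i * y.h j - x.h j * y.h i = 0 := by
        apply norm_lt_of_dvd hdet
        refine lt_of_lt_of_le ?_ (cx.pl hij)
        have e1 : ((x.h i * y.h j - x.h j * y.h i : 𝔾) : ℂ) =
            -((y.h i : ℂ) / (y.h j : ℂ) - (x.h i : ℂ) / (x.h j : ℂ)) * (x.h j * y.h j) := by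
          rw [GaussianInt.toComplex_sub, GaussianInt.toComplex_mul, GaussianInt.toComplex_mul]
          field_simp; ring
        rw [e1, norm_mul, norm_neg, norm_mul]
        have a1 := (cx.hu j).le
        have a2 := (cy.hu j).le
        have a3 : ‖(x.h j : ℂ)‖ * ‖(y.h j : ℂ)‖ ≤ pw ((c.H j + 1) / 2) * pw ((c.H j + 1) / 2) :=
          mul_le_mul a1 a2 (norm_nonneg _) (pw_pos _).le
        have a4 : 0 < ‖(x.h j : ℂ)‖ * ‖(y.h j : ℂ)‖ := by positivity
        calc _ < s * (‖(x.h j : ℂ)‖ * ‖(y.h j : ℂ)‖) := by gcongr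
          _ ≤ s * (pw ((c.H j + 1) / 2) * pw ((c.H j + 1) / 2)) := by
            have := pw_pos ((2 * c.M i j + c.E i j) / 2 - c.H j - 1)
            gcongr
          _ = _ := by rw [hs, ← pw_add, ← pw_add]; congr 1; ring
      obtain ⟨v, hv, v1, v2⟩ := assoc_of_det (gx.hne i) (gx.cop_hh hd) (gy.cop_hh hd)
        (sub_eq_zero.mp h0)
      rw [Finset.mem_image]
      refine ⟨v, mem_uset hv, ?_⟩
      have hk : ∀ a b, D4 i j a b → y.h a = v * x.h a := by
        intro a b hab
        have r1 := gx.rel i j a b hab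
        have r2 := gy.rel i j a b hab
        rw [hp y hyS x hx, hp y hyS x hx, hp y hyS x hx, v1, v2] at r2
        apply mul_right_cancel₀ (gx.pne hij)
        linear_combination r2 - v * r1
      apply Dat.ext
      · funext a
        rcases hd.cases a with rfl | rfl | rfl | rfl
        · exact v1.symm
        · exact v2.symm
        · exact (hk _ _ hd).symm
        · exact (hk _ _ hd.swap34).symm
      · exact hm x hx y hyS
      · exact he x hx y hyS
      · exact hu x hx y hyS
    have h3 : ((uset.image (fun v => (⟨fun a => v * x.h a, x.m, x.e, x.u⟩ : Dat))).card : ℝ) ≤ 9 :=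
      le_trans (by exact_mod_cast Finset.card_image_le) card_uset
    exact le_trans (by exact_mod_cast Finset.card_le_card hsub) h3

/-- everything equal -/
lemma Dat.mee_of {X : ℕ} {x y : Dat} (gx : Good X x) (gy : Good X y) {i j k l : Fin 4}
    (hd : D4 i j k l) (hu : x.u = y.u)
    (m1 : x.m i j = y.m i j) (m2 : x.m i k = y.m i k) (m3 : x.m i l = y.m i l)
    (m4 : x.m j k = y.m j k) (m5 : x.m j l = y.m j l) (m6 : x.m k l = y.m k l)
    (e1 : x.e i j = y.e i j) (e2 : x.e i k = y.e i k) (e3 : x.e i l = y.e i l) :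
    x.m = y.m ∧ x.e = y.e := by
  have e4 : x.e j k = y.e j k := by
    rw [gx.econj i l j k hd.swap34.swap23, gy.econj i l j k hd.swap34.swap23, hu, e3]
  have e5 : x.e j l = y.e j l := by
    rw [gx.econj i k j l hd.swap23, gy.econj i k j l hd.swap23, hu, e2]
  have e6 : x.e k l = y.e k l := by
    rw [gx.econj i j k l hd, gy.econj i j k l hd, hu, e1]
  constructor
  · funext a b
    rcases hd.cases a with rfl | rfl | rfl | rfl <;> rcases hd.cases b with rfl | rfl | rfl | rfl <;>
    first
    | assumption
    | (rw [gx.mdiag, gy.mdiag])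
    | (rw [gx.manti, gy.manti]; congr 1)
  · funext a b
    rcases hd.cases a with rfl | rfl | rfl | rfl <;> rcases hd.cases b with rfl | rfl | rfl | rfl <;>
    first
    | assumption
    | (rw [gx.ediag, gy.ediag])
    | (rw [gx.esym, gy.esym]; assumption)

lemma Good.gnp_le {X : ℕ} {x : Dat} (g : Good X x) {i j k l : Fin 4} (hd : D4 i j k l) :
    gn (x.p i j) ≤ X := by
  refine le_trans ?_ (g.size i j k l hd)
  have h1 := gn_pos (g.hne k)
  have h2 := gn_pos (g.hne l)
  exact Nat.le_mul_of_pos_left _ (Nat.mul_pos h1 h2)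

/-- counting elements with a coordinate dividing a fixed number -/
lemma card_div_fib {B : ℕ} {T : ℝ} (hT : DivB B T) (_hT0 : 0 ≤ T) (F : Finset Dat) (f : Dat → 𝔾) (z : 𝔾)
    (hz : z ≠ 0) (hzB : gn z ≤ B) (hf : ∀ x ∈ F, f x ∣ z) (K : ℝ) (hK : 0 ≤ K)
    (h : ∀ x ∈ F, ((F.filter (fun a => f a = f x)).card : ℝ) ≤ K) : (F.card : ℝ) ≤ K * T := by
  classical
  have h1 := card_fib' F f (F.image f) K hK (fun a ha => Finset.mem_image_of_mem _ ha) h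
  refine h1.trans ?_
  gcongr
  apply hT z hz hzB
  intro d hd
  obtain ⟨x, hx, rfl⟩ := Finset.mem_image.mp hd
  exact hf x hx

lemma alpha {X : ℕ} {T : ℝ} {c : Cls} (hT : DivB (X ^ 2) T) (hT0 : 0 ≤ T) (F : Finset Dat)
    (hF : ∀ x ∈ F, Good X x ∧ InCls c x) {i j k l a b : Fin 4} (hd : D4 i j k l) (hab : a ≠ b) :
    (F.card : ℝ) ≤ 10 ^ 11 * T ^ 3 * pw (c.M i j + c.M k l + c.E i j + c.M j k + c.M i l + c.E i l) *
      (1 + pw (c.H a + c.H b - 2 * c.M a b - c.E a b)) := by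
  classical
  set s := pw (c.H a + c.H b - 2 * c.M a b - c.E a b) with hs
  have hs0 : 0 < s := pw_pos _
  have h1 := card_fib' F (fun x => (x.m i j, x.m k l, x.e i j, x.m j k, x.m i l, x.e i l, x.u))
    (zset (c.M i j) ×ˢ zset (c.M k l) ×ˢ gset (c.E i j) ×ˢ zset (c.M j k) ×ˢ zset (c.M i l) ×ˢ
      gset (c.E i l) ×ˢ uset) (2304 * (1 + s) * T * T * T) (by positivity) ?_ ?_
  · refine h1.trans ?_
    simp only [Finset.card_product, Nat.cast_mul]
    have a1 := card_zset (c.M i j)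
    have a2 := card_zset (c.M k l)
    have a3 := card_gset (c.E i j)
    have a4 := card_zset (c.M j k)
    have a5 := card_zset (c.M i l)
    have a6 := card_gset (c.E i l)
    have a7 := card_uset
    have p1 := pw_pos (c.M i j)
    have p2 := pw_pos (c.M k l)
    have p3 := pw_pos (c.E i j)
    have p4 := pw_pos (c.M j k)
    have p5 := pw_pos (c.M i l)
    have p6 := pw_pos (c.E i l)
    calc _ ≤ 2304 * (1 + s) * T * T * T * ((5 * pw (c.M i j)) * ((5 * pw (c.M k l)) *
          ((18 * pw (c.E i j)) * ((5 * pw (c.M j k)) * ((5 * pw (c.M i l)) *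
          ((18 * pw (c.E i l)) * 9)))))) := by gcongr
      _ = (2304 * 5 * 5 * 18 * 5 * 5 * 18 * 9) * T ^ 3 * (pw (c.M i j) * pw (c.M k l) * pw (c.E i j) * pw (c.M j k) * pw (c.M i l) * pw (c.E i l)) * (1 + s) := by ring
      _ ≤ 10 ^ 11 * T ^ 3 * (pw (c.M i j) * pw (c.M k l) * pw (c.E i j) * pw (c.M j k) * pw (c.M i l) * pw (c.E i l)) * (1 + s) := by
        gcongr; norm_num
      _ = _ := by simp only [pw_add]
  · intro x hx
    obtain ⟨g, q⟩ := hF x hx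
    simp only [Finset.mem_product]
    exact ⟨mem_zset (q.Mu _ _ hd.ij), mem_zset (q.Mu _ _ hd.kl), mem_gset (q.Eu _ _ hd.ij),
      mem_zset (q.Mu _ _ hd.jk), mem_zset (q.Mu _ _ hd.il), mem_gset (q.Eu _ _ hd.il),
      mem_uset g.uu⟩
  · intro x hx
    obtain ⟨g, q⟩ := hF x hx
    set F1 := F.filter (fun y => (y.m i j, y.m k l, y.e i j, y.m j k, y.m i l, y.e i l, y.u) =
      (x.m i j, x.m k l, x.e i j, x.m j k, x.m i l, x.e i l, x.u)) with hF1
    have hF1' : ∀ y ∈ F1, (Good X y ∧ InCls c y) ∧ y.m i j = x.m i j ∧ y.m k l = x.m k l ∧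
        y.e i j = x.e i j ∧ y.m j k = x.m j k ∧ y.m i l = x.m i l ∧ y.e i l = x.e i l ∧ y.u = x.u := by
      intro y hy
      rw [hF1, Finset.mem_filter] at hy
      simp only [Prod.mk.injEq] at hy
      exact ⟨hF y hy.1, hy.2⟩
    set z := x.p i k * x.p l j with hz
    have hz0 : z ≠ 0 := mul_ne_zero (g.pne hd.ik) (g.pne hd.jl.symm)
    have hzB : gn z ≤ X ^ 2 := by
      rw [hz, gn_mul, sq]
      exact Nat.mul_le_mul (g.gnp_le hd.swap23) (g.gnp_le hd.swap23.opp.swap12)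
    have hzy : ∀ y ∈ F1, y.p i k * y.p l j = z := by
      intro y hy
      obtain ⟨⟨gy, qy⟩, b1, b2, b3, b4, b5, b6, b7⟩ := hF1' y hy
      have t1 := g.ptolemy hd
      have t2 := gy.ptolemy hd
      have c1 : y.p i j = x.p i j := by unfold Dat.p; rw [b1, b3]
      have c2 : y.p k l = x.p k l := by
        unfold Dat.p; rw [b2, gy.econj i j k l hd, g.econj i j k l hd, b3, b7]
      have c3 : y.p i l = x.p i l := by unfold Dat.p; rw [b5, b6]
      have c4 : y.p j k = x.p j k := by
        unfold Dat.p
        rw [b4, gy.econj i l j k hd.swap34.swap23, g.econj i l j k hd.swap34.swap23, b6, b7]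
      rw [c1, c2, c3, c4] at t2
      linear_combination t2 - t1
    apply card_div_fib hT hT0 F1 (fun y => (y.m i k : 𝔾)) z hz0 hzB
    · intro y hy
      rw [← hzy y hy]; unfold Dat.p
      exact ⟨y.e i k * ((y.m l j : 𝔾) * y.e l j), by ring⟩
    · positivity
    intro x2 hx2
    set F2 := F1.filter (fun y => (y.m i k : 𝔾) = x2.m i k) with hF2
    apply card_div_fib hT hT0 F2 (fun y => (y.m l j : 𝔾)) z hz0 hzB
    · intro y hy
      rw [← hzy y (Finset.mem_filter.mp hy).1]; unfold Dat.p
      exact ⟨(y.m i k : 𝔾) * y.e i k * y.e l j, by ring⟩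
    · positivity
    intro x3 hx3
    set F3 := F2.filter (fun y => (y.m l j : 𝔾) = x3.m l j) with hF3
    apply card_div_fib hT hT0 F3 (fun y => y.e i k) z hz0 hzB
    · intro y hy
      rw [← hzy y (Finset.mem_filter.mp (Finset.mem_filter.mp hy).1).1]; unfold Dat.p
      exact ⟨(y.m i k : 𝔾) * ((y.m l j : 𝔾) * y.e l j), by ring⟩
    · positivity
    intro x4 hx4
    set F4 := F3.filter (fun y => y.e i k = x4.e i k) with hF4
    have hF4' : ∀ y ∈ F4, y ∈ F1 ∧ y.m i k = x2.m i k ∧ y.m l j = x3.m l j ∧ y.e i k = x4.e i k := by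
      intro y hy
      rw [hF4, Finset.mem_filter, hF3, Finset.mem_filter, hF2, Finset.mem_filter] at hy
      exact ⟨hy.1.1.1, by exact_mod_cast hy.1.1.2, by exact_mod_cast hy.1.2, hy.2⟩
    have heq : ∀ y ∈ F4, ∀ w ∈ F4, y.m = w.m ∧ y.e = w.e := by
      intro y hy w hw
      obtain ⟨y1, y2, y3, y4⟩ := hF4' y hy
      obtain ⟨w1, w2, w3, w4⟩ := hF4' w hw
      obtain ⟨⟨gy, qy⟩, b1, b2, b3, b4, b5, b6, b7⟩ := hF1' y y1
      obtain ⟨⟨gw, qw⟩, d1, d2, d3, d4, d5, d6, d7⟩ := hF1' w w1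
      apply Dat.mee_of gy gw hd (b7.trans d7.symm) (b1.trans d1.symm) (y2.trans w2.symm)
        (b5.trans d5.symm) (b4.trans d4.symm) _ (b2.trans d2.symm) (b3.trans d3.symm)
        (y4.trans w4.symm) (b6.trans d6.symm)
      rw [gy.manti, gw.manti, y3, w3]
    apply hpack F4 (fun y hy => (hF1' y (hF4' y hy).1).1) (fun y hy w hw => (heq y hy w hw).1)
      (fun y hy w hw => (heq y hy w hw).2) _ hab
    intro y hy w hw
    exact (hF1' y (hF4' y hy).1).2.2.2.2.2.2.2.trans (hF1' w (hF4' w hw).1).2.2.2.2.2.2.2.symm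

/-! ### Method gamma -/

def SameTri (i j k : Fin 4) (x y : Dat) : Prop :=
  (x.h i = y.h i ∧ x.h j = y.h j ∧ x.h k = y.h k) ∧ (x.m i j = y.m i j ∧ x.m j k = y.m j k ∧
    x.m k i = y.m k i) ∧ (x.e i j = y.e i j ∧ x.e j k = y.e j k ∧ x.e k i = y.e k i) ∧ x.u = y.u

lemma gint_mul_star (z : 𝔾) : z * star z = ((gn z : ℤ) : 𝔾) := by
  rw [gn_int]
  ext <;> (simp; try ring)

lemma Good.cop_pe {X : ℕ} {x : Dat} (g : Good X x) {i j k l : Fin 4} (hd : D4 i j k l) :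
    IsCoprime (x.p i j) (x.e j k) := by
  have := g.cop_pp hd
  unfold Dat.p at this ⊢
  exact this.of_mul_right_right

lemma Good.cop_ee {X : ℕ} {x : Dat} (g : Good X x) {i j k l : Fin 4} (hd : D4 i j k l) :
    IsCoprime (x.e i j) (x.e j k) := by
  have := g.cop_pe hd
  unfold Dat.p at this
  exact this.of_mul_left_right

lemma Good.cop_mm {X : ℕ} {x : Dat} (g : Good X x) {i j k l : Fin 4} (hd : D4 i j k l) :
    IsCoprime (x.m i j : 𝔾) (x.m j k : 𝔾) := by
  have := g.cop_pp hd
  unfold Dat.p at this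
  exact this.of_mul_left_left.of_mul_right_left

/-- coefficient of the unknown `m k l` in the Ptolemy relation -/
def Dat.cf (x : Dat) (i j : Fin 4) : ℤ := x.m i j * gn (x.e i j)

lemma Dat.cf_eq {X : ℕ} {x : Dat} (g : Good X x) {i j k l : Fin 4} (hd : D4 i j k l) :
    (x.cf i j : 𝔾) * x.u = x.p i j * x.e k l := by
  unfold Dat.cf Dat.p
  push_cast
  rw [g.econj i j k l hd]
  have := gint_mul_star (x.e i j)
  push_cast at this
  rw [← this]; ring

lemma Good.cop_cf {X : ℕ} {x : Dat} (g : Good X x) {i j k l : Fin 4} (hd : D4 i j k l) :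
    IsCoprime (x.cf i j : 𝔾) (x.cf j k : 𝔾) := by
  have h1 : IsCoprime ((x.cf i j : 𝔾) * x.u) ((x.cf j k : 𝔾) * x.u) := by
    rw [Dat.cf_eq g hd, Dat.cf_eq g (hd.rot.swap34 : D4 j k i l)]
    have e1 := g.cop_pp hd
    have e2 : IsCoprime (x.p i j) (x.e i l) := by
      have := g.cop_pe hd.swap12.swap34
      rw [g.panti] at this
      exact (IsCoprime.neg_left_iff _ _).mp this
    have e3 : IsCoprime (x.e k l) (x.p j k) := (g.cop_pe hd.rot).symm
    have e4 : IsCoprime (x.e k l) (x.e i l) := by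
      rw [g.esym i l]; exact g.cop_ee hd.opp
    exact (e1.mul_right e2).mul_left (e3.mul_right e4)
  exact h1.of_mul_left_left.of_mul_right_left

lemma Good.ptol_int {X : ℕ} {x : Dat} (g : Good X x) {i j k l : Fin 4} (hd : D4 i j k l) :
    x.cf i j * x.m k l + x.cf k i * x.m j l + x.cf j k * x.m i l = 0 := by
  have h := g.ptolemy hd
  have h1 := Dat.cf_eq g hd
  have h2 := Dat.cf_eq g hd.swap23.swap12
  have h3 := Dat.cf_eq g hd.rot.swap34
  have hu := g.uu.ne_zero
  have : ((x.cf i j * x.m k l + x.cf k i * x.m j l + x.cf j k * x.m i l : ℤ) : 𝔾) = 0 := by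
    apply mul_right_cancel₀ hu
    push_cast
    rw [g.panti l j, g.panti i k] at h
    unfold Dat.p at *
    linear_combination h + (x.m k l : 𝔾) * h1 + (x.m j l : 𝔾) * h2 + (x.m i l : 𝔾) * h3
  exact_mod_cast this

lemma InCls.cfl {c : Cls} {x : Dat} (k : InCls c x) {i j : Fin 4} (h : i ≠ j) :
    pw (c.M i j + c.E i j) ≤ ‖((x.cf i j : 𝔾) : ℂ)‖ := by
  have e : ‖((x.cf i j : 𝔾) : ℂ)‖ = |(x.m i j : ℝ)| * gn (x.e i j) := by
    unfold Dat.cf; push_cast; simp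
  rw [e, pw_add]
  apply mul_le_mul (k.ml h) _ (pw_pos _).le (abs_nonneg _)
  rw [pw_nat]; exact_mod_cast k.El i j h

lemma norm_gint (m : ℤ) : ‖((m : 𝔾) : ℂ)‖ = |(m : ℝ)| := by simp

lemma tri_sec {X : ℕ} {c : Cls} (S : Finset Dat) (hS : ∀ x ∈ S, Good X x ∧ InCls c x)
    {i j k l : Fin 4} (hd : D4 i j k l) (hs : ∀ x ∈ S, ∀ y ∈ S, SameTri i j k x y) :
    (S.card : ℝ) ≤ 144 * (1 + pw (c.M i l + c.M j l - c.M i j - c.E i j)) := by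
  classical
  set s : ℝ := pw (c.M i j + c.E i j - 2 * c.M i l - 2) with hs'
  set R : ℝ := pw (c.M j l + 1 - c.M i l) with hR
  have key := pack_real S (fun x => (x.m j l : ℝ) / (x.m i l : ℝ)) R s 9 (pw_pos _) (by norm_num)
    (pw_pos _).le ?_ ?_
  · have e1 : (R / s) = 8 * pw (c.M i l + c.M j l - c.M i j - c.E i j) := by
      rw [hR, hs', ← pw_sub]
      have : (8 : ℝ) = pw 3 := by rw [show (3 : ℝ) = ((3 : ℕ) : ℝ) by norm_num, pw_nat]; norm_num
      rw [this, ← pw_add]; congr 1; ring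
    rw [e1] at key
    refine key.trans ?_
    have := pw_pos (c.M i l + c.M j l - c.M i j - c.E i j)
    nlinarith
  · intro x hx
    rw [abs_div]
    have a1 := ((hS x hx).2.mu hd.jl).le
    have a2 := (hS x hx).2.ml hd.il
    have : R = pw (c.M j l + 1) / pw (c.M i l) := by
      rw [hR, ← pw_sub]
    rw [this]
    exact div_le_div₀ (pw_pos _).le a1 (pw_pos _) a2
  · intro x hx
    obtain ⟨gx, cx⟩ := hS x hx
    have main : ∀ y ∈ S.filter (fun y => |(y.m j l : ℝ) / (y.m i l : ℝ) - (x.m j l : ℝ) / (x.m i l : ℝ)| < s),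
        ∃ v : 𝔾, IsUnit v ∧ (y.m i l : 𝔾) = v * x.m i l ∧ (y.m j l : 𝔾) = v * x.m j l ∧
          (y.m k l : 𝔾) = v * x.m k l ∧ y.h l = v * x.h l := by
      intro y hy
      rw [Finset.mem_filter] at hy
      obtain ⟨hyS, hy⟩ := hy
      obtain ⟨gy, cy⟩ := hS y hyS
      obtain ⟨⟨h1, h2, h3⟩, ⟨m1, m2, m3⟩, ⟨e1, e2, e3⟩, hu⟩ := hs x hx y hyS
      have c1 : x.cf i j = y.cf i j := by unfold Dat.cf; rw [m1, e1]
      have c2 : x.cf j k = y.cf j k := by unfold Dat.cf; rw [m2, e2]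
      have c3 : x.cf k i = y.cf k i := by unfold Dat.cf; rw [m3, e3]
      have p1 : x.p i j = y.p i j := by unfold Dat.p; rw [m1, e1]
      have r1 := gx.ptol_int hd
      have r2 := gy.ptol_int hd
      rw [← c1, ← c2, ← c3] at r2
      have hdet : (x.cf i j : 𝔾) ∣ ((x.m i l * y.m j l - x.m j l * y.m i l : ℤ) : 𝔾) := by
        apply (gx.cop_cf hd).dvd_of_dvd_mul_left
        refine ⟨((-(x.m k l * y.m j l) + y.m k l * x.m j l : ℤ) : 𝔾), ?_⟩
        have : x.cf j k * (x.m i l * y.m j l - x.m j l * y.m i l) =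
          x.cf i j * (-(x.m k l * y.m j l) + y.m k l * x.m j l) := by
          linear_combination y.m j l * r1 - x.m j l * r2
        exact_mod_cast this
      have hxj : (x.m i l : ℝ) ≠ 0 := by exact_mod_cast gx.mne i l hd.il
      have hyj : (y.m i l : ℝ) ≠ 0 := by exact_mod_cast gy.mne i l hd.il
      have h0 : ((x.m i l * y.m j l - x.m j l * y.m i l : ℤ) : 𝔾) = 0 := by
        apply norm_lt_of_dvd hdet
        refine lt_of_lt_of_le ?_ (cx.cfl hd.ij)
        rw [norm_gint]
        have e1 : ((x.m i l * y.m j l - x.m j l * y.m i l : ℤ) : ℝ) =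
            ((y.m j l : ℝ) / (y.m i l : ℝ) - (x.m j l : ℝ) / (x.m i l : ℝ)) * (x.m i l * y.m i l) := by
          push_cast
          field_simp
        rw [e1, abs_mul, abs_mul]
        have a1 := (cx.mu hd.il).le
        have a2 := (cy.mu hd.il).le
        have a3 : |(x.m i l : ℝ)| * |(y.m i l : ℝ)| ≤ pw (c.M i l + 1) * pw (c.M i l + 1) :=
          mul_le_mul a1 a2 (abs_nonneg _) (pw_pos _).le
        have a4 : 0 < |(x.m i l : ℝ)| * |(y.m i l : ℝ)| := by positivity
        calc _ < s * (|(x.m i l : ℝ)| * |(y.m i l : ℝ)|) := by gcongr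
          _ ≤ s * (pw (c.M i l + 1) * pw (c.M i l + 1)) := by
            have := pw_pos (c.M i j + c.E i j - 2 * c.M i l - 2)
            gcongr
          _ = _ := by rw [hs', ← pw_add, ← pw_add]; congr 1; ring
      have cop : ∀ z : Dat, Good X z → IsCoprime (z.m i l : 𝔾) (z.m j l : 𝔾) := by
        intro z gz
        have := gz.cop_mm hd.swap34.swap23
        rw [gz.manti l j] at this
        push_cast at this
        exact (IsCoprime.neg_right_iff _ _).mp this
      have h0' : (x.m i l : 𝔾) * (y.m j l : 𝔾) = (x.m j l : 𝔾) * (y.m i l : 𝔾) := by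
        push_cast at h0; exact sub_eq_zero.mp h0
      obtain ⟨v, hv, v1, v2⟩ := assoc_of_det (by exact_mod_cast gx.mne i l hd.il) (cop x gx)
        (cop y gy) h0'
      have hcf : (x.cf i j : 𝔾) ≠ 0 := by
        have : x.cf i j ≠ 0 := by
          unfold Dat.cf
          apply mul_ne_zero (gx.mne i j hd.ij)
          have := gn_pos (gx.ene i j hd.ij)
          omega
        exact_mod_cast this
      refine ⟨v, hv, v1, v2, ?_, ?_⟩
      · have r1' : (x.cf i j : 𝔾) * x.m k l + x.cf k i * x.m j l + x.cf j k * x.m i l = 0 := by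
          exact_mod_cast r1
        have r2' : (x.cf i j : 𝔾) * y.m k l + x.cf k i * y.m j l + x.cf j k * y.m i l = 0 := by
          exact_mod_cast r2
        rw [v1, v2] at r2'
        apply mul_left_cancel₀ hcf
        linear_combination r2' - v * r1'
      · have r1' := gx.rel i j l k hd.swap34
        have r2' := gy.rel i j l k hd.swap34
        have q1 : y.p j l = v * x.p j l := by
          unfold Dat.p
          rw [v2, gx.econj i k j l hd.swap23, gy.econj i k j l hd.swap23, ← hu, gx.esym i k,
            gy.esym i k, ← e3]; ring
        have q2 : y.p l i = v * x.p l i := by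
          rw [gy.panti, gx.panti]
          unfold Dat.p
          rw [v1, gx.econj j k i l hd.rot.swap34, gy.econj j k i l hd.rot.swap34, ← hu, ← e2]; ring
        rw [q1, q2, ← h1, ← h2, ← p1] at r2'
        apply mul_right_cancel₀ (gx.pne hd.ij)
        linear_combination r2' - v * r1'
    set S' := S.filter (fun y => |(y.m j l : ℝ) / (y.m i l : ℝ) - (x.m j l : ℝ) / (x.m i l : ℝ)| < s) with hS'
    have hinj : Set.InjOn (fun y : Dat => (y.m i l : 𝔾)) S' := by
      intro y hy z hz hyz
      simp only at hyz
      obtain ⟨v, hv, v1, v2, v3, v4⟩ := main y hy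
      obtain ⟨w, hw, w1, w2, w3, w4⟩ := main z hz
      have hvw : v = w := by
        apply mul_right_cancel₀ (b := (x.m i l : 𝔾))
        · exact_mod_cast gx.mne i l hd.il
        · rw [← v1, ← w1, hyz]
      subst hvw
      have hyS := (Finset.mem_filter.mp hy).1
      have hzS := (Finset.mem_filter.mp hz).1
      obtain ⟨gy, cy⟩ := hS y hyS
      obtain ⟨gz, cz⟩ := hS z hzS
      obtain ⟨⟨h1, h2, h3⟩, ⟨m1, m2, m3⟩, ⟨e1, e2, e3⟩, hu⟩ := hs y hyS z hzS
      have f1 : y.m j l = z.m j l := by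
        have := v2.trans w2.symm; exact_mod_cast this
      have f2 : y.m k l = z.m k l := by
        have := v3.trans w3.symm; exact_mod_cast this
      apply Dat.ext_of gy gz hd h1 h2 h3 (v4.trans w4.symm) hu m1 _ (by exact_mod_cast hyz) m2 f1 f2 e1
      · rw [gy.esym, gz.esym]; exact e3
      · rw [gy.econj j k i l hd.rot.swap34, gz.econj j k i l hd.rot.swap34, hu, e2]
      · rw [gy.manti, gz.manti, m3]
    rw [← Finset.card_image_of_injOn hinj]
    have := gunits_card (x.m i l : 𝔾) (S'.image (fun y : Dat => (y.m i l : 𝔾))) (by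
      intro w hw
      obtain ⟨y, hy, rfl⟩ := Finset.mem_image.mp hw
      obtain ⟨v, hv, v1, _⟩ := main y hy
      exact ⟨v, hv, v1⟩)
    exact_mod_cast this

def TriB (F : Finset Dat) (i j k : Fin 4) (K : ℝ) : Prop :=
  ∀ S ⊆ F, (∀ x ∈ S, ∀ y ∈ S, SameTri i j k x y) → (S.card : ℝ) ≤ K

lemma tri_AE {X : ℕ} {c : Cls} (F : Finset Dat) (hF : ∀ x ∈ F, Good X x ∧ InCls c x)
    {i j k l : Fin 4} (hd : D4 i j k l) (K : ℝ) (hK0 : 0 ≤ K) (hK : TriB F i j k K) :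
    (F.card : ℝ) ≤ 10 ^ 10 * K * pw (c.H i + c.H j + c.H k + c.E i j + c.E j k + c.E k i) := by
  classical
  have h1 := card_fib' F (fun x => (x.h i, x.h j, x.h k, x.e i j, x.e j k, x.e k i, x.u))
    (gset (c.H i) ×ˢ gset (c.H j) ×ˢ gset (c.H k) ×ˢ gset (c.E i j) ×ˢ gset (c.E j k) ×ˢ
      gset (c.E k i) ×ˢ uset) (K * 9) (by positivity) ?_ ?_
  · refine h1.trans ?_
    simp only [Finset.card_product, Nat.cast_mul]
    have a1 := card_gset (c.H i)
    have a2 := card_gset (c.H j)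
    have a3 := card_gset (c.H k)
    have a4 := card_gset (c.E i j)
    have a5 := card_gset (c.E j k)
    have a6 := card_gset (c.E k i)
    have a7 := card_uset
    have p1 := pw_pos (c.H i)
    have p2 := pw_pos (c.H j)
    have p3 := pw_pos (c.H k)
    have p4 := pw_pos (c.E i j)
    have p5 := pw_pos (c.E j k)
    have p6 := pw_pos (c.E k i)
    calc _ ≤ K * 9 * ((18 * pw (c.H i)) * ((18 * pw (c.H j)) *
          ((18 * pw (c.H k)) * ((18 * pw (c.E i j)) * ((18 * pw (c.E j k)) *
          ((18 * pw (c.E k i)) * 9)))))) := by gcongr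
      _ = (9 * 18 ^ 6 * 9) * (K * (pw (c.H i) * pw (c.H j) * pw (c.H k) * pw (c.E i j) * pw (c.E j k) * pw (c.E k i))) := by ring
      _ ≤ 10 ^ 10 * (K * (pw (c.H i) * pw (c.H j) * pw (c.H k) * pw (c.E i j) * pw (c.E j k) * pw (c.E k i))) := by
        gcongr; norm_num
      _ = _ := by simp only [pw_add]; ring
  · intro x hx
    obtain ⟨g, q⟩ := hF x hx
    simp only [Finset.mem_product]
    exact ⟨mem_gset (q.Hu _), mem_gset (q.Hu _), mem_gset (q.Hu _), mem_gset (q.Eu _ _ hd.ij),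
      mem_gset (q.Eu _ _ hd.jk), mem_gset (q.Eu _ _ hd.ik.symm), mem_uset g.uu⟩
  · intro x hx
    obtain ⟨g, q⟩ := hF x hx
    set F1 := F.filter (fun y => (y.h i, y.h j, y.h k, y.e i j, y.e j k, y.e k i, y.u) =
      (x.h i, x.h j, x.h k, x.e i j, x.e j k, x.e k i, x.u)) with hF1
    have hF1' : ∀ y ∈ F1, (y ∈ F ∧ Good X y ∧ InCls c y) ∧ y.h i = x.h i ∧ y.h j = x.h j ∧
        y.h k = x.h k ∧ y.e i j = x.e i j ∧ y.e j k = x.e j k ∧ y.e k i = x.e k i ∧ y.u = x.u := by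
      intro y hy
      rw [hF1, Finset.mem_filter] at hy
      simp only [Prod.mk.injEq] at hy
      exact ⟨⟨hy.1, hF y hy.1⟩, hy.2⟩
    have main : ∀ y ∈ F1, ∃ v : 𝔾, IsUnit v ∧ (y.m i j : 𝔾) = v * x.m i j ∧ (y.m k i : 𝔾) = v * x.m k i ∧
          (y.m j k : 𝔾) = v * x.m j k := by
      intro y hy
      obtain ⟨⟨hyF, gy, qy⟩, b1, b2, b3, b4, b5, b6, b7⟩ := hF1' y hy
      have r1 := g.rel i j k l hd
      have r2 := gy.rel i j k l hd
      unfold Dat.p at r1 r2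
      rw [b1, b2, b3, b4, b5, b6] at r2
      set A := x.h k * x.e i j with hA
      set B := x.h i * x.e j k with hB
      set D := x.h j * x.e k i with hD
      have hnc := g.ncol i j k l hd
      have hAB : (A * star B).im ≠ 0 := by
        intro h0
        apply hnc
        have : x.h k * x.p i j * star (x.h i * x.p j k) = ((x.m i j * x.m j k : ℤ) : 𝔾) * (A * star B) := by
          unfold Dat.p
          rw [hA, hB]
          simp only [star_mul]
          rw [show star (x.m j k : 𝔾) = (x.m j k : 𝔾) by ext <;> simp]
          push_cast; ring
        rw [this]
        clear this
        generalize A * star B = Z at *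
        simp [h0]
      have hB0 : B ≠ 0 := mul_ne_zero (g.hne i) (g.ene j k hd.jk)
      have k1 : A * ((x.m i j * y.m k i - y.m i j * x.m k i : ℤ) : 𝔾) + B * ((x.m j k * y.m k i - y.m j k * x.m k i : ℤ) : 𝔾) = 0 := by
        push_cast
        linear_combination (y.m k i : 𝔾) * r1 - (x.m k i : 𝔾) * r2
      have k2 : (x.m i j * y.m k i - y.m i j * x.m k i : ℤ) = 0 := by
        have k3 : A * star B * ((x.m i j * y.m k i - y.m i j * x.m k i : ℤ) : 𝔾) + ((gn B : ℤ) : 𝔾) * ((x.m j k * y.m k i - y.m j k * x.m k i : ℤ) : 𝔾) = 0 := by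
          rw [← gint_mul_star]
          linear_combination star B * k1
        have k4 := congrArg Zsqrtd.im k3
        generalize A * star B = Z at *
        generalize (x.m i j * y.m k i - y.m i j * x.m k i : ℤ) = d1 at *
        generalize (x.m j k * y.m k i - y.m j k * x.m k i : ℤ) = d2 at *
        simp at k4
        tauto
      rw [k2] at k1
      have k5 : (x.m j k * y.m k i - y.m j k * x.m k i : ℤ) = 0 := by
        have : ((x.m j k * y.m k i - y.m j k * x.m k i : ℤ) : 𝔾) = 0 := by
          apply mul_left_cancel₀ hB0
          rw [mul_zero, ← k1]; simp
        exact_mod_cast this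
      have k2' : ((x.m i j : ℤ) : 𝔾) * (y.m k i : 𝔾) = (x.m k i : 𝔾) * (y.m i j : 𝔾) := by
        have : x.m i j * y.m k i = x.m k i * y.m i j := by linarith
        exact_mod_cast this
      obtain ⟨v, hv, v1, v2⟩ := assoc_of_det (by exact_mod_cast g.mne i j hd.ij)
        (g.cop_mm hd.swap23.swap12).symm (gy.cop_mm hd.swap23.swap12).symm k2'
      refine ⟨v, hv, v1, v2, ?_⟩
      have k5' : (x.m j k : 𝔾) * (y.m k i : 𝔾) = (y.m j k : 𝔾) * (x.m k i : 𝔾) := by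
        have : x.m j k * y.m k i = y.m j k * x.m k i := by linarith
        exact_mod_cast this
      apply mul_right_cancel₀ (b := (x.m k i : 𝔾)) (by exact_mod_cast g.mne k i hd.ik.symm)
      rw [← k5', v2]; ring
    have h2 := card_fib' F1 (fun y => (y.m i j : 𝔾)) (F1.image (fun y => (y.m i j : 𝔾))) K hK0
      (fun a ha => Finset.mem_image_of_mem _ ha) ?_
    · refine h2.trans ?_
      gcongr
      have := gunits_card (x.m i j : 𝔾) (F1.image (fun y : Dat => (y.m i j : 𝔾))) (by
        intro w hw
        obtain ⟨y, hy, rfl⟩ := Finset.mem_image.mp hw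
        obtain ⟨v, hv, v1, _⟩ := main y hy
        exact ⟨v, hv, v1⟩)
      exact_mod_cast this
    · intro z hz
      apply hK
      · intro y hy
        exact (hF1' y (Finset.mem_filter.mp hy).1).1.1
      intro y hy w hw
      rw [Finset.mem_filter] at hy hw
      obtain ⟨⟨hyF, gy, qy⟩, b1, b2, b3, b4, b5, b6, b7⟩ := hF1' y hy.1
      obtain ⟨⟨hwF, gw, qw⟩, d1, d2, d3, d4, d5, d6, d7⟩ := hF1' w hw.1
      obtain ⟨v, hv, v1, v2, v3⟩ := main y hy.1
      obtain ⟨v', hv', v1', v2', v3'⟩ := main w hw.1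
      have hyw := hy.2.trans hw.2.symm
      have hvw : v = v' := by
        apply mul_right_cancel₀ (b := (x.m i j : 𝔾))
        · exact_mod_cast g.mne i j hd.ij
        · rw [← v1, ← v1', hyw]
      subst hvw
      have f1 := v2.trans v2'.symm
      have f2 := v3.trans v3'.symm
      exact ⟨⟨b1.trans d1.symm, b2.trans d2.symm, b3.trans d3.symm⟩, ⟨by exact_mod_cast hyw,
        by exact_mod_cast f2, by exact_mod_cast f1⟩, ⟨b4.trans d4.symm, b5.trans d5.symm, b6.trans d6.symm⟩,
        b7.trans d7.symm⟩

lemma tri_DS {X : ℕ} {T : ℝ} {c : Cls} (hT : DivB (X ^ 2) T) (hT0 : 0 ≤ T) (F : Finset Dat)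
    (hF : ∀ x ∈ F, Good X x ∧ InCls c x)
    {i j k l : Fin 4} (hd : D4 i j k l) (K : ℝ) (hK0 : 0 ≤ K) (hK : TriB F i j k K) :
    (F.card : ℝ) ≤ 10 ^ 10 * K * T ^ 4 * pw (c.M i j + c.M j k + c.M k i + c.H k + c.E i j) *
      (1 + pw (c.H i + c.E j k - 2 * c.M k i)) := by
  classical
  set s := pw (c.H i + c.E j k - 2 * c.M k i) with hs
  have hs0 : 0 < s := pw_pos _
  have h1 := card_fib' F (fun x => (x.m i j, x.m j k, x.m k i, x.h k, x.e i j, x.u))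
    (zset (c.M i j) ×ˢ zset (c.M j k) ×ˢ zset (c.M k i) ×ˢ gset (c.H k) ×ˢ gset (c.E i j) ×ˢ uset)
    (K * T * T * T * T * 128 * (1 + s)) (by positivity) ?_ ?_
  · refine h1.trans ?_
    simp only [Finset.card_product, Nat.cast_mul]
    have a1 := card_zset (c.M i j)
    have a2 := card_zset (c.M j k)
    have a3 := card_zset (c.M k i)
    have a4 := card_gset (c.H k)
    have a5 := card_gset (c.E i j)
    have a7 := card_uset
    have p1 := pw_pos (c.M i j)
    have p2 := pw_pos (c.M j k)
    have p3 := pw_pos (c.M k i)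
    have p4 := pw_pos (c.H k)
    have p5 := pw_pos (c.E i j)
    calc _ ≤ K * T * T * T * T * 128 * (1 + s) * ((5 * pw (c.M i j)) * ((5 * pw (c.M j k)) *
          ((5 * pw (c.M k i)) * ((18 * pw (c.H k)) * ((18 * pw (c.E i j)) * 9))))) := by gcongr
      _ = (128 * 5 ^ 3 * 18 ^ 2 * 9) * (K * T ^ 4 * (pw (c.M i j) * pw (c.M j k) * pw (c.M k i) * pw (c.H k) * pw (c.E i j)) * (1 + s)) := by ring
      _ ≤ 10 ^ 10 * (K * T ^ 4 * (pw (c.M i j) * pw (c.M j k) * pw (c.M k i) * pw (c.H k) * pw (c.E i j)) * (1 + s)) := by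
        gcongr; norm_num
      _ = _ := by simp only [pw_add]; ring
  · intro x hx
    obtain ⟨g, q⟩ := hF x hx
    simp only [Finset.mem_product]
    exact ⟨mem_zset (q.Mu _ _ hd.ij), mem_zset (q.Mu _ _ hd.jk), mem_zset (q.Mu _ _ hd.ik.symm),
      mem_gset (q.Hu _), mem_gset (q.Eu _ _ hd.ij), mem_uset g.uu⟩
  · intro x hx
    obtain ⟨g, q⟩ := hF x hx
    set F1 := F.filter (fun y => (y.m i j, y.m j k, y.m k i, y.h k, y.e i j, y.u) =
      (x.m i j, x.m j k, x.m k i, x.h k, x.e i j, x.u)) with hF1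
    have hF1' : ∀ y ∈ F1, (y ∈ F ∧ Good X y ∧ InCls c y) ∧ y.m i j = x.m i j ∧ y.m j k = x.m j k ∧
        y.m k i = x.m k i ∧ y.h k = x.h k ∧ y.e i j = x.e i j ∧ y.u = x.u := by
      intro y hy
      rw [hF1, Finset.mem_filter] at hy
      simp only [Prod.mk.injEq] at hy
      exact ⟨⟨hy.1, hF y hy.1⟩, hy.2⟩
    have key := pack_complex F1 (fun y => ((y.h i * y.e j k : 𝔾) : ℂ))
      (pw ((c.H i + c.E j k + 2) / 2)) (pw (c.M k i)) (K * T * T * T * T) (pw_pos _) (by positivity)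
      (pw_pos _).le ?_ ?_
    · refine key.trans ?_
      have e1 : (pw ((c.H i + c.E j k + 2) / 2) / pw (c.M k i)) ^ 2 = 4 * s := by
        rw [← pw_sub, pw_sq, hs]
        have : (4 : ℝ) = pw 2 := by rw [show (2 : ℝ) = ((2 : ℕ) : ℝ) by norm_num, pw_nat]; norm_num
        rw [this, ← pw_add]; congr 1; ring
      rw [e1]
      have : 0 ≤ K * T * T * T * T := by positivity
      nlinarith [mul_nonneg this hs0.le]
    · intro y hy
      obtain ⟨⟨hyF, gy, qy⟩, b⟩ := hF1' y hy
      simp only [GaussianInt.toComplex_mul, norm_mul]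
      have a1 := (qy.hu i).le
      have a2 := (qy.eu hd.jk).le
      calc _ ≤ pw ((c.H i + 1) / 2) * pw ((c.E j k + 1) / 2) :=
            mul_le_mul a1 a2 (norm_nonneg _) (pw_pos _).le
        _ = _ := by rw [← pw_add]; congr 1; ring
    intro x2 hx2
    set F2 := F1.filter (fun y => ‖((y.h i * y.e j k : 𝔾) : ℂ) - ((x2.h i * x2.e j k : 𝔾) : ℂ)‖ < pw (c.M k i)) with hF2
    set Y := x2.h i * x2.e j k with hY
    set Z := x2.h j * x2.e k i with hZ
    obtain ⟨⟨hx2F, g2, q2⟩, d1, d2, d3, d4, d5, d6⟩ := hF1' x2 hx2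
    have hF2' : ∀ y ∈ F2, y.h i * y.e j k = Y ∧ y.h j * y.e k i = Z := by
      intro y hy
      rw [hF2, Finset.mem_filter] at hy
      obtain ⟨hyF1, hy⟩ := hy
      obtain ⟨⟨hyF, gy, qy⟩, b1, b2, b3, b4, b5, b6⟩ := hF1' y hyF1
      have r1 := g2.rel i j k l hd
      have r2 := gy.rel i j k l hd
      unfold Dat.p at r1 r2
      rw [b1, b2, b3, b4, b5] at r2
      rw [d1, d2, d3, d4, d5] at r1
      have h0 : y.h i * y.e j k - Y = 0 := by
        apply norm_lt_of_dvd (a := (x.m k i : 𝔾))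
        · apply (g.cop_mm hd.rot.swap34).symm.dvd_of_dvd_mul_left
          refine ⟨x2.h j * x2.e k i - y.h j * y.e k i, ?_⟩
          rw [hY]
          linear_combination r2 - r1
        · rw [GaussianInt.toComplex_sub]
          refine lt_of_lt_of_le hy ?_
          rw [norm_gint]
          exact q.ml hd.ik.symm
      have h0' := sub_eq_zero.mp h0
      refine ⟨h0', ?_⟩
      apply mul_left_cancel₀ (a := (x.m k i : 𝔾)) (by exact_mod_cast g.mne k i hd.ik.symm)
      rw [hZ]
      linear_combination r2 - r1 - (x.m j k : 𝔾) * h0'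
    have gle : ∀ y : Dat, Good X y → gn (y.h i * y.e j k) ≤ X ^ 2 ∧ gn (y.h j * y.e k i) ≤ X ^ 2 ∧
        y.h i * y.e j k ≠ 0 ∧ y.h j * y.e k i ≠ 0 := by
      intro y gy
      have aux : ∀ {i j k l : Fin 4}, D4 i j k l → gn (y.h i * y.e j k) ≤ X ^ 2 := by
        intro i j k l hd
        have s1 := gy.size j k i l hd.rot.swap34
        have p1 := gn_pos (gy.hne l)
        have p2 : 1 ≤ gn (y.m j k : 𝔾) := gn_pos (by exact_mod_cast gy.mne j k hd.jk)
        unfold Dat.p at s1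
        rw [gn_mul] at s1 ⊢
        have : gn (y.h i) * gn (y.e j k) ≤ X := by
          refine le_trans ?_ s1
          calc gn (y.h i) * gn (y.e j k) ≤ (gn (y.h i) * gn (y.e j k)) * (gn (y.h l) * gn (y.m j k : 𝔾)) :=
                Nat.le_mul_of_pos_right _ (Nat.mul_pos p1 p2)
            _ = _ := by ring
        nlinarith [Nat.zero_le X]
      exact ⟨aux hd, aux hd.rot.swap34, mul_ne_zero (gy.hne _) (gy.ene _ _ hd.jk),
        mul_ne_zero (gy.hne _) (gy.ene _ _ hd.ik.symm)⟩
    obtain ⟨gY, gZ, Y0, Z0⟩ := gle x2 g2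
    rw [← hY] at gY Y0
    rw [← hZ] at gZ Z0
    apply card_div_fib hT hT0 F2 (fun y => y.h i) Y Y0 gY
    · intro y hy
      exact ⟨y.e j k, (hF2' y hy).1.symm⟩
    · positivity
    intro x3 hx3
    set F3 := F2.filter (fun y => y.h i = x3.h i) with hF3
    apply card_div_fib hT hT0 F3 (fun y => y.e j k) Y Y0 gY
    · intro y hy
      exact ⟨y.h i, by rw [mul_comm]; exact (hF2' y (Finset.mem_filter.mp hy).1).1.symm⟩
    · positivity
    intro x4 hx4
    set F4 := F3.filter (fun y => y.e j k = x4.e j k) with hF4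
    apply card_div_fib hT hT0 F4 (fun y => y.h j) Z Z0 gZ
    · intro y hy
      exact ⟨y.e k i, (hF2' y (Finset.mem_filter.mp (Finset.mem_filter.mp hy).1).1).2.symm⟩
    · positivity
    intro x5 hx5
    set F5 := F4.filter (fun y => y.h j = x5.h j) with hF5
    apply card_div_fib hT hT0 F5 (fun y => y.e k i) Z Z0 gZ
    · intro y hy
      exact ⟨y.h j, by rw [mul_comm]; exact (hF2' y (Finset.mem_filter.mp (Finset.mem_filter.mp (Finset.mem_filter.mp hy).1).1).1).2.symm⟩
    · positivity
    intro x6 hx6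
    have hmem : ∀ y ∈ F5.filter (fun y => y.e k i = x6.e k i), y ∈ F1 ∧ y.h i = x3.h i ∧ y.e j k = x4.e j k ∧
        y.h j = x5.h j ∧ y.e k i = x6.e k i := by
      intro y hy
      rw [Finset.mem_filter, hF5, Finset.mem_filter, hF4, Finset.mem_filter, hF3, Finset.mem_filter,
        hF2, Finset.mem_filter] at hy
      exact ⟨hy.1.1.1.1.1, hy.1.1.1.2, hy.1.1.2, hy.1.2, hy.2⟩
    apply hK
    · intro y hy
      exact (hF1' y (hmem y hy).1).1.1
    · intro y hy w hw
      obtain ⟨y1, y2, y3, y4, y5⟩ := hmem y hy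
      obtain ⟨w1, w2, w3, w4, w5⟩ := hmem w hw
      obtain ⟨_, b1, b2, b3, b4, b5, b6⟩ := hF1' y y1
      obtain ⟨_, f1, f2, f3, f4, f5, f6⟩ := hF1' w w1
      exact ⟨⟨y2.trans w2.symm, y4.trans w4.symm, b4.trans f4.symm⟩, ⟨b1.trans f1.symm, b2.trans f2.symm,
        b3.trans f3.symm⟩, ⟨b5.trans f5.symm, y3.trans w3.symm, y5.trans w5.symm⟩, b6.trans f6.symm⟩

lemma SameTri.rot {i j k : Fin 4} {x y : Dat} (h : SameTri i j k x y) : SameTri j k i x y := by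
  obtain ⟨⟨h1, h2, h3⟩, ⟨m1, m2, m3⟩, ⟨e1, e2, e3⟩, hu⟩ := h
  exact ⟨⟨h2, h3, h1⟩, ⟨m2, m3, m1⟩, ⟨e2, e3, e1⟩, hu⟩

lemma SameTri.swap {X : ℕ} {i j k : Fin 4} {x y : Dat} (gx : Good X x) (gy : Good X y)
    (h : SameTri i j k x y) : SameTri j i k x y := by
  obtain ⟨⟨h1, h2, h3⟩, ⟨m1, m2, m3⟩, ⟨e1, e2, e3⟩, hu⟩ := h
  refine ⟨⟨h2, h1, h3⟩, ⟨?_, ?_, ?_⟩, ⟨?_, ?_, ?_⟩, hu⟩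
  · rw [gx.manti, gy.manti, m1]
  · rw [gx.manti, gy.manti, m3]
  · rw [gx.manti, gy.manti, m2]
  · rw [gx.esym, gy.esym, e1]
  · rw [gx.esym, gy.esym, e3]
  · rw [gx.esym, gy.esym, e2]

lemma triB_sec {X : ℕ} {c : Cls} (F : Finset Dat) (hF : ∀ x ∈ F, Good X x ∧ InCls c x)
    {i j k l : Fin 4} (hd : D4 i j k l) :
    TriB F i j k (144 * (1 + pw (c.M i l + c.M j l - c.M i j - c.E i j))) :=
  fun S hS h => tri_sec S (fun x hx => hF x (hS hx)) hd h

lemma TriB.rot {F : Finset Dat} {i j k : Fin 4} {K : ℝ} (h : TriB F i j k K) : TriB F j k i K :=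
  fun S hS h' => h S hS (fun x hx y hy => (h' x hx y hy).rot.rot)

lemma TriB.swap {X : ℕ} {F : Finset Dat} (hF : ∀ x ∈ F, Good X x)
    {i j k : Fin 4} {K : ℝ} (h : TriB F i j k K) : TriB F j i k K :=
  fun S hS h' => h S hS (fun x hx y hy => (h' x hx y hy).swap (hF x (hS hx)) (hF y (hS hy)))

/-! symmetry of the class -/
lemma dy_unique {a b n : ℕ} (h1 : 2 ^ a ≤ n) (h2 : n < 2 ^ (a + 1)) (h3 : 2 ^ b ≤ n)
    (h4 : n < 2 ^ (b + 1)) : a = b := by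
  have k1 := (Nat.pow_lt_pow_iff_right (one_lt_two)).mp (h1.trans_lt h4)
  have k2 := (Nat.pow_lt_pow_iff_right (one_lt_two)).mp (h3.trans_lt h2)
  omega

lemma InCls.Msymm {X : ℕ} {c : Cls} {x : Dat} (q : InCls c x) (g : Good X x) {i j : Fin 4}
    (h : i ≠ j) : c.M i j = c.M j i := by
  have e : (x.m i j).natAbs = (x.m j i).natAbs := by rw [g.manti i j, Int.natAbs_neg]
  exact dy_unique (q.Ml i j h) (q.Mu i j h) (e ▸ q.Ml j i h.symm) (e ▸ q.Mu j i h.symm)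

lemma InCls.Esymm {X : ℕ} {c : Cls} {x : Dat} (q : InCls c x) (g : Good X x) {i j : Fin 4}
    (h : i ≠ j) : c.E i j = c.E j i := by
  have e : gn (x.e i j) = gn (x.e j i) := by rw [g.esym i j]
  exact dy_unique (q.El i j h) (q.Eu i j h) (e ▸ q.El j i h.symm) (e ▸ q.Eu j i h.symm)

lemma InCls.Eopp {X : ℕ} {c : Cls} {x : Dat} (q : InCls c x) (g : Good X x) {i j k l : Fin 4}
    (h : D4 i j k l) : c.E i j = c.E k l := by
  have e : gn (x.e i j) = gn (x.e k l) := by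
    rw [g.econj i j k l h, gn_mul, gn_star, gn_unit g.uu, one_mul]
  exact dy_unique (q.El i j h.ij) (q.Eu i j h.ij) (e ▸ q.El k l h.kl) (e ▸ q.Eu k l h.kl)

/-! ### Method (ii) -/

lemma star_gint (m : ℤ) : star (m : 𝔾) = (m : 𝔾) := by ext <;> simp

lemma star_uu {X : ℕ} {x : Dat} (g : Good X x) : x.u * star x.u = 1 := by
  rw [gint_mul_star, gn_unit g.uu]; simp

/-- parallel primitive vectors -/
lemma prim_par {e f : 𝔾} (he : IsCoprime e.re e.im) (hf : IsCoprime f.re f.im)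
    (h : e.re * f.im = e.im * f.re) : f = e ∨ f = -e := by
  have a1 : e.re ∣ f.re := he.dvd_of_dvd_mul_left ⟨f.im, h.symm⟩
  have a2 : f.re ∣ e.re := hf.dvd_of_dvd_mul_right ⟨e.im, by rw [h]; ring⟩
  have a3 : e.im ∣ f.im := he.symm.dvd_of_dvd_mul_left ⟨f.re, h⟩
  have a4 : f.im ∣ e.im := hf.symm.dvd_of_dvd_mul_right ⟨e.re, by rw [← h]; ring⟩
  have b1 : e.re.natAbs = f.re.natAbs := Nat.dvd_antisymm (Int.natAbs_dvd_natAbs.mpr a1) (Int.natAbs_dvd_natAbs.mpr a2)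
  have b2 : e.im.natAbs = f.im.natAbs := Nat.dvd_antisymm (Int.natAbs_dvd_natAbs.mpr a3) (Int.natAbs_dvd_natAbs.mpr a4)
  rw [Int.natAbs_eq_natAbs_iff] at b1 b2
  by_cases hr : e.re = 0
  · rcases b2 with b2 | b2
    · left; ext
      · rw [hr] at b1; simp at b1; omega
      · exact b2.symm
    · right; ext
      · rw [hr] at b1; simp at b1; simp; omega
      · simp; omega
  · by_cases hi : e.im = 0
    · rcases b1 with b1 | b1
      · left; ext
        · exact b1.symm
        · rw [hi] at b2; simp at b2; omega
      · right; ext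
        · simp; omega
        · rw [hi] at b2; simp at b2; simp; omega
    · rcases b1 with b1 | b1
      · left
        have : f.im = e.im := by
          apply mul_left_cancel₀ hr; rw [h, ← b1]; ring
        ext
        · exact b1.symm
        · exact this
      · right
        have : f.im = -e.im := by
          apply mul_left_cancel₀ hr; rw [h, b1]; ring
        ext
        · simp; omega
        · simp; omega

/-- data shared in method (ii) -/
def SameQ (i j k l : Fin 4) (x y : Dat) : Prop :=
  x.h = y.h ∧ x.u = y.u ∧ x.m i j = y.m i j ∧ x.m k l = y.m k l ∧ x.m j k = y.m j k ∧ x.m i l = y.m i l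


section
variable {X : ℕ} {x y : Dat} {i j k l : Fin 4}

lemma q_pkl (g : Good X x) (hd : D4 i j k l) : x.p k l = x.m k l * (x.u * star (x.e i j)) := by
  unfold Dat.p; rw [g.econj i j k l hd]
lemma q_pil (g : Good X x) (hd : D4 i j k l) : x.p i l = x.m i l * (x.u * star (x.e j k)) := by
  unfold Dat.p; rw [g.econj j k i l hd.rot.swap34]
lemma q_pjl (g : Good X x) (hd : D4 i j k l) : x.p j l = x.m j l * (x.u * star (x.e i k)) := by
  unfold Dat.p; rw [g.econj i k j l hd.swap23]

/-- relation for `p i k` -/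
lemma q_r1 (g : Good X x) (hd : D4 i j k l) :
    x.h j * x.p i k = x.h k * x.p i j + x.h i * x.p j k := by
  have := g.rel i j k l hd
  rw [g.panti k i] at this
  linear_combination -this
lemma q_r2 (g : Good X x) (hd : D4 i j k l) :
    x.h l * x.p i k = - (x.h i * x.p k l) + x.h k * x.p i l := by
  have := g.rel i k l j hd.swap23.swap34
  rw [g.panti l i] at this
  linear_combination this
lemma q_r3 (g : Good X x) (hd : D4 i j k l) :
    x.h i * x.p j l = - (x.h l * x.p i j) + x.h j * x.p i l := by
  have := g.rel i j l k hd.swap34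
  rw [g.panti l i] at this
  linear_combination this

def cA (x : Dat) (i j k l : Fin 4) : 𝔾 := x.h l * x.h i * x.m j k
def cB (x : Dat) (i j k l : Fin 4) : 𝔾 := -(x.h j * x.h k * x.m i l * x.u)
def cC (x : Dat) (i j k l : Fin 4) : 𝔾 := -(x.h l * x.h k * x.m i j)
def cD (x : Dat) (i j k l : Fin 4) : 𝔾 := -(x.h j * x.h i * x.m k l * x.u)
def cQ (x : Dat) (i j k l : Fin 4) : 𝔾 := star (cA x i j k l) * cD x i j k l - cB x i j k l * star (cC x i j k l)
def cP (x : Dat) (i j k l : Fin 4) : 𝔾 := star (cA x i j k l) * cC x i j k l - cB x i j k l * star (cD x i j k l)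
def cN (x : Dat) (i j k l : Fin 4) : ℤ := gn (cA x i j k l) - gn (cB x i j k l)

lemma q_lin (g : Good X x) (hd : D4 i j k l) :
    cA x i j k l * x.e j k + cB x i j k l * star (x.e j k) =
      cC x i j k l * x.e i j + cD x i j k l * star (x.e i j) := by
  have h1 := q_r1 g hd
  have h2 := q_r2 g hd
  rw [q_pkl g hd, q_pil g hd] at h2
  unfold Dat.p at h1 h2
  unfold cA cB cC cD
  linear_combination x.h j * h2 - x.h l * h1

lemma q_f (g : Good X x) (hd : D4 i j k l) :
    (cN x i j k l : 𝔾) * x.e j k = cP x i j k l * x.e i j + cQ x i j k l * star (x.e i j) := by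
  have h := q_lin g hd
  have h' := congrArg star h
  simp only [star_add, star_mul', star_star] at h'
  unfold cN cP cQ
  push_cast
  have e1 := gint_mul_star (cA x i j k l)
  have e2 := gint_mul_star (cB x i j k l)
  push_cast at e1 e2
  rw [← e1, ← e2]
  linear_combination star (cA x i j k l) * h - cB x i j k l * h'

lemma gn_e_opp (g : Good X x) (hd : D4 i j k l) : gn (x.e k l) = gn (x.e i j) := by
  rw [g.econj i j k l hd, gn_mul, gn_star, gn_unit g.uu, one_mul]

lemma cN_ne (g : Good X x) (hd : D4 i j k l) : cN x i j k l ≠ 0 := by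
  intro h
  have := g.ntrap j k i l hd.rot.swap34
  apply this
  unfold cN cA cB at h
  have h' : gn (x.h l * x.h i * (x.m j k : 𝔾)) = gn (-(x.h j * x.h k * (x.m i l : 𝔾) * x.u)) := by
    omega
  unfold Dat.p
  simp only [gn_neg, gn_mul, gn_unit g.uu, mul_one] at h' ⊢
  rw [gn_e_opp g hd.rot.swap34]
  linear_combination gn (x.e j k) * h'

def cR (x : Dat) (i j k l : Fin 4) : ℤ :=
  gn (x.h i) * (x.m j k * x.m k l) + gn (x.h k) * (x.m i l * x.m i j)

lemma cR_ne (g : Good X x) (hd : D4 i j k l) : cR x i j k l ≠ 0 := by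
  intro h
  apply g.nbis i k j l hd.swap23
  unfold cR at h
  have h2 : (gn (x.h k) : ℤ) * (x.m i l * x.m i j) = - (gn (x.h i) * (x.m j k * x.m k l)) := by linarith
  have h3 := congrArg (fun z : ℤ => z.natAbs) h2
  simp only [Int.natAbs_neg, Int.natAbs_mul, Int.natAbs_natCast] at h3
  unfold Dat.p
  simp only [gn_mul, gn_intCast]
  rw [g.esym k j, gn_e_opp g hd, g.manti k j, Int.natAbs_neg, gn_e_opp g hd.rot.swap34]
  have h4 := congrArg (fun n : ℕ => n ^ 2) h3
  linear_combination gn (x.e i j) * gn (x.e j k) * h4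

lemma cQ_eq :
    cQ x i j k l = -(x.u * x.h j * star (x.h l) * (cR x i j k l : 𝔾)) := by
  unfold cQ cA cB cC cD cR
  have e1 := gint_mul_star (x.h i)
  have e2 := gint_mul_star (x.h k)
  push_cast at e1 e2 ⊢
  rw [← e1, ← e2]
  simp only [star_neg, star_mul', star_gint]
  ring

lemma cQ_ne (g : Good X x) (hd : D4 i j k l) : cQ x i j k l ≠ 0 := by
  rw [cQ_eq, neg_ne_zero]
  refine mul_ne_zero (mul_ne_zero (mul_ne_zero g.uu.ne_zero (g.hne j)) ?_) ?_
  · rw [star_ne_zero]; exact g.hne l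
  · exact_mod_cast cR_ne g hd

def Dat.om (x y : Dat) (i j k : Fin 4) : 𝔾 := x.e i j * y.e j k - y.e i j * x.e j k
def Dat.dt (x y : Dat) (i j : Fin 4) : ℤ := (x.e i j * star (y.e i j)).im

lemma q_om (gx : Good X x) (gy : Good X y) (hd : D4 i j k l) (hs : SameQ i j k l x y) :
    (cN x i j k l : 𝔾) * Dat.om x y i j k = cQ x i j k l * (⟨0, 2⟩ * ((Dat.dt x y i j : ℤ) : 𝔾)) := by
  obtain ⟨s1, s2, s3, s4, s5, s6⟩ := hs
  have h1 := q_f gx hd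
  have h2 := q_f gy hd
  have eA : cA y i j k l = cA x i j k l := by unfold cA; rw [s1, s5]
  have eB : cB y i j k l = cB x i j k l := by unfold cB; rw [s1, s6, s2]
  have eC : cC y i j k l = cC x i j k l := by unfold cC; rw [s1, s3]
  have eD : cD y i j k l = cD x i j k l := by unfold cD; rw [s1, s4, s2]
  have eP : cP y i j k l = cP x i j k l := by unfold cP; rw [eA, eB, eC, eD]
  have eQ : cQ y i j k l = cQ x i j k l := by unfold cQ; rw [eA, eB, eC, eD]
  have eN : cN y i j k l = cN x i j k l := by unfold cN; rw [eA, eB]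
  rw [eP, eQ, eN] at h2
  have key : (⟨0, 2⟩ * ((Dat.dt x y i j : ℤ) : 𝔾) : 𝔾) = x.e i j * star (y.e i j) - y.e i j * star (x.e i j) := by
    unfold Dat.dt
    ext <;> (simp; ring)
  rw [key]
  unfold Dat.om
  linear_combination x.e i j * h2 - y.e i j * h1


lemma coef_eq (hs : SameQ i j k l x y) : cP y i j k l = cP x i j k l ∧ cQ y i j k l = cQ x i j k l ∧
    cN y i j k l = cN x i j k l ∧ cR y i j k l = cR x i j k l := by
  obtain ⟨s1, s2, s3, s4, s5, s6⟩ := hs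
  have eA : cA y i j k l = cA x i j k l := by unfold cA; rw [s1, s5]
  have eB : cB y i j k l = cB x i j k l := by unfold cB; rw [s1, s6, s2]
  have eC : cC y i j k l = cC x i j k l := by unfold cC; rw [s1, s3]
  have eD : cD y i j k l = cD x i j k l := by unfold cD; rw [s1, s4, s2]
  refine ⟨?_, ?_, ?_, ?_⟩
  · unfold cP; rw [eA, eB, eC, eD]
  · unfold cQ; rw [eA, eB, eC, eD]
  · unfold cN; rw [eA, eB]
  · unfold cR; rw [s1, s3, s4, s5, s6]

/-- polarised Ptolemy -/
lemma q_pol (gx : Good X x) (gy : Good X y) (hd : D4 i j k l) (hs : SameQ i j k l x y) :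
    x.p i k * y.p j l + y.p i k * x.p j l =
      x.p i j * y.p k l + y.p i j * x.p k l + x.p i l * y.p j k + y.p i l * x.p j k := by
  obtain ⟨s1, s2, s3, s4, s5, s6⟩ := hs
  have a1 := q_r1 gx hd
  have a2 := q_r2 gx hd
  have a3 := q_r3 gx hd
  have b1 := q_r1 gy hd
  have b2 := q_r2 gy hd
  have b3 := q_r3 gy hd
  rw [← s1] at b1 b2 b3
  apply mul_left_cancel₀ (gx.hne i)
  linear_combination x.p i k * b3 + y.p i k * a3 - x.p i j * b2 - y.p i j * a2 + x.p i l * b1 + y.p i l * a1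

lemma q_ptol (gx : Good X x) (hd : D4 i j k l) :
    x.p i k * x.p j l = x.p i j * x.p k l + x.p i l * x.p j k := by
  have := gx.ptolemy hd
  rw [gx.panti l j] at this
  linear_combination -this

lemma q_ratio (gx : Good X x) (gy : Good X y) (hd : D4 i j k l) (hs : SameQ i j k l x y)
    (h0 : Dat.dt x y i j ≠ 0) : x.m i k * y.m j l = y.m i k * x.m j l := by
  have hpol := q_pol gx gy hd hs
  have px := q_ptol gx hd
  have py := q_ptol gy hd
  have ax := q_r1 gx hd
  have ay := q_r1 gy hd
  rw [q_pjl gx hd, q_pjl gy hd, q_pkl gx hd, q_pkl gy hd, q_pil gx hd, q_pil gy hd] at hpol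
  rw [q_pjl gx hd, q_pkl gx hd, q_pil gx hd] at px
  rw [q_pjl gy hd, q_pkl gy hd, q_pil gy hd] at py
  have hR := cR_ne gx hd
  obtain ⟨s1, s2, s3, s4, s5, s6⟩ := hs
  unfold Dat.p at *
  rw [← s2, ← s3, ← s4, ← s5, ← s6] at hpol
  rw [← s2, ← s3, ← s4, ← s5, ← s6] at py
  rw [← s1, ← s3, ← s5] at ay
  have hu := gx.uu.ne_zero
  have hpol' : (x.m i k : 𝔾) * y.m j l * (x.e i k * star (y.e i k)) +
      (y.m i k : 𝔾) * x.m j l * (y.e i k * star (x.e i k)) =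
      x.m i j * x.m k l * (x.e i j * star (y.e i j) + y.e i j * star (x.e i j)) +
      x.m i l * x.m j k * (x.e j k * star (y.e j k) + y.e j k * star (x.e j k)) := by
    apply mul_left_cancel₀ hu
    linear_combination hpol
  have him := congrArg Zsqrtd.im hpol'
  have him' : (x.m i k * y.m j l - y.m i k * x.m j l) *
      ((x.e i k).im * (y.e i k).re - (x.e i k).re * (y.e i k).im) = 0 := by
    simp at him
    linear_combination him
  rcases mul_eq_zero.mp him' with h | h
  · linarith
  exfalso
  have hpar := prim_par (gx.prim i k hd.ik) (gy.prim i k hd.ik) (by linarith)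
  obtain ⟨s, hs, hg⟩ : ∃ s : ℤ, s * s = 1 ∧ y.e i k = s * x.e i k := by
    rcases hpar with h | h
    · exact ⟨1, by norm_num, by rw [h]; simp⟩
    · exact ⟨-1, by norm_num, by rw [h]; simp⟩
  set a : 𝔾 := (x.m i k : 𝔾) with ha
  set b : 𝔾 := ((s * y.m i k : ℤ) : 𝔾) with hb
  have sa : star a = a := star_gint _
  have sb : star b = b := star_gint _
  set e2 := a * y.e i j - b * x.e i j with he2
  set f2 := a * y.e j k - b * x.e j k with hf2
  -- `p i k` vanishes at the combination
  have z1 : x.h k * x.m i j * e2 + x.h i * x.m j k * f2 = 0 := by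
    rw [he2, hf2, hb]
    rw [hg] at ay
    push_cast
    linear_combination (s : 𝔾) * y.m i k * ax - a * ay
  have z2 : (x.m i j : 𝔾) * x.m k l * (e2 * star e2) + x.m i l * x.m j k * (f2 * star f2) = 0 := by
    rw [he2, hf2]
    simp only [star_sub, star_mul', sa, sb]
    rw [hg] at hpol py
    apply mul_left_cancel₀ hu
    rw [hb]
    have ss : (s : 𝔾) * s = 1 := by exact_mod_cast hs
    simp only [star_mul', star_gint] at hpol py
    push_cast
    linear_combination (- a * a) * py - (s * y.m i k) ^ 2 * px + a * (s * y.m i k) * hpol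
  have hz1 : gn (x.h k) * (x.m i j) ^ 2 * (gn e2 : ℤ) = gn (x.h i) * (x.m j k) ^ 2 * (gn f2 : ℤ) := by
    have : x.h k * x.m i j * e2 = -(x.h i * x.m j k * f2) := by linear_combination z1
    have := congrArg gn this
    simp only [gn_neg, gn_mul, gn_intCast] at this
    zify at this
    simpa using this
  have hz2 : x.m i j * x.m k l * (gn e2 : ℤ) + x.m i l * x.m j k * (gn f2 : ℤ) = 0 := by
    rw [gint_mul_star, gint_mul_star] at z2
    exact_mod_cast z2
  have m1 := gx.mne i j hd.ij
  have m2 := gx.mne j k hd.jk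
  have hprod : x.m i j * x.m j k * (gn e2 : ℤ) * cR x i j k l = 0 := by
    unfold cR
    linear_combination gn (x.h i) * (x.m j k) ^ 2 * hz2 + x.m i l * x.m j k * hz1
  have he0 : (gn e2 : ℤ) = 0 := by
    rcases mul_eq_zero.mp hprod with h | h
    · rcases mul_eq_zero.mp h with h | h
      · rcases mul_eq_zero.mp h with h | h <;> contradiction
      · exact h
    · contradiction
  have he0' : e2 = 0 := by
    apply gn_eq_zero.mp; exact_mod_cast he0
  apply h0
  unfold Dat.dt
  have hA : (x.m i k : 𝔾) * (x.e i j * star (y.e i j)) = b * ((gn (x.e i j) : ℤ) : 𝔾) := by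
    rw [← gint_mul_star]
    have : star e2 = 0 := by rw [he0']; simp
    rw [he2] at this
    simp only [star_sub, star_mul', sa, sb] at this
    linear_combination x.e i j * this
  have := congrArg Zsqrtd.im hA
  rw [hb] at this
  simp only [Zsqrtd.im_mul, Zsqrtd.re_intCast, Zsqrtd.im_intCast] at this
  have m3 := gx.mne i k hd.ik
  simp at this ⊢
  tauto

lemma q_dvd (gx : Good X x) (gy : Good X y) (hd : D4 i j k l) (hs : SameQ i j k l x y) :
    x.h j * star (x.h l) * ((x.m i k / Int.gcd (x.m i k) (x.m j l) : ℤ) : 𝔾) ∣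
      EuclideanDomain.gcd (x.h j) (star (x.h l)) * Dat.om x y i j k := by
  by_cases h0 : Dat.dt x y i j = 0
  · have := q_om gx gy hd hs
    rw [h0] at this
    have h1 : Dat.om x y i j k = 0 := by
      apply mul_left_cancel₀ (a := (cN x i j k l : 𝔾)) (by exact_mod_cast cN_ne gx hd)
      rw [this]; simp
    rw [h1, mul_zero]; exact dvd_zero _
  have hrat := q_ratio gx gy hd hs h0
  set d : ℤ := (Int.gcd (x.m i k) (x.m j l) : ℤ) with hdd
  have hdpos : d ≠ 0 := by
    rw [hdd]; intro h
    have := Int.gcd_eq_zero_iff.mp (by exact_mod_cast h)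
    exact gx.mne i k hd.ik this.1
  obtain ⟨k5, hk5⟩ : d ∣ x.m i k := Int.gcd_dvd_left ..
  obtain ⟨k6, hk6⟩ : d ∣ x.m j l := Int.gcd_dvd_right ..
  have hdiv : x.m i k / d = k5 := by rw [hk5]; exact Int.mul_ediv_cancel_left _ hdpos
  rw [hdiv]
  have hcop : IsCoprime k5 k6 := by
    rw [Int.isCoprime_iff_gcd_eq_one]
    have : d.natAbs * Int.gcd k5 k6 = d.natAbs := by
      rw [← Int.gcd_mul_left, ← hk5, ← hk6]; simp [hdd]
    have hp : 0 < d.natAbs := Int.natAbs_pos.mpr hdpos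
    exact Nat.eq_of_mul_eq_mul_left hp (by rw [this, mul_one])
  obtain ⟨n, hn⟩ : k5 ∣ y.m i k := by
    apply hcop.dvd_of_dvd_mul_right
    refine ⟨y.m j l, ?_⟩
    rw [hk5, hk6] at hrat
    apply mul_left_cancel₀ hdpos
    linear_combination -hrat
  have cik : (k5 : 𝔾) ∣ (x.m i k : 𝔾) := ⟨d, by rw [hk5]; push_cast; ring⟩
  have cik' : (k5 : 𝔾) ∣ x.p i k := cik.trans (Dvd.intro _ rfl)
  have ax := q_r1 gx hd
  have ay := q_r1 gy hd
  have bx := congrArg star (q_r2 gx hd)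
  have by' := congrArg star (q_r2 gy hd)
  rw [q_pkl gx hd, q_pil gx hd] at bx
  rw [q_pkl gy hd, q_pil gy hd] at by'
  have huu := star_uu gx
  have hs' := hs
  obtain ⟨s1, s2, s3, s4, s5, s6⟩ := hs
  have pjl : ∀ {a b : 𝔾}, IsCoprime a b → IsCoprime (star a) (star b) := by
    intro a b ⟨p, q, h⟩
    refine ⟨star p, star q, ?_⟩
    have := congrArg star h
    simpa [star_add, star_mul'] using this
  have c1 : x.h j * (k5 : 𝔾) ∣ Dat.om x y i j k := by
    have hc : IsCoprime (x.h j * (k5 : 𝔾)) (x.h i * x.m j k) := by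
      have e1 : IsCoprime (x.h j) (x.h i) := gx.cop_hh hd.swap12
      have e2 : IsCoprime (x.h j) (x.m j k : 𝔾) := by
        have := gx.cop_hp hd.rot
        unfold Dat.p at this
        exact this.of_mul_right_left
      have e3 : IsCoprime (k5 : 𝔾) (x.h i) :=
        (gx.cop_hp hd.swap23).symm.of_isCoprime_of_dvd_left cik'
      have e4 : IsCoprime (k5 : 𝔾) (x.m j k : 𝔾) := by
        have := gx.cop_pp hd.swap23
        rw [gx.panti k j] at this
        have := (IsCoprime.neg_right_iff _ _).mp this
        unfold Dat.p at this cik'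
        exact (this.of_isCoprime_of_dvd_left cik').of_mul_right_left
      exact (e1.mul_right e2).mul_left (e3.mul_right e4)
    apply hc.dvd_of_dvd_mul_left
    refine ⟨x.e i j * (n * y.e i k) - y.e i j * (d * x.e i k), ?_⟩
    unfold Dat.p at ax ay
    rw [← s1, hn, ← s3, ← s5] at ay
    rw [hk5] at ax
    push_cast at ax ay
    unfold Dat.om
    linear_combination y.e i j * ax - x.e i j * ay
  have c2 : star (x.h l) * (k5 : 𝔾) ∣ Dat.om x y i j k := by
    have hc : IsCoprime (star (x.h l * (k5 : 𝔾))) (star (x.h k * x.m i l)) := by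
      apply pjl
      have e1 : IsCoprime (x.h l) (x.h k) := gx.cop_hh hd.opp.swap12
      have e2 : IsCoprime (x.h l) (x.m i l : 𝔾) := by
        have := gx.cop_hp hd.rot.rot.rot
        rw [gx.panti l i] at this
        have := (IsCoprime.neg_right_iff _ _).mp this
        unfold Dat.p at this
        exact this.of_mul_right_left
      have e3 : IsCoprime (k5 : 𝔾) (x.h k) := by
        have := gx.cop_hp hd.swap23.swap12
        rw [gx.panti k i] at this
        have := (IsCoprime.neg_right_iff _ _).mp this
        exact this.symm.of_isCoprime_of_dvd_left cik'
      have e4 : IsCoprime (k5 : 𝔾) (x.m i l : 𝔾) := by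
        have := gx.cop_pp hd.swap23.swap12.swap34
        rw [gx.panti k i] at this
        have := (IsCoprime.neg_left_iff _ _).mp this
        unfold Dat.p at this cik'
        exact (this.of_isCoprime_of_dvd_left cik').of_mul_right_left
      exact (e1.mul_right e2).mul_left (e3.mul_right e4)
    simp only [star_mul', star_gint] at hc
    apply hc.dvd_of_dvd_mul_left
    refine ⟨x.u * (x.e i j * (n * star (y.e i k)) - y.e i j * (d * star (x.e i k))), ?_⟩
    unfold Dat.p at bx by'
    rw [← s1, ← s2, hn, ← s4, ← s6] at by'
    rw [hk5] at bx
    push_cast at bx by'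
    simp only [star_add, star_neg, star_mul', star_star, star_intCast] at bx by'
    unfold Dat.om
    linear_combination x.u * y.e i j * bx - x.u * x.e i j * by' + (-star (x.h k) * x.m i l * (x.e i j * y.e j k - y.e i j * x.e j k)) * huu
  rw [EuclideanDomain.gcd_eq_gcd_ab (x.h j) (star (x.h l)), add_mul]
  obtain ⟨w1, hw1⟩ := c1
  obtain ⟨w2, hw2⟩ := c2
  apply dvd_add
  · refine ⟨EuclideanDomain.gcdA (x.h j) (star (x.h l)) * w2, ?_⟩
    rw [hw2]; ring
  · refine ⟨EuclideanDomain.gcdB (x.h j) (star (x.h l)) * w1, ?_⟩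
    rw [hw1]; ring


lemma q_near (gx : Good X x) (gy : Good X y) (hd : D4 i j k l) (hs : SameQ i j k l x y)
    (h0 : Dat.dt x y i j = 0) :
    (y.e i j = x.e i j ∨ y.e i j = -x.e i j) ∧ (y.m i k = x.m i k ∨ y.m i k = -x.m i k) := by
  have hpar : y.e i j = x.e i j ∨ y.e i j = -x.e i j := by
    apply prim_par (gx.prim i j hd.ij) (gy.prim i j hd.ij)
    unfold Dat.dt at h0
    simp at h0
    linarith
  refine ⟨hpar, ?_⟩
  obtain ⟨s, hs1, hg⟩ : ∃ s : 𝔾, (s = 1 ∨ s = -1) ∧ y.e i j = s * x.e i j := by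
    rcases hpar with h | h
    · exact ⟨1, by simp, by rw [h]; simp⟩
    · exact ⟨-1, by simp, by rw [h]; simp⟩
  have hss : star s = s := by rcases hs1 with h | h <;> rw [h] <;> simp
  have f1 := q_f gx hd
  have f2 := q_f gy hd
  obtain ⟨eP, eQ, eN, _⟩ := coef_eq hs
  rw [eP, eQ, eN, hg] at f2
  simp only [star_mul', hss] at f2
  have hf : y.e j k = s * x.e j k := by
    apply mul_left_cancel₀ (a := (cN x i j k l : 𝔾)) (by exact_mod_cast cN_ne gx hd)
    linear_combination f2 - s * f1
  have a1 := q_r1 gx hd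
  have a2 := q_r1 gy hd
  obtain ⟨s1, s2, s3, s4, s5, s6⟩ := hs
  have hp : y.p i k = s * x.p i k := by
    apply mul_left_cancel₀ (gx.hne j)
    rw [← s1] at a2
    unfold Dat.p at a1 a2 ⊢
    rw [← s3, ← s5, hg, hf] at a2
    linear_combination a2 - s * a1
  unfold Dat.p at hp
  have hgcd : ∀ z : Dat, Good X z → Int.gcd (z.m i k * (z.e i k).re) (z.m i k * (z.e i k).im) = (z.m i k).natAbs := by
    intro z gz
    rw [Int.gcd_mul_left, Int.isCoprime_iff_gcd_eq_one.mp (gz.prim i k hd.ik), mul_one]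
  have hre := congrArg Zsqrtd.re hp
  have him := congrArg Zsqrtd.im hp
  have hy := hgcd y gy
  have hx := hgcd x gx
  have : (y.m i k).natAbs = (x.m i k).natAbs := by
    rw [← hy, ← hx]
    rcases hs1 with h | h
    · rw [h] at hre him; simp at hre him; rw [hre, him]
    · rw [h] at hre him; simp at hre him; rw [hre, him, Int.neg_gcd, Int.gcd_neg]
  exact Int.natAbs_eq_natAbs_iff.mp this

lemma q_inj (gx : Good X x) (gy : Good X y) (hd : D4 i j k l) (hs : SameQ i j k l x y)
    (he : x.e i j = y.e i j) (hm : x.m i k = y.m i k) : x = y := by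
  have f1 := q_f gx hd
  have f2 := q_f gy hd
  obtain ⟨eP, eQ, eN, _⟩ := coef_eq hs
  rw [eP, eQ, eN, ← he] at f2
  have hf : x.e j k = y.e j k := by
    apply mul_left_cancel₀ (a := (cN x i j k l : 𝔾)) (by exact_mod_cast cN_ne gx hd)
    rw [f1, f2]
  have a1 := q_r1 gx hd
  have a2 := q_r1 gy hd
  have b1 := q_r3 gx hd
  have b2 := q_r3 gy hd
  rw [q_pjl gx hd, q_pil gx hd] at b1
  rw [q_pjl gy hd, q_pil gy hd] at b2
  obtain ⟨s1, s2, s3, s4, s5, s6⟩ := hs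
  have hg : x.e i k = y.e i k := by
    rw [← s1] at a2
    unfold Dat.p at a1 a2
    rw [← s3, ← s5, ← he, ← hf, ← hm] at a2
    apply mul_left_cancel₀ (a := x.h j * (x.m i k : 𝔾)) (mul_ne_zero (gx.hne j) (by exact_mod_cast gx.mne i k hd.ik))
    linear_combination a1 - a2
  have hmm : x.m j l = y.m j l := by
    rw [← s1, ← s2, ← s6, ← hf, ← hg] at b2
    unfold Dat.p at b1 b2
    rw [← s3, ← he] at b2
    have : (x.m j l : 𝔾) = (y.m j l : 𝔾) := by
      apply mul_right_cancel₀ (b := x.h i * (x.u * star (x.e i k))) (mul_ne_zero (gx.hne i) (mul_ne_zero gx.uu.ne_zero (by rw [star_ne_zero]; exact gx.ene i k hd.ik)))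
      linear_combination b1 - b2
    exact_mod_cast this
  apply Dat.ext_of gx gy hd (by rw [s1]) (by rw [s1]) (by rw [s1]) (by rw [s1]) s2 s3 hm s6 s5 hmm s4 he hg
  rw [gx.econj j k i l hd.rot.swap34, gy.econj j k i l hd.rot.swap34, s2, hf]

end

lemma gcd_star_ne {X : ℕ} {x : Dat} (g : Good X x) (j l : Fin 4) :
    EuclideanDomain.gcd (x.h j) (star (x.h l)) ≠ 0 := by
  intro h
  exact g.hne j (EuclideanDomain.gcd_eq_zero_iff.mp h).1

lemma two_fix {X : ℕ} {c : Cls} (S : Finset Dat) (hS : ∀ x ∈ S, Good X x ∧ InCls c x)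
    {i j k l : Fin 4} (hd : D4 i j k l) (hs : ∀ x ∈ S, ∀ y ∈ S, SameQ i j k l x y) :
    (S.card : ℝ) ≤ 256 * (1 + pw ((c.E i j + c.E j k) / 2 + c.t i k - c.M i k - (c.H j + c.H l) / 2
      + c.r j l / 2)) := by
  classical
  rcases S.eq_empty_or_nonempty with rfl | ⟨x0, hx0⟩
  · simp
    have := pw_pos ((c.E i j + c.E j k) / 2 + c.t i k - c.M i k - (c.H j + c.H l) / 2 + c.r j l / 2)
    positivity
  obtain ⟨g0, q0⟩ := hS x0 hx0
  set N : ℝ := |(cN x0 i j k l : ℝ)| with hN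
  set Q : ℝ := ‖(cQ x0 i j k l : ℂ)‖ with hQ
  have hNpos : 0 < N := by
    rw [hN, abs_pos]; exact_mod_cast cN_ne g0 hd
  have hQpos : 0 < Q := by
    rw [hQ, norm_pos_iff, Ne, GaussianInt.toComplex_eq_zero]; exact cQ_ne g0 hd
  set D : ℝ := pw ((c.H j + c.H l) / 2 + c.M i k - c.t i k - 1 - (c.r j l + 1) / 2) with hD
  set V : ℝ := pw ((c.E i j + c.E j k) / 2 + 2) with hV
  have hDpos : 0 < D := pw_pos _
  have hVpos : 0 < V := pw_pos _
  have hnorm : ∀ x ∈ S, ∀ y ∈ S, N * ‖(Dat.om x y i j k : ℂ)‖ = 2 * Q * |(Dat.dt x y i j : ℝ)| := by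
    intro x hx y hy
    obtain ⟨gx, qx⟩ := hS x hx
    obtain ⟨gy, qy⟩ := hS y hy
    have h := q_om gx gy hd (hs x hx y hy)
    obtain ⟨eP, eQ, eN, _⟩ := coef_eq (hs x0 hx0 x hx)
    rw [eN, eQ] at h
    have h2 := congrArg (fun z : 𝔾 => ‖(z : ℂ)‖) h
    simp only [GaussianInt.toComplex_mul, norm_mul, norm_gint] at h2
    have h3 : ‖((⟨0, 2⟩ : 𝔾) : ℂ)‖ = 2 := by
      have h4 := gn_real (⟨0, 2⟩ : 𝔾)
      have h5 : gn (⟨0, 2⟩ : 𝔾) = 4 := by decide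
      rw [h5] at h4
      have h6 := norm_nonneg ((⟨0, 2⟩ : 𝔾) : ℂ)
      push_cast at h4
      nlinarith
    rw [h3] at h2
    rw [hN, hQ, h2]; ring
  have hdt : ∀ x y : Dat, (Dat.dt x y i j : ℝ) = (x.e i j).im * (y.e i j).re - (y.e i j).im * (x.e i j).re := by
    intro x y; unfold Dat.dt; simp; ring
  have key := pack_det S (fun x => ((x.e i j).im : ℝ)) (fun x => ((x.e i j).re : ℝ)) (N * D / (2 * Q))
    (N * V / (2 * Q)) 4 (by positivity) (by norm_num) (by positivity) ?_ ?_
  · refine key.trans ?_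
    have e1 : N * V / (2 * Q) / (N * D / (2 * Q)) = V / D := by field_simp
    have e2 : V / D ≤ 16 * pw ((c.E i j + c.E j k) / 2 + c.t i k - c.M i k - (c.H j + c.H l) / 2 + c.r j l / 2) := by
      rw [hV, hD, ← pw_sub]
      have : (16 : ℝ) = pw 4 := by rw [show (4 : ℝ) = ((4 : ℕ) : ℝ) by norm_num, pw_nat]; norm_num
      rw [this, ← pw_add]; apply pw_mono; linarith
    rw [e1]
    linarith
  · intro x hx y hy
    rw [← hdt x y, le_div_iff₀ (by positivity)]
    have h := hnorm x hx y hy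
    have : ‖(Dat.om x y i j k : ℂ)‖ ≤ V := by
      unfold Dat.om
      rw [GaussianInt.toComplex_sub, GaussianInt.toComplex_mul, GaussianInt.toComplex_mul]
      refine (norm_sub_le _ _).trans ?_
      rw [norm_mul, norm_mul]
      have a1 := ((hS x hx).2.eu hd.ij).le
      have a2 := ((hS x hx).2.eu hd.jk).le
      have b1 := ((hS y hy).2.eu hd.ij).le
      have b2 := ((hS y hy).2.eu hd.jk).le
      have c1 := mul_le_mul a1 b2 (norm_nonneg _) (pw_pos _).le
      have c2 := mul_le_mul b1 a2 (norm_nonneg _) (pw_pos _).le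
      have : V = 2 * (pw ((c.E i j + 1) / 2) * pw ((c.E j k + 1) / 2)) := by
        rw [hV, ← pw_add]
        nth_rw 3 [← pw_one]
        rw [← pw_add]; congr 1; ring
      linarith
    nlinarith
  · intro x hx
    obtain ⟨gx, qx⟩ := hS x hx
    have hfil : ∀ y ∈ S, |((x.e i j).im : ℝ) * (y.e i j).re - (y.e i j).im * (x.e i j).re| < N * D / (2 * Q) →
        Dat.dt x y i j = 0 := by
      intro y hy hlt
      obtain ⟨gy, qy⟩ := hS y hy
      rw [← hdt x y, lt_div_iff₀ (by positivity)] at hlt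
      have h := hnorm x hx y hy
      have hom : ‖(Dat.om x y i j k : ℂ)‖ < D := by
        have : N * ‖(Dat.om x y i j k : ℂ)‖ < N * D := by rw [h]; linarith
        exact lt_of_mul_lt_mul_left this hNpos.le
      have hdv := q_dvd gx gy hd (hs x hx y hy)
      have h0 := norm_lt_of_dvd hdv ?_
      · have hom0 : Dat.om x y i j k = 0 := by
          rcases mul_eq_zero.mp h0 with h | h
          · exact absurd h (gcd_star_ne gx j l)
          · exact h
        rw [hom0] at h
        simp at h
        rcases h with h | h
        · exact absurd h hQpos.ne'
        · exact_mod_cast h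
      · rw [GaussianInt.toComplex_mul, norm_mul, GaussianInt.toComplex_mul, GaussianInt.toComplex_mul, norm_mul, norm_mul, norm_gint]
        have g1 : ‖((EuclideanDomain.gcd (x.h j) (star (x.h l)) : 𝔾) : ℂ)‖ < pw ((c.r j l + 1) / 2) := by
          apply lt_pw_half (norm_nonneg _)
          rw [← gn_real]
          have := qx.ru j l hd.jl
          have h2 : ((c.r j l : ℝ) + 1) = ((c.r j l + 1 : ℕ) : ℝ) := by push_cast; ring
          rw [h2, pw_nat]; exact_mod_cast this
        have g2 := qx.hl j
        have g3 : pw (c.H l / 2) ≤ ‖((star (x.h l) : 𝔾) : ℂ)‖ := by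
          apply pw_half_le (norm_nonneg _)
          rw [← gn_real, gn_star, pw_nat]
          exact_mod_cast qx.Hl l
        have g4 : pw (c.M i k - c.t i k - 1) ≤ |((x.m i k / (Int.gcd (x.m i k) (x.m j l) : ℤ) : ℤ) : ℝ)| := by
          rw [Int.cast_div (Int.gcd_dvd_left ..) (by
            have := qx.tl i k j l hd.swap23
            have h2 : 0 < 2 ^ c.t i k := by positivity
            have : Int.gcd (x.m i k) (x.m j l) ≠ 0 := by omega
            exact_mod_cast this), abs_div]
          have t1 := qx.ml hd.ik
          have t2 := qx.tu i k j l hd.swap23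
          have t3 : |(((Int.gcd (x.m i k) (x.m j l) : ℕ) : ℤ) : ℝ)| ≤ pw (c.t i k + 1) := by
            have h2 : ((c.t i k : ℝ) + 1) = ((c.t i k + 1 : ℕ) : ℝ) := by push_cast; ring
            rw [h2, pw_nat]
            rw [Int.cast_natCast, Nat.abs_cast]
            exact_mod_cast t2.le
          have t4 : pw (c.M i k - c.t i k - 1) = pw (c.M i k) / pw (c.t i k + 1) := by
            rw [← pw_sub]; congr 1; ring
          rw [t4]
          apply div_le_div₀ (abs_nonneg _) t1 _ t3
          have := qx.tl i k j l hd.swap23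
          have h2 : 0 < 2 ^ c.t i k := by positivity
          have : 0 < Int.gcd (x.m i k) (x.m j l) := by omega
          rw [abs_pos]
          exact_mod_cast this.ne'
        calc _ < pw ((c.r j l + 1) / 2) * D := mul_lt_mul'' g1 hom (norm_nonneg _) (norm_nonneg _)
          _ = pw (c.H j / 2) * pw (c.H l / 2) * pw (c.M i k - c.t i k - 1) := by
            rw [hD, ← pw_add, ← pw_add, ← pw_add]; congr 1; ring
          _ ≤ _ := mul_le_mul (mul_le_mul g2 g3 (pw_pos _).le (norm_nonneg _)) g4 (pw_pos _).le (by positivity)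
    have hcard : (S.filter (fun q => |((x.e i j).im : ℝ) * (q.e i j).re - (q.e i j).im * (x.e i j).re| < N * D / (2 * Q))).card ≤
        (({x.e i j, -x.e i j} : Finset 𝔾) ×ˢ ({x.m i k, -x.m i k} : Finset ℤ)).card := by
      apply Finset.card_le_card_of_injOn (fun y => (y.e i j, y.m i k))
      · intro y hy
        rw [Finset.mem_coe, Finset.mem_filter] at hy
        have := q_near gx (hS y hy.1).1 hd (hs x hx y hy.1) (hfil y hy.1 hy.2)
        simp [this]
      · intro y hy z hz hyz
        rw [Finset.mem_coe, Finset.mem_filter] at hy hz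
        simp only [Prod.mk.injEq] at hyz
        exact q_inj (hS y hy.1).1 (hS z hz.1).1 hd (hs y hy.1 z hz.1) hyz.1 hyz.2
    have h4 : (({x.e i j, -x.e i j} : Finset 𝔾) ×ˢ ({x.m i k, -x.m i k} : Finset ℤ)).card ≤ 4 := by
      rw [Finset.card_product]
      exact Nat.mul_le_mul Finset.card_le_two Finset.card_le_two
    exact_mod_cast hcard.trans h4

lemma nat_quot_lt {a d M t : ℕ} (hd : d ∣ a) (h1 : 2 ^ t ≤ d) (h2 : a < 2 ^ (M + 1)) (ha : a ≠ 0) :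
    t ≤ M ∧ a / d < 2 ^ (M - t + 1) := by
  have hle : d ≤ a := Nat.le_of_dvd (Nat.pos_of_ne_zero ha) hd
  have h3 : 2 ^ t < 2 ^ (M + 1) := by omega
  have h4 : t < M + 1 := (Nat.pow_lt_pow_iff_right (by norm_num)).mp h3
  refine ⟨by omega, ?_⟩
  have hd0 : 0 < d := lt_of_lt_of_le (by positivity) h1
  rw [Nat.div_lt_iff_lt_mul hd0]
  calc a < 2 ^ (M + 1) := h2
    _ = 2 ^ (M - t + 1) * 2 ^ t := by rw [← pow_add]; congr 1; omega
    _ ≤ _ := Nat.mul_le_mul_left _ h1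

lemma Good.gnh_le {X : ℕ} {x : Dat} (g : Good X x) {i j k l : Fin 4} (hd : D4 i j k l) :
    gn (x.h k) ≤ X := by
  have h1 := g.size i j k l hd
  have h2 := gn_pos (g.hne l)
  have h3 := gn_pos (g.pne hd.ij)
  calc gn (x.h k) = gn (x.h k) * 1 * 1 := by ring
    _ ≤ _ := Nat.mul_le_mul (Nat.mul_le_mul_left _ h2) h3
    _ ≤ X := h1

lemma Good.gnm_le {X : ℕ} {x : Dat} (g : Good X x) {i j k l : Fin 4} (hd : D4 i j k l) :
    gn (x.m i j : 𝔾) ≤ X := by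
  have h1 := g.size i j k l hd
  have h2 := gn_pos (g.hne l)
  have h3 := gn_pos (g.hne k)
  have h4 := gn_pos (g.ene i j hd.ij)
  unfold Dat.p at h1
  rw [gn_mul] at h1
  calc gn (x.m i j : 𝔾) = 1 * 1 * (gn (x.m i j : 𝔾) * 1) := by ring
    _ ≤ _ := Nat.mul_le_mul (Nat.mul_le_mul h3 h2) (Nat.mul_le_mul_left _ h4)
    _ ≤ X := h1

set_option maxHeartbeats 400000 in
lemma two {X : ℕ} {T : ℝ} {c : Cls} (hX : 1 ≤ X) (hT : DivB (X ^ 2) T) (hT0 : 0 ≤ T) (F : Finset Dat)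
    (hF : ∀ x ∈ F, Good X x ∧ InCls c x) {i j k l : Fin 4} (hd : D4 i j k l) :
    (F.card : ℝ) ≤ 10 ^ 12 * T ^ 3 * pw (c.M i j + c.M k l + c.M j k + c.M i l - c.t i j - c.t j k
        + c.H i + c.H j + c.H k + c.H l) *
      (1 + pw ((c.E i j + c.E j k) / 2 + c.t i k - c.M i k - (c.H j + c.H l) / 2)) := by
  classical
  rcases F.eq_empty_or_nonempty with rfl | ⟨x0, hx0⟩
  · simp
    have := pw_pos ((c.E i j + c.E j k) / 2 + c.t i k - c.M i k - (c.H j + c.H l) / 2)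
    have := pw_pos (c.M i j + c.M k l + c.M j k + c.M i l - c.t i j - c.t j k
        + c.H i + c.H j + c.H k + c.H l)
    positivity
  set V := (c.E i j + c.E j k) / 2 + c.t i k - c.M i k - (c.H j + c.H l : ℝ) / 2 with hV
  have hXX : X ≤ X ^ 2 := by nlinarith
  have q1 : ∀ x ∈ F, c.t i j ≤ c.M k l ∧ (x.m k l / (Int.gcd (x.m i j) (x.m k l) : ℤ)).natAbs < 2 ^ (c.M k l - c.t i j + 1) := by
    intro x hx
    obtain ⟨g, q⟩ := hF x hx
    rw [Int.natAbs_ediv_of_dvd (Int.gcd_dvd_right ..), Int.natAbs_natCast]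
    exact nat_quot_lt (Int.natCast_dvd.mp (Int.gcd_dvd_right ..)) (q.tl i j k l hd) (q.Mu k l hd.kl)
      (by simpa using g.mne k l hd.kl)
  have q2 : ∀ x ∈ F, c.t j k ≤ c.M i l ∧ (x.m i l / (Int.gcd (x.m j k) (x.m i l) : ℤ)).natAbs < 2 ^ (c.M i l - c.t j k + 1) := by
    intro x hx
    obtain ⟨g, q⟩ := hF x hx
    rw [Int.natAbs_ediv_of_dvd (Int.gcd_dvd_right ..), Int.natAbs_natCast]
    exact nat_quot_lt (Int.natCast_dvd.mp (Int.gcd_dvd_right ..)) (q.tl j k i l hd.rot.swap34) (q.Mu i l hd.il)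
      (by simpa using g.mne i l hd.il)
  have q3 : ∀ x ∈ F, c.r j l ≤ c.H l ∧ gn (star (x.h l) / (EuclideanDomain.gcd (x.h j) (star (x.h l)))) < 2 ^ (c.H l - c.r j l + 1) := by
    intro x hx
    obtain ⟨g, q⟩ := hF x hx
    have h0 := gcd_star_ne g j l
    have hdv := EuclideanDomain.gcd_dvd_right (x.h j) (star (x.h l))
    have hm := EuclideanDomain.mul_div_cancel' h0 hdv
    have hg := congrArg gn hm
    rw [gn_mul, gn_star] at hg
    have hg0 := gn_pos h0
    have := nat_quot_lt (a := gn (x.h l)) (d := gn (EuclideanDomain.gcd (x.h j) (star (x.h l)))) ⟨_, hg.symm⟩ (q.rl j l hd.jl) (q.Hu l)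
      (by have := gn_pos (g.hne l); omega)
    rw [← hg, Nat.mul_div_cancel_left _ hg0] at this
    exact this
  have hr1 : (0 : ℝ) ≤ c.r j l := Nat.cast_nonneg _
  set s := pw (V + c.r j l / 2) with hs
  have hs0 : 0 < s := pw_pos _
  have h1 := card_fib' F (fun x => (x.m i j, x.m j k, x.h i, x.h j, x.h k, x.u))
    (zset (c.M i j) ×ˢ zset (c.M j k) ×ˢ gset (c.H i) ×ˢ gset (c.H j) ×ˢ gset (c.H k) ×ˢ uset)
    (256 * (1 + s) * (450 * (pw (c.M k l - c.t i j) * pw (c.M i l - c.t j k) * pw (c.H l - c.r j l))) * T * T * T) ?_ ?_ ?_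
  · refine h1.trans ?_
    simp only [Finset.card_product, Nat.cast_mul]
    have a1 := card_zset (c.M i j)
    have a2 := card_zset (c.M j k)
    have a3 := card_gset (c.H i)
    have a4 := card_gset (c.H j)
    have a5 := card_gset (c.H k)
    have a7 := card_uset
    have p1 := pw_pos (c.M i j)
    have p2 := pw_pos (c.M j k)
    have p3 := pw_pos (c.H i)
    have p4 := pw_pos (c.H j)
    have p5 := pw_pos (c.H k)
    have p6 := pw_pos (c.M k l - c.t i j)
    have p7 := pw_pos (c.M i l - c.t j k)
    have p8 := pw_pos (c.H l - c.r j l)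
    have key : pw (c.M i j) * (pw (c.M j k) * (pw (c.H i) * (pw (c.H j) * pw (c.H k)))) *
        (pw (c.M k l - c.t i j) * pw (c.M i l - c.t j k) * pw (c.H l - c.r j l)) * (1 + s) ≤
        pw (c.M i j + c.M k l + c.M j k + c.M i l - c.t i j - c.t j k + c.H i + c.H j + c.H k + c.H l) *
          (1 + pw V) := by
      rw [mul_add, mul_add, hs]
      simp only [← pw_add, mul_one]
      apply add_le_add <;> apply pw_mono <;> linarith
    calc _ ≤ 256 * (1 + s) * (450 * (pw (c.M k l - c.t i j) * pw (c.M i l - c.t j k) * pw (c.H l - c.r j l))) * T * T * T *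
        ((5 * pw (c.M i j)) * ((5 * pw (c.M j k)) * ((18 * pw (c.H i)) * ((18 * pw (c.H j)) * ((18 * pw (c.H k)) * 9))))) := by
          gcongr
      _ = 151165440000 * T ^ 3 * (pw (c.M i j) * (pw (c.M j k) * (pw (c.H i) * (pw (c.H j) * pw (c.H k)))) *
        (pw (c.M k l - c.t i j) * pw (c.M i l - c.t j k) * pw (c.H l - c.r j l)) * (1 + s)) := by ring
      _ ≤ 151165440000 * T ^ 3 * (pw (c.M i j + c.M k l + c.M j k + c.M i l - c.t i j - c.t j k + c.H i + c.H j + c.H k + c.H l) *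
          (1 + pw V)) := by gcongr
      _ ≤ _ := by
        have := pw_pos (c.M i j + c.M k l + c.M j k + c.M i l - c.t i j - c.t j k + c.H i + c.H j + c.H k + c.H l)
        have := pw_pos V
        rw [← mul_assoc]
        gcongr; norm_num
  · have p6 := pw_pos (c.M k l - c.t i j)
    have p7 := pw_pos (c.M i l - c.t j k)
    have p8 := pw_pos (c.H l - c.r j l)
    positivity
  · intro x hx
    obtain ⟨g, q⟩ := hF x hx
    simp only [Finset.mem_product]
    exact ⟨mem_zset (q.Mu _ _ hd.ij), mem_zset (q.Mu _ _ hd.jk), mem_gset (q.Hu i), mem_gset (q.Hu j), mem_gset (q.Hu k), mem_uset g.uu⟩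
  intro x1 hx1
  have p6 := pw_pos (c.M k l - c.t i j)
  have p7 := pw_pos (c.M i l - c.t j k)
  have p8 := pw_pos (c.H l - c.r j l)
  obtain ⟨g1, qq1⟩ := hF x1 hx1
  set F1 := F.filter (fun y => (y.m i j, y.m j k, y.h i, y.h j, y.h k, y.u) = (x1.m i j, x1.m j k, x1.h i, x1.h j, x1.h k, x1.u)) with hF1
  have hF1' : ∀ y ∈ F1, y ∈ F ∧ y.m i j = x1.m i j ∧ y.m j k = x1.m j k ∧ y.h i = x1.h i ∧ y.h j = x1.h j ∧ y.h k = x1.h k ∧ y.u = x1.u := by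
    intro y hy
    rw [hF1, Finset.mem_filter] at hy
    simpa using hy
  apply card_div_fib hT hT0 F1 (fun y => (((Int.gcd (y.m i j) (y.m k l) : ℕ) : ℤ) : 𝔾)) (x1.m i j)
    (by exact_mod_cast g1.mne i j hd.ij) ((g1.gnm_le hd).trans hXX)
  · intro y hy
    rw [← (hF1' y hy).2.1]
    exact map_dvd (Int.castRingHom 𝔾) (Int.gcd_dvd_left ..)
  · positivity
  intro x2 hx2
  set F2 := F1.filter (fun y => (((Int.gcd (y.m i j) (y.m k l) : ℕ) : ℤ) : 𝔾) = ((Int.gcd (x2.m i j) (x2.m k l) : ℕ) : ℤ)) with hF2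
  apply card_div_fib hT hT0 F2 (fun y => (((Int.gcd (y.m j k) (y.m i l) : ℕ) : ℤ) : 𝔾)) (x1.m j k)
    (by exact_mod_cast g1.mne j k hd.jk) ((g1.gnm_le hd.rot).trans hXX)
  · intro y hy
    rw [← (hF1' y (Finset.mem_filter.mp hy).1).2.2.1]
    exact map_dvd (Int.castRingHom 𝔾) (Int.gcd_dvd_left ..)
  · positivity
  intro x3 hx3
  set F3 := F2.filter (fun y => (((Int.gcd (y.m j k) (y.m i l) : ℕ) : ℤ) : 𝔾) = ((Int.gcd (x3.m j k) (x3.m i l) : ℕ) : ℤ)) with hF3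
  apply card_div_fib hT hT0 F3 (fun y => EuclideanDomain.gcd (y.h j) (star (y.h l))) (x1.h j)
    (g1.hne j) ((g1.gnh_le hd.swap23).trans hXX)
  · intro y hy
    rw [← (hF1' y (Finset.mem_filter.mp (Finset.mem_filter.mp hy).1).1).2.2.2.2.1]
    exact EuclideanDomain.gcd_dvd_left ..
  · positivity
  intro x4 hx4
  set F4 := F3.filter (fun y => EuclideanDomain.gcd (y.h j) (star (y.h l)) = EuclideanDomain.gcd (x4.h j) (star (x4.h l))) with hF4
  have hF4' : ∀ y ∈ F4, y ∈ F1 ∧ Int.gcd (y.m i j) (y.m k l) = Int.gcd (x2.m i j) (x2.m k l) ∧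
      Int.gcd (y.m j k) (y.m i l) = Int.gcd (x3.m j k) (x3.m i l) ∧
      EuclideanDomain.gcd (y.h j) (star (y.h l)) = EuclideanDomain.gcd (x4.h j) (star (x4.h l)) := by
    intro y hy
    rw [hF4, Finset.mem_filter, hF3, Finset.mem_filter, hF2, Finset.mem_filter] at hy
    obtain ⟨⟨⟨a, b⟩, c'⟩, d⟩ := hy
    exact ⟨a, by exact_mod_cast b, by exact_mod_cast c', d⟩
  have h5 := card_fib' F4 (fun y => (y.m k l / (Int.gcd (y.m i j) (y.m k l) : ℤ), y.m i l / (Int.gcd (y.m j k) (y.m i l) : ℤ),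
      star (y.h l) / (EuclideanDomain.gcd (y.h j) (star (y.h l)))))
    (zset (c.M k l - c.t i j) ×ˢ zset (c.M i l - c.t j k) ×ˢ gset (c.H l - c.r j l)) (256 * (1 + s)) (by positivity) ?_ ?_
  · refine h5.trans ?_
    simp only [Finset.card_product, Nat.cast_mul]
    have a1 := card_zset (c.M k l - c.t i j)
    have a2 := card_zset (c.M i l - c.t j k)
    have a3 := card_gset (c.H l - c.r j l)
    rw [Nat.cast_sub (q1 x0 hx0).1] at a1
    rw [Nat.cast_sub (q2 x0 hx0).1] at a2
    rw [Nat.cast_sub (q3 x0 hx0).1] at a3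
    calc _ ≤ 256 * (1 + s) * ((5 * pw (c.M k l - c.t i j)) * ((5 * pw (c.M i l - c.t j k)) * (18 * pw (c.H l - c.r j l)))) := by
          apply mul_le_mul_of_nonneg_left _ (by positivity)
          exact mul_le_mul a1 (mul_le_mul a2 a3 (Nat.cast_nonneg _) (by positivity)) (mul_nonneg (Nat.cast_nonneg _) (Nat.cast_nonneg _)) (by positivity)
      _ = _ := by ring
  · intro y hy
    have hyF := (hF1' y (hF4' y hy).1).1
    simp only [Finset.mem_product]
    exact ⟨mem_zset (q1 y hyF).2, mem_zset (q2 y hyF).2, mem_gset (q3 y hyF).2⟩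
  intro x5 hx5
  apply two_fix (X := X) _ _ hd
  · intro y hy z hz
    rw [Finset.mem_filter] at hy hz
    simp only [Prod.mk.injEq] at hy hz
    obtain ⟨hy, y1, y2, y3⟩ := hy
    obtain ⟨hz, z1, z2, z3⟩ := hz
    obtain ⟨yf, b1, b2, b3⟩ := hF4' y hy
    obtain ⟨zf, c1, c2, c3⟩ := hF4' z hz
    obtain ⟨yF, d1, d2, d3, d4, d5, d6⟩ := hF1' y yf
    obtain ⟨zF, e1, e2, e3, e4, e5, e6⟩ := hF1' z zf
    have k1 : y.m k l = z.m k l := by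
      rw [← Int.ediv_mul_cancel (Int.gcd_dvd_right (a := y.m i j) (b := y.m k l)), ← Int.ediv_mul_cancel (Int.gcd_dvd_right (a := z.m i j) (b := z.m k l)), y1, z1, b1, c1]
    have k2 : y.m i l = z.m i l := by
      rw [← Int.ediv_mul_cancel (Int.gcd_dvd_right (a := y.m j k) (b := y.m i l)), ← Int.ediv_mul_cancel (Int.gcd_dvd_right (a := z.m j k) (b := z.m i l)), y2, z2, b2, c2]
    have k3 : y.h l = z.h l := by
      apply star_injective
      rw [← EuclideanDomain.mul_div_cancel' (gcd_star_ne (hF y yF).1 j l) (EuclideanDomain.gcd_dvd_right (y.h j) (star (y.h l))),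
        ← EuclideanDomain.mul_div_cancel' (gcd_star_ne (hF z zF).1 j l) (EuclideanDomain.gcd_dvd_right (z.h j) (star (z.h l))), y3, z3, b3, c3]
    refine ⟨?_, ?_, ?_, ?_, ?_, ?_⟩
    · funext a
      rcases hd.cases a with rfl | rfl | rfl | rfl
      · rw [d3, e3]
      · rw [d4, e4]
      · rw [d5, e5]
      · exact k3
    · rw [d6, e6]
    · rw [d1, e1]
    · exact k1
    · rw [d2, e2]
    · exact k2
  · intro y hy
    exact hF y (hF1' y (hF4' y (Finset.mem_filter.mp hy).1).1).1

/-! ### The linear program -/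

def TwoAlt (θ m s1 s2 : ℝ) : Prop := θ < m ∨ (θ < m + s1 ∧ θ < m + s2)

def GamAlt (θ f u1 u2 g s1 s2 s3 : ℝ) : Prop :=
  (θ < f ∧ θ < g) ∨ (θ < f + u1 ∧ θ < f + u2 ∧ θ < g) ∨
  (θ < f + s1 ∧ θ < f + s2 ∧ θ < f + s3 ∧ θ < g + s1 ∧ θ < g + s2 ∧ θ < g + s3) ∨
  (θ < f + u1 + s1 ∧ θ < f + u1 + s2 ∧ θ < f + u1 + s3 ∧ θ < f + u2 + s1 ∧ θ < f + u2 + s2 ∧ θ < f + u2 + s3 ∧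
    θ < g + s1 ∧ θ < g + s2 ∧ θ < g + s3)

lemma lp_core {L a b c d m1 m2 m3 m4 m5 m6 e1 e2 e3 t1 t2 t3 : ℝ} (hL : 0 < L)
    (za : 0 ≤ a) (zb : 0 ≤ b) (zc : 0 ≤ c) (zd : 0 ≤ d) (zm1 : 0 ≤ m1) (zm2 : 0 ≤ m2) (zm3 : 0 ≤ m3) (zm4 : 0 ≤ m4) (ze1 : 0 ≤ e1) (ze2 : 0 ≤ e2) (ze3 : 0 ≤ e3) (zt1 : 0 ≤ t1) (zt2 : 0 ≤ t2) (zt3 : 0 ≤ t3)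
    (q1 : 2 * m1 + a + b + e1 ≤ 2 * L)
    (q2 : 2 * m2 + c + d + e1 ≤ 2 * L)
    (q3 : 2 * m3 + a + c + e2 ≤ 2 * L)
    (q4 : 2 * m4 + b + d + e2 ≤ 2 * L)
    (q5 : 2 * m5 + a + d + e3 ≤ 2 * L)
    (q6 : 2 * m6 + b + c + e3 ≤ 2 * L)
    (r5 : t3 ≤ m5)
    (r6 : t3 ≤ m6)
    (al1 : 76 / 29 * L < m1 + m2 + m3 + m4 + e1 + e2)
    (al2 : 76 / 29 * L < m1 + m2 + m5 + m6 + e1 + e3)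
    (tw3 : TwoAlt (76 / 29 * L) (a + b + c + d + m1 + m2 + m3 + m4 - t1 - t2) (-a / 2 - d / 2 - m5 + e1 / 2 + e2 / 2 + t3) (-b / 2 - c / 2 - m6 + e1 / 2 + e2 / 2 + t3))
    (tw2 : TwoAlt (76 / 29 * L) (a + b + c + d + m1 + m2 + m5 + m6 - t1 - t3) (-a / 2 - c / 2 - m3 + e1 / 2 + e3 / 2 + t2) (-b / 2 - d / 2 - m4 + e1 / 2 + e3 / 2 + t2))
    (tw1 : TwoAlt (76 / 29 * L) (a + b + c + d + m3 + m4 + m5 + m6 - t2 - t3) (-a / 2 - b / 2 - m1 + e2 / 2 + e3 / 2 + t1) (-c / 2 - d / 2 - m2 + e2 / 2 + e3 / 2 + t1))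
    (ga : GamAlt (76 / 29 * L) (b + m1 + m3 + m5 + e1) (c - 2 * m5 + e2) (d - 2 * m3 + e3) (b + c + d + e1 + e2 + e3) (-m1 + m4 + m6 - e1) (m2 - m3 + m6 - e2) (m2 + m4 - m5 - e3))
    (gb : GamAlt (76 / 29 * L) (d + m1 + m4 + m6 + e2) (a - 2 * m6 + e1) (c - 2 * m1 + e3) (a + c + d + e1 + e2 + e3) (-m1 + m3 + m5 - e1) (m2 - m4 + m5 - e2) (m2 + m3 - m6 - e3))
    (gc : GamAlt (76 / 29 * L) (a + m2 + m3 + m6 + e2) (d - 2 * m6 + e1) (b - 2 * m2 + e3) (a + b + d + e1 + e2 + e3) (-m2 + m4 + m5 - e1) (m1 - m3 + m5 - e2) (m1 + m4 - m6 - e3))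
    (gd : GamAlt (76 / 29 * L) (c + m2 + m4 + m5 + e1) (b - 2 * m5 + e2) (a - 2 * m4 + e3) (a + b + c + e1 + e2 + e3) (-m2 + m3 + m6 - e1) (m1 - m4 + m6 - e2) (m1 + m3 - m5 - e3)) : False := by
  unfold TwoAlt at tw1 tw2 tw3
  unfold GamAlt at ga gb gc gd
  rcases tw3 with y16 | ⟨y16, y17⟩
  · rcases gd with ⟨y17, y18⟩ | ⟨y17, y18, y19⟩ | ⟨y17, y18, y19, y20, y21, y22⟩ | ⟨y17, y18, y19, y20, y21, y22, y23, y24, y25⟩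
    · rcases gc with ⟨y19, y20⟩ | ⟨y19, y20, y21⟩ | ⟨y19, y20, y21, y22, y23, y24⟩ | ⟨y19, y20, y21, y22, y23, y24, y25, y26, y27⟩
      · rcases ga with ⟨y21, y22⟩ | ⟨y21, y22, y23⟩ | ⟨y21, y22, y23, y24, y25, y26⟩ | ⟨y21, y22, y23, y24, y25, y26, y27, y28, y29⟩
        · linarith only [hL, zd, zt1, zt2, q1, q2, q3, q4, q5, q6, y16, y17, y19, y22]
        · linarith only [hL, za, zd, zt1, zt2, q1, q2, q3, q4, q6, y16, y17, y19, y21, y22]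
        · linarith only [hL, zd, zm1, zt1, zt2, q2, q3, q4, q5, q6, y16, y17, y19, y22, y24]
        · linarith only [hL, q4, q6, y21, y24]
      · rcases tw2 with y22 | ⟨y22, y23⟩
        · linarith only [hL, zc, zd, zm1, zt1, zt2, zt3, q1, q2, q3, q4, q5, y16, y17, y19, y20, y22]
        · linarith only [hL, zc, zd, zm1, zt1, zt3, q1, q2, q3, q4, q5, y16, y17, y19, y20, y22]
      · linarith only [hL, zb, zd, zt1, zt2, q1, q3, q4, q5, q6, al1, y16, y17, y19, y22]
      · linarith only [hL, q1, q5, y20, y23]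
    · rcases gb with ⟨y20, y21⟩ | ⟨y20, y21, y22⟩ | ⟨y20, y21, y22, y23, y24, y25⟩ | ⟨y20, y21, y22, y23, y24, y25, y26, y27, y28⟩
      · rcases tw1 with y22 | ⟨y22, y23⟩
        · linarith only [hL, zb, zd, zm3, zt1, zt2, zt3, q1, q2, q3, q4, q6, y16, y17, y18, y20, y22]
        · linarith only [hL, zb, zd, zm3, zt2, zt3, q1, q2, q3, q4, q6, y16, y17, y18, y20, y22]
      · rcases ga with ⟨y23, y24⟩ | ⟨y23, y24, y25⟩ | ⟨y23, y24, y25, y26, y27, y28⟩ | ⟨y23, y24, y25, y26, y27, y28, y29, y30, y31⟩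
        · rcases tw2 with y25 | ⟨y25, y26⟩
          · linarith only [hL, za, zb, zm2, zt1, zt2, zt3, q1, q2, q3, q4, q5, y16, y20, y21, y23, y25]
          · linarith only [hL, za, zb, zm2, zt1, zt3, q1, q2, q3, q4, q5, y16, y20, y21, y23, y26]
        · rcases tw1 with y26 | ⟨y26, y27⟩
          · rcases gc with ⟨y27, y28⟩ | ⟨y27, y28, y29⟩ | ⟨y27, y28, y29, y30, y31, y32⟩ | ⟨y27, y28, y29, y30, y31, y32, y33, y34, y35⟩
            · linarith only [hL, zc, zt1, zt2, zt3, q1, q2, q3, q4, q6, al2, y16, y17, y20, y23, y24, y26, y27]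
            · rcases tw2 with y30 | ⟨y30, y31⟩
              · linarith only [hL, zt1, zt2, zt3, q1, q2, q3, q4, al1, y16, y17, y20, y23, y26, y27, y30]
              · linarith only [hL, zt1, zt2, zt3, q1, q2, q3, q4, q5, q6, al1, y16, y17, y20, y23, y26, y27, y30]
            · linarith only [hL, za, zm3, zt1, zt2, zt3, q1, q2, q3, q4, q6, y16, y17, y21, y23, y24, y26, y29]
            · linarith only [hL, q1, q5, y28, y31]
          · rcases gc with ⟨y28, y29⟩ | ⟨y28, y29, y30⟩ | ⟨y28, y29, y30, y31, y32, y33⟩ | ⟨y28, y29, y30, y31, y32, y33, y34, y35, y36⟩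
            · linarith only [hL, zc, zt2, zt3, q1, q2, q3, q4, q6, al2, y16, y17, y20, y23, y24, y26, y28]
            · rcases tw2 with y31 | ⟨y31, y32⟩
              · linarith only [hL, zt1, zt2, zt3, q1, q2, q3, q4, q5, q6, al1, y16, y17, y20, y23, y26, y28, y31]
              · linarith only [hL, zt1, zt2, zt3, q1, q2, q3, q4, q5, q6, al1, y16, y17, y20, y23, y26, y28, y31]
            · linarith only [hL, za, zm3, zt2, zt3, q1, q2, q3, q4, q6, y16, y17, y21, y23, y24, y26, y30]
            · linarith only [hL, q1, q5, y29, y32]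
        · linarith only [hL, zb, ze2, zt1, zt2, q1, q2, q3, q4, q5, y16, y20, y21, y23]
        · linarith only [hL, q4, q6, y23, y26]
      · linarith only [hL, zd, ze1, zt1, zt2, q1, q2, q3, q4, y16, y17, y18, y22]
      · linarith only [hL, q2, q5, y21, y24]
    · rcases gc with ⟨y23, y24⟩ | ⟨y23, y24, y25⟩ | ⟨y23, y24, y25, y26, y27, y28⟩ | ⟨y23, y24, y25, y26, y27, y28, y29, y30, y31⟩
      · linarith only [hL, zb, zd, zm1, zt1, zt2, q1, q3, q4, q5, q6, al1, y16, y18, y20, y23]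
      · linarith only [hL, zc, ze2, zt1, zt2, q1, q2, q3, q4, q5, y16, y17, y23, y24]
      · linarith only [hL, zb, zd, zt1, zt2, q1, q3, q4, q5, q6, al1, y16, y18, y20, y21, y23]
      · linarith only [hL, q1, q5, y24, y27]
    · linarith only [hL, q3, q6, y17, y20]
  · rcases ga with ⟨y18, y19⟩ | ⟨y18, y19, y20⟩ | ⟨y18, y19, y20, y21, y22, y23⟩ | ⟨y18, y19, y20, y21, y22, y23, y24, y25, y26⟩
    · rcases gb with ⟨y20, y21⟩ | ⟨y20, y21, y22⟩ | ⟨y20, y21, y22, y23, y24, y25⟩ | ⟨y20, y21, y22, y23, y24, y25, y26, y27, y28⟩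
      · rcases gc with ⟨y22, y23⟩ | ⟨y22, y23, y24⟩ | ⟨y22, y23, y24, y25, y26, y27⟩ | ⟨y22, y23, y24, y25, y26, y27, y28, y29, y30⟩
        · rcases tw1 with y24 | ⟨y24, y25⟩
          · rcases tw2 with y25 | ⟨y25, y26⟩
            · linarith only [hL, zc, ze3, zt1, zt2, q1, q2, q3, q4, q5, q6, y17, y18, y21, y22, y24, y25]
            · linarith only [hL, zc, ze3, zt1, zt2, q1, q2, q3, q4, q5, q6, y17, y18, y21, y22, y24, y25]
          · linarith only [hL, zc, zt1, zt2, q1, q2, q3, q4, q5, q6, r5, y17, y18, y19, y20, y22, y24]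
        · rcases tw2 with y25 | ⟨y25, y26⟩
          · linarith only [hL, za, zc, zm4, zt1, zt2, q1, q2, q3, q4, q5, al2, y16, y18, y20, y22, y23, y25]
          · linarith only [hL, za, zc, zm4, zt1, q1, q2, q3, q4, q5, y16, y18, y20, y22, y25]
        · linarith only [hL, zc, zt1, zt2, q1, q2, q3, q4, r6, y16, y18, y24, y26, y27]
        · linarith only [hL, q1, q5, y23, y26]
      · rcases tw2 with y23 | ⟨y23, y24⟩
        · linarith only [hL, za, zb, zm2, zt1, zt2, q1, q2, q3, q4, q5, q6, y17, y18, y21, y23]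
        · linarith only [hL, za, zt1, q1, q2, q3, q4, q5, q6, y17, y18, y21, y23]
      · linarith only [hL, za, zm4, zt1, zt2, q2, q3, q4, q5, r5, y17, y18, y21, y23]
      · linarith only [hL, q2, q5, y21, y24]
    · rcases gc with ⟨y21, y22⟩ | ⟨y21, y22, y23⟩ | ⟨y21, y22, y23, y24, y25, y26⟩ | ⟨y21, y22, y23, y24, y25, y26, y27, y28, y29⟩
      · rcases tw1 with y23 | ⟨y23, y24⟩
        · linarith only [hL, za, zc, zm4, zt1, zt2, q1, q2, q3, q4, q6, y17, y18, y19, y21, y23]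
        · linarith only [hL, zc, zt2, q1, q2, q3, q4, q6, y17, y18, y21, y23]
      · rcases gd with ⟨y24, y25⟩ | ⟨y24, y25, y26⟩ | ⟨y24, y25, y26, y27, y28, y29⟩ | ⟨y24, y25, y26, y27, y28, y29, y30, y31, y32⟩
        · rcases tw2 with y26 | ⟨y26, y27⟩
          · linarith only [hL, za, zd, zm1, zt1, zt2, q1, q2, q3, q4, q5, y16, y19, y21, y22, y24, y26]
          · linarith only [hL, zd, zt1, q1, q2, q3, q4, q5, y16, y21, y24, y26]
        · rcases tw1 with y27 | ⟨y27, y28⟩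
          · rcases gb with ⟨y28, y29⟩ | ⟨y28, y29, y30⟩ | ⟨y28, y29, y30, y31, y32, y33⟩ | ⟨y28, y29, y30, y31, y32, y33, y34, y35, y36⟩
            · linarith only [hL, zb, zt1, zt2, q1, q2, q3, q4, q5, q6, al1, y17, y18, y21, y25, y27, y28]
            · rcases tw2 with y31 | ⟨y31, y32⟩
              · linarith only [hL, zt1, zt2, zt3, q1, q2, q3, q4, q5, q6, al1, y17, y18, y21, y24, y27, y29, y31]
              · linarith only [hL, zt1, zt2, zt3, q1, q2, q3, q4, q5, q6, al1, y17, y18, y21, y24, y27, y29, y31]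
            · linarith only [hL, za, zm4, zt1, zt2, q1, q2, q3, q4, q6, y17, y18, y22, y24, y25, y27, y29]
            · linarith only [hL, q2, q5, y29, y32]
          · rcases tw2 with y29 | ⟨y29, y30⟩
            · rcases gb with ⟨y30, y31⟩ | ⟨y30, y31, y32⟩ | ⟨y30, y31, y32, y33, y34, y35⟩ | ⟨y30, y31, y32, y33, y34, y35, y36, y37, y38⟩
              · linarith only [hL, zb, zt2, q1, q2, q3, q4, q5, q6, y17, y25, y28, y30]
              · linarith only [hL, zt1, zt2, zt3, q1, q2, q3, q4, q5, q6, al1, y17, y18, y21, y24, y27, y29, y31]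
              · linarith only [hL, zc, zt2, q1, q2, q3, q4, q6, y16, y21, y24, y28, y31]
              · linarith only [hL, q2, q5, y31, y34]
            · rcases gb with ⟨y31, y32⟩ | ⟨y31, y32, y33⟩ | ⟨y31, y32, y33, y34, y35, y36⟩ | ⟨y31, y32, y33, y34, y35, y36, y37, y38, y39⟩
              · linarith only [hL, zb, zt2, q1, q2, q3, q4, q6, y17, y24, y28, y31]
              · linarith only [hL, zt1, zt2, zt3, q1, q2, q3, q4, q5, q6, al1, y17, y18, y21, y24, y27, y29, y31]
              · linarith only [hL, za, zt2, q1, q2, q3, q4, q6, y16, y18, y24, y25, y28, y32]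
              · linarith only [hL, q2, q5, y32, y35]
        · rcases tw2 with y30 | ⟨y30, y31⟩
          · linarith only [hL, za, zc, zm1, zm2, zt1, zt2, q1, q2, q3, q4, q5, y16, y19, y21, y24, y30]
          · linarith only [hL, zc, zt1, q1, q2, q3, q4, q5, y16, y21, y24, y30]
        · linarith only [hL, q3, q6, y24, y27]
      · rcases tw1 with y27 | ⟨y27, y28⟩
        · linarith only [hL, za, zm3, zm4, zt1, zt2, q1, q2, q4, q5, q6, y17, y19, y21, y27]
        · linarith only [hL, za, zt2, q1, q2, q3, q4, q5, q6, y17, y19, y21, y27]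
      · linarith only [hL, q1, q5, y22, y25]
    · rcases gb with ⟨y24, y25⟩ | ⟨y24, y25, y26⟩ | ⟨y24, y25, y26, y27, y28, y29⟩ | ⟨y24, y25, y26, y27, y28, y29, y30, y31, y32⟩
      · linarith only [hL, za, zt1, zt2, q1, q2, q3, q4, q5, q6, r5, y17, y19, y21, y24]
      · rcases tw2 with y27 | ⟨y27, y28⟩
        · linarith only [hL, zb, zm1, zm2, zt1, zt2, q1, q2, q4, q5, q6, y17, y19, y22, y25, y27]
        · linarith only [hL, zb, zt1, q1, q2, q4, q5, q6, y17, y19, y25, y27]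
      · linarith only [hL, za, zc, ze3, q2, q4, q5, q6, y19, y21, y22, y24]
      · linarith only [hL, q2, q5, y25, y28]
    · linarith only [hL, q4, q6, y18, y21]

lemma GamAlt.swap {θ f u1 u2 g s1 s2 s3 : ℝ} (h : GamAlt θ f u1 u2 g s1 s2 s3) :
    GamAlt θ f u1 u2 g s2 s1 s3 := by
  unfold GamAlt at *
  rcases h with h | h | ⟨a, b, c, d, e, f⟩ | ⟨a, b, c, d, e, f, g, h, i⟩
  · exact Or.inl h
  · exact Or.inr (Or.inl h)
  · exact Or.inr (Or.inr (Or.inl ⟨b, a, c, e, d, f⟩))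
  · exact Or.inr (Or.inr (Or.inr ⟨b, a, c, e, d, f, h, g, i⟩))

lemma pw_alt {A A' θ v N : ℝ} (hA0 : 0 ≤ A') (hA : A' ≤ A) (hN : A * pw θ < N) (h : N ≤ A' * pw v) : θ < v := by
  by_contra hv
  push Not at hv
  have h1 := pw_mono hv
  have h2 := pw_pos v
  have h3 := pw_pos θ
  have : A' * pw v ≤ A * pw θ := mul_le_mul hA h1 h2.le (hA0.trans hA)
  linarith

lemma one_pw_nonpos {s : ℝ} (h : s ≤ 0) : 1 + pw s ≤ 2 := by
  have := pw_mono h; rw [pw_zero] at this; linarith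
lemma one_pw_nonneg {s : ℝ} (h : 0 ≤ s) : 1 + pw s ≤ 2 * pw s := by
  have := pw_mono h; rw [pw_zero] at this; linarith

/-- handling a factor `1 + pw s` -/
lemma pw_alt2 {A A' θ v s N : ℝ} (hA0 : 0 ≤ A') (hA : 2 * A' ≤ A) (hN : A * pw θ < N) (h : N ≤ A' * pw v * (1 + pw s)) :
    (s ≤ 0 → θ < v) ∧ (0 < s → θ < v + s) := by
  have hv := pw_pos v
  constructor
  · intro hs
    apply pw_alt (by linarith) hA hN (h.trans _)
    have := one_pw_nonpos hs
    calc _ ≤ A' * pw v * 2 := by gcongr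
      _ = _ := by ring
  · intro hs
    apply pw_alt (by linarith) hA hN (h.trans _)
    have := one_pw_nonneg hs.le
    rw [pw_add]
    calc _ ≤ A' * pw v * (2 * pw s) := by gcongr
      _ = _ := by ring

section
variable {X : ℕ} {T θ : ℝ} {c : Cls} {F : Finset Dat}

lemma gam (hT : DivB (X ^ 2) T) (hT1 : 1 ≤ T) (hF : ∀ x ∈ F, Good X x ∧ InCls c x)
    (hN : 10 ^ 18 * T ^ 4 * pw θ < F.card) {i j k l : Fin 4} (hd : D4 i j k l) :
    GamAlt θ (c.M i j + c.M j k + c.M k i + c.H k + c.E i j) (c.H i + c.E j k - 2 * c.M k i)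
      (c.H j + c.E i k - 2 * c.M k j) (c.H i + c.H j + c.H k + c.E i j + c.E j k + c.E k i)
      (c.M i l + c.M j l - c.M i j - c.E i j) (c.M j l + c.M k l - c.M j k - c.E j k)
      (c.M k l + c.M i l - c.M k i - c.E k i) := by
  have hT0 : 0 ≤ T := by linarith
  have hT4 : 1 ≤ T ^ 4 := one_le_pow₀ hT1
  have hne : F.Nonempty := by
    rw [← Finset.card_pos]
    have : 0 ≤ 10 ^ 18 * T ^ 4 * pw θ := by have := pw_pos θ; positivity
    exact_mod_cast this.trans_lt hN
  obtain ⟨x0, hx0⟩ := hne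
  obtain ⟨g0, q0⟩ := hF x0 hx0
  have b1 := triB_sec F hF hd
  have b2 := (triB_sec F hF hd.swap12.swap23).rot.rot
  have b3 := (triB_sec F hF hd.swap23.swap12).rot
  set s1 : ℝ := c.M i l + c.M j l - c.M i j - c.E i j with hs1
  set s2 : ℝ := c.M j l + c.M k l - c.M j k - c.E j k with hs2
  set s3 : ℝ := c.M k l + c.M i l - c.M k i - c.E k i with hs3
  set f : ℝ := c.M i j + c.M j k + c.M k i + c.H k + c.E i j with hf
  set u1 : ℝ := c.H i + c.E j k - 2 * c.M k i with hu1
  set u2 : ℝ := c.H j + c.E i k - 2 * c.M k j with hu2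
  set g : ℝ := c.H i + c.H j + c.H k + c.E i j + c.E j k + c.E k i with hg
  have main : ∀ s : ℝ, TriB F i j k (288 * pw s) →
      (u1 ≤ 0 ∨ u2 ≤ 0 → θ < f + s) ∧ (¬ (u1 ≤ 0 ∨ u2 ≤ 0) → θ < f + u1 + s ∧ θ < f + u2 + s) ∧ θ < g + s := by
    intro s hK
    have hs := pw_pos s
    have k1 := tri_DS hT hT0 F hF hd _ (by positivity) hK
    have k2 := tri_DS hT hT0 F hF hd.swap12 _ (by positivity) (hK.swap (fun x hx => (hF x hx).1))
    have k3 := tri_AE F hF hd _ (by positivity) hK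
    have e : c.M j i + c.M i k + c.M k j + c.H k + c.E j i = f := by
      rw [hf, q0.Msymm g0 hd.ij, q0.Msymm g0 hd.jk, q0.Msymm g0 hd.ik, q0.Esymm g0 hd.ij]; ring
    rw [e] at k2
    have a1 : (F.card : ℝ) ≤ (10 ^ 10 * 288 * T ^ 4) * pw (f + s) * (1 + pw u1) := by
      rw [← hf, ← hu1] at k1
      refine k1.trans (le_of_eq ?_)
      rw [pw_add _ s]; ring
    have a2 : (F.card : ℝ) ≤ (10 ^ 10 * 288 * T ^ 4) * pw (f + s) * (1 + pw u2) := by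
      rw [← hu2] at k2
      refine k2.trans (le_of_eq ?_)
      rw [pw_add _ s]; ring
    have a3 : (F.card : ℝ) ≤ (10 ^ 10 * 288) * pw (g + s) := by
      rw [← hg] at k3
      refine k3.trans (le_of_eq ?_)
      rw [pw_add _ s]; ring
    have c3 := pw_alt (by norm_num) (by linarith) hN a3
    obtain ⟨c1, d1⟩ := pw_alt2 (by positivity) (by linarith) hN a1
    obtain ⟨c2, d2⟩ := pw_alt2 (by positivity) (by linarith) hN a2
    refine ⟨fun h => h.elim c1 c2, fun h => ?_, c3⟩
    push Not at h
    have := d1 h.1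
    have := d2 h.2
    exact ⟨by linarith, by linarith⟩
  have lo : ∀ s : ℝ, s ≤ 0 → TriB F i j k (144 * (1 + pw s)) → TriB F i j k (288 * pw 0) := by
    intro s hs hK S hS h
    have := hK S hS h
    have h2 := one_pw_nonpos hs
    rw [pw_zero]; linarith
  have hi : ∀ s : ℝ, 0 < s → TriB F i j k (144 * (1 + pw s)) → TriB F i j k (288 * pw s) := by
    intro s hs hK S hS h
    have := hK S hS h
    have h2 := one_pw_nonneg hs.le
    linarith
  have case0 : TriB F i j k (288 * pw 0) → GamAlt θ f u1 u2 g s1 s2 s3 := by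
    intro h
    obtain ⟨h1, h2, h3⟩ := main 0 h
    rw [add_zero] at h1 h3
    simp only [add_zero] at h2
    by_cases hu : u1 ≤ 0 ∨ u2 ≤ 0
    · exact Or.inl ⟨h1 hu, h3⟩
    · exact Or.inr (Or.inl ⟨(h2 hu).1, (h2 hu).2, h3⟩)
  have e2 : (c.M j l + c.M k l - c.M j k - c.E j k : ℝ) = s2 := rfl
  rcases le_or_gt s1 0 with h1 | h1
  · exact case0 (lo _ h1 b1)
  rcases le_or_gt s2 0 with h2 | h2
  · exact case0 (lo _ h2 b2)
  rcases le_or_gt s3 0 with h3 | h3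
  · exact case0 (lo _ h3 b3)
  obtain ⟨m1, n1, o1⟩ := main _ (hi _ h1 b1)
  obtain ⟨m2, n2, o2⟩ := main _ (hi _ h2 b2)
  obtain ⟨m3, n3, o3⟩ := main _ (hi _ h3 b3)
  by_cases hu : u1 ≤ 0 ∨ u2 ≤ 0
  · exact Or.inr (Or.inr (Or.inl ⟨m1 hu, m2 hu, m3 hu, o1, o2, o3⟩))
  · exact Or.inr (Or.inr (Or.inr ⟨(n1 hu).1, (n2 hu).1, (n3 hu).1, (n1 hu).2, (n2 hu).2, (n3 hu).2, o1, o2, o3⟩))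

lemma twoalt (hX : 1 ≤ X) (hT : DivB (X ^ 2) T) (hT1 : 1 ≤ T) (hF : ∀ x ∈ F, Good X x ∧ InCls c x)
    (hN : 10 ^ 18 * T ^ 4 * pw θ < F.card) {i j k l : Fin 4} (hd : D4 i j k l)
    (h3 : c.t k l = c.t i j) :
    TwoAlt θ (c.M i j + c.M k l + c.M j k + c.M i l - c.t i j - c.t j k + c.H i + c.H j + c.H k + c.H l)
      ((c.E i j + c.E j k) / 2 + c.t i k - c.M i k - (c.H j + c.H l) / 2)
      ((c.E i j + c.E j k) / 2 + c.t j l - c.M j l - (c.H k + c.H i) / 2) := by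
  have hT0 : 0 ≤ T := by linarith
  have hT3 : 1 ≤ T ^ 3 := one_le_pow₀ hT1
  have hT4 : T ^ 3 ≤ T ^ 4 := pow_le_pow_right₀ hT1 (by norm_num)
  have hne : F.Nonempty := by
    rw [← Finset.card_pos]
    have : 0 ≤ 10 ^ 18 * T ^ 4 * pw θ := by have := pw_pos θ; positivity
    exact_mod_cast this.trans_lt hN
  obtain ⟨x0, hx0⟩ := hne
  obtain ⟨g0, q0⟩ := hF x0 hx0
  have k1 := two hX hT hT0 F hF hd
  have k2 := two hX hT hT0 F hF hd.rot
  rw [q0.Msymm g0 hd.il.symm, q0.Msymm g0 hd.ij.symm, h3, ← q0.Eopp g0 hd] at k2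
  have e : (c.M j k + c.M i l + c.M k l + c.M i j - c.t j k - c.t i j + c.H j + c.H k + c.H l + c.H i : ℝ) =
    c.M i j + c.M k l + c.M j k + c.M i l - c.t i j - c.t j k + c.H i + c.H j + c.H k + c.H l := by ring
  rw [e, add_comm (c.E j k : ℝ)] at k2
  obtain ⟨c1, d1⟩ := pw_alt2 (by positivity) (by linarith) hN k1
  obtain ⟨c2, d2⟩ := pw_alt2 (by positivity) (by linarith) hN k2
  rcases le_or_gt ((c.E i j + c.E j k) / 2 + c.t i k - c.M i k - (c.H j + c.H l) / 2 : ℝ) 0 with h1 | h1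
  · exact Or.inl (c1 h1)
  rcases le_or_gt ((c.E i j + c.E j k) / 2 + c.t j l - c.M j l - (c.H k + c.H i) / 2 : ℝ) 0 with h2 | h2
  · exact Or.inl (c2 h2)
  exact Or.inr ⟨d1 h1, d2 h2⟩

lemma alphaalt {L : ℝ} (hT : DivB (X ^ 2) T) (hT1 : 1 ≤ T) (hF : ∀ x ∈ F, Good X x ∧ InCls c x)
    (hN : 10 ^ 18 * T ^ 4 * pw θ < F.card) {i j k l : Fin 4} (hd : D4 i j k l) (hL : 2 * L ≤ θ)
    (hq : ∀ i j k l, D4 i j k l → (2 * c.M i j + c.H k + c.H l + c.E i j : ℝ) ≤ 2 * L) :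
    θ < c.M i j + c.M k l + c.E i j + c.M j k + c.M i l + c.E i l := by
  have hT0 : 0 ≤ T := by linarith
  have hT3 : 1 ≤ T ^ 3 := one_le_pow₀ hT1
  have hT4 : T ^ 3 ≤ T ^ 4 := pow_le_pow_right₀ hT1 (by norm_num)
  have hne : F.Nonempty := by
    rw [← Finset.card_pos]
    have : 0 ≤ 10 ^ 18 * T ^ 4 * pw θ := by have := pw_pos θ; positivity
    exact_mod_cast this.trans_lt hN
  obtain ⟨x0, hx0⟩ := hne
  obtain ⟨g0, q0⟩ := hF x0 hx0
  by_contra hc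
  push Not at hc
  have key : ∀ a b, a ≠ b → θ < (c.M i j + c.M k l + c.E i j + c.M j k + c.M i l + c.E i l : ℝ) + (c.H a + c.H b - 2 * c.M a b - c.E a b) := by
    intro a b hab
    obtain ⟨c1, d1⟩ := pw_alt2 (by positivity) (by linarith) hN (alpha hT hT0 F hF hd hab)
    rcases le_or_gt (c.H a + c.H b - 2 * c.M a b - c.E a b : ℝ) 0 with h1 | h1
    · linarith [c1 h1]
    · exact d1 h1
  have a1 := key i j hd.ij
  have a2 := key k l hd.kl
  have a3 := key j k hd.jk
  have a4 := key i l hd.il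
  have b1 := hq i j k l hd
  have b2 := hq k l i j hd.opp
  have b3 := hq j k i l hd.rot.swap34
  have b4 := hq i l j k hd.swap34.swap23
  have e1 := q0.Eopp g0 hd
  have e2 := q0.Eopp g0 hd.rot.swap34
  rw [← e1] at a2 b2
  rw [e2] at a3 b3
  linarith
end

lemma InCls.tsymm {X : ℕ} {c : Cls} {x : Dat} (q : InCls c x) (g : Good X x) {i j k l : Fin 4}
    (h : D4 i j k l) : c.t i j = c.t j i := by
  have e : Int.gcd (x.m i j) (x.m k l) = Int.gcd (x.m j i) (x.m k l) := by
    rw [g.manti i j, Int.neg_gcd]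
  exact dy_unique (q.tl i j k l h) (q.tu i j k l h) (e ▸ q.tl j i k l h.swap12) (e ▸ q.tu j i k l h.swap12)

lemma InCls.topp {c : Cls} {x : Dat} (q : InCls c x) {i j k l : Fin 4}
    (h : D4 i j k l) : c.t i j = c.t k l := by
  have e : Int.gcd (x.m i j) (x.m k l) = Int.gcd (x.m k l) (x.m i j) := Int.gcd_comm ..
  exact dy_unique (q.tl i j k l h) (q.tu i j k l h) (e ▸ q.tl k l i j h.opp) (e ▸ q.tu k l i j h.opp)

lemma InCls.tle {X : ℕ} {c : Cls} {x : Dat} (q : InCls c x) (g : Good X x) {i j k l : Fin 4}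
    (h : D4 i j k l) : c.t i j ≤ c.M i j := by
  have h1 := q.tl i j k l h
  have h2 := q.Mu i j h.ij
  have h3 : Int.gcd (x.m i j) (x.m k l) ≤ (x.m i j).natAbs := by
    apply Nat.le_of_dvd
    · have := g.mne i j h.ij; omega
    · exact Int.natCast_dvd.mp (Int.gcd_dvd_left ..)
  have h4 : 2 ^ c.t i j < 2 ^ (c.M i j + 1) := by omega
  have := (Nat.pow_lt_pow_iff_right (one_lt_two)).mp h4
  omega

lemma InCls.size {X : ℕ} {c : Cls} {x : Dat} (q : InCls c x) (g : Good X x) (hX : 1 ≤ X) {i j k l : Fin 4}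
    (h : D4 i j k l) : (2 * c.M i j + c.H k + c.H l + c.E i j : ℝ) ≤ 2 * (Real.logb 2 X / 2) := by
  have h1 := g.size i j k l h
  unfold Dat.p at h1
  rw [gn_mul, gn_intCast] at h1
  have h2 : 2 ^ c.H k * 2 ^ c.H l * ((2 ^ c.M i j) ^ 2 * 2 ^ c.E i j) ≤ X := by
    refine le_trans ?_ h1
    exact Nat.mul_le_mul (Nat.mul_le_mul (q.Hl k) (q.Hl l)) (Nat.mul_le_mul (Nat.pow_le_pow_left (q.Ml i j h.ij) 2) (q.El i j h.ij))
  rw [mul_div_cancel₀ _ (two_ne_zero), Real.le_logb_iff_rpow_le (by norm_num) (by exact_mod_cast hX)]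
  have h3 : (2 : ℝ) ^ (2 * c.M i j + c.H k + c.H l + c.E i j : ℝ) = ((2 ^ c.H k * 2 ^ c.H l * ((2 ^ c.M i j) ^ 2 * 2 ^ c.E i j) : ℕ) : ℝ) := by
    rw [show (2 * c.M i j + c.H k + c.H l + c.E i j : ℝ) = ((2 * c.M i j + c.H k + c.H l + c.E i j : ℕ) : ℝ) by push_cast; ring, Real.rpow_natCast]
    push_cast
    ring
  rw [h3]; exact_mod_cast h2

lemma class_bound {X : ℕ} {T : ℝ} {c : Cls} {F : Finset Dat} (hX : 2 ≤ X) (hT : DivB (X ^ 2) T) (hT1 : 1 ≤ T)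
    (hF : ∀ x ∈ F, Good X x ∧ InCls c x) :
    (F.card : ℝ) ≤ 10 ^ 18 * T ^ 4 * (X : ℝ) ^ (38 / 29 : ℝ) := by
  set L := Real.logb 2 X / 2 with hLdef
  have hL : 0 < L := by
    have : 0 < Real.logb 2 X := Real.logb_pos (by norm_num) (by exact_mod_cast hX)
    positivity
  have e : (X : ℝ) ^ (38 / 29 : ℝ) = pw (76 / 29 * L) := by
    unfold pw
    rw [hLdef, show 76 / 29 * (Real.logb 2 X / 2) = Real.logb 2 X * (38 / 29) by ring, Real.rpow_mul (by norm_num),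
      Real.rpow_logb (by norm_num) (by norm_num) (by positivity)]
  rw [e]
  by_contra hN
  push Not at hN
  have hne : F.Nonempty := by
    rw [← Finset.card_pos]
    have : 0 ≤ 10 ^ 18 * T ^ 4 * pw (76 / 29 * L) := by have := pw_pos (76 / 29 * L); positivity
    exact_mod_cast this.trans_lt hN
  obtain ⟨x, hx⟩ := hne
  obtain ⟨g, q⟩ := hF x hx
  have hX1 : 1 ≤ X := by omega
  have d0 : D4 0 1 2 3 := by decide
  have hq : ∀ i j k l, D4 i j k l → (2 * c.M i j + c.H k + c.H l + c.E i j : ℝ) ≤ 2 * L := fun i j k l h => q.size g hX1 h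
  have M10 : c.M 1 0 = c.M 0 1 := q.Msymm g (by decide)
  have M20 : c.M 2 0 = c.M 0 2 := q.Msymm g (by decide)
  have M30 : c.M 3 0 = c.M 0 3 := q.Msymm g (by decide)
  have M21 : c.M 2 1 = c.M 1 2 := q.Msymm g (by decide)
  have M31 : c.M 3 1 = c.M 1 3 := q.Msymm g (by decide)
  have M32 : c.M 3 2 = c.M 2 3 := q.Msymm g (by decide)
  have E10 : c.E 1 0 = c.E 0 1 := q.Esymm g (by decide)
  have E23 : c.E 2 3 = c.E 0 1 := q.Eopp g (by decide)
  have E32 : c.E 3 2 = c.E 0 1 := (q.Esymm g (by decide)).trans E23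
  have E03 : c.E 0 3 = c.E 1 2 := q.Eopp g (by decide)
  have E30 : c.E 3 0 = c.E 1 2 := (q.Esymm g (by decide)).trans E03
  have E21 : c.E 2 1 = c.E 1 2 := q.Esymm g (by decide)
  have E20 : c.E 2 0 = c.E 0 2 := q.Esymm g (by decide)
  have E13 : c.E 1 3 = c.E 0 2 := q.Eopp g (by decide)
  have E31 : c.E 3 1 = c.E 0 2 := (q.Esymm g (by decide)).trans E13
  have t10 : c.t 1 0 = c.t 0 1 := (q.tsymm g (by decide : D4 1 0 2 3))
  have t23 : c.t 2 3 = c.t 0 1 := q.topp (by decide)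
  have t32 : c.t 3 2 = c.t 0 1 := (q.tsymm g (by decide : D4 3 2 0 1)).trans t23
  have t03 : c.t 0 3 = c.t 1 2 := q.topp (by decide)
  have t30 : c.t 3 0 = c.t 1 2 := (q.tsymm g (by decide : D4 3 0 1 2)).trans t03
  have t21 : c.t 2 1 = c.t 1 2 := (q.tsymm g (by decide : D4 2 1 0 3))
  have t20 : c.t 2 0 = c.t 0 2 := (q.tsymm g (by decide : D4 2 0 1 3))
  have t13 : c.t 1 3 = c.t 0 2 := q.topp (by decide)
  have t31 : c.t 3 1 = c.t 0 2 := (q.tsymm g (by decide : D4 3 1 0 2)).trans t13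
  have q1 := hq 0 1 2 3 (by decide)
  have q2 := hq 2 3 0 1 (by decide)
  have q3 := hq 1 2 0 3 (by decide)
  have q4 := hq 0 3 1 2 (by decide)
  have q5 := hq 0 2 1 3 (by decide)
  have q6 := hq 1 3 0 2 (by decide)
  have r5 := q.tle g (by decide : D4 0 2 1 3)
  have r6 := q.tle g (by decide : D4 1 3 0 2)
  have al1 := alphaalt (L := L) hT hT1 hF hN (by decide : D4 0 1 2 3) (by linarith) hq
  have al2 := alphaalt (L := L) hT hT1 hF hN (by decide : D4 1 0 2 3) (by linarith) hq
  have tw3 := twoalt hX1 hT hT1 hF hN (by decide : D4 0 1 2 3) t23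
  have tw2 := twoalt hX1 hT hT1 hF hN (by decide : D4 1 0 2 3) (t23.trans t10.symm)
  have tw1 := twoalt hX1 hT hT1 hF hN (by decide : D4 0 2 1 3) t13
  have ga := gam hT hT1 hF hN (by decide : D4 0 1 2 3)
  have gb := (gam hT hT1 hF hN (by decide : D4 3 0 1 2)).swap
  have gc := (gam hT hT1 hF hN (by decide : D4 1 2 3 0)).swap
  have gd := gam hT hT1 hF hN (by decide : D4 2 3 0 1)
  simp only [M10, M20, M30, M21, M31, M32, E10, E23, E32, E03, E30, E21, E20, E13, E31, t10, t23, t32, t03, t30, t21,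
    t20, t13, t31] at q1 q2 q3 q4 q5 q6 r5 r6 al1 al2 tw3 tw2 tw1 ga gb gc gd
  have r5' : (c.t 0 2 : ℝ) ≤ c.M 0 2 := by exact_mod_cast r5
  have r6' : (c.t 0 2 : ℝ) ≤ c.M 1 3 := by exact_mod_cast r6
  refine lp_core (L := L) (a := c.H 3) (b := c.H 2) (c := c.H 0) (d := c.H 1) (m1 := c.M 0 1) (m2 := c.M 2 3)
    (m3 := c.M 1 2) (m4 := c.M 0 3) (m5 := c.M 0 2) (m6 := c.M 1 3) (e1 := c.E 0 1) (e2 := c.E 1 2) (e3 := c.E 0 2)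
    (t1 := c.t 0 1) (t2 := c.t 1 2) (t3 := c.t 0 2) hL (Nat.cast_nonneg _) (Nat.cast_nonneg _) (Nat.cast_nonneg _)
    (Nat.cast_nonneg _) (Nat.cast_nonneg _) (Nat.cast_nonneg _) (Nat.cast_nonneg _) (Nat.cast_nonneg _)
    (Nat.cast_nonneg _) (Nat.cast_nonneg _) (Nat.cast_nonneg _) (Nat.cast_nonneg _) (Nat.cast_nonneg _) (Nat.cast_nonneg _)
    (by linarith) (by linarith) (by linarith) (by linarith) (by linarith) (by linarith) r5' r6' (by linarith) (by linarith)
    ?_ ?_ ?_ ?_ ?_ ?_ ?_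
  · convert tw3 using 1 <;> ring
  · convert tw2 using 1 <;> ring
  · convert tw1 using 1 <;> ring
  · convert ga using 1 <;> ring
  · convert gb using 1 <;> ring
  · convert gc using 1 <;> ring
  · convert gd using 1 <;> ring

lemma D4.two {i j k l k' l' : Fin 4} (h : D4 i j k l) (h' : D4 i j k' l') :
    (k' = k ∧ l' = l) ∨ (k' = l ∧ l' = k) := by
  revert i j k l k' l'; decide

open Classical in
noncomputable def Dat.gc (x : Dat) (i j : Fin 4) : ℕ :=
  if h : ∃ q : Fin 4 × Fin 4, D4 i j q.1 q.2 then
    Int.gcd (x.m i j) (x.m h.choose.1 h.choose.2) else 1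

lemma Good.gc_eq {X : ℕ} {x : Dat} (g : Good X x) {i j k l : Fin 4} (hd : D4 i j k l) :
    x.gc i j = Int.gcd (x.m i j) (x.m k l) := by
  have h : ∃ q : Fin 4 × Fin 4, D4 i j q.1 q.2 := ⟨(k, l), hd⟩
  unfold Dat.gc
  rw [dif_pos h]
  rcases D4.two hd h.choose_spec with ⟨h1, h2⟩ | ⟨h1, h2⟩
  · rw [h1, h2]
  · rw [h1, h2, g.manti l k, Int.gcd_neg]

noncomputable def Dat.val (x : Dat) (s : Fin 5) (i j : Fin 4) : ℕ :=
  ![gn (x.h i), (x.m i j).natAbs, gn (x.e i j), x.gc i j,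
    gn (EuclideanDomain.gcd (x.h i) (star (x.h j)))] s

lemma dy_clamp {v X : ℕ} (h1 : 1 ≤ v) (h2 : v ≤ X) :
    2 ^ (min (Nat.log 2 v) (Nat.log 2 X)) ≤ v ∧ v < 2 ^ (min (Nat.log 2 v) (Nat.log 2 X) + 1) := by
  rw [min_eq_left (Nat.log_mono_right h2)]
  exact ⟨Nat.pow_log_le_self 2 (by omega), Nat.lt_pow_succ_log_self (by norm_num) v⟩

lemma Good.gnh {X : ℕ} {x : Dat} (g : Good X x) (i : Fin 4) : gn (x.h i) ≤ X := by
  obtain ⟨j, hj⟩ : ∃ j : Fin 4, i ≠ j := by revert i; decide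
  obtain ⟨k, l, hd⟩ := D4.exists_of_ne hj
  exact g.gnh_le hd.opp

lemma Good.natAbs_le {X : ℕ} {x : Dat} (g : Good X x) {i j : Fin 4} (h : i ≠ j) :
    (x.m i j).natAbs ≤ X := by
  obtain ⟨k, l, hd⟩ := D4.exists_of_ne h
  have := g.gnm_le hd
  rw [gn_intCast] at this
  nlinarith [Nat.le_self_pow (n := 2) (by norm_num) (x.m i j).natAbs]

lemma Good.gcd_rng {X : ℕ} {x : Dat} (g : Good X x) {i j k l : Fin 4} (hd : D4 i j k l) :
    1 ≤ Int.gcd (x.m i j) (x.m k l) ∧ Int.gcd (x.m i j) (x.m k l) ≤ X := by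
  have h0 := g.mne i j hd.ij
  refine ⟨Int.gcd_pos_of_ne_zero_left _ h0, le_trans ?_ (g.natAbs_le hd.ij)⟩
  apply Nat.le_of_dvd
  · omega
  · exact Int.natCast_dvd.mp (Int.gcd_dvd_left ..)

lemma good_class_card {X : ℕ} {B : ℝ} (hB : 0 ≤ B)
    (hc : ∀ (c : Cls) (F : Finset Dat), (∀ x ∈ F, Good X x ∧ InCls c x) → (F.card : ℝ) ≤ B)
    (F : Finset Dat) (hF : ∀ x ∈ F, Good X x) :
    (F.card : ℝ) ≤ B * ((Nat.log 2 X + 1 : ℕ) : ℝ) ^ 80 := by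
  classical
  set f : Dat → (Fin 5 → Fin 4 → Fin 4 → ℕ) := fun x s i j => min (Nat.log 2 (x.val s i j)) (Nat.log 2 X) with hf
  have key := card_fib' F f (Fintype.piFinset fun _ => Fintype.piFinset fun _ => Fintype.piFinset fun _ =>
    Finset.range (Nat.log 2 X + 1)) B hB ?_ ?_
  · refine key.trans (le_of_eq ?_)
    congr 1
    simp only [Fintype.card_piFinset, Finset.card_range, Finset.prod_const, Finset.card_univ, Fintype.card_fin]
    push_cast
    rw [← pow_mul, ← pow_mul]
  · intro x _
    simp only [Fintype.mem_piFinset, Finset.mem_range, hf]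
    intro s i j; omega
  · intro x _
    apply hc ⟨fun i => f x 0 i i, f x 1, f x 2, f x 3, f x 4⟩
    intro y hy
    rw [Finset.mem_filter] at hy
    obtain ⟨hy, e⟩ := hy
    have g := hF y hy
    rw [← e]
    have v0 : ∀ i, 1 ≤ gn (y.h i) ∧ gn (y.h i) ≤ X := fun i => ⟨gn_pos (g.hne i), g.gnh i⟩
    have v1 : ∀ i j, i ≠ j → 1 ≤ (y.m i j).natAbs ∧ (y.m i j).natAbs ≤ X := fun i j h =>
      ⟨by have := g.mne i j h; omega, g.natAbs_le h⟩
    have v2 : ∀ i j, i ≠ j → 1 ≤ gn (y.e i j) ∧ gn (y.e i j) ≤ X := by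
      intro i j h
      refine ⟨gn_pos (g.ene i j h), ?_⟩
      obtain ⟨k, l, hd⟩ := D4.exists_of_ne h
      have h1 := g.gnp_le hd
      unfold Dat.p at h1
      rw [gn_mul] at h1
      refine le_trans (Nat.le_mul_of_pos_left _ ?_) h1
      exact gn_pos (by exact_mod_cast g.mne i j h)
    have v4 : ∀ i j, 1 ≤ gn (EuclideanDomain.gcd (y.h i) (star (y.h j))) ∧
        gn (EuclideanDomain.gcd (y.h i) (star (y.h j))) ≤ X := by
      intro i j
      refine ⟨gn_pos (gcd_star_ne g i j), le_trans ?_ (g.gnh i)⟩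
      obtain ⟨q, hq⟩ := EuclideanDomain.gcd_dvd_left (y.h i) (star (y.h j))
      conv_rhs => rw [hq, gn_mul]
      apply Nat.le_mul_of_pos_right
      apply gn_pos
      rintro rfl
      exact g.hne i (by rw [hq, mul_zero])
    have w3 : ∀ i j k l, D4 i j k l →
        2 ^ f y 3 i j ≤ Int.gcd (y.m i j) (y.m k l) ∧ Int.gcd (y.m i j) (y.m k l) < 2 ^ (f y 3 i j + 1) := by
      intro i j k l hd
      have h1 : f y 3 i j = min (Nat.log 2 (Int.gcd (y.m i j) (y.m k l))) (Nat.log 2 X) := by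
        rw [← g.gc_eq hd]; rfl
      rw [h1]
      exact dy_clamp (g.gcd_rng hd).1 (g.gcd_rng hd).2
    exact ⟨g, ⟨fun i => (dy_clamp (v0 i).1 (v0 i).2).1, fun i => (dy_clamp (v0 i).1 (v0 i).2).2,
      fun i j h => (dy_clamp (v1 i j h).1 (v1 i j h).2).1, fun i j h => (dy_clamp (v1 i j h).1 (v1 i j h).2).2,
      fun i j h => (dy_clamp (v2 i j h).1 (v2 i j h).2).1, fun i j h => (dy_clamp (v2 i j h).1 (v2 i j h).2).2,
      fun i j k l h => (w3 i j k l h).1, fun i j k l h => (w3 i j k l h).2,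
      fun i j _ => (dy_clamp (v4 i j).1 (v4 i j).2).1, fun i j _ => (dy_clamp (v4 i j).1 (v4 i j).2).2⟩⟩

lemma natlog_le {δ : ℝ} (hδ : 0 < δ) : ∃ C : ℝ, 1 ≤ C ∧ ∀ X : ℕ, 2 ≤ X →
    ((Nat.log 2 X + 1 : ℕ) : ℝ) ≤ C * (X : ℝ) ^ δ := by
  refine ⟨1 + 2 / δ, by have : 0 < 2 / δ := by positivity
                        linarith, ?_⟩
  intro X hX
  have h1 : (Nat.log 2 X : ℝ) ≤ Real.logb 2 X := by
    rw [Real.le_logb_iff_rpow_le (by norm_num) (by positivity), Real.rpow_natCast]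
    exact_mod_cast Nat.pow_log_le_self 2 (by omega)
  have h2 : Real.logb 2 X ≤ 2 * Real.log X := by
    rw [Real.logb, div_le_iff₀ (Real.log_pos (by norm_num))]
    have := Real.log_two_gt_d9
    have : 0 ≤ Real.log X := Real.log_natCast_nonneg X
    nlinarith
  have h3 := Real.log_le_rpow_div (x := X) (by positivity) hδ
  have h4 : 1 ≤ (X : ℝ) ^ δ := Real.one_le_rpow (by exact_mod_cast (by omega : 1 ≤ X)) hδ.le
  push_cast
  calc (Nat.log 2 X : ℝ) + 1 ≤ 2 * ((X : ℝ) ^ δ / δ) + (X : ℝ) ^ δ := by linarith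
    _ = _ := by ring

theorem good_count (ε : ℝ) (hε : 0 < ε) : ∃ C : ℝ, 1 ≤ C ∧ ∀ X : ℕ, 2 ≤ X → ∀ F : Finset Dat,
    (∀ x ∈ F, Good X x) → (F.card : ℝ) ≤ C * (X : ℝ) ^ (38 / 29 + ε : ℝ) := by
  obtain ⟨C1, hC1, h1⟩ := divisor_bound (ε / 16) (by positivity)
  obtain ⟨C2, hC2, h2⟩ := natlog_le (δ := ε / 160) (by positivity)
  refine ⟨10 ^ 18 * C1 ^ 4 * C2 ^ 80, ?_, ?_⟩
  · have := one_le_pow₀ (n := 4) hC1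
    have := one_le_pow₀ (n := 80) hC2
    have : 1 ≤ C1 ^ 4 * C2 ^ 80 := one_le_mul_of_one_le_of_one_le ‹_› ‹_›
    nlinarith
  intro X hX F hF
  have hX0 : (0 : ℝ) < X := by positivity
  have hX1 : (1 : ℝ) ≤ X := by exact_mod_cast (by omega : 1 ≤ X)
  have hT := h1 (X ^ 2) (Nat.one_le_pow _ _ (by omega))
  have hT1 : 1 ≤ C1 * ((X ^ 2 : ℕ) : ℝ) ^ (ε / 16) :=
    one_le_mul_of_one_le_of_one_le hC1 (Real.one_le_rpow (by push_cast; exact one_le_pow₀ hX1) (by positivity))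
  have hTe : (C1 * ((X ^ 2 : ℕ) : ℝ) ^ (ε / 16)) ^ 4 = C1 ^ 4 * (X : ℝ) ^ (ε / 2) := by
    rw [mul_pow]; congr 1
    push_cast
    rw [← Real.rpow_natCast (X : ℝ) 2, ← Real.rpow_mul hX0.le, ← Real.rpow_natCast _ 4, ← Real.rpow_mul hX0.le]
    congr 1; push_cast; ring
  have key := good_class_card (X := X) (B := 10 ^ 18 * (C1 * ((X ^ 2 : ℕ) : ℝ) ^ (ε / 16)) ^ 4 * (X : ℝ) ^ (38 / 29 : ℝ))
    (by positivity) (fun c F h => class_bound hX hT hT1 h) F hF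
  refine key.trans ?_
  have h3 : (((Nat.log 2 X + 1 : ℕ) : ℝ)) ^ 80 ≤ C2 ^ 80 * (X : ℝ) ^ (ε / 2) := by
    calc (((Nat.log 2 X + 1 : ℕ) : ℝ)) ^ 80 ≤ (C2 * (X : ℝ) ^ (ε / 160)) ^ 80 := by
          gcongr; exact h2 X hX
      _ = _ := by
        rw [mul_pow]; congr 1
        rw [← Real.rpow_natCast _ 80, ← Real.rpow_mul hX0.le]
        congr 1; push_cast; ring
  rw [hTe]
  calc _ ≤ 10 ^ 18 * (C1 ^ 4 * (X : ℝ) ^ (ε / 2)) * (X : ℝ) ^ (38 / 29 : ℝ) * (C2 ^ 80 * (X : ℝ) ^ (ε / 2)) := by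
        gcongr
    _ = 10 ^ 18 * C1 ^ 4 * C2 ^ 80 * ((X : ℝ) ^ (38 / 29 : ℝ) * (X : ℝ) ^ (ε / 2) * (X : ℝ) ^ (ε / 2)) := by ring
    _ = _ := by
      rw [← Real.rpow_add hX0, ← Real.rpow_add hX0]
      congr 2; ring

/-! ### Structure of concyclic quadruples -/

structure Nice (D : Fin 4 → Fin 4 → GaussianInt) : Prop where
  tri : ∀ i j k, D i j + D j k + D k i = 0
  conc : ∀ i j k l, D4 i j k l → (D i j * D k l * star (D i k * D j l)).im = 0
  ncol : ∀ i j k l, D4 i j k l → (D i j * star (D j k)).im ≠ 0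
  ntrap : ∀ i j k l, D4 i j k l → gn (D i j) ≠ gn (D k l)
  nbis : ∀ i j k l, D4 i j k l → gn (D i k * D i l) ≠ gn (D j k * D j l)

lemma gint_content {z : 𝔾} (hz : z ≠ 0) : ∃ (m : ℤ) (e : 𝔾), z = m * e ∧ IsCoprime e.re e.im := by
  have hg : 0 < Int.gcd z.re z.im := by
    rw [Int.gcd_pos_iff]
    by_contra h
    push Not at h
    exact hz (by ext <;> simp [h.1, h.2])
  obtain ⟨g, a, b, h1, h2, h3, h4⟩ := Int.exists_gcd_one' hg
  refine ⟨g, ⟨a, b⟩, ?_, Int.isCoprime_iff_gcd_eq_one.mpr h2⟩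
  ext <;> simp [h3, h4] <;> ring

lemma two_real {P R : 𝔾} (hP : P ≠ 0) (_hR : R ≠ 0) (hc : IsCoprime P R) (h : (P * star R).im = 0) :
    (P.im = 0 ∧ R.im = 0) ∨ (P.re = 0 ∧ R.re = 0) := by
  have e : P * star R = R * star P := by
    have h1 : star (P * star R) = P * star R := by
      ext
      · simp
      · rw [Zsqrtd.im_star, h, neg_zero]
    rw [← h1]; simp [mul_comm]
  have d : P ∣ star P := hc.dvd_of_dvd_mul_left ⟨star R, e.symm⟩
  obtain ⟨w, hw⟩ := d
  have hw1 : gn w = 1 := by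
    have h1 := congrArg gn hw
    rw [gn_star, gn_mul] at h1
    have := gn_pos hP
    nlinarith
  have hRw : star R = R * w := by
    apply mul_left_cancel₀ hP
    rw [e, hw]; ring
  have hw2 := gn_int w
  rw [hw1] at hw2
  push_cast at hw2
  have a1 := congrArg Zsqrtd.re hw
  have a2 := congrArg Zsqrtd.im hw
  have b1 := congrArg Zsqrtd.re hRw
  have b2 := congrArg Zsqrtd.im hRw
  simp only [Zsqrtd.re_star, Zsqrtd.im_star, Zsqrtd.re_mul, Zsqrtd.im_mul] at a1 a2 b1 b2
  have r1 : w.re ≤ 1 := by nlinarith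
  have r2 : -1 ≤ w.re := by nlinarith
  have i1 : w.im ≤ 1 := by nlinarith
  have i2 : -1 ≤ w.im := by nlinarith
  generalize w.re = x at *
  generalize w.im = y at *
  have nd : ¬ ((∃ s, P.re = s ∧ P.im = s ∧ R.re = R.im) ∨ (∃ s, P.re = s ∧ P.im = -s ∧ R.re = - R.im)) := by
    rintro (⟨s, h1, h2, h3⟩ | ⟨s, h1, h2, h3⟩)
    · have : IsUnit (⟨1, 1⟩ : 𝔾) := hc.isUnit_of_dvd' ⟨(s : 𝔾), by ext <;> simp [h1, h2]⟩
        ⟨(R.re : 𝔾), by ext <;> simp [h3]⟩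
      have := gn_unit this
      revert this; decide
    · have : IsUnit (⟨1, -1⟩ : 𝔾) := hc.isUnit_of_dvd' ⟨(s : 𝔾), by ext <;> simp [h1, h2]⟩
        ⟨(R.re : 𝔾), by ext <;> simp [h3]⟩
      have := gn_unit this
      revert this; decide
  interval_cases x <;> interval_cases y <;> first | omega | (exfalso; apply nd; simp at a1 a2 b1 b2; first | (left; exact ⟨P.re, rfl, by omega, by omega⟩) | (right; exact ⟨P.re, rfl, by omega, by omega⟩))

lemma D4_ind (A : Fin 4 → Fin 4 → Fin 4 → Fin 4 → Prop)
    (h12 : ∀ i j k l, D4 i j k l → A i j k l → A j i k l)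
    (h23 : ∀ i j k l, D4 i j k l → A i j k l → A i k j l)
    (h34 : ∀ i j k l, D4 i j k l → A i j k l → A i j l k)
    (h0 : A 0 1 2 3) (i j k l : Fin 4) (hd : D4 i j k l) : A i j k l := by
  have st : ∀ i j k l, D4 i j k l → (A i j k l ↔ A j i k l) := fun i j k l h =>
    ⟨h12 i j k l h, h12 j i k l h.swap12⟩
  have st2 : ∀ i j k l, D4 i j k l → (A i j k l ↔ A i k j l) := fun i j k l h =>
    ⟨h23 i j k l h, h23 i k j l h.swap23⟩
  have st3 : ∀ i j k l, D4 i j k l → (A i j k l ↔ A i j l k) := fun i j k l h =>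
    ⟨h34 i j k l h, h34 i j l k h.swap34⟩
  -- move `0` to the front, then `1` to the second place
  suffices H : ∀ j k l, D4 0 j k l → A 0 j k l by
    rcases hd.cases 0 with rfl | rfl | rfl | rfl
    · exact H _ _ _ hd
    · exact h12 _ _ _ _ hd.swap12 (H _ _ _ hd.swap12)
    · exact h23 _ _ _ _ hd.swap23 (h12 _ _ _ _ hd.swap23.swap12 (H _ _ _ hd.swap23.swap12))
    · exact h34 _ _ _ _ hd.swap34 (h23 _ _ _ _ hd.swap34.swap23 (h12 _ _ _ _ hd.swap34.swap23.swap12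
        (H _ _ _ hd.swap34.swap23.swap12)))
  suffices H : ∀ k l, D4 0 1 k l → A 0 1 k l by
    intro j k l hd
    rcases hd.cases 1 with h | rfl | rfl | rfl
    · exact absurd h (by decide)
    · exact H _ _ hd
    · exact h23 _ _ _ _ hd.swap23 (H _ _ hd.swap23)
    · exact h34 _ _ _ _ hd.swap34 (h23 _ _ _ _ hd.swap34.swap23 (H _ _ hd.swap34.swap23))
  intro k l hd
  rcases hd.cases 2 with h | h | rfl | rfl
  · exact absurd h (by decide)
  · exact absurd h (by decide)
  · have : l = 3 := by revert l; decide
    subst this; exact h0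
  · have : k = 3 := by revert k; decide
    subst this; exact h34 _ _ _ _ (by decide) h0

/-- existence of `γ` and the `h`, `p` factors -/
lemma struct_hp {D : Fin 4 → Fin 4 → 𝔾} (hD : Nice D) : ∃ (γ : 𝔾) (h : Fin 4 → 𝔾) (p : Fin 4 → Fin 4 → 𝔾),
    γ ≠ 0 ∧ (∀ i, h i ≠ 0) ∧ (∀ i j k l, D4 i j k l → D i j = γ * (h k * h l * p i j)) ∧
    (∀ i j k l, D4 i j k l → IsCoprime (h k * p i j) (h i * p j k)) := by
  have hdiag : ∀ i, D i i = 0 := by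
    intro i
    have := hD.tri i i i
    have h3 : (3 : 𝔾) * D i i = 0 := by linear_combination this
    rcases mul_eq_zero.mp h3 with h | h
    · exact absurd h (by decide)
    · exact h
  have hanti : ∀ i j, D i j = - D j i := by
    intro i j
    have := hD.tri i j i
    rw [hdiag i] at this
    linear_combination this
  have hne : ∀ i j, i ≠ j → D i j ≠ 0 := by
    intro i j h h0
    obtain ⟨k, l, hd⟩ := D4.exists_of_ne h
    apply hD.ncol i j k l hd
    rw [h0]; simp
  -- the overall gcd
  obtain ⟨γ, hγ⟩ : ∃ γ, ∀ d, d ∣ γ ↔ ∀ i j, d ∣ D i j := by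
    refine ⟨EuclideanDomain.gcd (D 0 1) (EuclideanDomain.gcd (D 0 2) (D 0 3)), fun d => ⟨?_, ?_⟩⟩
    · intro h
      have h1 := h.trans (EuclideanDomain.gcd_dvd_left _ _)
      have h2 := (h.trans (EuclideanDomain.gcd_dvd_right _ _)).trans (EuclideanDomain.gcd_dvd_left _ _)
      have h3 := (h.trans (EuclideanDomain.gcd_dvd_right _ _)).trans (EuclideanDomain.gcd_dvd_right _ _)
      have hz : ∀ i, d ∣ D 0 i := by
        intro i; fin_cases i
        · simp only [Fin.zero_eta, hdiag]; exact dvd_zero _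
        · exact h1
        · exact h2
        · exact h3
      intro i j
      have : D i j = D 0 j - D 0 i := by linear_combination hD.tri i j 0 - hanti j 0 - hanti 0 i + hanti i 0 + hanti 0 i - hanti i 0
      rw [this]; exact dvd_sub (hz j) (hz i)
    · intro h
      exact EuclideanDomain.dvd_gcd (h 0 1) (EuclideanDomain.dvd_gcd (h 0 2) (h 0 3))
  have hγd : ∀ i j, γ ∣ D i j := (hγ γ).mp dvd_rfl
  have hγ0 : γ ≠ 0 := by
    rintro rfl
    exact hne 0 1 (by decide) (zero_dvd_iff.mp (hγd 0 1))
  choose D' hD' using hγd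
  have htri' : ∀ i j k, D' i j + D' j k + D' k i = 0 := by
    intro i j k
    apply mul_left_cancel₀ hγ0
    have := hD.tri i j k
    rw [hD' i j, hD' j k, hD' k i] at this
    linear_combination this
  have hanti' : ∀ i j, D' i j = - D' j i := by
    intro i j
    apply mul_left_cancel₀ hγ0
    have := hanti i j
    rw [hD' i j, hD' j i] at this
    linear_combination this
  have hne' : ∀ i j, i ≠ j → D' i j ≠ 0 := fun i j h h0 => hne i j h (by rw [hD', h0, mul_zero])
  have hdiag' : ∀ i, D' i i = 0 := by
    intro i
    apply mul_left_cancel₀ hγ0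
    rw [← hD', hdiag, mul_zero]
  have hunit : ∀ d, (∀ i j, d ∣ D' i j) → IsUnit d := by
    intro d hd
    have h1 : γ * d ∣ γ := (hγ _).mpr fun i j => by rw [hD']; exact mul_dvd_mul_left γ (hd i j)
    rw [← mul_one γ, mul_assoc, one_mul] at h1
    exact isUnit_of_dvd_one ((mul_dvd_mul_iff_left hγ0).mp h1)
  -- triangle gcds
  have htrigcd : ∀ i j k l, D4 i j k l → ∀ d, d ∣ D' i j → d ∣ D' j k → ∀ a b, a ≠ l → b ≠ l → d ∣ D' a b := by
    intro i j k l hd d h1 h2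
    have h3 : d ∣ D' i k := by
      have : D' i k = D' i j + D' j k := by linear_combination hanti' i k - htri' i j k
      rw [this]; exact dvd_add h1 h2
    have hi : ∀ a, a ≠ l → d ∣ D' i a := by
      intro a ha
      rcases hd.cases a with rfl | rfl | rfl | rfl
      · rw [hdiag']; exact dvd_zero _
      · exact h1
      · exact h3
      · exact absurd rfl ha
    intro a b ha hb
    have : D' a b = D' i b - D' i a := by linear_combination htri' a b i - hanti' b i
    rw [this]; exact dvd_sub (hi b hb) (hi a ha)
  have hex : ∀ l, ∃ h, ∀ d, d ∣ h ↔ ∀ a b, a ≠ l → b ≠ l → d ∣ D' a b := by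
    intro l
    obtain ⟨k, hk⟩ : ∃ k : Fin 4, l ≠ k := by revert l; decide
    obtain ⟨i, j, hd⟩ := D4.exists_of_ne hk
    refine ⟨EuclideanDomain.gcd (D' i j) (D' j k), fun d => ⟨?_, ?_⟩⟩
    · intro h
      exact htrigcd i j k l hd.opp.swap34 d (h.trans (EuclideanDomain.gcd_dvd_left _ _))
        (h.trans (EuclideanDomain.gcd_dvd_right _ _))
    · intro h
      exact EuclideanDomain.dvd_gcd (h _ _ hd.ik.symm hd.il.symm) (h _ _ hd.il.symm hd.ij.symm)
  choose h hh using hex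
  have hhd : ∀ l a b, a ≠ l → b ≠ l → h l ∣ D' a b := fun l => (hh l (h l)).mp dvd_rfl
  have hh0 : ∀ i, h i ≠ 0 := by
    intro l h0
    obtain ⟨k, hk⟩ := exists_ne l
    obtain ⟨i, j, hd⟩ := D4.exists_of_ne hk.symm
    have := hhd l i j hd.ik.symm hd.il.symm
    rw [h0, zero_dvd_iff] at this
    exact hne' i j hd.kl this
  have hcop : ∀ k l, k ≠ l → IsCoprime (h k) (h l) := by
    intro k l hkl
    obtain ⟨i, j, hd⟩ := D4.exists_of_ne hkl
    rw [← EuclideanDomain.gcd_isUnit_iff]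
    apply hunit
    set d := EuclideanDomain.gcd (h k) (h l)
    have dk : ∀ a b, a ≠ k → b ≠ k → d ∣ D' a b := (hh k d).mp (EuclideanDomain.gcd_dvd_left _ _)
    have dl : ∀ a b, a ≠ l → b ≠ l → d ∣ D' a b := (hh l d).mp (EuclideanDomain.gcd_dvd_right _ _)
    have hi : ∀ a, d ∣ D' i a := by
      intro a
      by_cases ha : a = k
      · exact dl i a hd.jk.symm (by rw [ha]; exact hkl)
      · exact dk i a hd.ik.symm ha
    intro a b
    have : D' a b = D' i b - D' i a := by linear_combination htri' a b i - hanti' b i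
    rw [this]; exact dvd_sub (hi b) (hi a)
  have hpex : ∀ i j, ∃ p, ∀ k l, D4 i j k l → D' i j = h k * h l * p := by
    intro i j
    by_cases hij : i = j
    · exact ⟨0, fun k l hd => absurd hij hd.ij⟩
    obtain ⟨k, l, hd⟩ := D4.exists_of_ne hij
    obtain ⟨p, hp⟩ := (hcop k l hd.kl).mul_dvd (hhd k i j hd.ik hd.jk) (hhd l i j hd.il hd.jl)
    refine ⟨p, fun k' l' hd' => ?_⟩
    rcases D4.two hd hd' with ⟨rfl, rfl⟩ | ⟨rfl, rfl⟩
    · exact hp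
    · rw [hp]; ring
  choose p hp using hpex
  refine ⟨γ, h, p, hγ0, hh0, fun i j k l hd => by rw [hD', hp i j k l hd], ?_⟩
  intro i j k l hd
  rw [← EuclideanDomain.gcd_isUnit_iff]
  set d := EuclideanDomain.gcd (h k * p i j) (h i * p j k) with hdd
  have e1 : h l * d ∣ D' i j := by
    rw [hp i j k l hd, show h k * h l * p i j = h l * (h k * p i j) by ring]
    exact mul_dvd_mul_left _ (EuclideanDomain.gcd_dvd_left _ _)
  have e2 : h l * d ∣ D' j k := by
    rw [hp j k i l (hd.rot.swap34), show h i * h l * p j k = h l * (h i * p j k) by ring]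
    exact mul_dvd_mul_left _ (EuclideanDomain.gcd_dvd_right _ _)
  have e3 : h l * d ∣ h l * 1 := by
    rw [mul_one]
    exact (hh l _).mpr (htrigcd i j k l hd _ e1 e2)
  exact isUnit_of_dvd_one ((mul_dvd_mul_iff_left (hh0 l)).mp e3)

lemma third_eq {j k l : Fin 4} (h : D4 0 j k l) : 2 - k - l = j := by revert j k l; decide

lemma star_mul_self_unit {u : 𝔾} (hu : IsUnit u) : u * star u = 1 := by
  rw [gint_mul_star, gn_unit hu]; simp

lemma prim_star_unit {u e : 𝔾} (hu : u = 1 ∨ u = ⟨0, 1⟩) (he : IsCoprime e.re e.im) :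
    IsCoprime (u * star e).re (u * star e).im := by
  rcases hu with rfl | rfl
  · simpa using he.neg_right
  · simpa using he.symm

lemma im_cancel {n : ℤ} {z : 𝔾} (hn : n ≠ 0) (h : ((n : 𝔾) * z).im = 0) : z.im = 0 := by
  simpa [hn] using h

theorem structure_lemma {D : Fin 4 → Fin 4 → 𝔾} (hD : Nice D) : ∃ (γ : 𝔾) (x : Dat), γ ≠ 0 ∧
    (∀ i j k l, D4 i j k l → D i j = γ * (x.h k * x.h l * x.p i j)) ∧
    ∀ X, (∀ i j, gn (D i j) ≤ gn γ * X) → Good X x := by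
  obtain ⟨γ, h, p, hγ, hh, hp, hcop⟩ := struct_hp hD
  have hne : ∀ i j, i ≠ j → D i j ≠ 0 := by
    intro i j h h0
    obtain ⟨k, l, hd⟩ := D4.exists_of_ne h
    apply hD.ncol i j k l hd
    rw [h0]; simp
  have hpne : ∀ i j, i ≠ j → p i j ≠ 0 := by
    intro i j hij h0
    obtain ⟨k, l, hd⟩ := D4.exists_of_ne hij
    apply hne i j hij
    rw [hp i j k l hd, h0]; simp
  have hDanti : ∀ i j, D i j = - D j i := by
    intro i j
    have h1 := hD.tri i i i
    have h3 : (3 : 𝔾) * D i i = 0 := by linear_combination h1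
    have h4 : D i i = 0 := by
      rcases mul_eq_zero.mp h3 with h | h
      · exact absurd h (by decide)
      · exact h
    linear_combination hD.tri i j i - h4
  have hpanti : ∀ i j, i ≠ j → p i j = - p j i := by
    intro i j hij
    obtain ⟨k, l, hd⟩ := D4.exists_of_ne hij
    have h1 := hp i j k l hd
    have h2 := hp j i k l hd.swap12
    rw [hDanti i j, h2] at h1
    have h3 : γ * (h k * h l) * p i j = γ * (h k * h l) * (- p j i) := by linear_combination -h1
    exact mul_left_cancel₀ (mul_ne_zero hγ (mul_ne_zero (hh k) (hh l))) h3
  have hcpp : ∀ i j k l, D4 i j k l → IsCoprime (p i j) (p j k) := fun i j k l hd =>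
    (hcop i j k l hd).of_mul_left_right.of_mul_right_right
  have hcross : ∀ i j k l, D4 i j k l → (p i j * p k l * star (p i k * p j l)).im = 0 := by
    intro i j k l hd
    have h1 := hD.conc i j k l hd
    rw [hp i j k l hd, hp k l i j hd.opp, hp i k j l hd.swap23, hp j l i k hd.swap23.opp] at h1
    set G := γ * γ * (h i * h j * h k * h l) with hG
    have h2 : γ * (h k * h l * p i j) * (γ * (h i * h j * p k l)) *
        star (γ * (h j * h l * p i k) * (γ * (h i * h k * p j l))) =
        ((gn G : ℤ) : 𝔾) * (p i j * p k l * star (p i k * p j l)) := by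
      rw [← gint_mul_star, hG]
      simp only [star_mul']
      ring
    rw [h2] at h1
    apply im_cancel _ h1
    have : 1 ≤ gn G := by
      apply gn_pos
      simp [hG, hγ, hh]
    omega
  have hswap : ∀ i j k l, D4 i j k l →
      ((p i j * p k l).im = 0 ∧ (p i k * p j l).im = 0) ∨ ((p i j * p k l).re = 0 ∧ (p i k * p j l).re = 0) := by
    intro i j k l hd
    apply two_real (mul_ne_zero (hpne _ _ hd.ij) (hpne _ _ hd.kl)) (mul_ne_zero (hpne _ _ hd.ik) (hpne _ _ hd.jl)) _
      (hcross i j k l hd)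
    have c1 : IsCoprime (p i j) (p i k) := by
      rw [hpanti i j hd.ij]; exact (hcpp j i k l hd.swap12).neg_left
    have c2 : IsCoprime (p i j) (p j l) := hcpp i j l k hd.swap34
    have c3 : IsCoprime (p k l) (p i k) := (hcpp i k l j hd.swap23.swap34).symm
    have c4 : IsCoprime (p k l) (p j l) := by
      rw [hpanti j l hd.jl]
      exact (hcpp k l j i hd.opp.swap34).neg_right
    exact (c1.mul_right c2).mul_left (c3.mul_right c4)
  have im_re : ∀ i j k l, D4 i j k l → (p i j * p k l).im = 0 → (p i j * p k l).re ≠ 0 := by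
    intro i j k l hd h1 h2
    exact mul_ne_zero (hpne _ _ hd.ij) (hpne _ _ hd.kl) (by ext <;> simp only [h1, h2] <;> rfl)
  obtain ⟨u, hu, hu2⟩ : ∃ u : 𝔾, (u = 1 ∨ u = ⟨0, 1⟩) ∧ ∀ i j k l, D4 i j k l → (star u * (p i j * p k l)).im = 0 := by
    rcases hswap 0 1 2 3 (by decide) with ⟨h1, -⟩ | ⟨h1, -⟩
    · refine ⟨1, Or.inl rfl, ?_⟩
      simp only [star_one, one_mul]
      apply D4_ind (fun i j k l => (p i j * p k l).im = 0) _ _ _ h1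
      · intro i j k l hd h; rw [hpanti j i hd.ij.symm, neg_mul, Zsqrtd.im_neg, h, neg_zero]
      · intro i j k l hd h
        rcases hswap i j k l hd with h' | h'
        · exact h'.2
        · exact absurd h'.1 (im_re i j k l hd h)
      · intro i j k l hd h; rw [hpanti l k hd.kl.symm, mul_neg, Zsqrtd.im_neg, h, neg_zero]
    · refine ⟨⟨0, 1⟩, Or.inr rfl, ?_⟩
      have e : ∀ z : 𝔾, (star (⟨0, 1⟩ : 𝔾) * z).im = - z.re := by intro z; simp
      simp only [e, neg_eq_zero]
      apply D4_ind (fun i j k l => (p i j * p k l).re = 0) _ _ _ h1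
      · intro i j k l hd h; rw [hpanti j i hd.ij.symm, neg_mul, Zsqrtd.re_neg, h, neg_zero]
      · intro i j k l hd h
        rcases hswap i j k l hd with h' | h'
        · exact absurd h (im_re i j k l hd h'.1)
        · exact h'.2
      · intro i j k l hd h; rw [hpanti l k hd.kl.symm, mul_neg, Zsqrtd.re_neg, h, neg_zero]
  have huu : IsUnit u := by
    rcases hu with rfl | rfl
    · exact isUnit_one
    · exact IsUnit.of_mul_eq_one (⟨0, -1⟩ : 𝔾) (by decide)
  have hus := star_mul_self_unit huu
  -- primitive parts at `0`
  have hEex : ∀ j, ∃ (m : ℤ) (e : 𝔾), j ≠ 0 → p 0 j = m * e ∧ IsCoprime e.re e.im := by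
    intro j
    by_cases hj : j = 0
    · exact ⟨0, 0, fun h => absurd hj h⟩
    · obtain ⟨m, e, h1⟩ := gint_content (hpne 0 j (Ne.symm hj))
      exact ⟨m, e, fun _ => h1⟩
  choose m0 E hE using hEex
  set e : Fin 4 → Fin 4 → 𝔾 := fun i j => if i = j then 0 else if i = 0 then E j else if j = 0 then E i
    else u * star (E (2 - i - j)) with he
  have e_diag : ∀ i, e i i = 0 := by intro i; simp [he]
  have e0 : ∀ j, j ≠ 0 → e 0 j = E j := by intro j hj; simp [he, hj.symm]
  have e1 : ∀ j, j ≠ 0 → e j 0 = E j := by intro j hj; simp [he, hj]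
  have e2 : ∀ j k l, D4 0 j k l → e k l = u * star (E j) := by
    intro j k l hd
    simp [he, hd.kl, hd.ik.symm, hd.il.symm, third_eq hd]
  have esym : ∀ i j, e i j = e j i := by
    intro i j
    by_cases hij : i = j
    · rw [hij]
    by_cases hi : i = 0
    · subst hi; rw [e0 j (Ne.symm hij), e1 j (Ne.symm hij)]
    by_cases hj : j = 0
    · subst hj; rw [e0 i hij, e1 i hij]
    have : (2 : Fin 4) - i - j = 2 - j - i := by revert i j; decide
    simp [he, hij, Ne.symm hij, hi, hj, this]
  have econj : ∀ i j k l, D4 i j k l → e k l = u * star (e i j) := by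
    intro i j k l hd
    rcases hd.cases 0 with rfl | rfl | rfl | rfl
    · rw [e0 j hd.ij.symm, e2 j k l hd]
    · rw [e1 i hd.ij, e2 i k l hd.swap12]
    · rw [e0 l hd.kl.symm, e2 l i j (hd.opp)]
      simp only [star_mul', star_star]; rw [← mul_assoc, hus, one_mul]
    · rw [e1 k hd.kl, e2 k i j (hd.opp.swap12)]
      simp only [star_mul', star_star]; rw [← mul_assoc, hus, one_mul]
  have eprim : ∀ i j, i ≠ j → IsCoprime (e i j).re (e i j).im := by
    intro i j hij
    obtain ⟨k, l, hd⟩ := D4.exists_of_ne hij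
    rcases hd.cases 0 with rfl | rfl | rfl | rfl
    · rw [e0 j hd.ij.symm]; exact (hE j hd.ij.symm).2
    · rw [e1 i hd.ij]; exact (hE i hd.ij).2
    · rw [e2 l i j hd.opp]; exact prim_star_unit hu (hE l hd.kl.symm).2
    · rw [e2 k i j hd.opp.swap12]; exact prim_star_unit hu (hE k hd.kl).2
  have hmul : ∀ i j k l, D4 i j k l → ∀ (m : ℤ), p i j = m * e i j → ∃ m' : ℤ, p k l = m' * e k l := by
    intro i j k l hd m hm
    obtain ⟨m', f, hf, hfp⟩ := gint_content (hpne k l hd.kl)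
    have h1 := hu2 i j k l hd
    rw [hm, hf, show star u * (m * e i j * (m' * f)) = ((m * m' : ℤ) : 𝔾) * (star u * e i j * f) by push_cast; ring] at h1
    have hm0 : m ≠ 0 := by rintro rfl; exact hpne i j hd.ij (by rw [hm]; simp)
    have hm0' : m' ≠ 0 := by rintro rfl; exact hpne k l hd.kl (by rw [hf]; simp)
    have h2 := im_cancel (mul_ne_zero hm0 hm0') h1
    have h3 : f = e k l ∨ f = - e k l := by
      apply prim_par (eprim k l hd.kl) hfp
      rw [econj i j k l hd]
      have h5 : star (u * star (e i j)) * f = star u * e i j * f := by simp [star_mul']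
      rw [← h5] at h2
      simp only [Zsqrtd.im_mul, Zsqrtd.re_star, Zsqrtd.im_star] at h2 ⊢
      linear_combination h2
    rcases h3 with h3 | h3
    · exact ⟨m', by rw [hf, h3]⟩
    · exact ⟨-m', by rw [hf, h3]; push_cast; ring⟩
  have hmex : ∀ i j, ∃ m : ℤ, (i ≠ j → p i j = m * e i j) ∧ (i = j → m = 0) := by
    intro i j
    by_cases hij : i = j
    · exact ⟨0, fun h => absurd hij h, fun _ => rfl⟩
    suffices ∃ m : ℤ, p i j = m * e i j by
      obtain ⟨m, hm⟩ := this
      exact ⟨m, fun _ => hm, fun h => absurd h hij⟩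
    have z1 : ∀ j, j ≠ 0 → p 0 j = m0 j * e 0 j := by
      intro j hj; rw [e0 j hj]; exact (hE j hj).1
    obtain ⟨k, l, hd⟩ := D4.exists_of_ne hij
    rcases hd.cases 0 with rfl | rfl | rfl | rfl
    · exact ⟨_, z1 j hd.ij.symm⟩
    · exact ⟨-m0 i, by rw [hpanti i 0 hd.ij, z1 i hd.ij, esym]; push_cast; ring⟩
    · exact hmul 0 l i j hd.opp _ (z1 l hd.kl.symm)
    · exact hmul 0 k i j hd.opp.swap12 _ (z1 k hd.kl)
  choose m hm hmd using hmex
  have ene : ∀ i j, i ≠ j → e i j ≠ 0 := by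
    intro i j hij h0
    exact hpne i j hij (by rw [hm i j hij, h0, mul_zero])
  set x : Dat := ⟨h, m, e, u⟩ with hx
  have xp : ∀ i j, i ≠ j → x.p i j = p i j := fun i j hij => (hm i j hij).symm
  have hp' : ∀ i j k l, D4 i j k l → D i j = γ * (h k * h l * x.p i j) := by
    intro i j k l hd; rw [xp i j hd.ij]; exact hp i j k l hd
  refine ⟨γ, x, hγ, hp', ?_⟩
  intro X hX
  refine ⟨hh, ?_, ene, fun i => hmd i i rfl, e_diag, ?_, esym, eprim, huu, econj, ?_, ?_, ?_, ?_, ?_, ?_⟩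
  · intro i j hij h0
    exact hpne i j hij (by rw [hm i j hij]; change m i j = 0 at h0; rw [h0]; simp)
  · intro i j
    change m i j = - m j i
    by_cases hij : i = j
    · rw [hmd i j hij, hmd j i hij.symm]; rfl
    have h1 := hpanti i j hij
    rw [hm i j hij, hm j i (Ne.symm hij), esym j i, ← neg_mul] at h1
    have h2 := mul_right_cancel₀ (ene i j hij) h1
    exact_mod_cast h2
  · intro i j k l hd
    have h1 := hD.tri i j k
    rw [hp' i j k l hd, hp' j k i l hd.rot.swap34, hp' k i j l hd.rot.swap34.rot.swap34] at h1
    apply mul_left_cancel₀ (mul_ne_zero hγ (hh l))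
    rw [mul_zero, ← h1]; simp only [hx]; ring
  · intro i j k l hd
    rw [xp i j hd.ij, xp j k hd.jk]; exact hcop i j k l hd
  · intro i j k l hd
    have h1 := hX i j
    rw [hp' i j k l hd, gn_mul, gn_mul, gn_mul] at h1
    exact Nat.le_of_mul_le_mul_left h1 (gn_pos hγ)
  · intro i j k l hd h0
    apply hD.ntrap i j k l hd
    rw [hp' i j k l hd, hp' k l i j hd.opp, gn_mul, gn_mul γ]
    change gn (h k * h l * x.p i j) = gn (h i * h j * x.p k l) at h0
    rw [h0]
  · intro i j k l hd h0
    apply hD.nbis i j k l hd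
    change gn (h j * h j * x.p i k * x.p i l) = gn (h i * h i * x.p j k * x.p j l) at h0
    rw [hp' i k j l hd.swap23, hp' i l j k hd.swap34.swap23, hp' j k i l hd.rot.swap34, hp' j l i k hd.swap23.opp]
    rw [show γ * (h j * h l * x.p i k) * (γ * (h j * h k * x.p i l)) = (γ * γ * (h k * h l)) * (h j * h j * x.p i k * x.p i l) by ring,
      show γ * (h i * h l * x.p j k) * (γ * (h i * h k * x.p j l)) = (γ * γ * (h k * h l)) * (h i * h i * x.p j k * x.p j l) by ring,
      gn_mul, gn_mul (γ * γ * (h k * h l)), h0]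
  · intro i j k l hd h0
    apply hD.ncol i j k l hd
    rw [hp' i j k l hd, hp' j k i l hd.rot.swap34]
    change (h k * x.p i j * star (h i * x.p j k)).im = 0 at h0
    have : γ * (h k * h l * x.p i j) * star (γ * (h i * h l * x.p j k)) =
        ((gn (γ * h l) : ℤ) : 𝔾) * (h k * x.p i j * star (h i * x.p j k)) := by
      rw [← gint_mul_star]; simp only [star_mul']; ring
    rw [this]
    generalize h k * x.p i j * star (h i * x.p j k) = w at h0
    simp [h0]

lemma sum_rpow_bdd : ∃ S : ℝ, 1 ≤ S ∧ ∀ (B : ℕ) (θ : ℝ), 38 / 29 ≤ θ →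
    ∑ k ∈ Finset.Icc 1 B, ((k : ℝ) ^ θ)⁻¹ ≤ S := by
  have hs : Summable (fun k : ℕ => ((k : ℝ) ^ (38 / 29 : ℝ))⁻¹) := Real.summable_nat_rpow_inv.mpr (by norm_num)
  refine ⟨1 + ∑' k : ℕ, ((k : ℝ) ^ (38 / 29 : ℝ))⁻¹, ?_, ?_⟩
  · have : 0 ≤ ∑' k : ℕ, ((k : ℝ) ^ (38 / 29 : ℝ))⁻¹ := tsum_nonneg fun k => by positivity
    linarith
  · intro B θ hθ
    calc ∑ k ∈ Finset.Icc 1 B, ((k : ℝ) ^ θ)⁻¹ ≤ ∑ k ∈ Finset.Icc 1 B, ((k : ℝ) ^ (38 / 29 : ℝ))⁻¹ := by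
          apply Finset.sum_le_sum
          intro k hk
          have hk1 : (1 : ℝ) ≤ k := by exact_mod_cast (Finset.mem_Icc.mp hk).1
          apply inv_anti₀ (by positivity)
          exact Real.rpow_le_rpow_of_exponent_le hk1 hθ
      _ ≤ ∑' k : ℕ, ((k : ℝ) ^ (38 / 29 : ℝ))⁻¹ := hs.sum_le_tsum _ (fun k _ => by positivity)
      _ ≤ _ := by linarith

theorem nice_count (ε : ℝ) (hε : 0 < ε) : ∃ C : ℝ, 1 ≤ C ∧ ∀ n : ℕ, 1 ≤ n →
    ∀ F : Finset (Fin 4 → Fin 4 → 𝔾), (∀ D ∈ F, Nice D ∧ ∀ i j, gn (D i j) ≤ 2 * n ^ 2) →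
      (F.card : ℝ) ≤ C * (n : ℝ) ^ (76 / 29 + ε : ℝ) := by
  classical
  obtain ⟨C1, hC1, h1⟩ := divisor_bound (ε / 16) (by positivity)
  obtain ⟨C2, hC2, h2⟩ := good_count (ε / 8) (by positivity)
  obtain ⟨S, hS, h3⟩ := sum_rpow_bdd
  set θ : ℝ := 38 / 29 + ε / 8 with hθ
  have hθ0 : 0 ≤ θ := by rw [hθ]; positivity
  refine ⟨(C1 * 4 ^ (ε / 16)) * (C2 * 4 ^ θ) * S, ?_, ?_⟩
  · have a1 : (1 : ℝ) ≤ 4 ^ (ε / 16) := Real.one_le_rpow (by norm_num) (by positivity)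
    have a2 : (1 : ℝ) ≤ 4 ^ θ := Real.one_le_rpow (by norm_num) hθ0
    exact one_le_mul_of_one_le_of_one_le (one_le_mul_of_one_le_of_one_le
      (one_le_mul_of_one_le_of_one_le hC1 a1) (one_le_mul_of_one_le_of_one_le hC2 a2)) hS
  intro n hn F hF
  have hn0 : (0 : ℝ) < n := by positivity
  set B := 2 * n ^ 2 with hB
  have hB1 : 1 ≤ B := by have := Nat.one_le_pow 2 n hn; omega
  have hst : ∀ D : Fin 4 → Fin 4 → 𝔾, ∃ (γ : 𝔾) (x : Dat), D ∈ F → γ ≠ 0 ∧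
    (∀ i j k l, D4 i j k l → D i j = γ * (x.h k * x.h l * x.p i j)) ∧
    ∀ X, (∀ i j, gn (D i j) ≤ gn γ * X) → Good X x := by
    intro D
    by_cases hD : D ∈ F
    · obtain ⟨γ, x, h⟩ := structure_lemma (hF D hD).1
      exact ⟨γ, x, fun _ => h⟩
    · exact ⟨0, ⟨0, 0, 0, 0⟩, fun h => absurd h hD⟩
  choose γ x hx using hst
  have hdiag : ∀ D ∈ F, ∀ i, D i i = 0 := by
    intro D hD i
    have h1 := (hF D hD).1.tri i i i
    have h3 : (3 : 𝔾) * D i i = 0 := by linear_combination h1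
    rcases mul_eq_zero.mp h3 with h | h
    · exact absurd h (by decide)
    · exact h
  have hγB : ∀ D ∈ F, gn (γ D) ∈ Finset.Icc 1 B := by
    intro D hD
    obtain ⟨g0, g1, -⟩ := hx D hD
    rw [Finset.mem_Icc]
    refine ⟨gn_pos g0, le_trans ?_ ((hF D hD).2 0 1)⟩
    have e := g1 0 1 2 3 (by decide)
    rw [e, gn_mul]
    apply Nat.le_mul_of_pos_right
    apply gn_pos
    intro h0
    rw [h0, mul_zero] at e
    apply (hF D hD).1.ncol 0 1 2 3 (by decide)
    rw [e]; simp
  have hT := h1 (B ^ 2) (Nat.one_le_pow _ _ hB1)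
  set T := C1 * ((B ^ 2 : ℕ) : ℝ) ^ (ε / 16) with hTd
  have hT0 : 0 ≤ T := by positivity
  have hper : ∀ k ∈ Finset.Icc 1 B, ((F.filter (fun D => gn (γ D) = k)).card : ℝ) ≤
      (C2 * (4 * (n : ℝ) ^ 2) ^ θ * T) * ((k : ℝ) ^ θ)⁻¹ := by
    intro k hk
    rw [Finset.mem_Icc] at hk
    have hk0 : (0 : ℝ) < k := by exact_mod_cast hk.1
    have hX2 : 2 ≤ B / k + 1 := by
      have := Nat.div_pos hk.2 hk.1
      omega
    have hcT : (((gball k).filter (fun z => gn z = k)).card : ℝ) ≤ T := by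
      apply hT (k : 𝔾) (by exact_mod_cast (by omega : k ≠ 0))
      · have := gn_intCast (k : ℤ)
        simp only [Int.cast_natCast, Int.natAbs_natCast] at this
        rw [this]; exact Nat.pow_le_pow_left hk.2 2
      · intro d hd
        rw [Finset.mem_filter] at hd
        refine ⟨star d, ?_⟩
        rw [gint_mul_star, hd.2]; simp
    have key := card_fib' (F.filter (fun D => gn (γ D) = k)) γ ((gball k).filter (fun z => gn z = k))
      (C2 * ((B / k + 1 : ℕ) : ℝ) ^ θ) (by positivity) ?_ ?_
    · have hle : ((B / k + 1 : ℕ) : ℝ) ≤ 4 * (n : ℝ) ^ 2 / k := by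
        have a1 : ((B / k : ℕ) : ℝ) ≤ (B : ℝ) / k := Nat.cast_div_le
        have a2 : (1 : ℝ) ≤ (B : ℝ) / k := by
          rw [le_div_iff₀ hk0, one_mul]; exact_mod_cast hk.2
        have a3 : (B : ℝ) = 2 * (n : ℝ) ^ 2 := by rw [hB]; push_cast; ring
        push_cast
        calc ((B / k : ℕ) : ℝ) + 1 ≤ (B : ℝ) / k + (B : ℝ) / k := add_le_add a1 a2
          _ = _ := by rw [a3]; ring
      calc _ ≤ _ := key
        _ ≤ C2 * (4 * (n : ℝ) ^ 2 / k) ^ θ * T := by gcongr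
        _ = _ := by rw [Real.div_rpow (by positivity) (by positivity)]; field_simp
    · intro D hD
      rw [Finset.mem_filter] at hD
      rw [Finset.mem_filter]
      exact ⟨mem_gball hD.2.le, hD.2⟩
    · intro D0 hD0
      rw [Finset.mem_filter] at hD0
      set G := ((F.filter (fun D => gn (γ D) = k)).filter (fun D => γ D = γ D0)) with hG
      have hGm : ∀ D ∈ G, D ∈ F ∧ gn (γ D) = k ∧ γ D = γ D0 := by
        intro D hD
        rw [hG, Finset.mem_filter, Finset.mem_filter] at hD
        exact ⟨hD.1.1, hD.1.2, hD.2⟩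
      have hinj : Set.InjOn x (G : Set (Fin 4 → Fin 4 → 𝔾)) := by
        intro D hD D' hD' e
        obtain ⟨f1, f2, f3⟩ := hGm D hD
        obtain ⟨f1', f2', f3'⟩ := hGm D' hD'
        funext i j
        by_cases hij : i = j
        · rw [hij, hdiag D f1, hdiag D' f1']
        · obtain ⟨a, b, hd⟩ := D4.exists_of_ne hij
          rw [(hx D f1).2.1 i j a b hd, (hx D' f1').2.1 i j a b hd, e, f3, f3']
      rw [← Finset.card_image_of_injOn hinj]
      apply h2 _ hX2
      intro y hy
      rw [Finset.mem_image] at hy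
      obtain ⟨D, hD, rfl⟩ := hy
      obtain ⟨f1, f2, f3⟩ := hGm D hD
      apply (hx D f1).2.2
      intro i j
      refine ((hF D f1).2 i j).trans ?_
      rw [f2]
      have := Nat.lt_mul_div_succ B hk.1
      exact this.le
  have hsum : (F.card : ℝ) ≤ (C2 * (4 * (n : ℝ) ^ 2) ^ θ * T) * S := by
    rw [Finset.card_eq_sum_card_fiberwise (f := fun D => gn (γ D)) (t := Finset.Icc 1 B) hγB]
    push_cast
    calc _ ≤ ∑ k ∈ Finset.Icc 1 B, (C2 * (4 * (n : ℝ) ^ 2) ^ θ * T) * ((k : ℝ) ^ θ)⁻¹ := Finset.sum_le_sum hper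
      _ = (C2 * (4 * (n : ℝ) ^ 2) ^ θ * T) * ∑ k ∈ Finset.Icc 1 B, ((k : ℝ) ^ θ)⁻¹ := by rw [Finset.mul_sum]
      _ ≤ _ := by
        gcongr
        exact h3 B θ (by rw [hθ]; linarith)
  refine hsum.trans ?_
  have e1 : (4 * (n : ℝ) ^ 2) ^ θ = 4 ^ θ * (n : ℝ) ^ (2 * θ) := by
    rw [Real.mul_rpow (by norm_num) (by positivity), ← Real.rpow_natCast _ 2, ← Real.rpow_mul hn0.le]
    norm_num
  have e2 : ((B ^ 2 : ℕ) : ℝ) ^ (ε / 16) = 4 ^ (ε / 16) * (n : ℝ) ^ (4 * (ε / 16)) := by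
    rw [hB]; push_cast
    rw [show (2 * (n : ℝ) ^ 2) ^ 2 = 4 * (n : ℝ) ^ 4 by ring, Real.mul_rpow (by norm_num) (by positivity),
      ← Real.rpow_natCast _ 4, ← Real.rpow_mul hn0.le]
    norm_num
  have e4 : (n : ℝ) ^ (2 * θ) * (n : ℝ) ^ (4 * (ε / 16)) ≤ (n : ℝ) ^ (76 / 29 + ε) := by
    rw [← Real.rpow_add hn0]
    apply Real.rpow_le_rpow_of_exponent_le (by exact_mod_cast hn)
    rw [hθ]; linarith
  rw [hTd, e1, e2]
  calc _ = (C1 * 4 ^ (ε / 16)) * (C2 * 4 ^ θ) * S * ((n : ℝ) ^ (2 * θ) * (n : ℝ) ^ (4 * (ε / 16))) := by ring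
    _ ≤ _ := by gcongr

/-! ### Monotone sums and line counts -/

lemma msum {F : ℝ → ℝ} (M : ℕ) (θ : ℝ) (h0 : 0 ≤ θ) (h1 : θ ≤ 1) (hF : AntitoneOn F (Set.Ici 0))
    (hn : ∀ x, 0 ≤ F x) : |∑ i ∈ range M, F (θ + i) - ∫ x in (0 : ℝ)..M, F x| ≤ F 0 := by
  have hA : AntitoneOn F (Set.Icc (0 : ℝ) (0 + M)) := hF.mono Set.Icc_subset_Ici_self
  have u1 := hA.sum_le_integral
  have u2 := hA.integral_le_sum
  simp only [zero_add] at u1 u2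
  have e1 : ∑ i ∈ range M, F (θ + i) ≤ ∑ i ∈ range M, F i := by
    apply Finset.sum_le_sum
    intro i _
    refine hF ?_ ?_ ?_
    · rw [Set.mem_Ici]; positivity
    · rw [Set.mem_Ici]; positivity
    · linarith
  have e2 : ∑ i ∈ range M, F ((i + 1 : ℕ) : ℝ) ≤ ∑ i ∈ range M, F (θ + i) := by
    apply Finset.sum_le_sum
    intro i _
    push_cast
    refine hF ?_ ?_ ?_
    · rw [Set.mem_Ici]; positivity
    · rw [Set.mem_Ici]; positivity
    · linarith
  have e3 : ∑ i ∈ range M, F ((i + 1 : ℕ) : ℝ) + F 0 = ∑ i ∈ range M, F i + F M := by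
    have := Finset.sum_range_succ' (fun i : ℕ => F i) M
    rw [Finset.sum_range_succ] at this
    simpa using this.symm
  have := hn M
  rw [abs_le]
  constructor <;> linarith

lemma interval_count (lo hi : ℝ) : |((Finset.Icc ⌈lo⌉ ⌊hi⌋).card : ℝ) - max 0 (hi - lo)| ≤ 1 := by
  rw [Int.card_Icc]
  have a1 := Int.floor_le hi
  have a2 := Int.lt_floor_add_one hi
  have a3 := Int.le_ceil lo
  have a4 := Int.ceil_lt_add_one lo
  by_cases h : 0 ≤ ⌊hi⌋ + 1 - ⌈lo⌉
  · have e : (((⌊hi⌋ + 1 - ⌈lo⌉).toNat : ℕ) : ℝ) = ⌊hi⌋ + 1 - ⌈lo⌉ := by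
      have : (((⌊hi⌋ + 1 - ⌈lo⌉).toNat : ℤ) : ℝ) = ((⌊hi⌋ + 1 - ⌈lo⌉ : ℤ) : ℝ) := by
        rw [Int.toNat_of_nonneg h]
      push_cast at this; exact this
    rw [e]
    have h' : (0 : ℝ) ≤ ⌊hi⌋ + 1 - ⌈lo⌉ := by exact_mod_cast h
    rcases max_cases 0 (hi - lo) with ⟨h1, h2⟩ | ⟨h1, h2⟩ <;> rw [h1, abs_le] <;> constructor <;> linarith
  · push Not at h
    rw [Int.toNat_of_nonpos h.le]
    have h' : (⌊hi⌋ + 1 - ⌈lo⌉ : ℝ) < 0 := by exact_mod_cast h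
    rcases max_cases 0 (hi - lo) with ⟨h1, h2⟩ | ⟨h1, h2⟩ <;> rw [h1, abs_le] <;> constructor <;> simp <;> linarith

/-- number of integer points of `[0,X] × [0,Y]` on the line `a x + b y = t` -/
lemma line_count (a b X Y t : ℤ) (ha : 0 < a) (hb : 0 < b) (hab : IsCoprime a b) :
    |((((Finset.Icc 0 X) ×ˢ (Finset.Icc 0 Y)).filter (fun v => a * v.1 + b * v.2 = t)).card : ℝ) -
      max 0 (min (min ((X : ℝ) / b) ((Y : ℝ) / a)) (min ((t : ℝ) / (a * b)) ((a * X + b * Y - t : ℝ) / (a * b))))| ≤ 1 := by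
  obtain ⟨u, v, huv⟩ := hab
  set x0 := u * t with hx0
  set y0 := v * t with hy0
  have h0 : a * x0 + b * y0 = t := by rw [hx0, hy0]; linear_combination t * huv
  set lo : ℝ := max (-(y0 : ℝ) / a) (((x0 : ℝ) - X) / b) with hlo
  set hi : ℝ := min (((Y : ℝ) - y0) / a) ((x0 : ℝ) / b) with hhi
  have ha' : (0 : ℝ) < a := by exact_mod_cast ha
  have hb' : (0 : ℝ) < b := by exact_mod_cast hb
  have hcard : (((Finset.Icc 0 X) ×ˢ (Finset.Icc 0 Y)).filter (fun v => a * v.1 + b * v.2 = t)).card =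
      (Finset.Icc ⌈lo⌉ ⌊hi⌋).card := by
    symm
    apply Finset.card_bij (fun k _ => (x0 - b * k, y0 + a * k))
    · intro k hk
      rw [Finset.mem_Icc, Int.ceil_le, Int.le_floor, hlo, hhi, max_le_iff, le_min_iff, div_le_iff₀ ha',
        div_le_iff₀ hb', le_div_iff₀ ha', le_div_iff₀ hb'] at hk
      obtain ⟨⟨k1, k2⟩, k3, k4⟩ := hk
      have k1' : -y0 ≤ k * a := by exact_mod_cast k1
      have k2' : x0 - X ≤ k * b := by exact_mod_cast k2
      have k3' : k * a ≤ Y - y0 := by exact_mod_cast k3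
      have k4' : k * b ≤ x0 := by exact_mod_cast k4
      simp only [Finset.mem_filter, Finset.mem_product, Finset.mem_Icc]
      refine ⟨⟨⟨by linarith, by linarith⟩, by linarith, by linarith⟩, ?_⟩
      linear_combination h0
    · intro k _ k' _ h
      simp only [Prod.mk.injEq] at h
      have : a * k = a * k' := by linarith [h.2]
      exact mul_left_cancel₀ ha.ne' this
    · rintro ⟨x, y⟩ hxy
      simp only [Finset.mem_filter, Finset.mem_product, Finset.mem_Icc] at hxy
      obtain ⟨⟨⟨x1, x2⟩, y1, y2⟩, h2⟩ := hxy
      have h3 : a * (x0 - x) = b * (y - y0) := by linarith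
      have h4 : a ∣ y - y0 := by
        have : IsCoprime a b := ⟨u, v, huv⟩
        exact this.dvd_of_dvd_mul_left ⟨_, h3.symm⟩
      obtain ⟨k, hk⟩ := h4
      have h5 : x0 - x = b * k := by
        apply mul_left_cancel₀ ha.ne'
        rw [h3, hk]; ring
      refine ⟨k, ?_, by ext <;> simp <;> linarith⟩
      rw [Finset.mem_Icc, Int.ceil_le, Int.le_floor, hlo, hhi, max_le_iff, le_min_iff, div_le_iff₀ ha',
        div_le_iff₀ hb', le_div_iff₀ ha', le_div_iff₀ hb']
      refine ⟨⟨?_, ?_⟩, ?_, ?_⟩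
      · exact_mod_cast (by linarith : -y0 ≤ k * a)
      · exact_mod_cast (by linarith : x0 - X ≤ k * b)
      · exact_mod_cast (by linarith : k * a ≤ Y - y0)
      · exact_mod_cast (by linarith : k * b ≤ x0)
  rw [hcard]
  have h0' : (a : ℝ) * x0 + b * y0 = t := by exact_mod_cast h0
  have : hi - lo = min (min ((X : ℝ) / b) ((Y : ℝ) / a)) (min ((t : ℝ) / (a * b)) ((a * X + b * Y - t : ℝ) / (a * b))) := by
    have e1 : (X : ℝ) / b = x0 / b - (x0 - X) / b := by ring
    have e2 : (Y : ℝ) / a = (Y - y0) / a - (-y0 / a) := by ring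
    have e3 : (t : ℝ) / (a * b) = x0 / b - (-y0 / a) := by rw [← h0']; field_simp; ring
    have e4 : (a * X + b * Y - t : ℝ) / (a * b) = (Y - y0) / a - (x0 - X) / b := by rw [← h0']; field_simp; ring
    rw [e1, e2, e3, e4, hlo, hhi]
    generalize ((Y : ℝ) - y0) / a = p1
    generalize (x0 : ℝ) / b = p2
    generalize -(y0 : ℝ) / a = q1
    generalize ((x0 : ℝ) - X) / b = q2
    grind
  rw [← this]
  exact interval_count lo hi

/-! ### The integrals giving the main term -/

lemma hasDerivAt_pp (k : ℕ) (hk : 1 ≤ k) (x : ℝ) :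
    HasDerivAt (fun x : ℝ => (max x 0) ^ (k + 1)) ((k + 1 : ℝ) * (max x 0) ^ k) x := by
  rcases lt_trichotomy x 0 with h | h | h
  · rw [max_eq_right h.le, zero_pow (by omega), mul_zero]
    apply (hasDerivAt_const x (0 : ℝ)).congr_of_eventuallyEq
    filter_upwards [Iio_mem_nhds h] with y hy
    rw [max_eq_right (le_of_lt hy), zero_pow (by omega)]
  · subst h
    rw [max_self, zero_pow (by omega), mul_zero, hasDerivAt_iff_isLittleO_nhds_zero]
    simp only [zero_add, max_self, smul_zero, sub_zero]
    rw [zero_pow (by omega : k + 1 ≠ 0)]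
    simp only [sub_zero]
    refine Asymptotics.IsBigO.trans_isLittleO ?_ (Asymptotics.isLittleO_pow_id (by omega : 1 < k + 1))
    apply Asymptotics.IsBigO.of_bound 1
    filter_upwards with y
    rw [one_mul, norm_pow, norm_pow]
    gcongr
    rw [Real.norm_eq_abs, Real.norm_eq_abs]
    rcases max_cases y 0 with ⟨e, _⟩ | ⟨e, _⟩ <;> rw [e] <;> simp
  · rw [max_eq_left h.le]
    have := hasDerivAt_pow (k + 1) x
    simp only [Nat.add_sub_cancel] at this
    push_cast at this
    apply this.congr_of_eventuallyEq
    filter_upwards [Ioi_mem_nhds h] with y hy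
    rw [max_eq_left (le_of_lt hy)]

lemma integral_pp (k : ℕ) (hk : 1 ≤ k) (α β T : ℝ) (hα : α ≠ 0) :
    ∫ j in (0 : ℝ)..T, (max (α * j + β) 0) ^ k =
      ((max (α * T + β) 0) ^ (k + 1) - (max β 0) ^ (k + 1)) / ((k + 1) * α) := by
  have hd : ∀ j ∈ Set.uIcc 0 T, HasDerivAt (fun j : ℝ => (max (α * j + β) 0) ^ (k + 1) / ((k + 1) * α))
      ((max (α * j + β) 0) ^ k) j := by
    intro j _
    have h1 : HasDerivAt (fun j : ℝ => α * j + β) α j := by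
      simpa using ((hasDerivAt_id j).const_mul α).add_const β
    have h2 := ((hasDerivAt_pp k hk (α * j + β)).comp j h1).div_const ((k + 1) * α)
    have h3 : (k + 1 : ℝ) ≠ 0 := by positivity
    have h4 : (k + 1 : ℝ) * (max (α * j + β) 0) ^ k * α / ((k + 1) * α) = (max (α * j + β) 0) ^ k := by
      field_simp
    rw [h4] at h2
    exact h2
  rw [intervalIntegral.integral_eq_sub_of_hasDerivAt hd]
  · simp only [mul_zero, zero_add]; ring
  · apply Continuous.intervalIntegrable; fun_prop

lemma integral_ppair (u v T : ℝ) (hu : 0 ≤ u) (huv : u ≤ v) (hT : u ≤ T) :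
    ∫ σ in (0 : ℝ)..T, (max (u - σ) 0) ^ 2 * (max (v - σ) 0) ^ 2 =
      u ^ 5 / 5 + (v - u) * u ^ 4 / 2 + (v - u) ^ 2 * u ^ 3 / 3 := by
  have e : ∀ σ : ℝ, (max (u - σ) 0) ^ 2 * (max (v - σ) 0) ^ 2 =
      (max ((-1) * σ + u) 0) ^ 4 + (2 * (v - u) * (max ((-1) * σ + u) 0) ^ 3 +
        (v - u) ^ 2 * (max ((-1) * σ + u) 0) ^ 2) := by
    intro σ
    rcases le_total u σ with h | h
    · rw [max_eq_right (by linarith : u - σ ≤ 0), max_eq_right (by linarith : -1 * σ + u ≤ 0)]; ring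
    · rw [max_eq_left (by linarith : 0 ≤ u - σ), max_eq_left (by linarith : 0 ≤ -1 * σ + u),
        max_eq_left (by linarith : 0 ≤ v - σ)]; ring
  simp_rw [e]
  rw [intervalIntegral.integral_add, intervalIntegral.integral_add, intervalIntegral.integral_const_mul,
    intervalIntegral.integral_const_mul, integral_pp 4 (by norm_num) _ _ _ (by norm_num),
    integral_pp 3 (by norm_num) _ _ _ (by norm_num), integral_pp 2 (by norm_num) _ _ _ (by norm_num),
    max_eq_right (by linarith : -1 * T + u ≤ 0), max_eq_left hu]
  · push_cast; ring
  all_goals apply Continuous.intervalIntegrable; fun_prop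

/-- length of the line segment; `m` box side, direction `(a,b)`, height `σ`, step `j` -/
noncomputable def Ln (m a b σ j : ℝ) : ℝ :=
  max 0 (min (min ((m - j * a) / b) ((m - j * b) / a)) ((m * (a + b) - |σ| - j * (a ^ 2 + b ^ 2)) / (2 * a * b)))

noncomputable def In (m a b σ : ℝ) : ℝ := ∫ j in (0 : ℝ)..(m / a), Ln m a b σ j

lemma Ln_nonneg (m a b σ j : ℝ) : 0 ≤ Ln m a b σ j := le_max_left _ _

lemma Ln_cont (m a b σ : ℝ) : Continuous (Ln m a b σ) := by
  unfold Ln; fun_prop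

lemma Ln_zero {m a b σ j : ℝ} (ha : 0 < a) (hb : 0 < b) (hj : m / a ≤ j) : Ln m a b σ j = 0 := by
  unfold Ln
  apply max_eq_left
  apply (min_le_left _ _).trans ((min_le_left _ _).trans _)
  rw [div_le_iff₀ ha] at hj
  exact div_nonpos_of_nonpos_of_nonneg (by linarith) hb.le

lemma Ln_anti_j {m a b : ℝ} (σ : ℝ) (ha : 0 < a) (hb : 0 < b) : Antitone (Ln m a b σ) := by
  intro j j' h
  unfold Ln
  gcongr

lemma Ln_anti_σ {m a b σ σ' : ℝ} (j : ℝ) (ha : 0 < a) (hb : 0 < b) (h : |σ| ≤ |σ'|) :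
    Ln m a b σ' j ≤ Ln m a b σ j := by
  unfold Ln
  gcongr

lemma Ln_le {m a b σ j : ℝ} (hm : 0 ≤ m) (ha : 0 < a) (hb : 0 < b) (hj : 0 ≤ j) : Ln m a b σ j ≤ m / a := by
  unfold Ln
  apply max_le (by positivity)
  apply (min_le_left _ _).trans ((min_le_right _ _).trans _)
  have : 0 ≤ j * b := by positivity
  gcongr
  linarith

lemma In_eq {m a b σ T : ℝ} (ha : 0 < a) (hb : 0 < b) (hT : m / a ≤ T) :
    ∫ j in (0 : ℝ)..T, Ln m a b σ j = In m a b σ := by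
  unfold In
  rw [← intervalIntegral.integral_add_adjacent_intervals (b := m / a)
    ((Ln_cont m a b σ).intervalIntegrable _ _) ((Ln_cont m a b σ).intervalIntegrable _ _)]
  have : ∫ j in (m / a)..T, Ln m a b σ j = ∫ j in (m / a)..T, (0 : ℝ) := by
    apply intervalIntegral.integral_congr
    intro j hj
    rw [Set.uIcc_of_le hT] at hj
    exact Ln_zero ha hb hj.1
  rw [this]; simp

lemma In_nonneg {m a b σ : ℝ} (hm : 0 ≤ m) (ha : 0 < a) : 0 ≤ In m a b σ :=
  intervalIntegral.integral_nonneg (by positivity) (fun _ _ => Ln_nonneg _ _ _ _ _)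

lemma In_anti {m a b σ σ' : ℝ} (hm : 0 ≤ m) (ha : 0 < a) (hb : 0 < b) (h : |σ| ≤ |σ'|) :
    In m a b σ' ≤ In m a b σ := by
  apply intervalIntegral.integral_mono_on (by positivity) ((Ln_cont _ _ _ _).intervalIntegrable _ _)
    ((Ln_cont _ _ _ _).intervalIntegrable _ _)
  intro j _
  exact Ln_anti_σ j ha hb h

lemma In_le {m a b σ : ℝ} (hm : 0 ≤ m) (ha : 0 < a) (hb : 0 < b) : In m a b σ ≤ (m / a) ^ 2 := by
  have h : In m a b σ ≤ ∫ j in (0 : ℝ)..(m / a), m / a := by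
    apply intervalIntegral.integral_mono_on (by positivity) ((Ln_cont _ _ _ _).intervalIntegrable _ _)
      (by simp)
    intro j hj
    exact Ln_le hm ha hb hj.1
  rw [intervalIntegral.integral_const] at h
  simp only [sub_zero, smul_eq_mul] at h
  linarith [h, sq (m / a)]

lemma Ln_formula {m a b σ j : ℝ} (hm : 0 ≤ m) (hb : 0 < b) (hab : b ≤ a) (hσ : 0 ≤ σ) (hj0 : 0 ≤ j)
    (hj : j ≤ m / a) : Ln m a b σ j = (1 / (2 * a * b)) *
      (max (-(a ^ 2 + b ^ 2) * j + (m * (a + b) - σ)) 0 -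
      (max (-(a ^ 2 - b ^ 2) * j + (m * (a - b) - σ)) 0 +
      max ((a ^ 2 - b ^ 2) * j + (-(m * (a - b)) - σ)) 0)) := by
  have ha : 0 < a := by linarith
  rw [le_div_iff₀ ha] at hj
  set k := 2 * a * b with hk
  have hkp : 0 < k := by positivity
  unfold Ln
  rw [abs_of_nonneg hσ]
  have e1 : (m - j * a) / b = (2 * a * (m - j * a)) / k := by rw [hk]; field_simp
  have e2 : (m - j * b) / a = (2 * b * (m - j * b)) / k := by rw [hk]; field_simp
  have n1 : 0 ≤ 2 * a * (m - j * a) := by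
    have : 0 ≤ m - j * a := by linarith
    positivity
  have n2 : 0 ≤ 2 * b * (m - j * b) := by
    have : 0 ≤ m - j * b := by nlinarith
    positivity
  rw [e1, e2, ← hk, min_div_div_right hkp.le, min_div_div_right hkp.le,
    show (0 : ℝ) = 0 / k by simp, max_div_div_right hkp.le]
  rw [div_eq_iff hkp.ne', zero_div]
  rw [show ∀ y : ℝ, 1 / k * y * k = y by intro y; field_simp]
  have f1 : 2 * a * (m - j * a) = (-(a ^ 2 + b ^ 2) * j + (m * (a + b) - σ)) -
      ((a ^ 2 - b ^ 2) * j + (-(m * (a - b)) - σ)) := by ring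
  have f2 : 2 * b * (m - j * b) = (-(a ^ 2 + b ^ 2) * j + (m * (a + b) - σ)) -
      (-(a ^ 2 - b ^ 2) * j + (m * (a - b) - σ)) := by ring
  have f3 : m * (a + b) - σ - j * (a ^ 2 + b ^ 2) = -(a ^ 2 + b ^ 2) * j + (m * (a + b) - σ) := by ring
  have f4 : ((a ^ 2 - b ^ 2) * j + (-(m * (a - b)) - σ)) + (-(a ^ 2 - b ^ 2) * j + (m * (a - b) - σ)) ≤ 0 := by
    linarith
  rw [f1] at n1 ⊢
  rw [f2] at n2 ⊢
  rw [f3]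
  generalize -(a ^ 2 + b ^ 2) * j + (m * (a + b) - σ) = t at *
  generalize -(a ^ 2 - b ^ 2) * j + (m * (a - b) - σ) = u at *
  generalize (a ^ 2 - b ^ 2) * j + (-(m * (a - b)) - σ) = v at *
  clear * - n1 n2 f4
  grind

lemma In_one {m σ : ℝ} (hm : 0 ≤ m) (hσ : 0 ≤ σ) :
    In m 1 1 σ = (max (2 * m - σ) 0) ^ 2 / 8 := by
  unfold In
  have : ∫ j in (0 : ℝ)..(m / 1), Ln m 1 1 σ j = ∫ j in (0 : ℝ)..(m / 1), (1 / 2) * (max (-2 * j + (2 * m - σ)) 0) ^ 1 := by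
    apply intervalIntegral.integral_congr
    intro j hj
    rw [Set.uIcc_of_le (by positivity)] at hj
    rw [Ln_formula hm one_pos le_rfl hσ hj.1 hj.2]
    norm_num
    rw [show m * 2 = 2 * m by ring]; simp [hσ]
  rw [this, intervalIntegral.integral_const_mul, integral_pp 1 le_rfl _ _ _ (by norm_num),
    max_eq_right (by linarith : -2 * (m / 1) + (2 * m - σ) ≤ 0)]
  push_cast; ring

lemma In_formula {m a b σ : ℝ} (hm : 0 ≤ m) (hb : 0 < b) (hab : b < a) (hσ : 0 ≤ σ) :
    In m a b σ = 1 / (4 * a * b * (a ^ 2 + b ^ 2)) * (max (m * (a + b) - σ) 0) ^ 2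
      - 1 / (4 * a * b * (a ^ 2 - b ^ 2)) * (max (m * (a - b) - σ) 0) ^ 2
      - a / (2 * b * (a ^ 2 + b ^ 2) * (a ^ 2 - b ^ 2)) * (max (m * (b * (a - b) / a) - σ) 0) ^ 2 := by
  have ha : 0 < a := by linarith
  have hd : 0 < a - b := by linarith
  have hD : 0 < a ^ 2 - b ^ 2 := by nlinarith
  have hN : 0 < a ^ 2 + b ^ 2 := by positivity
  unfold In
  have : ∫ j in (0 : ℝ)..(m / a), Ln m a b σ j = ∫ j in (0 : ℝ)..(m / a), (1 / (2 * a * b)) *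
      ((max (-(a ^ 2 + b ^ 2) * j + (m * (a + b) - σ)) 0) ^ 1 -
      ((max (-(a ^ 2 - b ^ 2) * j + (m * (a - b) - σ)) 0) ^ 1 +
      (max ((a ^ 2 - b ^ 2) * j + (-(m * (a - b)) - σ)) 0) ^ 1)) := by
    apply intervalIntegral.integral_congr
    intro j hj
    rw [Set.uIcc_of_le (by positivity)] at hj
    simp only [pow_one]
    exact Ln_formula hm hb hab.le hσ hj.1 hj.2
  rw [this, intervalIntegral.integral_const_mul, intervalIntegral.integral_sub, intervalIntegral.integral_add,
    integral_pp 1 le_rfl _ _ _ (by linarith), integral_pp 1 le_rfl _ _ _ (by linarith),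
    integral_pp 1 le_rfl _ _ _ hD.ne']
  · have e1 : -(a ^ 2 + b ^ 2) * (m / a) + (m * (a + b) - σ) = m * (b * (a - b) / a) - σ := by
      field_simp; ring
    have e2 : (a ^ 2 - b ^ 2) * (m / a) + (-(m * (a - b)) - σ) = m * (b * (a - b) / a) - σ := by
      field_simp; ring
    have e3 : -(a ^ 2 - b ^ 2) * (m / a) + (m * (a - b) - σ) ≤ 0 := by
      have : -(a ^ 2 - b ^ 2) * (m / a) + (m * (a - b) - σ) = - (m * (b * (a - b) / a)) - σ := by
        field_simp; ring
      rw [this]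
      have : 0 ≤ m * (b * (a - b) / a) := by positivity
      linarith
    have e4 : (-(m * (a - b)) - σ) ≤ 0 := by
      have : 0 ≤ m * (a - b) := by positivity
      linarith
    rw [e1, e2, max_eq_right e3, max_eq_right e4]
    generalize max (m * (b * (a - b) / a) - σ) 0 = X
    generalize max (m * (a + b) - σ) 0 = Y
    generalize max (m * (a - b) - σ) 0 = Z
    push_cast
    field_simp
    ring
  all_goals apply Continuous.intervalIntegrable; fun_prop

lemma int_In_one {m : ℝ} (hm : 0 ≤ m) : ∫ σ in (0 : ℝ)..(m * (1 + 1)), (In m 1 1 σ) ^ 2 = m ^ 5 / 10 := by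
  have : ∫ σ in (0 : ℝ)..(m * (1 + 1)), (In m 1 1 σ) ^ 2 = ∫ σ in (0 : ℝ)..(m * (1 + 1)),
      (1 / 64) * ((max (2 * m - σ) 0) ^ 2 * (max (2 * m - σ) 0) ^ 2) := by
    apply intervalIntegral.integral_congr
    intro σ hσ
    rw [Set.uIcc_of_le (by positivity)] at hσ
    simp only
    rw [In_one hm hσ.1]; ring
  rw [this, intervalIntegral.integral_const_mul, integral_ppair _ _ _ (by positivity) le_rfl (by linarith)]
  ring

lemma int_In {m : ℝ} {a b : ℕ} (hm : 0 ≤ m) (hb : 0 < b) (hab : b < a) :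
    ∫ σ in (0 : ℝ)..(m * (a + b)), (In m a b σ) ^ 2 = 4 * fab a b * m ^ 5 := by
  have hb' : (0 : ℝ) < b := by exact_mod_cast hb
  have hab' : (b : ℝ) < a := by exact_mod_cast hab
  unfold fab
  generalize (b : ℝ) = b at *
  generalize (a : ℝ) = a at *
  have ha : 0 < a := by linarith
  have hd : 0 < a - b := by linarith
  have hD : 0 < a ^ 2 - b ^ 2 := by nlinarith
  have hN : 0 < a ^ 2 + b ^ 2 := by positivity
  set c := b * (a - b) / a with hc
  have hc0 : 0 ≤ c := by positivity
  have hc1 : c ≤ a - b := by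
    rw [hc, div_le_iff₀ ha]; nlinarith
  obtain ⟨A, hA⟩ : ∃ A, A = 1 / (4 * a * b * (a ^ 2 + b ^ 2)) := ⟨_, rfl⟩
  obtain ⟨B, hB⟩ : ∃ B, B = 1 / (4 * a * b * (a ^ 2 - b ^ 2)) := ⟨_, rfl⟩
  obtain ⟨C, hC⟩ : ∃ C, C = a / (2 * b * (a ^ 2 + b ^ 2) * (a ^ 2 - b ^ 2)) := ⟨_, rfl⟩
  have h1 : m * c ≤ m * (a - b) := by gcongr
  have h2 : m * (a - b) ≤ m * (a + b) := by gcongr; linarith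
  have h0 : 0 ≤ m * c := by positivity
  have h3 : 0 ≤ m * (a - b) := by positivity
  have h4 : 0 ≤ m * (a + b) := by positivity
  have : ∫ σ in (0 : ℝ)..(m * (a + b)), (In m a b σ) ^ 2 = ∫ σ in (0 : ℝ)..(m * (a + b)),
      (A ^ 2 * ((max (m * (a + b) - σ) 0) ^ 2 * (max (m * (a + b) - σ) 0) ^ 2) +
      (B ^ 2 * ((max (m * (a - b) - σ) 0) ^ 2 * (max (m * (a - b) - σ) 0) ^ 2) +
      (C ^ 2 * ((max (m * c - σ) 0) ^ 2 * (max (m * c - σ) 0) ^ 2) +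
      (-2 * A * B * ((max (m * (a - b) - σ) 0) ^ 2 * (max (m * (a + b) - σ) 0) ^ 2) +
      (-2 * A * C * ((max (m * c - σ) 0) ^ 2 * (max (m * (a + b) - σ) 0) ^ 2) +
      2 * B * C * ((max (m * c - σ) 0) ^ 2 * (max (m * (a - b) - σ) 0) ^ 2)))))) := by
    apply intervalIntegral.integral_congr
    intro σ hσ
    rw [Set.uIcc_of_le (by positivity)] at hσ
    simp only
    rw [In_formula hm hb' hab' hσ.1, ← hA, ← hB, ← hC, ← hc]; ring
  rw [this, intervalIntegral.integral_add, intervalIntegral.integral_add, intervalIntegral.integral_add,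
    intervalIntegral.integral_add, intervalIntegral.integral_add]
  · simp only [intervalIntegral.integral_const_mul]
    rw [integral_ppair _ _ _ h4 le_rfl le_rfl, integral_ppair _ _ _ h3 le_rfl h2,
      integral_ppair _ _ _ h0 le_rfl (h1.trans h2), integral_ppair _ _ _ h3 h2 h2,
      integral_ppair _ _ _ h0 (h1.trans h2) (h1.trans h2), integral_ppair _ _ _ h0 h1 (h1.trans h2)]
    rw [hA, hB, hC, hc]
    have e : a ^ 2 - b ^ 2 = (a - b) * (a + b) := by ring
    have hs : a + b ≠ 0 := by positivity
    rw [e]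
    field_simp
    ring
  all_goals apply Continuous.intervalIntegrable; fun_prop

/-! ### Counting for one direction -/

/-- pairs `p, q = p + j (a,b)` in the box `[0,m]^2` with `(a,b)·(p+q) = s` -/
noncomputable def cnt (m : ℕ) (a b s j : ℤ) : ℕ :=
  (((Finset.Icc (0 : ℤ) (m - j * a)) ×ˢ (Finset.Icc (0 : ℤ) (m - j * b))).filter
    (fun v => 2 * (a * v.1 + b * v.2) + j * (a ^ 2 + b ^ 2) = s)).card

lemma cnt_odd {m : ℕ} {a b s j : ℤ} (h : ∀ t, s - j * (a ^ 2 + b ^ 2) ≠ 2 * t) : cnt m a b s j = 0 := by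
  unfold cnt
  rw [Finset.card_eq_zero, Finset.filter_eq_empty_iff]
  intro v _ hv
  exact h (a * v.1 + b * v.2) (by linarith)

lemma cnt_large {m : ℕ} {a b s j : ℤ} (h : (m : ℤ) < j * a) : cnt m a b s j = 0 := by
  unfold cnt
  rw [Finset.Icc_eq_empty (by linarith : ¬ (0 : ℤ) ≤ m - j * a)]
  simp

lemma cnt_Ln {m : ℕ} {a b s j t : ℤ} (ha : 0 < a) (hb : 0 < b) (hab : IsCoprime a b)
    (h : s - j * (a ^ 2 + b ^ 2) = 2 * t) :
    |(cnt m a b s j : ℝ) - Ln m a b (s - m * (a + b)) j| ≤ 1 := by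
  have h1 := line_count a b (m - j * a) (m - j * b) t ha hb hab
  have e : cnt m a b s j = (((Finset.Icc 0 (m - j * a)) ×ˢ (Finset.Icc 0 (m - j * b))).filter
      (fun v => a * v.1 + b * v.2 = t)).card := by
    unfold cnt
    congr 1
    ext v
    simp only [Finset.mem_filter, and_congr_right_iff]
    intro _
    constructor <;> intro h' <;> linarith
  rw [← e] at h1
  have ha' : (0 : ℝ) < a := by exact_mod_cast ha
  have hb' : (0 : ℝ) < b := by exact_mod_cast hb
  have h' : (s : ℝ) - j * (a ^ 2 + b ^ 2) = 2 * t := by exact_mod_cast h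
  have e2 : min ((t : ℝ) / (a * b)) ((a * ((m - j * a : ℤ) : ℝ) + b * ((m - j * b : ℤ) : ℝ) - t : ℝ) / (a * b)) =
      (m * (a + b) - |(s : ℝ) - m * (a + b)| - j * (a ^ 2 + b ^ 2)) / (2 * a * b) := by
    have hk : (0 : ℝ) ≤ a * b := by positivity
    rw [min_div_div_right hk, show ∀ y : ℝ, y / (2 * a * b) = (y / 2) / (a * b) by intro y; field_simp]
    congr 1
    push_cast
    rcases abs_cases ((s : ℝ) - m * (a + b)) with ⟨e, h2⟩ | ⟨e, h2⟩ <;> rw [e]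
    · rw [min_eq_right (by linarith)]; linarith
    · rw [min_eq_left (by linarith)]; linarith
  rw [e2] at h1
  push_cast at h1
  exact h1

lemma cnt_Ln' {m : ℕ} {a b s j t : ℤ} (ha : 0 < a) (hb : 0 < b) (hab : IsCoprime a b)
    (h : s - j * (a ^ 2 + b ^ 2) = 2 * t) :
    |(cnt m a b s j : ℝ) - Ln m a b (s - m * (a + b)) j| ≤ if j * a ≤ m then 1 else 0 := by
  split_ifs with h1
  · exact cnt_Ln ha hb hab h
  · push Not at h1
    rw [cnt_large h1, Ln_zero (by exact_mod_cast ha) (by exact_mod_cast hb)]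
    · simp
    · rw [div_le_iff₀ (by exact_mod_cast ha)]
      exact_mod_cast h1.le

lemma rp_aux {m : ℕ} {a b s : ℤ} (q δ M : ℕ) (ha : 0 < a) (hb : 0 < b) (hab : IsCoprime a b)
    (hδ : 1 ≤ δ) (hδq : δ ≤ q) (hM : m ≤ q * M)
    (hpar : ∀ i : ℕ, ∃ t, s - (δ + q * i : ℤ) * (a ^ 2 + b ^ 2) = 2 * t) :
    |∑ i ∈ range M, (cnt m a b s (δ + q * i) : ℝ) - In m a b (s - m * (a + b)) / q| ≤ 2 * (m / a) := by
  have ha' : (0 : ℝ) < a := by exact_mod_cast ha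
  have ha1 : (1 : ℝ) ≤ a := by exact_mod_cast ha
  have hb' : (0 : ℝ) < b := by exact_mod_cast hb
  have hq : (0 : ℝ) < q := by
    have : 0 < q := by omega
    exact_mod_cast this
  set σ : ℝ := s - m * (a + b) with hσ
  have h1 := msum (F := fun x => Ln m a b σ (q * x)) M (δ / q) (by positivity)
    (by rw [div_le_one hq]; exact_mod_cast hδq)
    (by
      intro x _ y _ hxy
      apply Ln_anti_j σ ha' hb'
      gcongr) (fun x => Ln_nonneg _ _ _ _ _)
  rw [intervalIntegral.integral_comp_mul_left (fun j => Ln m a b σ j) hq.ne', mul_zero,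
    In_eq ha' hb' (by
      have h2 : (m : ℝ) ≤ q * M := by exact_mod_cast hM
      have h3 : (m : ℝ) / a ≤ m := div_le_self (by positivity) ha1
      linarith)] at h1
  have h2 : Ln m a b σ 0 ≤ m / a := Ln_le (by positivity) ha' hb' le_rfl
  have h3 : |∑ i ∈ range M, (cnt m a b s (δ + q * i) : ℝ) - ∑ i ∈ range M, Ln m a b σ (q * (δ / q + i))| ≤ m / a := by
    rw [← Finset.sum_sub_distrib]
    apply (Finset.abs_sum_le_sum_abs _ _).trans
    have : ∀ i ∈ range M, |(cnt m a b s (δ + q * i) : ℝ) - Ln m a b σ (q * (δ / q + i))| ≤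
        if (δ + q * i : ℤ) * a ≤ m then 1 else 0 := by
      intro i _
      obtain ⟨t, ht⟩ := hpar i
      have := cnt_Ln' (m := m) ha hb hab ht
      push_cast at this
      rw [show (q * (δ / q + i) : ℝ) = δ + q * i by field_simp]
      exact this
    apply (Finset.sum_le_sum this).trans
    rw [Finset.sum_boole]
    have hsub : (range M).filter (fun i : ℕ => (δ + q * i : ℤ) * a ≤ m) ⊆ range ((m : ℤ) / a).toNat := by
      intro i hi
      rw [Finset.mem_filter] at hi
      rw [Finset.mem_range, Int.lt_toNat, Int.lt_iff_add_one_le, Int.le_ediv_iff_mul_le ha]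
      refine le_trans ?_ hi.2
      have : (i : ℤ) + 1 ≤ δ + q * i := by
        have : (i : ℤ) ≤ q * i := by
          have : (1 : ℤ) ≤ q := by omega
          nlinarith
        omega
      gcongr
    have h4 := Finset.card_le_card hsub
    rw [Finset.card_range] at h4
    have h5 : ((((m : ℤ) / a).toNat : ℕ) : ℝ) ≤ m / a := by
      have h6 : ((((m : ℤ) / a).toNat : ℤ) : ℝ) = (((m : ℤ) / a : ℤ) : ℝ) := by
        rw [Int.toNat_of_nonneg (by positivity)]
      have h7 : ((((m : ℤ) / a).toNat : ℤ) : ℝ) = ((((m : ℤ) / a).toNat : ℕ) : ℝ) := by push_cast; rfl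
      rw [← h7, h6, le_div_iff₀ ha']
      have := Int.ediv_mul_le (m : ℤ) ha.ne'
      exact_mod_cast this
    exact le_trans (by exact_mod_cast h4) h5
  have h6 : (q : ℝ)⁻¹ • In m a b σ = In m a b σ / q := by rw [smul_eq_mul]; ring
  rw [h6] at h1
  have h7 := abs_sub_le (∑ i ∈ range M, (cnt m a b s (δ + q * i) : ℝ)) (∑ i ∈ range M, Ln m a b σ (q * (δ / q + i)))
    (In m a b σ / q)
  linarith

noncomputable def rp (m : ℕ) (a b s : ℤ) : ℕ := ∑ i ∈ range (2 * m), cnt m a b s (i + 1)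

noncomputable def Wp (m : ℕ) (a b : ℤ) : ℕ := ∑ s ∈ range (2 * (m * (a + b).toNat) + 1), (rp m a b s) ^ 2

lemma sum_range_two {R : Type*} [AddCommMonoid R] (f : ℕ → R) (M : ℕ) :
    ∑ i ∈ range (2 * M), f i = ∑ i ∈ range M, f (2 * i) + ∑ i ∈ range M, f (2 * i + 1) := by
  induction M with
  | zero => simp
  | succ k ih =>
    rw [show 2 * (k + 1) = 2 * k + 1 + 1 by ring, Finset.sum_range_succ, Finset.sum_range_succ, ih,
      Finset.sum_range_succ, Finset.sum_range_succ]
    abel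

/-- the density `1/q` -/
def qq (a b : ℤ) : ℕ := if (a ^ 2 + b ^ 2) % 2 = 1 then 2 else 1

lemma rp_est {m : ℕ} {a b s : ℤ} (ha : 0 < a) (hb : 0 < b) (hab : IsCoprime a b)
    (h : qq a b = 2 ∨ s % 2 = 0) :
    |(rp m a b s : ℝ) - In m a b (s - m * (a + b)) / qq a b| ≤ 2 * (m / a) := by
  by_cases hN : (a ^ 2 + b ^ 2) % 2 = 1
  · have hq : qq a b = 2 := by simp [qq, hN]
    rw [hq]
    obtain ⟨k, hk⟩ : ∃ k, a ^ 2 + b ^ 2 = 2 * k + 1 := ⟨(a ^ 2 + b ^ 2) / 2, by omega⟩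
    unfold rp
    rcases Int.emod_two_eq_zero_or_one s with hs | hs
    · have e : ∑ i ∈ range (2 * m), cnt m a b s (i + 1) = ∑ i ∈ range m, cnt m a b s ((2 : ℕ) + (2 : ℕ) * i) := by
        rw [sum_range_two, Finset.sum_eq_zero, zero_add]
        · apply Finset.sum_congr rfl
          intro i _
          congr 1; push_cast; ring
        · intro i _
          apply cnt_odd
          intro t ht
          push_cast at ht
          rw [hk] at ht
          have : s = 2 * (t + (2 * i + 1) * k + i) + 1 := by linarith
          omega
      rw [e]
      push_cast
      have := rp_aux (m := m) (s := s) 2 2 m ha hb hab (by norm_num) (by norm_num) (by omega) (by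
        intro i
        refine ⟨s / 2 - (1 + i) * (a ^ 2 + b ^ 2), ?_⟩
        have : s = 2 * (s / 2) := by omega
        push_cast
        linarith)
      push_cast at this
      exact this
    · have e : ∑ i ∈ range (2 * m), cnt m a b s (i + 1) = ∑ i ∈ range m, cnt m a b s ((1 : ℕ) + (2 : ℕ) * i) := by
        rw [sum_range_two, add_comm, Finset.sum_eq_zero, zero_add]
        · apply Finset.sum_congr rfl
          intro i _
          congr 1; push_cast; ring
        · intro i _
          apply cnt_odd
          intro t ht
          push_cast at ht
          rw [hk] at ht
          have : s = 2 * (t + (2 * i + 2) * k + i + 1) := by linarith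
          omega
      rw [e]
      push_cast
      have := rp_aux (m := m) (s := s) 2 1 m ha hb hab (by norm_num) (by norm_num) (by omega) (by
        intro i
        refine ⟨s / 2 - k - i * (a ^ 2 + b ^ 2), ?_⟩
        have : s = 2 * (s / 2) + 1 := by omega
        push_cast
        linarith)
      push_cast at this
      exact this
  · have hq : qq a b = 1 := by simp [qq, hN]
    rw [hq] at h ⊢
    have hs : s % 2 = 0 := by omega
    obtain ⟨k, hk⟩ : ∃ k, a ^ 2 + b ^ 2 = 2 * k := ⟨(a ^ 2 + b ^ 2) / 2, by omega⟩
    have := rp_aux (m := m) (s := s) 1 1 (2 * m) ha hb hab (by norm_num) (by norm_num) (by omega) (by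
        intro i
        refine ⟨s / 2 - (1 + i) * k, ?_⟩
        have : s = 2 * (s / 2) := by omega
        push_cast
        rw [hk]
        linarith)
    unfold rp
    push_cast at this ⊢
    have e : ∀ i : ℕ, (1 + 1 * i : ℤ) = i + 1 := by intro i; ring
    simp_rw [e] at this
    exact this

lemma sum_sym (h : ℝ → ℝ) (he : ∀ x, h (-x) = h x) (K : ℕ) :
    ∑ i ∈ range (2 * K + 1), h ((i : ℝ) - K) = h 0 + 2 * ∑ i ∈ range K, h (1 + i) := by
  rw [show 2 * K + 1 = K + (K + 1) by ring, Finset.sum_range_add, Finset.sum_range_succ',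
    ← Finset.sum_range_reflect]
  have e1 : ∑ j ∈ range K, h (((K - 1 - j : ℕ) : ℝ) - K) = ∑ i ∈ range K, h (1 + i) := by
    apply Finset.sum_congr rfl
    intro j hj
    rw [Finset.mem_range] at hj
    rw [Nat.sub_sub, Nat.cast_sub (by omega), ← he]
    congr 1; push_cast; ring
  have e2 : ∑ k ∈ range K, h (((K + (k + 1) : ℕ) : ℝ) - K) = ∑ i ∈ range K, h (1 + i) := by
    apply Finset.sum_congr rfl
    intro j hj
    congr 1; push_cast; ring
  rw [e1, e2]
  simp; ring

lemma Wp_core {x : ℝ} (hx : 1 ≤ x) (K : ℕ) (r J : ℕ → ℝ) (hr : ∀ i, |r i - J i| ≤ 2 * x)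
    (h0 : ∀ i, 0 ≤ J i) (h1 : ∀ i, J i ≤ x ^ 2) :
    |∑ i ∈ range K, r i ^ 2 - ∑ i ∈ range K, J i ^ 2| ≤ K * (8 * x ^ 3) := by
  rw [← Finset.sum_sub_distrib]
  apply (Finset.abs_sum_le_sum_abs _ _).trans
  have : ∀ i ∈ range K, |r i ^ 2 - J i ^ 2| ≤ 8 * x ^ 3 := by
    intro i _
    rw [show r i ^ 2 - J i ^ 2 = (r i - J i) * (r i + J i) by ring, abs_mul]
    have h2 := hr i
    have h3 : |r i + J i| ≤ 4 * x ^ 2 := by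
      have h4 : |r i + J i| ≤ |r i - J i| + |2 * J i| := by
        rw [show r i + J i = (r i - J i) + 2 * J i by ring]; exact abs_add_le _ _
      rw [abs_of_nonneg (by linarith [h0 i] : 0 ≤ 2 * J i)] at h4
      nlinarith [h1 i, h0 i]
    calc _ ≤ (2 * x) * (4 * x ^ 2) := by gcongr
      _ = _ := by ring
  apply (Finset.sum_le_sum this).trans
  simp

lemma Wp_est {m : ℕ} {a b : ℤ} (hb : 0 < b) (hba : b ≤ a) (ham : a ≤ m) (hab : IsCoprime a b) :
    |(Wp m a b : ℝ) - (∫ σ in (0 : ℝ)..(m * (a + b)), (In m a b σ) ^ 2) / qq a b| ≤ 43 * (m : ℝ) ^ 4 / a ^ 2 := by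
  have ha : 0 < a := by omega
  have ha' : (0 : ℝ) < a := by exact_mod_cast ha
  have ha1 : (1 : ℝ) ≤ a := by exact_mod_cast ha
  have hb' : (0 : ℝ) < b := by exact_mod_cast hb
  have hba' : (b : ℝ) ≤ a := by exact_mod_cast hba
  have ham' : (a : ℝ) ≤ m := by exact_mod_cast ham
  have hm : (0 : ℝ) < m := by linarith
  set x : ℝ := m / a with hx
  have hx1 : 1 ≤ x := by rw [hx, le_div_iff₀ ha']; linarith
  obtain ⟨e, he⟩ : ∃ e : ℕ, e = (a + b).toNat := ⟨_, rfl⟩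
  have heZ : (e : ℤ) = a + b := by rw [he]; omega
  have heR : (e : ℝ) = a + b := by exact_mod_cast heZ
  have hI0 : ∀ σ, 0 ≤ In m a b σ := fun σ => In_nonneg hm.le ha'
  have hI1 : ∀ σ, In m a b σ ≤ x ^ 2 := fun σ => In_le hm.le ha' hb'
  have hIe : ∀ σ, In m a b (-σ) = In m a b σ := by
    intro σ
    apply le_antisymm <;> apply In_anti hm.le ha' hb' <;> simp
  -- general step
  have key : ∀ (q q' K : ℕ) (r : ℕ → ℝ), 1 ≤ q → 1 ≤ q' → q * q' = 2 → (q' : ℝ) * K = m * (a + b) → K ≤ m * e →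
      (∀ i, |r i - In m a b (q' * ((i : ℝ) - K)) / q| ≤ 2 * x) →
      |∑ i ∈ range (2 * K + 1), r i ^ 2 - (∫ σ in (0 : ℝ)..(m * (a + b)), (In m a b σ) ^ 2) / q| ≤ 43 * (m : ℝ) ^ 4 / a ^ 2 := by
    intro q q' K r hq hq' hqq hK hKm hr
    have hq1 : (1 : ℝ) ≤ q := by exact_mod_cast hq
    have hq'1 : (1 : ℝ) ≤ q' := by exact_mod_cast hq'
    have hqq' : (q : ℝ) * q' = 2 := by exact_mod_cast hqq
    have h1 := Wp_core hx1 (2 * K + 1) r (fun i => In m a b (q' * ((i : ℝ) - K)) / q) hr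
      (fun i => div_nonneg (hI0 _) (by linarith)) (fun i => (div_le_self (hI0 _) hq1).trans (hI1 _))
    have h2 := sum_sym (fun y => (In m a b (q' * y) / q) ^ 2) (by
      intro y; rw [mul_neg, hIe]) K
    rw [h2] at h1
    have h3 := msum (F := fun y => (In m a b (q' * y)) ^ 2) K 1 zero_le_one le_rfl (by
      intro y hy z hz hyz
      rw [Set.mem_Ici] at hy hz
      have : In m a b (q' * z) ≤ In m a b (q' * y) := by
        apply In_anti hm.le ha' hb'
        rw [abs_of_nonneg (by positivity), abs_of_nonneg (by positivity)]
        gcongr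
      have h0 := hI0 (q' * z)
      simp only
      gcongr) (fun y => sq_nonneg _)
    rw [intervalIntegral.integral_comp_mul_left (fun σ => (In m a b σ) ^ 2) (by linarith : (q' : ℝ) ≠ 0), mul_zero,
      hK, smul_eq_mul] at h3
    have hI00 : (In m a b 0) ^ 2 ≤ x ^ 4 := by
      have h0 := hI0 0
      calc (In m a b 0) ^ 2 ≤ (x ^ 2) ^ 2 := by gcongr; exact hI1 0
        _ = x ^ 4 := by ring
    have hI00' : 0 ≤ (In m a b 0) ^ 2 := sq_nonneg _
    generalize hJ : ∫ σ in (0 : ℝ)..(m * (a + b)), (In m a b σ) ^ 2 = J at *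
    have hsum : ∑ i ∈ range K, (In m a b (q' * (1 + (i : ℝ))) / q) ^ 2 =
        (∑ i ∈ range K, (In m a b (q' * (1 + (i : ℝ)))) ^ 2) / q ^ 2 := by
      rw [Finset.sum_div]
      apply Finset.sum_congr rfl
      intro i _; rw [div_pow]
    rw [hsum] at h1
    generalize ∑ i ∈ range K, (In m a b (q' * (1 + (i : ℝ)))) ^ 2 = X at *
    simp only [mul_zero, zero_div] at h1 h3
    have hJq : J / q = 2 * ((q' : ℝ)⁻¹ * J) / q ^ 2 := by
      field_simp
      linear_combination J * hqq'
    have h4 : |(In m a b 0 / q) ^ 2 + 2 * (X / q ^ 2) - J / q| ≤ 3 * x ^ 4 := by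
      rw [hJq]
      have : (In m a b 0 / q) ^ 2 + 2 * (X / q ^ 2) - 2 * ((q' : ℝ)⁻¹ * J) / q ^ 2 =
        ((In m a b 0) ^ 2 + 2 * (X - (q' : ℝ)⁻¹ * J)) / q ^ 2 := by
        ring
      rw [this, abs_div, abs_of_nonneg (by positivity : (0 : ℝ) ≤ q ^ 2)]
      apply (div_le_self (abs_nonneg _) (one_le_pow₀ hq1)).trans
      rw [abs_le] at h3 ⊢
      constructor <;> linarith [h3.1, h3.2]
    have h5 : ((2 * K + 1 : ℕ) : ℝ) * (8 * x ^ 3) ≤ 40 * (m : ℝ) ^ 4 / a ^ 2 := by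
      have h6 : ((2 * K + 1 : ℕ) : ℝ) ≤ 5 * a * m := by
        have : (K : ℝ) ≤ m * e := by exact_mod_cast hKm
        rw [heR] at this
        push_cast
        nlinarith
      calc _ ≤ 5 * a * m * (8 * x ^ 3) := by gcongr
        _ = _ := by rw [hx]; field_simp; ring
    have h7 : 3 * x ^ 4 ≤ 3 * (m : ℝ) ^ 4 / a ^ 2 := by
      rw [hx, div_pow, mul_div_assoc]
      gcongr
      · norm_num
    have h8 := abs_sub_le (∑ i ∈ range (2 * K + 1), r i ^ 2) ((In m a b 0 / q) ^ 2 + 2 * (X / q ^ 2)) (J / q)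
    have h9 : 43 * (m : ℝ) ^ 4 / a ^ 2 = 40 * (m : ℝ) ^ 4 / a ^ 2 + 3 * (m : ℝ) ^ 4 / a ^ 2 := by ring
    linarith
  unfold Wp
  rw [← he]
  by_cases hN : (a ^ 2 + b ^ 2) % 2 = 1
  · have hq : qq a b = 2 := by simp [qq, hN]
    rw [hq]
    have := key 2 1 (m * e) (fun i => (rp m a b i : ℝ)) (by norm_num) (by norm_num) (by norm_num)
      (by push_cast; rw [heR]; ring) le_rfl (by
        intro i
        have := rp_est (m := m) (s := i) ha hb hab (Or.inl hq)
        rw [hq] at this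
        push_cast at this ⊢
        rw [one_mul, heR]
        exact this)
    push_cast at this ⊢
    exact this
  · have hq : qq a b = 1 := by simp [qq, hN]
    have hpar : (a + b) % 2 = 0 := by
      have h1 : (a ^ 2 + b ^ 2) % 2 = 0 := by omega
      have h2 : 2 ∣ (a + b) ^ 2 := by
        have : (a + b) ^ 2 = (a ^ 2 + b ^ 2) + 2 * (a * b) := by ring
        omega
      have := Int.prime_two.dvd_of_dvd_pow h2
      omega
    obtain ⟨e', he'⟩ : ∃ e', e = 2 * e' := ⟨e / 2, by omega⟩
    rw [hq]
    have h1 : ∑ s ∈ range (2 * (m * e) + 1), (rp m a b s) ^ 2 = ∑ i ∈ range (2 * (m * e') + 1), (rp m a b (2 * i)) ^ 2 := by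
      rw [Finset.sum_range_succ, sum_range_two, Finset.sum_range_succ, he']
      have hz : ∑ i ∈ range (m * (2 * e')), (rp m a b ((2 * i + 1 : ℕ) : ℤ)) ^ 2 = 0 := by
        apply Finset.sum_eq_zero
        intro i _
        have : rp m a b ((2 * i + 1 : ℕ) : ℤ) = 0 := by
          unfold rp
          apply Finset.sum_eq_zero
          intro j _
          apply cnt_odd
          intro t ht
          obtain ⟨k, hk⟩ : ∃ k, a ^ 2 + b ^ 2 = 2 * k := ⟨(a ^ 2 + b ^ 2) / 2, by omega⟩
          rw [hk] at ht
          push_cast at ht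
          have : (1 : ℤ) = 2 * (t + (j + 1) * k - i) := by linarith
          omega
        rw [this]; rfl
      rw [hz, add_zero, show m * (2 * e') = 2 * (m * e') by ring]
      push_cast
      rfl
    rw [h1]
    have he'R : (e : ℝ) = 2 * e' := by exact_mod_cast he'
    have := key 1 2 (m * e') (fun i => (rp m a b (2 * i) : ℝ)) (by norm_num) (by norm_num) (by norm_num)
      (by push_cast; rw [← heR, he'R]; ring) (by rw [he']; nlinarith) (by
        intro i
        have := rp_est (m := m) (s := 2 * i) ha hb hab (Or.inr (by omega))
        rw [hq] at this
        push_cast at this ⊢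
        rw [mul_sub, show (2 * (m * e') : ℝ) = m * (2 * e') by ring, ← he'R, heR]
        exact this)
    push_cast at this ⊢
    exact this

/-! ### The direction `(1,0)` -/

lemma count_even (M : ℕ) : ∑ i ∈ range M, (if 2 ∣ i then 1 else 0) = (M + 1) / 2 := by
  induction M with
  | zero => simp
  | succ k ih =>
    rw [Finset.sum_range_succ, ih]
    split_ifs with h <;> omega

lemma cnt10 (m M : ℕ) (s : ℤ) (i : ℕ) (hM : (M : ℤ) = m - |s - m|) :
    cnt m 1 0 s (i + 1) = if i < M ∧ 2 ∣ (M - 1 - i) then m + 1 else 0 := by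
  split_ifs with h
  · obtain ⟨h1, h2⟩ := h
    unfold cnt
    have h3 : ∃ t, s - (i + 1) = 2 * t := by
      refine ⟨(s - (i + 1)) / 2, ?_⟩
      rcases abs_cases (s - m) with ⟨e, _⟩ | ⟨e, _⟩ <;> omega
    obtain ⟨t, ht⟩ := h3
    have ht0 : 0 ≤ t := by
      rcases abs_cases (s - m) with ⟨e, _⟩ | ⟨e, _⟩ <;> omega
    have ht1 : t ≤ m - (i + 1) := by
      rcases abs_cases (s - m) with ⟨e, _⟩ | ⟨e, _⟩ <;> omega
    have : ((Finset.Icc (0 : ℤ) (m - (i + 1) * 1) ×ˢ Finset.Icc (0 : ℤ) (m - (i + 1) * 0)).filter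
        (fun v => 2 * (1 * v.1 + 0 * v.2) + (i + 1 : ℤ) * (1 ^ 2 + 0 ^ 2) = s)) = {t} ×ˢ Finset.Icc (0 : ℤ) m := by
      ext ⟨x, y⟩
      simp only [Finset.mem_filter, Finset.mem_product, Finset.mem_Icc, Finset.mem_singleton]
      constructor
      · rintro ⟨⟨_, h5⟩, h6⟩
        constructor <;> omega
      · rintro ⟨h5, h6⟩
        omega
    rw [this, Finset.card_product]
    simp
  · unfold cnt
    rw [Finset.card_eq_zero, Finset.filter_eq_empty_iff]
    rintro ⟨x, y⟩ hv h2
    simp only [Finset.mem_product, Finset.mem_Icc] at hv h2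
    apply h
    rcases abs_cases (s - m) with ⟨e, _⟩ | ⟨e, _⟩ <;> omega

lemma rp10 (m M : ℕ) (s : ℤ) (hM : (M : ℤ) = m - |s - m|) :
    rp m 1 0 s = (m + 1) * ((M + 1) / 2) := by
  unfold rp
  have hMm : M ≤ 2 * m := by
    have := abs_nonneg (s - m)
    omega
  rw [← Finset.sum_subset (Finset.range_subset_range.mpr hMm)]
  · rw [← count_even, ← Finset.sum_range_reflect, Finset.mul_sum]
    apply Finset.sum_congr rfl
    intro i hi
    rw [Finset.mem_range] at hi
    rw [show (((M - 1 - i : ℕ) : ℤ) + 1) = ((M - 1 - i : ℕ) : ℤ) + 1 by rfl, cnt10 m M s (M - 1 - i) hM]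
    have : M - 1 - (M - 1 - i) = i := by omega
    rw [this]
    have h2 : M - 1 - i < M := by omega
    simp [h2]
  · intro i _ hi
    rw [Finset.mem_range] at hi
    rw [cnt10 m M s i hM, if_neg (by tauto)]

lemma Wp10 (m : ℕ) (hm : 1 ≤ m) : |(Wp m 1 0 : ℝ) - (m : ℝ) ^ 5 / 6| ≤ 25 * (m : ℝ) ^ 4 := by
  have hm1 : (1 : ℝ) ≤ m := by exact_mod_cast hm
  set r : ℕ → ℝ := fun i => if i ≤ 2 * m then (rp m 1 0 i : ℝ) else (m : ℝ) * (max ((m : ℝ) - |(i : ℝ) - m|) 0) / 2 with hr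
  set J : ℕ → ℝ := fun i => (m : ℝ) * (max ((m : ℝ) - |(i : ℝ) - m|) 0) / 2 with hJ
  have h1 := Wp_core hm1 (2 * m + 1) r J (by
    intro i
    rw [hr, hJ]
    dsimp only
    split_ifs with h
    · obtain ⟨M, hM⟩ : ∃ M : ℕ, (M : ℤ) = m - |(i : ℤ) - m| := by
        refine ⟨(m - |(i : ℤ) - m|).toNat, Int.toNat_of_nonneg ?_⟩
        rcases abs_cases ((i : ℤ) - m) with ⟨e, _⟩ | ⟨e, _⟩ <;> omega
      have hMR : (M : ℝ) = m - |(i : ℝ) - m| := by exact_mod_cast hM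
      rw [rp10 m M i hM, ← hMR, max_eq_left (by positivity)]
      have hMm : (M : ℝ) ≤ m := by rw [hMR]; linarith [abs_nonneg ((i : ℝ) - m)]
      have h2 : (M : ℝ) ≤ 2 * (((M + 1) / 2 : ℕ) : ℝ) := by
        exact_mod_cast (by omega : M ≤ 2 * ((M + 1) / 2))
      have h3 : 2 * (((M + 1) / 2 : ℕ) : ℝ) ≤ M + 1 := by
        exact_mod_cast (by omega : 2 * ((M + 1) / 2) ≤ M + 1)
      rw [Nat.cast_mul]
      generalize (((M + 1) / 2 : ℕ) : ℝ) = ρ at *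
      have hM0 : (0 : ℝ) ≤ M := by positivity
      push_cast
      rw [abs_le]; constructor <;> nlinarith
    · simp) (by intro i; rw [hJ]; dsimp only; positivity) (by
      intro i
      rw [hJ]
      dsimp only
      have h2 : max ((m : ℝ) - |(i : ℝ) - m|) 0 ≤ m := max_le (by linarith [abs_nonneg ((i : ℝ) - m)]) (by linarith)
      have h3 : 0 ≤ max ((m : ℝ) - |(i : ℝ) - m|) 0 := le_max_right _ _
      nlinarith)
  have e1 : (Wp m 1 0 : ℝ) = ∑ i ∈ range (2 * m + 1), r i ^ 2 := by
    unfold Wp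
    push_cast
    apply Finset.sum_congr (by simp)
    intro i hi
    simp only [Finset.mem_range] at hi
    rw [hr]; dsimp only
    rw [if_pos (by have : (1 + 0 : ℤ).toNat = 1 := by rfl
                   omega)]
  have h2 := sum_sym (fun y => ((m : ℝ) * (max ((m : ℝ) - |y|) 0) / 2) ^ 2) (by intro y; simp only [abs_neg]) m
  rw [← e1] at h1
  have e2 : ∑ i ∈ range (2 * m + 1), J i ^ 2 = ((m : ℝ) * (max ((m : ℝ) - |0|) 0) / 2) ^ 2 +
    2 * ∑ i ∈ range m, ((m : ℝ) * (max ((m : ℝ) - |1 + (i : ℝ)|) 0) / 2) ^ 2 := h2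
  have e3 : ∑ i ∈ range m, ((m : ℝ) * (max ((m : ℝ) - |1 + (i : ℝ)|) 0) / 2) ^ 2 =
      (m : ℝ) ^ 2 / 4 * ∑ i ∈ range m, (max (-1 * (1 + (i : ℝ)) + m) 0) ^ 2 := by
    rw [Finset.mul_sum]
    apply Finset.sum_congr rfl
    intro i _
    rw [abs_of_nonneg (by positivity), show (-1 * (1 + (i : ℝ)) + m) = m - (1 + i) by ring]; ring
  have h3 := msum (F := fun y : ℝ => (max (-1 * y + m) 0) ^ 2) m 1 zero_le_one le_rfl (by
      intro y _ z _ hyz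
      dsimp only
      gcongr ?_ ^ 2
      apply max_le_max _ le_rfl
      linarith) (fun y => sq_nonneg _)
  rw [integral_pp 2 (by norm_num) _ _ _ (by norm_num)] at h3
  rw [e2, e3, abs_zero, sub_zero, max_eq_left (by linarith)] at h1
  rw [max_eq_right (by linarith : -1 * (m : ℝ) + m ≤ 0), max_eq_left (by linarith : (0 : ℝ) ≤ m)] at h3
  simp only [mul_zero, zero_add] at h3
  rw [max_eq_left (by linarith : (0 : ℝ) ≤ m)] at h3
  generalize ∑ i ∈ range m, (max (-1 * (1 + (i : ℝ)) + m) 0) ^ 2 = X at *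
  have h4 : |X - (m : ℝ) ^ 3 / 3| ≤ (m : ℝ) ^ 2 := by
    convert h3 using 2
    push_cast; ring_nf
  have h5 : |((m : ℝ) * m / 2) ^ 2 + 2 * ((m : ℝ) ^ 2 / 4 * X) - (m : ℝ) ^ 5 / 6| ≤ (m : ℝ) ^ 4 := by
    rw [show ((m : ℝ) * m / 2) ^ 2 + 2 * ((m : ℝ) ^ 2 / 4 * X) - (m : ℝ) ^ 5 / 6 =
      (m : ℝ) ^ 4 / 4 + (m : ℝ) ^ 2 / 2 * (X - (m : ℝ) ^ 3 / 3) by ring]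
    rw [abs_le] at h4 ⊢
    have hp : (0 : ℝ) < (m : ℝ) ^ 2 := by positivity
    constructor <;> nlinarith [h4.1, h4.2]
  have h6 : ((2 * m + 1 : ℕ) : ℝ) * (8 * (m : ℝ) ^ 3) ≤ 24 * (m : ℝ) ^ 4 := by
    push_cast
    have hp : (0 : ℝ) < (m : ℝ) ^ 3 := by positivity
    nlinarith
  have := abs_sub_le (Wp m 1 0 : ℝ) (((m : ℝ) * m / 2) ^ 2 + 2 * ((m : ℝ) ^ 2 / 4 * X)) ((m : ℝ) ^ 5 / 6)
  linarith

/-! ### Pairs of segments with a common perpendicular bisector -/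

noncomputable def bx (m : ℕ) : Finset 𝔾 :=
  ((Finset.Icc (0 : ℤ) m) ×ˢ (Finset.Icc (0 : ℤ) m)).image (fun v => (⟨v.1, v.2⟩ : 𝔾))

lemma mem_bx {m : ℕ} {z : 𝔾} : z ∈ bx m ↔ (0 ≤ z.re ∧ z.re ≤ m) ∧ 0 ≤ z.im ∧ z.im ≤ m := by
  unfold bx
  rw [Finset.mem_image]
  constructor
  · rintro ⟨v, hv, rfl⟩
    simpa using hv
  · intro h
    exact ⟨(z.re, z.im), by simpa using h, rfl⟩

lemma card_bx (m : ℕ) : (bx m).card = (m + 1) ^ 2 := by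
  unfold bx
  rw [Finset.card_image_of_injective, Finset.card_product]
  · simp; ring
  · rintro ⟨x, y⟩ ⟨x', y'⟩ h
    simpa [Zsqrtd.ext_iff] using h

/-- the segments `ab` and `cd` have the same perpendicular bisector -/
def SB (a b c d : 𝔾) : Prop :=
  ((a - b) * star (c - d)).im = 0 ∧ ((c + d - a - b) * star (a - b)).re = 0

/-- `ν` is the primitive direction of `z` -/
def IsDir (ν z : 𝔾) : Prop := IsCoprime ν.re ν.im ∧ ∃ j : ℤ, 1 ≤ j ∧ z = j * ν

lemma IsDir.exists {z : 𝔾} (hz : z ≠ 0) : ∃ ν, IsDir ν z := by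
  obtain ⟨m, e, h1, h2⟩ := gint_content hz
  rcases lt_trichotomy m 0 with h | h | h
  · refine ⟨-e, ?_, -m, by omega, by rw [h1]; push_cast; ring⟩
    simpa using (IsCoprime.neg_neg_iff _ _).mpr h2
  · subst h; simp at h1; exact absurd h1 hz
  · exact ⟨e, h2, m, by omega, h1⟩

lemma coprime_ne_zero {ν : 𝔾} (h : IsCoprime ν.re ν.im) : ν ≠ 0 := by
  rintro rfl
  obtain ⟨u, v, h⟩ := h
  simp at h

lemma IsDir.uniq {ν ν' z : 𝔾} (h : IsDir ν z) (h' : IsDir ν' z) : ν = ν' := by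
  obtain ⟨h1, j, hj, e⟩ := h
  obtain ⟨h2, j', hj', e'⟩ := h'
  have e1 : j * ν.re = j' * ν'.re := by
    have := congrArg Zsqrtd.re (e.symm.trans e'); simpa using this
  have e2 : j * ν.im = j' * ν'.im := by
    have := congrArg Zsqrtd.im (e.symm.trans e'); simpa using this
  have h3 : ν'.re * ν.im = ν'.im * ν.re := by
    have : j * (ν'.re * ν.im - ν'.im * ν.re) = 0 := by linear_combination ν'.re * e2 - ν'.im * e1
    rcases mul_eq_zero.mp this with h | h
    · omega
    · linarith
  rcases prim_par h2 h1 h3 with h | h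
  · exact h
  · exfalso
    rw [h] at e1 e2
    simp only [Zsqrtd.re_neg, Zsqrtd.im_neg] at e1 e2
    have hp : j + j' ≠ 0 := by omega
    have e3 : ν'.re = 0 := by
      have : (j + j') * ν'.re = 0 := by linarith
      exact (mul_eq_zero.mp this).resolve_left hp
    have e4 : ν'.im = 0 := by
      have : (j + j') * ν'.im = 0 := by linarith
      exact (mul_eq_zero.mp this).resolve_left hp
    exact coprime_ne_zero h2 (by ext <;> simp [e3, e4])

lemma sb_iff {a b c d ν : 𝔾} (h : IsDir ν (b - a)) :
    (SB a b c d ∧ c ≠ d ∧ 0 < ((b - a) * star (d - c)).re) ↔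
      (IsDir ν (d - c) ∧ (star ν * (a + b)).re = (star ν * (c + d)).re) := by
  obtain ⟨h1, j, hj, e⟩ := h
  have hν := coprime_ne_zero h1
  have hN : 0 < ν.re * ν.re + ν.im * ν.im := by
    have := gn_pos hν
    rw [← gn_int]; exact_mod_cast this
  have eab : a - b = -(j * ν) := by rw [← e]; ring
  have dot : ((c + d - a - b) * star (a - b)).re = j * ((star ν * (a + b)).re - (star ν * (c + d)).re) := by
    rw [eab]; simp; ring
  constructor
  · rintro ⟨⟨h2, h3⟩, h4, h5⟩
    rw [dot] at h3
    have h6 : (star ν * (a + b)).re = (star ν * (c + d)).re := by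
      rcases mul_eq_zero.mp h3 with h | h
      · omega
      · linarith
    refine ⟨?_, h6⟩
    obtain ⟨ν', h7, j', hj', e'⟩ := IsDir.exists (sub_ne_zero.mpr h4.symm)
    have ecd : c - d = -(j' * ν') := by rw [← e']; ring
    rw [eab, ecd] at h2
    rw [e, e'] at h5
    simp at h2 h5
    have h8 : ν.re * ν'.im = ν.im * ν'.re := by
      have : (j * j') * (ν.re * ν'.im - ν.im * ν'.re) = 0 := by linear_combination -h2
      rcases mul_eq_zero.mp this with h | h
      · rcases mul_eq_zero.mp h with h | h <;> omega
      · linarith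
    rcases prim_par h1 h7 h8 with h | h
    · rw [← h]; exact ⟨h7, j', hj', e'⟩
    · exfalso
      rw [h] at h5
      simp at h5
      have : 0 < j * j' := by positivity
      nlinarith
  · rintro ⟨⟨_, j', hj', e'⟩, h2⟩
    have ecd : c - d = -(j' * ν) := by rw [← e']; ring
    refine ⟨⟨?_, ?_⟩, ?_, ?_⟩
    · rw [eab, ecd]; simp; ring
    · rw [dot, h2]; ring
    · rintro rfl
      rw [sub_self] at e'
      have : (j' : 𝔾) ≠ 0 := by
        have : j' ≠ 0 := by omega
        exact_mod_cast this
      exact (mul_ne_zero this hν) e'.symm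
    · rw [e, e']
      simp
      have : 0 < j * j' := by positivity
      nlinarith

noncomputable def bx4 (m : ℕ) : Finset ((𝔾 × 𝔾) × (𝔾 × 𝔾)) := (bx m ×ˢ bx m) ×ˢ (bx m ×ˢ bx m)

open Classical in
noncomputable def Wall (m : ℕ) : ℕ := ((bx4 m).filter
  (fun P => P.1.1 ≠ P.1.2 ∧ P.2.1 ≠ P.2.2 ∧ SB P.1.1 P.1.2 P.2.1 P.2.2)).card

open Classical in
noncomputable def Wpos (m : ℕ) : ℕ := ((bx4 m).filter
  (fun P => (P.1.1 ≠ P.1.2 ∧ P.2.1 ≠ P.2.2 ∧ SB P.1.1 P.1.2 P.2.1 P.2.2) ∧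
    0 < ((P.1.2 - P.1.1) * star (P.2.2 - P.2.1)).re)).card

open Classical in
noncomputable def Wq (m : ℕ) (ν : 𝔾) : ℕ := ((bx4 m).filter
  (fun P => IsDir ν (P.1.2 - P.1.1) ∧ IsDir ν (P.2.2 - P.2.1) ∧
    (star ν * (P.1.1 + P.1.2)).re = (star ν * (P.2.1 + P.2.2)).re)).card

lemma Wall_eq (m : ℕ) : Wall m = 2 * Wpos m := by
  classical
  unfold Wall Wpos
  rw [← Finset.card_filter_add_card_filter_not (fun P : (𝔾 × 𝔾) × (𝔾 × 𝔾) => 0 < ((P.1.2 - P.1.1) * star (P.2.2 - P.2.1)).re)]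
  rw [Finset.filter_filter, Finset.filter_filter, two_mul]
  congr 1
  apply Finset.card_bij (fun P _ => (P.1, (P.2.2, P.2.1)))
  · rintro ⟨⟨p, q⟩, r, s⟩ h
    simp only [bx4, Finset.mem_filter, Finset.mem_product] at h ⊢
    obtain ⟨⟨⟨a1, a2⟩, a3, a4⟩, ⟨a5, a6, a7, a8⟩, a9⟩ := h
    refine ⟨⟨⟨a1, a2⟩, a4, a3⟩, ⟨a5, a6.symm, ?_, ?_⟩, ?_⟩
    · rw [← neg_sub r s, star_neg, mul_neg, Zsqrtd.im_neg, a7, neg_zero]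
    · rw [add_comm s r]; exact a8
    · by_contra hcon
      have h1 : ((q - p) * star (s - r)).re = 0 := by
        have : ((q - p) * star (r - s)).re = -((q - p) * star (s - r)).re := by
          rw [← neg_sub s r, star_neg, mul_neg, Zsqrtd.re_neg]
        linarith
      have h2 : ((q - p) * star (s - r)).im = 0 := by
        have : (q - p) * star (s - r) = (p - q) * star (r - s) := by
          rw [← neg_sub r s, ← neg_sub p q, star_neg]; ring
        rw [this]; exact a7
      have h3 : (q - p) * star (s - r) = 0 := Zsqrtd.ext h1 h2
      rcases mul_eq_zero.mp h3 with h | h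
      · exact a5 (sub_eq_zero.mp h).symm
      · rw [star_eq_zero] at h; exact a6 (sub_eq_zero.mp h).symm
  · rintro ⟨⟨p, q⟩, r, s⟩ _ ⟨⟨p', q'⟩, r', s'⟩ _ h
    simp only [Prod.mk.injEq] at h ⊢
    tauto
  · rintro ⟨⟨p, q⟩, r, s⟩ h
    simp only [bx4, Finset.mem_filter, Finset.mem_product] at h
    obtain ⟨⟨⟨a1, a2⟩, a3, a4⟩, ⟨a5, a6, a7, a8⟩, a9⟩ := h
    refine ⟨((p, q), (s, r)), ?_, rfl⟩
    simp only [bx4, Finset.mem_filter, Finset.mem_product]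
    refine ⟨⟨⟨a1, a2⟩, a4, a3⟩, ⟨a5, a6.symm, ?_, ?_⟩, ?_⟩
    · rw [← neg_sub r s, star_neg, mul_neg, Zsqrtd.im_neg, a7, neg_zero]
    · rw [add_comm s r]; exact a8
    · have : ((q - p) * star (r - s)).re = -((q - p) * star (s - r)).re := by
          rw [← neg_sub s r, star_neg, mul_neg, Zsqrtd.re_neg]
      rw [this]; linarith

noncomputable def VV (m : ℕ) : Finset 𝔾 := by
  classical
  exact (((Finset.Icc (-(m : ℤ)) m) ×ˢ (Finset.Icc (-(m : ℤ)) m)).image (fun v => (⟨v.1, v.2⟩ : 𝔾))).filter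
    (fun ν => IsCoprime ν.re ν.im)

lemma mem_VV {m : ℕ} {z : 𝔾} : z ∈ VV m ↔ ((-(m : ℤ) ≤ z.re ∧ z.re ≤ m) ∧ -(m : ℤ) ≤ z.im ∧ z.im ≤ m) ∧
    IsCoprime z.re z.im := by
  classical
  unfold VV
  rw [Finset.mem_filter, Finset.mem_image]
  constructor
  · rintro ⟨⟨v, hv, rfl⟩, h⟩
    exact ⟨by simpa using hv, h⟩
  · intro h
    exact ⟨⟨(z.re, z.im), by simpa using h.1, rfl⟩, h.2⟩

lemma dir_bd {m : ℕ} {p q ν : 𝔾} (hp : p ∈ bx m) (hq : q ∈ bx m) (h : IsDir ν (q - p)) : ν ∈ VV m := by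
  rw [mem_bx] at hp hq
  obtain ⟨h1, j, hj, e⟩ := h
  have e1 : q.re - p.re = j * ν.re := by have := congrArg Zsqrtd.re e; simpa using this
  have e2 : q.im - p.im = j * ν.im := by have := congrArg Zsqrtd.im e; simpa using this
  rw [mem_VV]
  have key : ∀ x : ℤ, -(m : ℤ) ≤ j * x → j * x ≤ m → -(m : ℤ) ≤ x ∧ x ≤ m := by
    intro x h3 h4
    constructor
    · by_contra hc; push Not at hc; nlinarith
    · by_contra hc; push Not at hc; nlinarith
  exact ⟨⟨key _ (by linarith) (by linarith), key _ (by linarith) (by linarith)⟩, h1⟩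

lemma Wpos_eq (m : ℕ) : Wpos m = ∑ ν ∈ VV m, Wq m ν := by
  classical
  unfold Wpos Wq
  rw [← Finset.card_biUnion]
  · congr 1
    ext ⟨⟨p, q⟩, r, s⟩
    simp only [bx4, Finset.mem_filter, Finset.mem_product, Finset.mem_biUnion]
    constructor
    · rintro ⟨⟨⟨a1, a2⟩, a3, a4⟩, ⟨a5, a6, a7⟩, a9⟩
      obtain ⟨ν, hν⟩ := IsDir.exists (sub_ne_zero.mpr a5.symm)
      have := (sb_iff hν).mp ⟨a7, a6, a9⟩
      exact ⟨ν, dir_bd a1 a2 hν, ⟨⟨a1, a2⟩, a3, a4⟩, hν, this⟩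
    · rintro ⟨ν, _, ⟨⟨a1, a2⟩, a3, a4⟩, hν, h⟩
      obtain ⟨b1, b2, b3⟩ := (sb_iff hν).mpr h
      refine ⟨⟨⟨a1, a2⟩, a3, a4⟩, ⟨?_, b2, b1⟩, b3⟩
      rintro rfl
      rw [sub_self, zero_mul] at b3
      simp at b3
  · intro ν _ ν' _ hne
    rw [Function.onFun, Finset.disjoint_left]
    intro P h h'
    rw [Finset.mem_filter] at h h'
    exact hne (h.2.1.uniq h'.2.1)

lemma Wq_sym (m : ℕ) (T A : 𝔾 → 𝔾) (hT : ∀ z ∈ bx m, T z ∈ bx m) (hinj : Function.Injective T)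
    (hA : ∀ p q, T q - T p = A (q - p)) (hd : ∀ ν z, IsDir ν z → IsDir (A ν) (A z)) (c : 𝔾 → ℤ)
    (hc : ∀ ν p q, (star (A ν) * (T p + T q)).re = (star ν * (p + q)).re + c ν) (ν : 𝔾) :
    Wq m ν ≤ Wq m (A ν) := by
  classical
  unfold Wq
  apply Finset.card_le_card_of_injOn (fun P => ((T P.1.1, T P.1.2), (T P.2.1, T P.2.2)))
  · rintro ⟨⟨p, q⟩, r, s⟩ h
    simp only [bx4, Finset.coe_filter, Finset.mem_product, Set.mem_ofPred_eq] at h ⊢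
    obtain ⟨⟨⟨a1, a2⟩, a3, a4⟩, a5, a6, a7⟩ := h
    refine ⟨⟨⟨hT _ a1, hT _ a2⟩, hT _ a3, hT _ a4⟩, ?_, ?_, ?_⟩
    · rw [hA]; exact hd _ _ a5
    · rw [hA]; exact hd _ _ a6
    · rw [hc, hc, a7]
  · rintro ⟨⟨p, q⟩, r, s⟩ _ ⟨⟨p', q'⟩, r', s'⟩ _ h
    simp only [Prod.mk.injEq] at h ⊢
    exact ⟨⟨hinj h.1.1, hinj h.1.2⟩, hinj h.2.1, hinj h.2.2⟩

def grot (z : 𝔾) : 𝔾 := ⟨-z.im, z.re⟩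
def gswap (z : 𝔾) : 𝔾 := ⟨z.im, z.re⟩

lemma Wq_rot_le (m : ℕ) (ν : 𝔾) : Wq m ν ≤ Wq m (grot ν) := by
  apply Wq_sym m (fun z => ⟨m - z.im, z.re⟩) grot _ _ _ _ (fun ν => -2 * m * ν.im)
  · intro ν p q
    simp [grot]; ring
  · intro z hz
    rw [mem_bx] at hz ⊢
    simp only
    omega
  · intro z w h
    simp [Zsqrtd.ext_iff] at h
    ext <;> omega
  · intro p q
    ext <;> simp [grot]
  · rintro ν z ⟨h1, j, hj, rfl⟩
    refine ⟨?_, j, hj, ?_⟩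
    · simp only [grot]; exact (IsCoprime.neg_right h1).symm
    · ext <;> simp [grot]

lemma Wq_swap_le (m : ℕ) (ν : 𝔾) : Wq m ν ≤ Wq m (gswap ν) := by
  apply Wq_sym m gswap gswap _ _ _ _ (fun ν => 0)
  · intro ν p q
    simp [gswap]; ring
  · intro z hz
    rw [mem_bx] at hz ⊢
    simp only [gswap]
    omega
  · intro z w h
    simp [gswap, Zsqrtd.ext_iff] at h
    ext <;> omega
  · intro p q
    ext <;> simp [gswap]
  · rintro ν z ⟨h1, j, hj, rfl⟩
    refine ⟨?_, j, hj, ?_⟩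
    · simp only [gswap]; exact h1.symm
    · ext <;> simp [gswap]

lemma Wq_swap (m : ℕ) (ν : 𝔾) : Wq m (gswap ν) = Wq m ν := by
  apply le_antisymm
  · have := Wq_swap_le m (gswap ν)
    simpa [gswap] using this
  · exact Wq_swap_le m ν

lemma Wq_rot (m : ℕ) (ν : 𝔾) : Wq m (grot ν) = Wq m ν := by
  apply le_antisymm
  · have h1 := Wq_rot_le m (grot ν)
    have h2 := Wq_rot_le m (grot (grot ν))
    have h3 := Wq_rot_le m (grot (grot (grot ν)))
    have e : grot (grot (grot (grot ν))) = ν := by ext <;> simp [grot]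
    rw [e] at h3
    exact h1.trans (h2.trans h3)
  · exact Wq_rot_le m ν

open Classical in
noncomputable def Pf (m : ℕ) (ν : 𝔾) (s : ℤ) : Finset (𝔾 × 𝔾) := (bx m ×ˢ bx m).filter
  (fun P => IsDir ν (P.2 - P.1) ∧ (star ν * (P.1 + P.2)).re = s)

lemma card_Pf (m : ℕ) (a b s : ℤ) (ha : 1 ≤ a) (hb : 0 ≤ b) (hab : IsCoprime a b) :
    (Pf m ⟨a, b⟩ s).card = rp m a b s := by
  classical
  unfold rp cnt
  rw [← Finset.card_sigma]
  symm
  apply Finset.card_bij (fun (x : (_ : ℕ) × (ℤ × ℤ)) _ => ((⟨x.2.1, x.2.2⟩ : 𝔾),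
    (⟨x.2.1 + (x.1 + 1) * a, x.2.2 + (x.1 + 1) * b⟩ : 𝔾)))
  · rintro ⟨i, x, y⟩ h
    simp only [Finset.mem_sigma, Finset.mem_filter, Finset.mem_product, Finset.mem_Icc, Finset.mem_range] at h
    obtain ⟨_, ⟨⟨h1, h2⟩, h3, h4⟩, h5⟩ := h
    have k1 : 0 ≤ (i + 1 : ℤ) * a := by positivity
    have k2 : 0 ≤ (i + 1 : ℤ) * b := by positivity
    simp only [Pf, Finset.mem_filter, Finset.mem_product, mem_bx]
    refine ⟨⟨⟨⟨h1, by linarith⟩, h3, by linarith⟩, ⟨by linarith, by linarith⟩, by linarith, by linarith⟩, ⟨hab, i + 1, by omega, ?_⟩, ?_⟩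
    · ext <;> simp
    · simp; linarith
  · rintro ⟨i, x, y⟩ _ ⟨i', x', y'⟩ _ h
    simp only [Prod.mk.injEq, Zsqrtd.ext_iff] at h
    obtain ⟨⟨rfl, rfl⟩, h3, h4⟩ := h
    have : (i : ℤ) = i' := by
      have : (i - i' : ℤ) * a = 0 := by linarith
      rcases mul_eq_zero.mp this with h | h <;> omega
    have : i = i' := by exact_mod_cast this
    subst this; rfl
  · rintro ⟨p, q⟩ h
    simp only [Pf, Finset.mem_filter, Finset.mem_product, mem_bx] at h
    obtain ⟨⟨⟨⟨h1, h2⟩, h3, h4⟩, ⟨h5, h6⟩, h7, h8⟩, ⟨_, j, hj, e⟩, h9⟩ := h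
    have e1 : q.re - p.re = j * a := by have := congrArg Zsqrtd.re e; simpa using this
    have e2 : q.im - p.im = j * b := by have := congrArg Zsqrtd.im e; simpa using this
    have hjm : j ≤ m := by nlinarith
    have hj' : (((j - 1).toNat : ℕ) : ℤ) = j - 1 := Int.toNat_of_nonneg (by omega)
    refine ⟨⟨(j - 1).toNat, p.re, p.im⟩, ?_, ?_⟩
    · simp only [Finset.mem_sigma, Finset.mem_filter, Finset.mem_product, Finset.mem_Icc, Finset.mem_range]
      rw [hj']
      refine ⟨by omega, ⟨⟨h1, ?_⟩, h3, ?_⟩, ?_⟩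
      · linarith
      · linarith
      · simp at h9
        have e1' : q.re = p.re + j * a := by linarith
        have e2' : q.im = p.im + j * b := by linarith
        rw [e1', e2'] at h9
        linarith
    · simp only
      rw [hj']
      ext <;> simp <;> linarith

lemma Wq_eq (m : ℕ) (a b : ℤ) (ha : 1 ≤ a) (hb : 0 ≤ b) (hab : IsCoprime a b) : Wq m ⟨a, b⟩ = Wp m a b := by
  classical
  unfold Wq Wp
  set S := m * (a + b).toNat with hS
  have hSZ : (S : ℤ) = m * (a + b) := by
    rw [hS, Nat.cast_mul, Int.toNat_of_nonneg (by omega)]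
  have hfib := Finset.card_eq_sum_card_fiberwise (s := (bx4 m).filter
    (fun P => IsDir ⟨a, b⟩ (P.1.2 - P.1.1) ∧ IsDir ⟨a, b⟩ (P.2.2 - P.2.1) ∧
    (star (⟨a, b⟩ : 𝔾) * (P.1.1 + P.1.2)).re = (star (⟨a, b⟩ : 𝔾) * (P.2.1 + P.2.2)).re)) (t := range (2 * S + 1))
    (f := fun P => ((star (⟨a, b⟩ : 𝔾) * (P.1.1 + P.1.2)).re).toNat) (by
      rintro ⟨⟨p, q⟩, r, s⟩ h
      simp only [bx4, Finset.coe_filter, Finset.mem_product, mem_bx, Set.mem_ofPred_eq] at h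
      obtain ⟨⟨⟨⟨⟨h1, h2⟩, h3, h4⟩, ⟨h5, h6⟩, h7, h8⟩, _⟩, _⟩ := h
      simp only [Finset.coe_range, Set.mem_Iio]
      rw [Int.toNat_lt_of_ne_zero (by omega)]
      push_cast
      rw [hSZ]
      simp
      nlinarith)
  rw [hfib]
  apply Finset.sum_congr rfl
  intro s _
  rw [← card_Pf m a b s ha hb hab, sq, ← Finset.card_product]
  congr 1
  ext ⟨⟨p, q⟩, r, t⟩
  simp only [Finset.mem_filter, bx4, Pf, Finset.mem_product]
  have key : p ∈ bx m → q ∈ bx m → (((star (⟨a, b⟩ : 𝔾) * (p + q)).re).toNat = s ↔ (star (⟨a, b⟩ : 𝔾) * (p + q)).re = s) := by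
    intro hp hq
    rw [mem_bx] at hp hq
    have : 0 ≤ (star (⟨a, b⟩ : 𝔾) * (p + q)).re := by
      have h1 : 0 ≤ a * (p.re + q.re) := by
        have : 0 ≤ p.re + q.re := by linarith
        positivity
      have h2 : 0 ≤ b * (p.im + q.im) := by
        have : 0 ≤ p.im + q.im := by linarith
        positivity
      simp; linarith
    omega
  constructor
  · rintro ⟨⟨⟨⟨a1, a2⟩, a3⟩, a4, a5, a6⟩, a7⟩
    have := (key a1 a2).mp a7
    exact ⟨⟨⟨a1, a2⟩, a4, this⟩, a3, a5, a6 ▸ this⟩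
  · rintro ⟨⟨⟨a1, a2⟩, a4, a7⟩, a3, a5, a6⟩
    exact ⟨⟨⟨⟨a1, a2⟩, a3⟩, a4, a5, by rw [a6, a7]⟩, (key a1 a2).mpr a7⟩

lemma Wpos_four (m : ℕ) : Wpos m = 4 * ∑ ν ∈ (VV m).filter (fun ν => 0 < ν.re ∧ 0 ≤ ν.im), Wq m ν := by
  classical
  rw [Wpos_eq]
  have rot : ∀ (P Q : 𝔾 → Prop) [DecidablePred P] [DecidablePred Q], (∀ ν, P ν ↔ Q (grot ν)) →
      ∑ ν ∈ (VV m).filter P, Wq m ν = ∑ ν ∈ (VV m).filter Q, Wq m ν := by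
    intro P Q _ _ h
    apply Finset.sum_bij (fun ν _ => grot ν)
    · intro ν hν
      rw [Finset.mem_filter, mem_VV] at hν ⊢
      refine ⟨⟨?_, ?_⟩, (h ν).mp hν.2⟩
      · simp only [grot]; omega
      · simp only [grot]; exact (IsCoprime.neg_right hν.1.2).symm
    · intro ν _ ν' _ h
      simp only [grot, Zsqrtd.ext_iff] at h
      ext <;> omega
    · intro ν hν
      have e : grot ⟨ν.im, -ν.re⟩ = ν := by ext <;> simp [grot]
      refine ⟨⟨ν.im, -ν.re⟩, ?_, e⟩
      rw [Finset.mem_filter, mem_VV] at hν ⊢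
      refine ⟨⟨?_, ?_⟩, (h _).mpr (by rw [e]; exact hν.2)⟩
      · simp only; omega
      · simp only; exact (IsCoprime.neg_left hν.1.2).symm
    · intro ν _
      exact (Wq_rot m ν).symm
  have r1 := rot (fun ν => 0 < ν.re ∧ 0 ≤ ν.im) (fun ν => ν.re ≤ 0 ∧ 0 < ν.im) (by
    intro ν; simp only [grot]; omega)
  have r2 := rot (fun ν => ν.re ≤ 0 ∧ 0 < ν.im) (fun ν => ν.re < 0 ∧ ν.im ≤ 0) (by
    intro ν; simp only [grot]; omega)
  have r3 := rot (fun ν => ν.re < 0 ∧ ν.im ≤ 0) (fun ν => 0 ≤ ν.re ∧ ν.im < 0) (by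
    intro ν; simp only [grot]; omega)
  have e : ∑ ν ∈ VV m, Wq m ν = ∑ ν ∈ (VV m).filter (fun ν => 0 < ν.re ∧ 0 ≤ ν.im), Wq m ν +
      ∑ ν ∈ (VV m).filter (fun ν => ν.re ≤ 0 ∧ 0 < ν.im), Wq m ν +
      ∑ ν ∈ (VV m).filter (fun ν => ν.re < 0 ∧ ν.im ≤ 0), Wq m ν +
      ∑ ν ∈ (VV m).filter (fun ν => 0 ≤ ν.re ∧ ν.im < 0), Wq m ν := by
    simp only [Finset.sum_filter]
    rw [← Finset.sum_add_distrib, ← Finset.sum_add_distrib, ← Finset.sum_add_distrib]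
    apply Finset.sum_congr rfl
    intro ν hν
    rw [mem_VV] at hν
    have h0 : ν.re ≠ 0 ∨ ν.im ≠ 0 := by
      by_contra h; push Not at h
      exact coprime_ne_zero hν.2 (by ext <;> simp [h.1, h.2])
    split_ifs <;> omega
  rw [e, ← r3, ← r2, ← r1]; ring

noncomputable def Tsum (m : ℕ) : ℕ :=
  ∑ a ∈ range (m + 1), ∑ b ∈ (Finset.Ico 1 a).filter (fun b => Nat.gcd a b = 1), Wp m a b

lemma Wpos_main (m : ℕ) (hm : 1 ≤ m) : Wpos m = 4 * (Wp m 1 0 + Wp m 1 1 + 2 * Tsum m) := by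
  classical
  rw [Wpos_four]
  congr 1
  have e : ∑ ν ∈ (VV m).filter (fun ν => 0 < ν.re ∧ 0 ≤ ν.im), Wq m ν =
      ∑ ν ∈ (VV m).filter (fun ν => 0 < ν.re ∧ ν.im = 0), Wq m ν +
      ∑ ν ∈ (VV m).filter (fun ν => 0 < ν.re ∧ ν.im = ν.re), Wq m ν +
      (∑ ν ∈ (VV m).filter (fun ν => 0 < ν.im ∧ ν.im < ν.re), Wq m ν +
      ∑ ν ∈ (VV m).filter (fun ν => 0 < ν.re ∧ ν.re < ν.im), Wq m ν) := by
    simp only [Finset.sum_filter]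
    rw [← Finset.sum_add_distrib, ← Finset.sum_add_distrib, ← Finset.sum_add_distrib]
    apply Finset.sum_congr rfl
    intro ν hν
    split_ifs <;> omega
  have e1 : (VV m).filter (fun ν => 0 < ν.re ∧ ν.im = 0) = {⟨1, 0⟩} := by
    ext ν
    rw [Finset.mem_filter, mem_VV, Finset.mem_singleton]
    constructor
    · rintro ⟨⟨_, h⟩, h1, h2⟩
      rw [h2, isCoprime_zero_right, Int.isUnit_iff] at h
      ext <;> simp <;> omega
    · rintro rfl
      simp only
      exact ⟨⟨by omega, isCoprime_one_left⟩, by omega, trivial⟩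
  have e2 : (VV m).filter (fun ν => 0 < ν.re ∧ ν.im = ν.re) = {⟨1, 1⟩} := by
    ext ν
    rw [Finset.mem_filter, mem_VV, Finset.mem_singleton]
    constructor
    · rintro ⟨⟨_, h⟩, h1, h2⟩
      rw [h2, isCoprime_self, Int.isUnit_iff] at h
      ext <;> simp <;> omega
    · rintro rfl
      simp only
      exact ⟨⟨by omega, isCoprime_one_left⟩, by omega, trivial⟩
  have e3 : ∑ ν ∈ (VV m).filter (fun ν => 0 < ν.re ∧ ν.re < ν.im), Wq m ν =
      ∑ ν ∈ (VV m).filter (fun ν => 0 < ν.im ∧ ν.im < ν.re), Wq m ν := by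
    apply Finset.sum_bij (fun ν _ => gswap ν)
    · intro ν hν
      rw [Finset.mem_filter, mem_VV] at hν ⊢
      refine ⟨⟨?_, ?_⟩, ?_⟩
      · simp only [gswap]; omega
      · simp only [gswap]; exact hν.1.2.symm
      · simp only [gswap]; omega
    · intro ν _ ν' _ h
      simp only [gswap, Zsqrtd.ext_iff] at h
      ext <;> omega
    · intro ν hν
      refine ⟨gswap ν, ?_, by simp [gswap]⟩
      rw [Finset.mem_filter, mem_VV] at hν ⊢
      refine ⟨⟨?_, ?_⟩, ?_⟩
      · simp only [gswap]; omega
      · simp only [gswap]; exact hν.1.2.symm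
      · simp only [gswap]; omega
    · intro ν _
      exact (Wq_swap m ν).symm
  have e4 : ∑ ν ∈ (VV m).filter (fun ν => 0 < ν.im ∧ ν.im < ν.re), Wq m ν = Tsum m := by
    unfold Tsum
    rw [Finset.sum_sigma']
    symm
    apply Finset.sum_bij (fun (x : (_ : ℕ) × ℕ) _ => (⟨x.1, x.2⟩ : 𝔾))
    · rintro ⟨a, b⟩ h
      simp only [Finset.mem_sigma, Finset.mem_filter, Finset.mem_Ico, Finset.mem_range, mem_VV] at h ⊢
      refine ⟨⟨by omega, ?_⟩, by omega, by omega⟩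
      exact Nat.isCoprime_iff_coprime.mpr h.2.2
    · rintro ⟨a, b⟩ _ ⟨a', b'⟩ _ h
      simp only [Zsqrtd.ext_iff, Nat.cast_inj] at h
      obtain ⟨rfl, rfl⟩ := h; rfl
    · intro ν hν
      rw [Finset.mem_filter, mem_VV] at hν
      have a1 : ((ν.re.toNat : ℕ) : ℤ) = ν.re := Int.toNat_of_nonneg (by omega)
      have a2 : ((ν.im.toNat : ℕ) : ℤ) = ν.im := Int.toNat_of_nonneg (by omega)
      refine ⟨⟨ν.re.toNat, ν.im.toNat⟩, ?_, ?_⟩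
      · simp only [Finset.mem_sigma, Finset.mem_filter, Finset.mem_Ico, Finset.mem_range]
        refine ⟨by omega, by omega, ?_⟩
        have := hν.1.2
        rw [← a1, ← a2, Nat.isCoprime_iff_coprime] at this
        exact this
      · ext <;> simp <;> omega
    · rintro ⟨a, b⟩ h
      simp only [Finset.mem_sigma, Finset.mem_filter, Finset.mem_Ico, Finset.mem_range] at h ⊢
      exact (Wq_eq m a b (by omega) (by omega) (Nat.isCoprime_iff_coprime.mpr h.2.2)).symm
  rw [e, e1, e2, e3, e4, Finset.sum_singleton, Finset.sum_singleton, Wq_eq m 1 0 le_rfl le_rfl isCoprime_one_left,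
    Wq_eq m 1 1 le_rfl zero_le_one isCoprime_one_left]
  ring

/-! ### Asymptotics of the main term -/

lemma fab_abs {a b : ℕ} (hb : 0 < b) (hab : b < a) : |fab a b| ≤ 1 / (2 * (a : ℝ) ^ 3) := by
  have hb' : (0 : ℝ) < b := by exact_mod_cast hb
  have hab' : (b : ℝ) < a := by exact_mod_cast hab
  unfold fab
  generalize (b : ℝ) = b at *
  generalize (a : ℝ) = a at *
  have ha : 0 < a := by linarith
  rw [abs_div, abs_of_pos (by positivity : 0 < 240 * a ^ 5 * (a + b) ^ 2 * (a ^ 2 + b ^ 2)),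
    div_le_div_iff₀ (by positivity) (by positivity)]
  have hp : ∀ i j : ℕ, i + j = 6 → |a ^ i * b ^ j| ≤ a ^ 6 := by
    intro i j h
    rw [abs_of_nonneg (by positivity), ← h, pow_add]
    gcongr
  have h1 : |20 * a ^ 6 + 25 * a ^ 5 * b - 7 * a ^ 4 * b ^ 2 + 28 * a ^ 3 * b ^ 3 - 20 * a ^ 2 * b ^ 4 + 3 * a * b ^ 5 - b ^ 6|
      ≤ 104 * a ^ 6 := by
    have p1 := abs_le.mp (hp 5 1 rfl)
    have p2 := abs_le.mp (hp 4 2 rfl)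
    have p3 := abs_le.mp (hp 3 3 rfl)
    have p4 := abs_le.mp (hp 2 4 rfl)
    have p5 := abs_le.mp (hp 1 5 rfl)
    have p6 := abs_le.mp (hp 0 6 rfl)
    simp only [pow_one, pow_zero, one_mul] at p1 p2 p3 p4 p5 p6
    have p0 : 0 ≤ a ^ 6 := by positivity
    rw [abs_le]
    constructor <;> linarith [p1.1, p1.2, p2.1, p2.2, p3.1, p3.2, p4.1, p4.2, p5.1, p5.2, p6.1, p6.2]
  have h2 : a ^ 2 * a ^ 2 ≤ (a + b) ^ 2 * (a ^ 2 + b ^ 2) := by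
    gcongr
    · linarith
    · nlinarith
  calc _ ≤ 104 * a ^ 6 * (2 * a ^ 3) := by gcongr
    _ ≤ 240 * a ^ 5 * (a ^ 2 * a ^ 2) := by
      have : 0 ≤ a ^ 9 := by positivity
      nlinarith
    _ ≤ 240 * a ^ 5 * ((a + b) ^ 2 * (a ^ 2 + b ^ 2)) := by gcongr
    _ = _ := by ring

noncomputable def gterm (a : ℕ) : ℝ := ∑ b ∈ (Finset.Ico 1 a).filter (fun b => Nat.gcd a b = 1),
    2 * (3 + (-1 : ℝ) ^ (a + b)) * fab a b

lemma gterm_abs (a : ℕ) : |gterm a| ≤ 4 * ((a : ℝ) ^ 2)⁻¹ := by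
  rcases Nat.eq_zero_or_pos a with rfl | ha
  · simp [gterm]
  have ha' : (0 : ℝ) < a := by exact_mod_cast ha
  unfold gterm
  apply (Finset.abs_sum_le_sum_abs _ _).trans
  have : ∀ b ∈ (Finset.Ico 1 a).filter (fun b => Nat.gcd a b = 1), |2 * (3 + (-1 : ℝ) ^ (a + b)) * fab a b| ≤ 4 / (a : ℝ) ^ 3 := by
    intro b hb
    rw [Finset.mem_filter, Finset.mem_Ico] at hb
    rw [abs_mul]
    have h1 : |2 * (3 + (-1 : ℝ) ^ (a + b))| ≤ 8 := by
      rcases neg_one_pow_eq_or ℝ (a + b) with h | h <;> rw [h] <;> norm_num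
    calc _ ≤ 8 * (1 / (2 * (a : ℝ) ^ 3)) := by
          gcongr; exact fab_abs (by omega) (by omega)
      _ = _ := by field_simp; norm_num
  apply (Finset.sum_le_sum this).trans
  rw [Finset.sum_const, nsmul_eq_mul]
  have hc : (((Finset.Ico 1 a).filter (fun b => Nat.gcd a b = 1)).card : ℝ) ≤ a := by
    have h1 := Finset.card_filter_le (Finset.Ico 1 a) (fun b => Nat.gcd a b = 1)
    rw [Nat.card_Ico] at h1
    exact_mod_cast (by omega)
  calc _ ≤ (a : ℝ) * (4 / (a : ℝ) ^ 3) := by gcongr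
    _ = _ := by field_simp

lemma gterm_summable : Summable gterm := by
  apply Summable.of_norm_bounded (g := fun a : ℕ => 4 * ((a : ℝ) ^ 2)⁻¹)
  · exact (Real.summable_nat_pow_inv.mpr (by norm_num)).mul_left 4
  · intro a; exact gterm_abs a

lemma gterm_tail (m : ℕ) (hm : 1 ≤ m) : |∑ a ∈ range (m + 1), gterm a - ∑' a, gterm a| ≤ 4 / m := by
  have ht := gterm_summable.hasSum.tendsto_sum_nat
  have ht2 := ((tendsto_const_nhds (x := ∑ a ∈ range (m + 1), gterm a)).sub ht).abs
  apply le_of_tendsto ht2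
  filter_upwards [Filter.eventually_ge_atTop (m + 1)] with N hN
  rw [abs_sub_comm, ← Finset.sum_Ico_eq_sub _ hN]
  apply (Finset.abs_sum_le_sum_abs _ _).trans
  apply (Finset.sum_le_sum (fun a _ => gterm_abs a)).trans
  rw [← Finset.mul_sum, div_eq_mul_inv]
  gcongr
  have h1 := sum_Ioc_inv_sq_le_sub (α := ℝ) (k := m) (n := N - 1) (by omega) (by omega)
  have h2 : Finset.Ico (m + 1) N = Finset.Ioc m (N - 1) := by
    ext x; simp only [Finset.mem_Ico, Finset.mem_Ioc]; omega
  rw [h2]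
  have h3 : (0 : ℝ) ≤ (((N - 1 : ℕ) : ℝ))⁻¹ := by positivity
  linarith

lemma harm (m : ℕ) (hm : 1 ≤ m) : ∑ a ∈ range (m + 1), ((a : ℝ))⁻¹ ≤ 2 * Real.sqrt m := by
  have h1 := harmonic_le_one_add_log m
  have h2 : ∑ a ∈ range (m + 1), ((a : ℝ))⁻¹ = ((harmonic m : ℚ) : ℝ) := by
    rw [Finset.sum_range_succ', harmonic]
    push_cast; simp
  have hm' : (1 : ℝ) ≤ m := by exact_mod_cast hm
  have h3 : Real.log m = 2 * Real.log (Real.sqrt m) := by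
    rw [Real.log_sqrt (by linarith)]; ring
  have h4 : 0 < Real.sqrt m := Real.sqrt_pos.mpr (by linarith)
  have h5 := Real.log_le_sub_one_of_pos h4
  rw [h2]; linarith

lemma qq_eq (a b : ℕ) : (4 : ℝ) / (qq a b) * 2 = 2 * (3 + (-1 : ℝ) ^ (a + b)) := by
  have h : ((a : ℤ) ^ 2 + (b : ℤ) ^ 2) % 2 = ((a + b : ℕ) : ℤ) % 2 := by
    have h1 : ((a : ℤ) ^ 2 + (b : ℤ) ^ 2) = ((a + b : ℕ) : ℤ) * ((a + b : ℕ) : ℤ) - 2 * (a * b) := by push_cast; ring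
    rw [h1]
    rcases Int.emod_two_eq_zero_or_one ((a + b : ℕ) : ℤ) with h | h
    · obtain ⟨k, hk⟩ : ∃ k, ((a + b : ℕ) : ℤ) = 2 * k := ⟨((a + b : ℕ) : ℤ) / 2, by omega⟩
      rw [hk]
      have : 2 * k * (2 * k) - 2 * (a * b : ℤ) = 2 * (2 * k * k - a * b) := by ring
      omega
    · obtain ⟨k, hk⟩ : ∃ k, ((a + b : ℕ) : ℤ) = 2 * k + 1 := ⟨((a + b : ℕ) : ℤ) / 2, by omega⟩
      rw [hk]
      have : (2 * k + 1) * (2 * k + 1) - 2 * (a * b : ℤ) = 2 * (2 * k * k + 2 * k - a * b) + 1 := by ring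
      omega
  unfold qq
  rw [h]
  rcases Nat.even_or_odd (a + b) with he | ho
  · rw [if_neg (by rw [Nat.even_iff] at he; omega), he.neg_one_pow]; norm_num
  · rw [if_pos (by rw [Nat.odd_iff] at ho; omega), ho.neg_one_pow]; norm_num

lemma Tsum_est (m : ℕ) (hm : 1 ≤ m) :
    |2 * (Tsum m : ℝ) - (∑ a ∈ range (m + 1), gterm a) * (m : ℝ) ^ 5| ≤ 172 * (m : ℝ) ^ 4 * Real.sqrt m := by
  unfold Tsum gterm
  push_cast
  rw [Finset.mul_sum, Finset.sum_mul, ← Finset.sum_sub_distrib]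
  apply (Finset.abs_sum_le_sum_abs _ _).trans
  have : ∀ a ∈ range (m + 1), |2 * ∑ b ∈ (Finset.Ico 1 a).filter (fun b => Nat.gcd a b = 1), (Wp m a b : ℝ) -
      (∑ b ∈ (Finset.Ico 1 a).filter (fun b => Nat.gcd a b = 1), 2 * (3 + (-1 : ℝ) ^ (a + b)) * fab a b) * (m : ℝ) ^ 5|
      ≤ 86 * (m : ℝ) ^ 4 * ((a : ℝ))⁻¹ := by
    intro a ham
    rw [Finset.mem_range] at ham
    rcases Nat.eq_zero_or_pos a with rfl | ha
    · simp
    have ha' : (0 : ℝ) < a := by exact_mod_cast ha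
    rw [Finset.mul_sum, Finset.sum_mul, ← Finset.sum_sub_distrib]
    apply (Finset.abs_sum_le_sum_abs _ _).trans
    have hb : ∀ b ∈ (Finset.Ico 1 a).filter (fun b => Nat.gcd a b = 1),
        |2 * (Wp m a b : ℝ) - 2 * (3 + (-1 : ℝ) ^ (a + b)) * fab a b * (m : ℝ) ^ 5| ≤ 86 * (m : ℝ) ^ 4 / a ^ 2 := by
      intro b hb
      rw [Finset.mem_filter, Finset.mem_Ico] at hb
      have h1 := Wp_est (m := m) (a := a) (b := b) (by omega) (by omega) (by omega) (Nat.isCoprime_iff_coprime.mpr hb.2)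
      push_cast at h1
      rw [int_In (by positivity) (by omega) (by omega)] at h1
      rw [← qq_eq a b, show 2 * (Wp m a b : ℝ) - 4 / (qq a b : ℝ) * 2 * fab a b * (m : ℝ) ^ 5 =
        2 * ((Wp m a b : ℝ) - 4 * fab a b * (m : ℝ) ^ 5 / (qq a b : ℝ)) by ring, abs_mul, abs_two]
      calc _ ≤ 2 * (43 * (m : ℝ) ^ 4 / a ^ 2) := by gcongr
        _ = _ := by ring
    apply (Finset.sum_le_sum hb).trans
    rw [Finset.sum_const, nsmul_eq_mul]
    have hc : (((Finset.Ico 1 a).filter (fun b => Nat.gcd a b = 1)).card : ℝ) ≤ a := by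
      have h1 := Finset.card_filter_le (Finset.Ico 1 a) (fun b => Nat.gcd a b = 1)
      rw [Nat.card_Ico] at h1
      exact_mod_cast (by omega)
    calc _ ≤ (a : ℝ) * (86 * (m : ℝ) ^ 4 / a ^ 2) := by gcongr
      _ = _ := by field_simp
  apply (Finset.sum_le_sum this).trans
  rw [← Finset.mul_sum]
  calc _ ≤ 86 * (m : ℝ) ^ 4 * (2 * Real.sqrt m) := by gcongr; exact harm m hm
    _ = _ := by ring

lemma Wall_est (m : ℕ) (hm : 1 ≤ m) :
    |(Wall m : ℝ) / 8 - gammaConst * (m : ℝ) ^ 5| ≤ 250 * (m : ℝ) ^ 4 * Real.sqrt m := by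
  have hm' : (1 : ℝ) ≤ m := by exact_mod_cast hm
  have e1 : (Wall m : ℝ) / 8 = Wp m 1 0 + Wp m 1 1 + 2 * Tsum m := by
    rw [Wall_eq, Wpos_main m hm]; push_cast; ring
  have h1 := Wp10 m hm
  have h2 := Wp_est (m := m) (a := 1) (b := 1) (by norm_num) le_rfl (by omega) isCoprime_one_left
  have hq : qq 1 1 = 1 := by simp [qq]
  rw [hq] at h2
  push_cast at h2
  rw [int_In_one (by linarith)] at h2
  have h3 := Tsum_est m hm
  have h4 := gterm_tail m hm
  have eg : gammaConst = 4 / 15 + ∑' a, gterm a := rfl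
  rw [e1, eg]
  set X := ∑ a ∈ range (m + 1), gterm a
  set Y := ∑' a, gterm a
  have h5 : |(X - Y) * (m : ℝ) ^ 5| ≤ 4 * (m : ℝ) ^ 4 := by
    rw [abs_mul, abs_of_nonneg (by positivity : (0 : ℝ) ≤ (m : ℝ) ^ 5)]
    calc _ ≤ 4 / (m : ℝ) * (m : ℝ) ^ 5 := by gcongr
      _ = _ := by field_simp
  have hs : 1 ≤ Real.sqrt m := Real.one_le_sqrt.mpr hm'
  have h6 : (m : ℝ) ^ 4 ≤ (m : ℝ) ^ 4 * Real.sqrt m := le_mul_of_one_le_right (by positivity) hs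
  norm_num at h2
  rw [abs_le] at *
  constructor <;> linarith [h1.1, h1.2, h2.1, h2.2, h3.1, h3.2, h5.1, h5.2]

/-! ### Elementary geometry of circles through Gaussian integers -/

def OnC (cx cy R : ℝ) (z : 𝔾) : Prop := ((z.re : ℝ) - cx) ^ 2 + ((z.im : ℝ) - cy) ^ 2 = R

lemma sb_swap34 {a b c d : 𝔾} (h : SB a b c d) : SB a b d c := by
  obtain ⟨h1, h2⟩ := h
  simp only [SB, Zsqrtd.im_mul, Zsqrtd.re_mul, Zsqrtd.re_star, Zsqrtd.im_star, Zsqrtd.re_sub,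
    Zsqrtd.im_sub, Zsqrtd.re_add, Zsqrtd.im_add] at h1 h2 ⊢
  exact ⟨by linear_combination -h1, by linear_combination h2⟩

lemma sb_swap12 {a b c d : 𝔾} (h : SB a b c d) : SB b a c d := by
  obtain ⟨h1, h2⟩ := h
  simp only [SB, Zsqrtd.im_mul, Zsqrtd.re_mul, Zsqrtd.re_star, Zsqrtd.im_star, Zsqrtd.re_sub,
    Zsqrtd.im_sub, Zsqrtd.re_add, Zsqrtd.im_add] at h1 h2 ⊢
  exact ⟨by linear_combination -h1, by linear_combination -h2⟩

lemma gsq_ne {a b : 𝔾} (h : a ≠ b) : (a.re - b.re) ^ 2 + (a.im - b.im) ^ 2 ≠ 0 := by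
  intro h0
  apply h
  ext <;> nlinarith [sq_nonneg (a.re - b.re), sq_nonneg (a.im - b.im)]

lemma sb_opp {a b c d : 𝔾} (hab : a ≠ b) (h : SB a b c d) : SB c d a b := by
  obtain ⟨h1, h2⟩ := h
  simp only [SB, Zsqrtd.im_mul, Zsqrtd.re_mul, Zsqrtd.re_star, Zsqrtd.im_star, Zsqrtd.re_sub,
    Zsqrtd.im_sub, Zsqrtd.re_add, Zsqrtd.im_add] at h1 h2 ⊢
  refine ⟨by linear_combination -h1, ?_⟩
  apply mul_left_cancel₀ (gsq_ne hab)
  linear_combination (-((a.re - b.re) * (c.re - d.re) + (a.im - b.im) * (c.im - d.im))) * h2 +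
     ((c.im + d.im - a.im - b.im) * (a.re - b.re) - (c.re + d.re - a.re - b.re) * (a.im - b.im)) * h1

/-- the fourth point is determined -/
lemma sb_det {a b c d d' : 𝔾} (hab : a ≠ b) (h : SB a b c d) (h' : SB a b c d') : d = d' := by
  obtain ⟨h1, h2⟩ := h
  obtain ⟨h3, h4⟩ := h'
  simp only [Zsqrtd.im_mul, Zsqrtd.re_mul, Zsqrtd.re_star, Zsqrtd.im_star, Zsqrtd.re_sub,
    Zsqrtd.im_sub, Zsqrtd.re_add, Zsqrtd.im_add] at h1 h2 h3 h4
  ext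
  · apply mul_left_cancel₀ (gsq_ne hab)
    linear_combination (a.re - b.re) * (h2 - h4) + (a.im - b.im) * (h3 - h1)
  · apply mul_left_cancel₀ (gsq_ne hab)
    linear_combination (a.im - b.im) * (h2 - h4) - (a.re - b.re) * (h3 - h1)

lemma onc_ncol {cx cy R : ℝ} {a b c : 𝔾} (ha : OnC cx cy R a) (hb : OnC cx cy R b)
    (hc : OnC cx cy R c) (hab : a ≠ b) (hac : a ≠ c) (hbc : b ≠ c) :
    ((a - b) * star (b - c)).im ≠ 0 := by
  intro h
  simp only [Zsqrtd.im_mul, Zsqrtd.re_star, Zsqrtd.im_star, Zsqrtd.re_sub, Zsqrtd.im_sub] at h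
  have h' : ((a.re : ℝ) - b.re) * (-((b.im : ℝ) - c.im)) + (a.im - b.im) * (b.re - c.re) = 0 := by
    exact_mod_cast h
  unfold OnC at ha hb hc
  have e1 : ((a.re - b.re) ^ 2 + (a.im - b.im) ^ 2 : ℝ) ≠ 0 := by exact_mod_cast gsq_ne hab
  have e2 : ((a.re - c.re) ^ 2 + (a.im - c.im) ^ 2 : ℝ) ≠ 0 := by exact_mod_cast gsq_ne hac
  have e3 : ((b.re - c.re) ^ 2 + (b.im - c.im) ^ 2 : ℝ) ≠ 0 := by exact_mod_cast gsq_ne hbc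
  generalize (a.re : ℝ) = a1 at *
  generalize (a.im : ℝ) = a2 at *
  generalize (b.re : ℝ) = b1 at *
  generalize (b.im : ℝ) = b2 at *
  generalize (c.re : ℝ) = c1 at *
  generalize (c.im : ℝ) = c2 at *
  have g1 : (b1 - c1) * (a1 + b1 - 2 * cx) + (b2 - c2) * (a2 + b2 - 2 * cy) = 0 := by
    apply mul_left_cancel₀ e1
    linear_combination ((a1 - b1) * (b1 - c1) + (a2 - b2) * (b2 - c2)) * (ha - hb) +
      ((a2 - b2) * (a1 + b1 - 2 * cx) - (a1 - b1) * (a2 + b2 - 2 * cy)) * h'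
  have g2 : (b1 - c1) * (a1 - c1) + (b2 - c2) * (a2 - c2) = 0 := by
    linear_combination g1 - (hb - hc)
  apply mul_ne_zero e2 e3
  linear_combination ((b1 - c1) * (a1 - c1) + (b2 - c2) * (a2 - c2)) * g2 +
    ((a1 - b1) * (-(b2 - c2)) + (a2 - b2) * (b1 - c1)) * h'

lemma onc_conc {cx cy R : ℝ} {a b c d : 𝔾} (ha : OnC cx cy R a) (hb : OnC cx cy R b)
    (hc : OnC cx cy R c) (hd : OnC cx cy R d) :
    ((b - a) * (d - c) * star ((c - a) * (d - b))).im = 0 := by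
  unfold OnC at ha hb hc hd
  simp only [Zsqrtd.im_mul, Zsqrtd.re_mul, Zsqrtd.re_star, Zsqrtd.im_star, Zsqrtd.re_sub, Zsqrtd.im_sub]
  suffices h : (((b.re - a.re) * (d.re - c.re) + -1 * (b.im - a.im) * (d.im - c.im)) *
      (-((c.re - a.re) * (d.im - b.im) + (c.im - a.im) * (d.re - b.re))) +
      ((b.re - a.re) * (d.im - c.im) + (b.im - a.im) * (d.re - c.re)) *
      ((c.re - a.re) * (d.re - b.re) + -1 * (c.im - a.im) * (d.im - b.im)) : ℝ) = 0 by
    exact_mod_cast h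
  generalize (a.re : ℝ) = a1 at *
  generalize (a.im : ℝ) = a2 at *
  generalize (b.re : ℝ) = b1 at *
  generalize (b.im : ℝ) = b2 at *
  generalize (c.re : ℝ) = c1 at *
  generalize (c.im : ℝ) = c2 at *
  generalize (d.re : ℝ) = d1 at *
  generalize (d.im : ℝ) = d2 at *
  linear_combination -((b1 - a1) * (c2 - a2) - (b2 - a2) * (c1 - a1)) * (hd - ha) -
    ((c1 - a1) * (d2 - a2) - (c2 - a2) * (d1 - a1)) * (hb - ha) -
    ((d1 - a1) * (b2 - a2) - (d2 - a2) * (b1 - a1)) * (hc - ha)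

lemma onc_of_sb {a b c d : 𝔾} (hab : a ≠ b) (h : SB a b c d)
    (hn : ((b - a) * star (c - a)).im ≠ 0) :
    ∃ cx cy R, OnC cx cy R a ∧ OnC cx cy R b ∧ OnC cx cy R c ∧ OnC cx cy R d := by
  obtain ⟨h1, h2⟩ := h
  simp only [Zsqrtd.im_mul, Zsqrtd.re_mul, Zsqrtd.re_star, Zsqrtd.im_star, Zsqrtd.re_sub,
    Zsqrtd.im_sub, Zsqrtd.re_add, Zsqrtd.im_add] at h1 h2 hn
  have h1' : ((a.re : ℝ) - b.re) * (-((c.im : ℝ) - d.im)) + (a.im - b.im) * (c.re - d.re) = 0 := by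
    exact_mod_cast h1
  have h2' : ((c.re : ℝ) + d.re - a.re - b.re) * (a.re - b.re) + -1 * (c.im + d.im - a.im - b.im) * -(a.im - b.im) = 0 := by
    exact_mod_cast h2
  have hn' : ((b.re : ℝ) - a.re) * (-((c.im : ℝ) - a.im)) + (b.im - a.im) * (c.re - a.re) ≠ 0 := by
    exact_mod_cast hn
  have e1 : ((a.re - b.re) ^ 2 + (a.im - b.im) ^ 2 : ℝ) ≠ 0 := by exact_mod_cast gsq_ne hab
  unfold OnC
  generalize (a.re : ℝ) = a1 at *
  generalize (a.im : ℝ) = a2 at *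
  generalize (b.re : ℝ) = b1 at *
  generalize (b.im : ℝ) = b2 at *
  generalize (c.re : ℝ) = c1 at *
  generalize (c.im : ℝ) = c2 at *
  generalize (d.re : ℝ) = d1 at *
  generalize (d.im : ℝ) = d2 at *
  set Δ := (b1 - a1) * (-(c2 - a2)) + (b2 - a2) * (c1 - a1) with hΔ
  set p := (b1 - a1) ^ 2 + (b2 - a2) ^ 2 with hp
  set q := (c1 - a1) ^ 2 + (c2 - a2) ^ 2 with hq
  obtain ⟨w1, hw1⟩ : ∃ w1, w1 * (2 * Δ) = -p * (c2 - a2) + q * (b2 - a2) := ⟨(-p * (c2 - a2) + q * (b2 - a2)) / (2 * Δ), by field_simp⟩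
  obtain ⟨w2, hw2⟩ : ∃ w2, w2 * (2 * Δ) = p * (c1 - a1) - q * (b1 - a1) := ⟨(p * (c1 - a1) - q * (b1 - a1)) / (2 * Δ), by field_simp⟩
  have f1 : 2 * ((b1 - a1) * w1 + (b2 - a2) * w2) = p := by
    apply mul_left_cancel₀ hn'
    linear_combination (b1 - a1) * hw1 + (b2 - a2) * hw2 - p * hΔ
  have f2 : 2 * ((c1 - a1) * w1 + (c2 - a2) * w2) = q := by
    apply mul_left_cancel₀ hn'
    linear_combination (c1 - a1) * hw1 + (c2 - a2) * hw2 - q * hΔ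
  refine ⟨a1 + w1, a2 + w2, w1 ^ 2 + w2 ^ 2, by ring, ?_, ?_, ?_⟩
  · linear_combination -f1 + hp
  · linear_combination -f2 + hq
  · have key : (d1 - c1) * (d1 + c1 - 2 * (a1 + w1)) + (d2 - c2) * (d2 + c2 - 2 * (a2 + w2)) = 0 := by
      apply mul_left_cancel₀ e1
      have g : (d1 + c1 - 2 * (a1 + w1)) * (a1 - b1) + (d2 + c2 - 2 * (a2 + w2)) * (a2 - b2) = 0 := by
        linear_combination h2' + f1 - hp
      linear_combination ((d1 - c1) * (a1 - b1) + (d2 - c2) * (a2 - b2)) * g + (-(d1 + c1 - 2 * (a1 + w1)) * (a2 - b2) + (d2 + c2 - 2 * (a2 + w2)) * (a1 - b1)) * h1'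
    linear_combination key - f2 + hq

lemma sb_of_prod {cx cy R : ℝ} {a b c d : 𝔾} (hR : R ≠ 0) (ha : OnC cx cy R a) (hb : OnC cx cy R b)
    (hc : OnC cx cy R c) (hd : OnC cx cy R d)
    (h : (⟨a.re - cx, a.im - cy⟩ : ℂ) * ⟨b.re - cx, b.im - cy⟩ = ⟨c.re - cx, c.im - cy⟩ * ⟨d.re - cx, d.im - cy⟩) :
    SB a b c d := by
  have conv : ∀ z : 𝔾, OnC cx cy R z → (⟨z.re - cx, z.im - cy⟩ : ℂ) * ⟨z.re - cx, -(z.im - cy)⟩ = R := by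
    intro z hz
    unfold OnC at hz
    apply Complex.ext
    · simp only [Complex.mul_re, Complex.mul_im, Complex.sub_re, Complex.sub_im, Complex.add_re, Complex.add_im, Complex.ofReal_re, Complex.ofReal_im, Complex.zero_re, Complex.zero_im]; linear_combination hz
    · simp only [Complex.mul_re, Complex.mul_im, Complex.sub_re, Complex.sub_im, Complex.add_re, Complex.add_im, Complex.ofReal_re, Complex.ofReal_im, Complex.zero_re, Complex.zero_im]; ring
  have ca := conv a ha
  have cb := conv b hb
  have cc := conv c hc
  have cd := conv d hd
  have hR' : (R : ℂ) ≠ 0 := by exact_mod_cast hR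
  have na : (⟨a.re - cx, a.im - cy⟩ : ℂ) ≠ 0 := left_ne_zero_of_mul (ca.trans_ne hR')
  have nb : (⟨b.re - cx, b.im - cy⟩ : ℂ) ≠ 0 := left_ne_zero_of_mul (cb.trans_ne hR')
  have k1 : ((⟨a.re - cx, a.im - cy⟩ : ℂ) - ⟨b.re - cx, b.im - cy⟩) * (⟨c.re - cx, -(c.im - cy)⟩ - ⟨d.re - cx, -(d.im - cy)⟩)
     = ((⟨a.re - cx, -(a.im - cy)⟩ : ℂ) - ⟨b.re - cx, -(b.im - cy)⟩) * (⟨c.re - cx, (c.im - cy)⟩ - ⟨d.re - cx, (d.im - cy)⟩) := by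
    generalize (⟨a.re - cx, a.im - cy⟩ : ℂ) = A at *
    generalize (⟨b.re - cx, b.im - cy⟩ : ℂ) = B at *
    generalize (⟨c.re - cx, c.im - cy⟩ : ℂ) = C at *
    generalize (⟨d.re - cx, d.im - cy⟩ : ℂ) = D at *
    generalize (⟨a.re - cx, -(a.im - cy)⟩ : ℂ) = A' at *
    generalize (⟨b.re - cx, -(b.im - cy)⟩ : ℂ) = B' at *
    generalize (⟨c.re - cx, -(c.im - cy)⟩ : ℂ) = C' at *
    generalize (⟨d.re - cx, -(d.im - cy)⟩ : ℂ) = D' at *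
    apply mul_left_cancel₀ (mul_ne_zero na nb)
    linear_combination (A - B) * (C' - D') * h + (A - B) * D * cc - (A - B) * C * cd - (C - D) * B * ca + (C - D) * A * cb
  have k2 : (((⟨c.re - cx, c.im - cy⟩ : ℂ) + ⟨d.re - cx, d.im - cy⟩) * (⟨a.re - cx, -(a.im - cy)⟩ - ⟨b.re - cx, -(b.im - cy)⟩))
     + (((⟨c.re - cx, -(c.im - cy)⟩ : ℂ) + ⟨d.re - cx, -(d.im - cy)⟩) * (⟨a.re - cx, (a.im - cy)⟩ - ⟨b.re - cx, (b.im - cy)⟩)) = 0 := by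
    generalize (⟨a.re - cx, a.im - cy⟩ : ℂ) = A at *
    generalize (⟨b.re - cx, b.im - cy⟩ : ℂ) = B at *
    generalize (⟨c.re - cx, c.im - cy⟩ : ℂ) = C at *
    generalize (⟨d.re - cx, d.im - cy⟩ : ℂ) = D at *
    generalize (⟨a.re - cx, -(a.im - cy)⟩ : ℂ) = A' at *
    generalize (⟨b.re - cx, -(b.im - cy)⟩ : ℂ) = B' at *
    generalize (⟨c.re - cx, -(c.im - cy)⟩ : ℂ) = C' at *
    generalize (⟨d.re - cx, -(d.im - cy)⟩ : ℂ) = D' at *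
    apply mul_left_cancel₀ (mul_ne_zero na nb)
    linear_combination (A - B) * (C' + D') * h + (A - B) * D * cc + (A - B) * C * cd + (C + D) * B * ca - (C + D) * A * cb
  have k1' := congrArg Complex.im k1
  have k2' := congrArg Complex.re k2
  simp only [Complex.mul_re, Complex.mul_im, Complex.sub_re, Complex.sub_im, Complex.add_re, Complex.add_im, Complex.ofReal_re, Complex.ofReal_im, Complex.zero_re, Complex.zero_im] at k1' k2'
  unfold OnC at *
  constructor
  · simp only [Zsqrtd.im_mul, Zsqrtd.re_star, Zsqrtd.im_star, Zsqrtd.re_sub, Zsqrtd.im_sub]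
    suffices h : (((a.re : ℝ) - b.re) * (-((c.im : ℝ) - d.im)) + (a.im - b.im) * (c.re - d.re)) = 0 by exact_mod_cast h
    linear_combination k1' / 2
  · simp only [Zsqrtd.re_mul, Zsqrtd.re_star, Zsqrtd.im_star, Zsqrtd.re_sub, Zsqrtd.im_sub, Zsqrtd.re_add, Zsqrtd.im_add]
    suffices h : ((c.re : ℝ) + d.re - a.re - b.re) * (a.re - b.re) + -1 * (c.im + d.im - a.im - b.im) * -(a.im - b.im) = 0 by exact_mod_cast h
    linear_combination k2' / 2 - ha + hb

lemma onc_R {cx cy R : ℝ} {a b : 𝔾} (ha : OnC cx cy R a) (hb : OnC cx cy R b) (hab : a ≠ b) : 0 < R := by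
  unfold OnC at *
  have e1 : ((a.re - b.re) ^ 2 + (a.im - b.im) ^ 2 : ℝ) ≠ 0 := by exact_mod_cast gsq_ne hab
  by_contra hR
  push Not at hR
  have q1 := sq_nonneg ((a.re : ℝ) - cx)
  have q2 := sq_nonneg ((a.im : ℝ) - cy)
  have q3 := sq_nonneg ((b.re : ℝ) - cx)
  have q4 := sq_nonneg ((b.im : ℝ) - cy)
  have r1 : ((a.re : ℝ) - cx) = 0 := by apply pow_eq_zero_iff (two_ne_zero) |>.mp; linarith
  have r2 : ((a.im : ℝ) - cy) = 0 := by apply pow_eq_zero_iff (two_ne_zero) |>.mp; linarith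
  have r3 : ((b.re : ℝ) - cx) = 0 := by apply pow_eq_zero_iff (two_ne_zero) |>.mp; linarith
  have r4 : ((b.im : ℝ) - cy) = 0 := by apply pow_eq_zero_iff (two_ne_zero) |>.mp; linarith
  apply e1
  rw [show (a.re : ℝ) - b.re = 0 by linarith, show (a.im : ℝ) - b.im = 0 by linarith]; norm_num

lemma onc_trap {cx cy R : ℝ} {a b c d : 𝔾} (ha : OnC cx cy R a) (hb : OnC cx cy R b)
    (hc : OnC cx cy R c) (hd : OnC cx cy R d) (hab : a ≠ b) (h : gn (b - a) = gn (d - c)) :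
    SB a c b d ∨ SB a d b c := by
  have hR : R ≠ 0 := (onc_R ha hb hab).ne'
  have conv : ∀ z : 𝔾, OnC cx cy R z → (⟨z.re - cx, z.im - cy⟩ : ℂ) * ⟨z.re - cx, -(z.im - cy)⟩ = R := by
    intro z hz
    unfold OnC at hz
    apply Complex.ext
    · simp only [Complex.mul_re, Complex.mul_im, Complex.sub_re, Complex.sub_im, Complex.add_re, Complex.add_im, Complex.ofReal_re, Complex.ofReal_im, Complex.zero_re, Complex.zero_im]; linear_combination hz
    · simp only [Complex.mul_re, Complex.mul_im, Complex.sub_re, Complex.sub_im, Complex.add_re, Complex.add_im, Complex.ofReal_re, Complex.ofReal_im, Complex.zero_re, Complex.zero_im]; ring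
  have ca := conv a ha
  have cb := conv b hb
  have cc := conv c hc
  have cd := conv d hd
  have hR' : (R : ℂ) ≠ 0 := by exact_mod_cast hR
  have hz : ((gn (b - a) : ℤ)) = gn (d - c) := by rw [h]
  rw [gn_int, gn_int] at hz
  simp only [Zsqrtd.re_sub, Zsqrtd.im_sub] at hz
  have hz' : ((b.re : ℝ) - a.re) * (b.re - a.re) + (b.im - a.im) * (b.im - a.im) =
    ((d.re : ℝ) - c.re) * (d.re - c.re) + (d.im - c.im) * (d.im - c.im) := by exact_mod_cast hz
  have key : (⟨a.re - cx, a.im - cy⟩ : ℂ) * ⟨b.re - cx, -(b.im - cy)⟩ + ⟨a.re - cx, -(a.im - cy)⟩ * ⟨b.re - cx, b.im - cy⟩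
    = ⟨c.re - cx, c.im - cy⟩ * ⟨d.re - cx, -(d.im - cy)⟩ + ⟨c.re - cx, -(c.im - cy)⟩ * ⟨d.re - cx, d.im - cy⟩ := by
    unfold OnC at *
    apply Complex.ext
    · simp only [Complex.mul_re, Complex.mul_im, Complex.sub_re, Complex.sub_im, Complex.add_re, Complex.add_im, Complex.ofReal_re, Complex.ofReal_im, Complex.zero_re, Complex.zero_im]; linear_combination -hz' + ha + hb - hc - hd
    · simp only [Complex.mul_re, Complex.mul_im, Complex.sub_re, Complex.sub_im, Complex.add_re, Complex.add_im, Complex.ofReal_re, Complex.ofReal_im, Complex.zero_re, Complex.zero_im]; ring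
  have p : ((⟨a.re - cx, a.im - cy⟩ : ℂ) * ⟨c.re - cx, c.im - cy⟩ - ⟨b.re - cx, b.im - cy⟩ * ⟨d.re - cx, d.im - cy⟩) *
     ((⟨a.re - cx, a.im - cy⟩ : ℂ) * ⟨d.re - cx, d.im - cy⟩ - ⟨b.re - cx, b.im - cy⟩ * ⟨c.re - cx, c.im - cy⟩) = 0 := by
    generalize (⟨a.re - cx, a.im - cy⟩ : ℂ) = A at *
    generalize (⟨b.re - cx, b.im - cy⟩ : ℂ) = B at *
    generalize (⟨c.re - cx, c.im - cy⟩ : ℂ) = C at *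
    generalize (⟨d.re - cx, d.im - cy⟩ : ℂ) = D at *
    generalize (⟨a.re - cx, -(a.im - cy)⟩ : ℂ) = A' at *
    generalize (⟨b.re - cx, -(b.im - cy)⟩ : ℂ) = B' at *
    generalize (⟨c.re - cx, -(c.im - cy)⟩ : ℂ) = C' at *
    generalize (⟨d.re - cx, -(d.im - cy)⟩ : ℂ) = D' at *
    apply mul_left_cancel₀ hR'
    linear_combination A * B * C * D * key - A ^ 2 * C * D * cb - B ^ 2 * C * D * ca + C ^ 2 * A * B * cd + D ^ 2 * A * B * cc
  rcases mul_eq_zero.mp p with h | h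
  · exact Or.inl (sb_of_prod hR ha hc hb hd (sub_eq_zero.mp h))
  · exact Or.inr (sb_of_prod hR ha hd hb hc (sub_eq_zero.mp h))

/-- two coincidences of bisectors give a right angle -/
lemma sb_sb {a b c d : 𝔾} (h : SB a b c d) (h' : SB a c b d) (hn : ((b - a) * star (c - a)).im ≠ 0) :
    ((b - a) * star (c - a)).re = 0 := by
  obtain ⟨h1, h2⟩ := h
  obtain ⟨h3, h4⟩ := h'
  simp only [Zsqrtd.im_mul, Zsqrtd.re_mul, Zsqrtd.re_star, Zsqrtd.im_star, Zsqrtd.re_sub,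
    Zsqrtd.im_sub, Zsqrtd.re_add, Zsqrtd.im_add] at h1 h2 h3 h4 hn ⊢
  have v1 : d.re - b.re - c.re + a.re = 0 := by
    apply mul_left_cancel₀ hn
    linear_combination (c.re - a.re) * h1 - (b.re - a.re) * h3
  have v2 : d.im - b.im - c.im + a.im = 0 := by
    apply mul_left_cancel₀ hn
    linear_combination (c.im - a.im) * h1 - (b.im - a.im) * h3
  have : 2 * ((b.re - a.re) * (c.re - a.re) + -1 * (b.im - a.im) * -(c.im - a.im)) = 0 := by
    linear_combination -h2 - (b.re - a.re) * v1 - (b.im - a.im) * v2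
  linarith

lemma bis_alg {x y q : 𝔾} (hx : x ≠ 0) (hy : y ≠ 0) (hq : q ≠ 0)
    (hc : (x * (q - y) * star (y * (q - x))).im = 0)
    (hg : gn (x * y) = gn ((x - q) * (y - q))) :
    gn y = gn (q - x) ∨ (2 * x - q) * star (2 * y - q) = -(q * star q) := by
  set X := x * star y with hX
  set Y := (x - q) * star (y - q) with hY
  have hXY : (X * star Y).im = 0 := by
    rw [hX, hY, ← hc]
    congr 1
    simp only [star_mul', star_sub, star_star]; ring
  have hn : gn X = gn Y := by
    rw [hX, hY, gn_mul, gn_star, gn_mul, gn_star, ← gn_mul, ← gn_mul, hg]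
  have hX0 : X ≠ 0 := mul_ne_zero hx (by rwa [Ne, star_eq_zero])
  have h3 : X = Y ∨ X = -Y := by
    have e1 : ((gn X : ℤ)) = gn Y := by rw [hn]
    have e0 : ((gn X : ℤ) : 𝔾) ≠ 0 := by have := gn_pos hX0; exact_mod_cast (by omega)
    have e2 : X * star Y = (((X * star Y).re : ℤ) : 𝔾) := by
      ext
      · simp
      · rw [hXY]; simp
    have e3 : (X * star Y).re ^ 2 = (gn X : ℤ) ^ 2 := by
      have := gn_int (X * star Y)
      rw [hXY, gn_mul, gn_star, ← hn] at this
      push_cast at this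
      linear_combination -this
    have e4 : ((gn X : ℤ) : 𝔾) * X = ((X * star Y).re : 𝔾) * Y := by
      rw [← e2, e1, ← gint_mul_star]; ring
    rcases sq_eq_sq_iff_eq_or_eq_neg.mp e3 with h | h
    · left
      rw [h] at e4
      exact mul_left_cancel₀ e0 e4
    · right
      rw [h] at e4
      apply mul_left_cancel₀ e0
      rw [e4]; push_cast; ring
  rcases h3 with h | h
  · left
    have e : q * star y = star q * (q - x) := by
      rw [hX, hY] at h
      rw [star_sub] at h
      linear_combination h
    have h2 := congrArg gn e
    rw [gn_mul, gn_mul, gn_star, gn_star] at h2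
    exact Nat.eq_of_mul_eq_mul_left (gn_pos hq) h2
  · right
    rw [hX, hY, star_sub] at h
    rw [star_sub, star_mul', show star (2 : 𝔾) = 2 from star_ofNat 2]
    linear_combination 2 * h

/-! ### Counting degenerate configurations -/

noncomputable def tup (m : ℕ) : Finset (Fin 4 → GaussianInt) := Fintype.piFinset (fun _ : Fin 4 => bx m)

lemma mem_tup {m : ℕ} {z : Fin 4 → 𝔾} : z ∈ tup m ↔ ∀ i, z i ∈ bx m := by
  unfold tup; exact Fintype.mem_piFinset

lemma tup_ext {i j k l : Fin 4} (hd : D4 i j k l) {z w : Fin 4 → 𝔾} (hi : z i = w i) (hj : z j = w j)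
    (hk : z k = w k) (hl : z l = w l) : z = w := by
  funext a
  rcases hd.cases a with rfl | rfl | rfl | rfl <;> assumption

lemma gn_bx {m n : ℕ} (h : m ≤ n) {z w : 𝔾} (hz : z ∈ bx m) (hw : w ∈ bx m) : gn (z - w) ≤ 2 * n ^ 2 := by
  rw [mem_bx] at hz hw
  zify
  rw [gn_int, Zsqrtd.re_sub, Zsqrtd.im_sub]
  have h' : (m : ℤ) ≤ n := by exact_mod_cast h
  obtain ⟨⟨a1, a2⟩, a3, a4⟩ := hz
  obtain ⟨⟨b1, b2⟩, b3, b4⟩ := hw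
  have e1 : |z.re - w.re| ≤ |(n : ℤ)| := by rw [abs_le]; rw [abs_of_nonneg (by omega)]; constructor <;> linarith
  have e2 : |z.im - w.im| ≤ |(n : ℤ)| := by rw [abs_le]; rw [abs_of_nonneg (by omega)]; constructor <;> linarith
  have := sq_le_sq.mpr e1
  have := sq_le_sq.mpr e2
  nlinarith

lemma abs_bx {n : ℕ} {x y : 𝔾} (hx : gn x ≤ 2 * n ^ 2) (hy : gn y ≤ 2 * n ^ 2) :
    gn (x * star y) ≤ 4 * n ^ 4 := by
  rw [gn_mul, gn_star]
  calc gn x * gn y ≤ (2 * n ^ 2) * (2 * n ^ 2) := Nat.mul_le_mul hx hy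
    _ = _ := by ring

noncomputable def axisK (n : ℕ) : Finset GaussianInt :=
  (Finset.Icc (-(2 * n ^ 2 : ℤ)) (2 * n ^ 2)).image (fun r => (⟨r, 0⟩ : 𝔾)) ∪
  (Finset.Icc (-(2 * n ^ 2 : ℤ)) (2 * n ^ 2)).image (fun r => (⟨0, r⟩ : 𝔾))

lemma card_axisK (n : ℕ) : ((axisK n).card : ℝ) ≤ 2 * (4 * (n : ℝ) ^ 2 + 1) := by
  have h1 : (axisK n).card ≤ 2 * (4 * n ^ 2 + 1) := by
    unfold axisK
    refine (Finset.card_union_le _ _).trans ?_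
    have : (Finset.Icc (-(2 * n ^ 2 : ℤ)) (2 * n ^ 2)).card = 4 * n ^ 2 + 1 := by
      rw [Int.card_Icc]
      have : (0 : ℤ) ≤ 2 * n ^ 2 := by positivity
      zify
      rw [Int.toNat_of_nonneg (by linarith)]; ring
    have := Finset.card_image_le (s := Finset.Icc (-(2 * n ^ 2 : ℤ)) (2 * n ^ 2)) (f := fun r => (⟨r, 0⟩ : 𝔾))
    have := Finset.card_image_le (s := Finset.Icc (-(2 * n ^ 2 : ℤ)) (2 * n ^ 2)) (f := fun r => (⟨0, r⟩ : 𝔾))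
    omega
  exact_mod_cast h1

lemma mem_axisK {n : ℕ} {w : 𝔾} (hw : gn w ≤ 4 * n ^ 4) (h : w.im = 0 ∨ w.re = 0) : w ∈ axisK n := by
  have h1 : w.re * w.re + w.im * w.im ≤ (2 * n ^ 2) ^ 2 := by
    rw [← gn_int]
    have : (gn w : ℤ) ≤ 4 * n ^ 4 := by exact_mod_cast hw
    linarith
  have h0 : (0 : ℤ) ≤ 2 * n ^ 2 := by positivity
  unfold axisK
  rw [Finset.mem_union, Finset.mem_image, Finset.mem_image]
  rcases h with h | h
  · left
    refine ⟨w.re, ?_, by ext <;> simp [h]⟩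
    rw [Finset.mem_Icc, ← abs_le]
    exact abs_le_of_sq_le_sq (by nlinarith) h0
  · right
    refine ⟨w.im, ?_, by ext <;> simp [h]⟩
    rw [Finset.mem_Icc, ← abs_le]
    exact abs_le_of_sq_le_sq (by nlinarith) h0

lemma col_count {m n : ℕ} (hn : m + 1 = n) {T : ℝ} (hT1 : 1 ≤ T) (hT : DivB (4 * n ^ 4) T)
    {i j k l : Fin 4} (hd : D4 i j k l) (S : Finset (Fin 4 → 𝔾)) (hS : S ⊆ tup m)
    (h : ∀ z ∈ S, z i ≠ z j ∧ SB (z i) (z j) (z k) (z l) ∧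
      (((z j - z i) * star (z k - z i)).im = 0 ∨ ((z j - z i) * star (z k - z i)).re = 0)) :
    (S.card : ℝ) ≤ 11 * T * (n : ℝ) ^ 4 := by
  classical
  have hn1 : (1 : ℝ) ≤ n := by exact_mod_cast (by omega : 1 ≤ n)
  have hb : ((bx m).card : ℝ) = (n : ℝ) ^ 2 := by rw [card_bx, hn]; push_cast; rfl
  have hg : ∀ z ∈ S, ∀ a b, gn (z a - z b) ≤ 2 * n ^ 2 := fun z hz a b =>
    gn_bx (by omega) (mem_tup.mp (hS hz) a) (mem_tup.mp (hS hz) b)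
  have h1 : ((S.filter (fun z => z k = z i)).card : ℝ) ≤ (n : ℝ) ^ 4 := by
    have : (S.filter (fun z => z k = z i)).card ≤ ((bx m) ×ˢ (bx m)).card := by
      apply Finset.card_le_card_of_injOn (fun z => (z i, z j))
      · intro z hz
        have hz := (Finset.mem_filter.mp hz).1
        simp only [Finset.coe_product, Set.mem_prod, Finset.mem_coe]
        exact ⟨mem_tup.mp (hS hz) _, mem_tup.mp (hS hz) _⟩
      · intro z hz w hw e
        obtain ⟨hz, ez⟩ := Finset.mem_filter.mp hz
        obtain ⟨hw, ew⟩ := Finset.mem_filter.mp hw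
        simp only [Prod.mk.injEq] at e
        have ek : z k = w k := by rw [ez, ew, e.1]
        refine tup_ext hd e.1 e.2 ek ?_
        apply sb_det (h z hz).1 (h z hz).2.1
        have := (h w hw).2.1
        rwa [← e.1, ← e.2, ← ek] at this
    rw [Finset.card_product] at this
    calc _ ≤ (((bx m).card * (bx m).card : ℕ) : ℝ) := by exact_mod_cast this
      _ = _ := by push_cast; rw [hb]; ring
  have h2 : ((S.filter (fun z => ¬ z k = z i)).card : ℝ) ≤ T * ((bx m) ×ˢ (axisK n)).card := by
    apply card_fib' _ (fun z => (z i, (z j - z i) * star (z k - z i))) _ T (by linarith)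
    · intro z hz
      have hz := (Finset.mem_filter.mp hz).1
      rw [Finset.mem_product]
      exact ⟨mem_tup.mp (hS hz) _, mem_axisK (abs_bx (hg z hz _ _) (hg z hz _ _)) (h z hz).2.2⟩
    · intro z hz
      obtain ⟨hz, ez⟩ := Finset.mem_filter.mp hz
      rw [← Finset.card_image_of_injOn (f := fun z => z j - z i)]
      · apply hT ((z j - z i) * star (z k - z i)) _ (abs_bx (hg z hz _ _) (hg z hz _ _))
        · intro d hd'
          obtain ⟨w, hw, rfl⟩ := Finset.mem_image.mp hd'
          have := (Finset.mem_filter.mp hw).2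
          simp only [Prod.mk.injEq] at this
          exact ⟨_, this.2.symm⟩
        · apply mul_ne_zero (sub_ne_zero.mpr (h z hz).1.symm)
          rw [Ne, star_eq_zero, sub_eq_zero]; exact ez
      · intro u hu v hv e
        simp only [Finset.coe_filter, Set.mem_ofPred_eq, Finset.mem_filter, Prod.mk.injEq] at hu hv
        obtain ⟨⟨hu, -⟩, ui, uw⟩ := hu
        obtain ⟨⟨hv, -⟩, vi, vw⟩ := hv
        simp only at e
        have ei : u i = v i := by rw [ui, vi]
        have ej : u j = v j := by rw [ei] at e; exact sub_left_injective e
        have ek : u k = v k := by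
          have e2 : (u j - u i) * star (u k - u i) = (u j - u i) * star (v k - u i) := by
            rw [uw, ← vw, ei, ej]
          have := star_injective (mul_left_cancel₀ (sub_ne_zero.mpr (h u hu).1.symm) e2)
          exact sub_left_injective this
        refine tup_ext hd ei ej ek ?_
        apply sb_det (h u hu).1 (h u hu).2.1
        have := (h v hv).2.1
        rwa [← ei, ← ej, ← ek] at this
  rw [Finset.card_product] at h2
  push_cast at h2
  rw [hb] at h2
  have h3 := card_axisK n
  rw [← Finset.card_filter_add_card_filter_not (s := S) (fun z => z k = z i)]
  push_cast
  have h4 : T * ((n : ℝ) ^ 2 * (axisK n).card) ≤ T * ((n : ℝ) ^ 2 * (10 * n ^ 2)) := by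
    gcongr
    nlinarith
  nlinarith [pow_pos (by linarith : (0 : ℝ) < n) 4]

lemma bis_count {m n : ℕ} (hn : m + 1 = n) {T : ℝ} (hT1 : 1 ≤ T) (hT : DivB (4 * n ^ 4) T)
    {i j k l : Fin 4} (hd : D4 i j k l) (S : Finset (Fin 4 → 𝔾)) (hS : S ⊆ tup m)
    (h : ∀ z ∈ S, z i ≠ z j ∧ (2 * (z k - z i) - (z j - z i)) * star (2 * (z l - z i) - (z j - z i)) =
      -((z j - z i) * star (z j - z i))) :
    (S.card : ℝ) ≤ T * (n : ℝ) ^ 4 := by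
  classical
  have hb : ((bx m).card : ℝ) = (n : ℝ) ^ 2 := by rw [card_bx, hn]; push_cast; rfl
  have hg : ∀ z ∈ S, ∀ a b, gn (z a - z b) ≤ 2 * n ^ 2 := fun z hz a b =>
    gn_bx (by omega) (mem_tup.mp (hS hz) a) (mem_tup.mp (hS hz) b)
  have hz2 : (2 : 𝔾) ≠ 0 := by
    intro h; have := congrArg Zsqrtd.re h; simp at this
  have h2 : (S.card : ℝ) ≤ T * ((bx m) ×ˢ (bx m)).card := by
    apply card_fib' _ (fun z => (z i, z j)) _ T (by linarith)
    · intro z hz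
      rw [Finset.mem_product]
      exact ⟨mem_tup.mp (hS hz) _, mem_tup.mp (hS hz) _⟩
    · intro z hz
      have hq : z j - z i ≠ 0 := sub_ne_zero.mpr (h z hz).1.symm
      have hw0 : -((z j - z i) * star (z j - z i)) ≠ 0 := by
        apply neg_ne_zero.mpr
        apply mul_ne_zero hq
        rwa [Ne, star_eq_zero]
      rw [← Finset.card_image_of_injOn (f := fun z => 2 * (z k - z i) - (z j - z i))]
      · apply hT (-((z j - z i) * star (z j - z i))) hw0
        · rw [gn_neg]
          exact (abs_bx (hg z hz _ _) (hg z hz _ _))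
        · intro d hd'
          obtain ⟨w, hw, rfl⟩ := Finset.mem_image.mp hd'
          obtain ⟨hw, e⟩ := Finset.mem_filter.mp hw
          simp only [Prod.mk.injEq] at e
          rw [← e.1, ← e.2]
          exact ⟨_, (h w hw).2.symm⟩
      · intro u hu v hv e
        simp only [Finset.coe_filter, Set.mem_ofPred_eq, Prod.mk.injEq] at hu hv
        obtain ⟨hu, ui, uj⟩ := hu
        obtain ⟨hv, vi, vj⟩ := hv
        simp only at e
        have ei : u i = v i := by rw [ui, vi]
        have ej : u j = v j := by rw [uj, vj]
        have ek : u k = v k := by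
          rw [ei, ej] at e
          apply mul_left_cancel₀ hz2
          linear_combination e
        refine tup_ext hd ei ej ek ?_
        have e1 := (h u hu).2
        have e2 := (h v hv).2
        rw [← ei, ← ej, ← ek] at e2
        have hnz : (2 * (u k - u i) - (u j - u i)) ≠ 0 := by
          intro h0
          rw [h0, zero_mul, ui, uj] at e1
          exact hw0 e1.symm
        have e3 := star_injective (mul_left_cancel₀ hnz (e1.trans e2.symm))
        apply mul_left_cancel₀ hz2
        linear_combination e3
  rw [Finset.card_product] at h2
  push_cast at h2
  rw [hb] at h2
  calc _ ≤ _ := h2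
    _ = _ := by ring

/-! ### From circles to pairs of segments with a common bisector -/

def Circ (z : Fin 4 → GaussianInt) : Prop := ∃ cx cy R, ∀ i, OnC cx cy R (z i)

open Classical in
noncomputable def CT (m : ℕ) : Finset (Fin 4 → GaussianInt) :=
  (tup m).filter (fun z => Function.Injective z ∧ Circ z)

open Classical in
noncomputable def Wt (m : ℕ) (i j k l : Fin 4) : Finset (Fin 4 → GaussianInt) :=
  (tup m).filter (fun z => z i ≠ z j ∧ z k ≠ z l ∧ SB (z i) (z j) (z k) (z l))

lemma card_Wt (m : ℕ) {i j k l : Fin 4} (hd : D4 i j k l) : (Wt m i j k l).card = Wall m := by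
  classical
  unfold Wt Wall
  apply Finset.card_nbij' (fun z => ((z i, z j), (z k, z l)))
    (fun P a => if a = i then P.1.1 else if a = j then P.1.2 else if a = k then P.2.1 else P.2.2)
  · intro z hz
    obtain ⟨h1, h2⟩ := Finset.mem_filter.mp hz
    rw [mem_tup] at h1
    refine Finset.mem_filter.mpr ⟨?_, h2⟩
    unfold bx4
    simp [h1]
  · intro P hP
    obtain ⟨h1, h2⟩ := Finset.mem_filter.mp hP
    unfold bx4 at h1
    simp only [Finset.mem_product] at h1
    refine Finset.mem_filter.mpr ⟨?_, ?_⟩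
    · rw [mem_tup]
      intro a
      dsimp only
      split_ifs
      exacts [h1.1.1, h1.1.2, h1.2.1, h1.2.2]
    · simpa [hd.ij.symm, hd.ik.symm, hd.il.symm, hd.jk.symm, hd.jl.symm, hd.kl.symm] using h2
  · intro z _
    funext a
    rcases hd.cases a with rfl | rfl | rfl | rfl <;>
      simp [hd.ij.symm, hd.ik.symm, hd.il.symm, hd.jk.symm, hd.jl.symm, hd.kl.symm]
  · intro P _
    simp [hd.ij.symm, hd.ik.symm, hd.il.symm, hd.jk.symm, hd.jl.symm, hd.kl.symm]

lemma nob_count {m n : ℕ} (hn : m + 1 = n) {T c : ℝ} (hT1 : 1 ≤ T) (hT : DivB (4 * n ^ 4) T) (hc0 : 0 ≤ c)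
    (hc : ∀ F : Finset (Fin 4 → Fin 4 → 𝔾), (∀ D ∈ F, Nice D ∧ ∀ i j, gn (D i j) ≤ 2 * n ^ 2) →
      (F.card : ℝ) ≤ c)
    (S : Finset (Fin 4 → 𝔾)) (hS : S ⊆ CT m)
    (h : ∀ z ∈ S, ∀ i j k l, D4 i j k l → ¬ SB (z i) (z j) (z k) (z l)) :
    (S.card : ℝ) ≤ c * (n : ℝ) ^ 2 + 256 * (T * (n : ℝ) ^ 4) := by
  classical
  have hb : ((bx m).card : ℝ) = (n : ℝ) ^ 2 := by rw [card_bx, hn]; push_cast; rfl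
  have hCT : ∀ z ∈ S, z ∈ tup m ∧ Function.Injective z ∧ Circ z := fun z hz => by
    have := hS hz
    unfold CT at this
    exact Finset.mem_filter.mp this
  have hg : ∀ z ∈ S, ∀ a b, gn (z a - z b) ≤ 2 * n ^ 2 := fun z hz a b =>
    gn_bx (by omega) (mem_tup.mp (hCT z hz).1 a) (mem_tup.mp (hCT z hz).1 b)
  set bad : (Fin 4 → 𝔾) → Fin 4 × Fin 4 × Fin 4 × Fin 4 → Prop := fun z p =>
    D4 p.1 p.2.1 p.2.2.1 p.2.2.2 ∧
      (2 * (z p.2.2.1 - z p.1) - (z p.2.1 - z p.1)) * star (2 * (z p.2.2.2 - z p.1) - (z p.2.1 - z p.1)) =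
      -((z p.2.1 - z p.1) * star (z p.2.1 - z p.1)) with hbad
  have hN : ((S.filter (fun z => Nice (fun i j => z j - z i))).card : ℝ) ≤ c * (bx m).card := by
    apply card_fib' _ (fun z => z 0) _ c hc0
    · intro z hz
      exact mem_tup.mp (hCT z (Finset.mem_filter.mp hz).1).1 0
    · intro z _
      rw [← Finset.card_image_of_injOn (f := fun (z : Fin 4 → 𝔾) (i j : Fin 4) => z j - z i)]
      · apply hc
        intro D hD
        obtain ⟨w, hw, rfl⟩ := Finset.mem_image.mp hD
        have hw := (Finset.mem_filter.mp hw).1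
        exact ⟨(Finset.mem_filter.mp hw).2, fun i j => hg w (Finset.mem_filter.mp hw).1 j i⟩
      · intro u hu v hv e
        have hu := (Finset.mem_filter.mp hu).2
        have hv := (Finset.mem_filter.mp hv).2
        funext a
        have := congrFun (congrFun e 0) a
        dsimp only at this hu hv
        rw [hu, hv] at this
        exact sub_left_injective this
  have hB : ∀ p, ((S.filter (fun z => bad z p)).card : ℝ) ≤ T * (n : ℝ) ^ 4 := by
    intro p
    by_cases hd : D4 p.1 p.2.1 p.2.2.1 p.2.2.2
    · apply bis_count hn hT1 hT hd
      · exact fun z hz => (hCT z (Finset.mem_filter.mp hz).1).1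
      · intro z hz
        obtain ⟨hz, h2⟩ := Finset.mem_filter.mp hz
        exact ⟨(hCT z hz).2.1.ne hd.ij, h2.2⟩
    · have : S.filter (fun z => bad z p) = ∅ := by
        apply Finset.filter_false_of_mem
        rintro z _ ⟨h, _⟩
        exact hd h
      rw [this]; simp; positivity
  have hcov : S ⊆ S.filter (fun z => Nice (fun i j => z j - z i)) ∪
      (Finset.univ : Finset (Fin 4 × Fin 4 × Fin 4 × Fin 4)).biUnion (fun p => S.filter (fun z => bad z p)) := by
    intro z hz
    rw [Finset.mem_union, Finset.mem_filter, Finset.mem_biUnion]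
    by_cases hex : ∃ p, bad z p
    · obtain ⟨p, hp⟩ := hex
      exact Or.inr ⟨p, Finset.mem_univ _, Finset.mem_filter.mpr ⟨hz, hp⟩⟩
    · left
      refine ⟨hz, ?_⟩
      obtain ⟨-, hinj, cx, cy, R, hC⟩ := hCT z hz
      have nt : ∀ i j k l, D4 i j k l → gn (z j - z i) ≠ gn (z l - z k) := by
        intro i j k l hd e
        rcases onc_trap (hC i) (hC j) (hC k) (hC l) (hinj.ne hd.ij) e with h' | h'
        · exact h z hz i k j l hd.swap23 h'
        · exact h z hz i l j k hd.swap34.swap23 h'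
      refine ⟨fun i j k => by ring, ?_, ?_, nt, ?_⟩
      · intro i j k l _
        exact onc_conc (hC i) (hC j) (hC k) (hC l)
      · intro i j k l hd
        have := onc_ncol (hC i) (hC j) (hC k) (hinj.ne hd.ij) (hinj.ne hd.ik) (hinj.ne hd.jk)
        rw [show (z j - z i) = -(z i - z j) by ring, show (z k - z j) = -(z j - z k) by ring, star_neg,
          neg_mul_neg]
        exact this
      · intro i j k l hd e
        have b1 : ((z k - z i) * (z j - z i - (z l - z i)) * star ((z l - z i) * (z j - z i - (z k - z i)))).im = 0 := by
          have := onc_conc (hC i) (hC k) (hC l) (hC j)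
          rw [show z j - z i - (z l - z i) = z j - z l by ring, show z j - z i - (z k - z i) = z j - z k by ring]
          exact this
        have b2 : gn ((z k - z i) * (z l - z i)) = gn ((z k - z i - (z j - z i)) * (z l - z i - (z j - z i))) := by
          rw [e]; congr 1; ring
        rcases bis_alg (sub_ne_zero.mpr (hinj.ne hd.ik.symm))
          (sub_ne_zero.mpr (hinj.ne hd.il.symm)) (sub_ne_zero.mpr (hinj.ne hd.ij.symm)) b1 b2 with h' | h'
        · refine nt i l k j hd.swap34.swap23.swap34 ?_
          rw [h']; congr 1; ring
        · exact hex ⟨(i, j, k, l), hd, h'⟩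
  calc (S.card : ℝ) ≤ ((S.filter (fun z => Nice (fun i j => z j - z i)) ∪
      (Finset.univ : Finset (Fin 4 × Fin 4 × Fin 4 × Fin 4)).biUnion (fun p => S.filter (fun z => bad z p))).card : ℝ) := by
        exact_mod_cast Finset.card_le_card hcov
    _ ≤ ((S.filter (fun z => Nice (fun i j => z j - z i))).card : ℝ) +
       ∑ p : Fin 4 × Fin 4 × Fin 4 × Fin 4, ((S.filter (fun z => bad z p)).card : ℝ) := by
        exact_mod_cast (Finset.card_union_le _ _).trans (Nat.add_le_add_left Finset.card_biUnion_le _)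
    _ ≤ c * (n : ℝ) ^ 2 + ∑ p : Fin 4 × Fin 4 × Fin 4 × Fin 4, T * (n : ℝ) ^ 4 := by
        rw [hb] at hN
        exact add_le_add hN (Finset.sum_le_sum fun p _ => hB p)
    _ = _ := by simp

lemma sb_reduce {z : Fin 4 → 𝔾} (hinj : Function.Injective z) {i j k l : Fin 4} (hd : D4 i j k l)
    (h : SB (z i) (z j) (z k) (z l)) :
    SB (z 0) (z 1) (z 2) (z 3) ∨ SB (z 0) (z 2) (z 1) (z 3) ∨ SB (z 0) (z 3) (z 1) (z 2) := by
  have key : ∀ j k l, D4 0 j k l → SB (z 0) (z j) (z k) (z l) →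
      SB (z 0) (z 1) (z 2) (z 3) ∨ SB (z 0) (z 2) (z 1) (z 3) ∨ SB (z 0) (z 3) (z 1) (z 2) := by
    intro j k l hd h
    have h2 := sb_swap34 h
    fin_cases j <;> fin_cases k <;> fin_cases l <;>
      first
      | exact absurd hd (by decide)
      | exact Or.inl h
      | exact Or.inl h2
      | exact Or.inr (Or.inl h)
      | exact Or.inr (Or.inl h2)
      | exact Or.inr (Or.inr h)
      | exact Or.inr (Or.inr h2)
  rcases hd.cases 0 with e | e | e | e <;> subst e
  · exact key _ _ _ hd h
  · exact key _ _ _ hd.swap12 (sb_swap12 h)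
  · exact key _ _ _ hd.opp (sb_opp (hinj.ne hd.ij) h)
  · exact key _ _ _ hd.opp.swap12 (sb_swap12 (sb_opp (hinj.ne hd.ij) h))

lemma wt_diff {m n : ℕ} (hn : m + 1 = n) {T : ℝ} (hT1 : 1 ≤ T) (hT : DivB (4 * n ^ 4) T)
    {i j k l : Fin 4} (hd : D4 i j k l) :
    (((Wt m i j k l) \ CT m).card : ℝ) ≤ 11 * T * (n : ℝ) ^ 4 := by
  classical
  apply col_count hn hT1 hT hd
  · intro z hz
    have := (Finset.mem_sdiff.mp hz).1
    unfold Wt at this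
    exact (Finset.mem_filter.mp this).1
  · intro z hz
    obtain ⟨h1, h2⟩ := Finset.mem_sdiff.mp hz
    unfold Wt at h1
    obtain ⟨h1, hij, hkl, hs⟩ := Finset.mem_filter.mp h1
    refine ⟨hij, hs, Or.inl ?_⟩
    by_contra hne
    apply h2
    unfold CT
    refine Finset.mem_filter.mpr ⟨h1, ?_, ?_⟩
    · have nik : z i ≠ z k := by
        intro e; rw [e] at hne; simp at hne
      have njk : z j ≠ z k := by
        intro e; apply hne; rw [e, gint_mul_star]; simp
      have nil : z i ≠ z l := by
        intro e
        apply hne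
        have := hs.1
        rw [← e] at this
        simp only [Zsqrtd.im_mul, Zsqrtd.re_star, Zsqrtd.im_star, Zsqrtd.re_sub, Zsqrtd.im_sub] at this ⊢
        linear_combination -this
      have njl : z j ≠ z l := by
        intro e
        apply hne
        have := hs.1
        rw [← e] at this
        simp only [Zsqrtd.im_mul, Zsqrtd.re_star, Zsqrtd.im_star, Zsqrtd.re_sub, Zsqrtd.im_sub] at this ⊢
        linear_combination -this
      intro a b e
      rcases hd.cases a with rfl | rfl | rfl | rfl <;> rcases hd.cases b with rfl | rfl | rfl | rfl <;>
        first
        | rfl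
        | exact absurd e ‹_›
        | exact absurd e.symm ‹_›
    · obtain ⟨cx, cy, R, ha, hb, hc, hd'⟩ := onc_of_sb hij hs hne
      refine ⟨cx, cy, R, fun a => ?_⟩
      rcases hd.cases a with rfl | rfl | rfl | rfl <;> assumption

lemma wt_inter {m n : ℕ} (hn : m + 1 = n) {T : ℝ} (hT1 : 1 ≤ T) (hT : DivB (4 * n ^ 4) T)
    {i j k l : Fin 4} (hd : D4 i j k l) (S : Finset (Fin 4 → 𝔾)) (hS : S ⊆ CT m)
    (h1 : ∀ z ∈ S, SB (z i) (z j) (z k) (z l)) (h2 : ∀ z ∈ S, SB (z i) (z k) (z j) (z l)) :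
    (S.card : ℝ) ≤ 11 * T * (n : ℝ) ^ 4 := by
  classical
  have hCT : ∀ z ∈ S, z ∈ tup m ∧ Function.Injective z ∧ Circ z := fun z hz => by
    have := hS hz
    unfold CT at this
    exact Finset.mem_filter.mp this
  apply col_count hn hT1 hT hd
  · exact fun z hz => (hCT z hz).1
  · intro z hz
    obtain ⟨-, hinj, cx, cy, R, hC⟩ := hCT z hz
    refine ⟨hinj.ne hd.ij, h1 z hz, Or.inr (sb_sb (h1 z hz) (h2 z hz) ?_)⟩
    have := onc_ncol (hC j) (hC i) (hC k) (hinj.ne hd.ij.symm) (hinj.ne hd.jk) (hinj.ne hd.ik)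
    rw [show z k - z i = -(z i - z k) by ring, star_neg, mul_neg, Zsqrtd.im_neg]
    exact neg_ne_zero.mpr this

lemma CT_est (ε : ℝ) (hε : 0 < ε) : ∃ C : ℝ, 1 ≤ C ∧ ∀ m n : ℕ, m + 1 = n →
    |((CT m).card : ℝ) - 3 * Wall m| ≤ C * (n : ℝ) ^ ((4 : ℝ) + 18 / 29 + ε) := by
  classical
  obtain ⟨C1, hC1, h1⟩ := divisor_bound (ε / 4) (by positivity)
  obtain ⟨C2, hC2, h2⟩ := nice_count ε hε
  have h41 : (1 : ℝ) ≤ 4 ^ (ε / 4) := Real.one_le_rpow (by norm_num) (by positivity)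
  refine ⟨C2 + 256 * (C1 * 4 ^ (ε / 4)), by nlinarith, ?_⟩
  intro m n hn
  have hn1 : 1 ≤ n := by omega
  have hnr : (1 : ℝ) ≤ n := by exact_mod_cast hn1
  have hn0 : (0 : ℝ) < n := by linarith
  set E := (n : ℝ) ^ ((4 : ℝ) + 18 / 29 + ε) with hE
  have hT := h1 (4 * n ^ 4) (by have := Nat.pow_pos (n := 4) hn1; omega)
  set T := C1 * (((4 * n ^ 4 : ℕ) : ℝ)) ^ (ε / 4) with hTd
  have hTe : T = C1 * 4 ^ (ε / 4) * (n : ℝ) ^ ε := by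
    rw [hTd]; push_cast
    rw [Real.mul_rpow (by norm_num) (by positivity), ← Real.rpow_natCast _ 4, ← Real.rpow_mul hn0.le]
    rw [show ((4 : ℕ) : ℝ) * (ε / 4) = ε by push_cast; ring]; ring
  have hnε : (1 : ℝ) ≤ (n : ℝ) ^ ε := Real.one_le_rpow hnr hε.le
  have hK1 : 1 ≤ C1 * 4 ^ (ε / 4) := by nlinarith
  have hT1 : 1 ≤ T := by rw [hTe]; nlinarith
  have hTE : T * (n : ℝ) ^ 4 ≤ C1 * 4 ^ (ε / 4) * E := by
    rw [hTe, hE, mul_assoc]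
    apply mul_le_mul_of_nonneg_left _ (by linarith)
    rw [← Real.rpow_natCast _ 4, ← Real.rpow_add hn0]
    apply Real.rpow_le_rpow_of_exponent_le hnr
    push_cast; linarith
  set c := C2 * (n : ℝ) ^ (76 / 29 + ε : ℝ) with hcd
  have hc0 : 0 ≤ c := by positivity
  have hcE : c * (n : ℝ) ^ 2 = C2 * E := by
    rw [hcd, hE, mul_assoc, ← Real.rpow_natCast _ 2, ← Real.rpow_add hn0]
    congr 2; push_cast; ring
  set A1 := (CT m).filter (fun z => SB (z 0) (z 1) (z 2) (z 3)) with hA1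
  set A2 := (CT m).filter (fun z => SB (z 0) (z 2) (z 1) (z 3)) with hA2
  set A3 := (CT m).filter (fun z => SB (z 0) (z 3) (z 1) (z 2)) with hA3
  set N := (CT m).filter (fun z => ¬ (SB (z 0) (z 1) (z 2) (z 3) ∨ SB (z 0) (z 2) (z 1) (z 3) ∨
    SB (z 0) (z 3) (z 1) (z 2))) with hN
  have hinj : ∀ z ∈ CT m, z ∈ tup m ∧ Function.Injective z := fun z hz => by
    unfold CT at hz
    exact ⟨(Finset.mem_filter.mp hz).1, (Finset.mem_filter.mp hz).2.1⟩
  have hd1 : D4 0 1 2 3 := by decide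
  have hd2 : D4 0 2 1 3 := by decide
  have hd3 : D4 0 3 1 2 := by decide
  have up : ∀ i j k l, D4 i j k l → (((CT m).filter (fun z => SB (z i) (z j) (z k) (z l))).card : ℝ) ≤ Wall m := by
    intro i j k l hd
    rw [← card_Wt m hd]
    have : ((CT m).filter (fun z => SB (z i) (z j) (z k) (z l))) ⊆ Wt m i j k l := by
      intro z hz
      obtain ⟨hz, hs⟩ := Finset.mem_filter.mp hz
      unfold Wt
      exact Finset.mem_filter.mpr ⟨(hinj z hz).1, (hinj z hz).2.ne hd.ij, (hinj z hz).2.ne hd.kl, hs⟩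
    exact_mod_cast Finset.card_le_card this
  have lo : ∀ i j k l, D4 i j k l → (Wall m : ℝ) ≤
      (((CT m).filter (fun z => SB (z i) (z j) (z k) (z l))).card : ℝ) + 11 * T * (n : ℝ) ^ 4 := by
    intro i j k l hd
    refine le_trans ?_ (add_le_add_right (wt_diff hn hT1 hT hd) _)
    rw [← card_Wt m hd]
    have : Wt m i j k l ⊆ ((CT m).filter (fun z => SB (z i) (z j) (z k) (z l))) ∪ (Wt m i j k l \ CT m) := by
      intro z hz
      rw [Finset.mem_union, Finset.mem_filter, Finset.mem_sdiff]
      by_cases hc : z ∈ CT m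
      · left
        refine ⟨hc, ?_⟩
        unfold Wt at hz
        exact (Finset.mem_filter.mp hz).2.2.2
      · exact Or.inr ⟨hz, hc⟩
    exact_mod_cast (Finset.card_le_card this).trans (Finset.card_union_le _ _)
  have u1 := up _ _ _ _ hd1
  have u2 := up _ _ _ _ hd2
  have u3 := up _ _ _ _ hd3
  have l1 := lo _ _ _ _ hd1
  have l2 := lo _ _ _ _ hd2
  have l3 := lo _ _ _ _ hd3
  rw [← hA1] at u1 l1
  rw [← hA2] at u2 l2
  rw [← hA3] at u3 l3
  have nb : (N.card : ℝ) ≤ c * (n : ℝ) ^ 2 + 256 * (T * (n : ℝ) ^ 4) := by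
    apply nob_count hn hT1 hT hc0 (h2 n hn1) N (Finset.filter_subset _ _)
    intro z hz i j k l hd hs
    obtain ⟨hz, hs'⟩ := Finset.mem_filter.mp hz
    exact hs' (sb_reduce (hinj z hz).2 hd hs)
  have i12 : ((A1 ∩ A2).card : ℝ) ≤ 11 * T * (n : ℝ) ^ 4 := by
    apply wt_inter hn hT1 hT hd1
    · exact fun z hz => (Finset.mem_filter.mp (Finset.mem_inter.mp hz).1).1
    · exact fun z hz => (Finset.mem_filter.mp (Finset.mem_inter.mp hz).1).2
    · exact fun z hz => (Finset.mem_filter.mp (Finset.mem_inter.mp hz).2).2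
  have i13 : ((A1 ∩ A3).card : ℝ) ≤ 11 * T * (n : ℝ) ^ 4 := by
    apply wt_inter hn hT1 hT (show D4 0 1 3 2 by decide)
    · exact fun z hz => (Finset.mem_filter.mp (Finset.mem_inter.mp hz).1).1
    · exact fun z hz => sb_swap34 (Finset.mem_filter.mp (Finset.mem_inter.mp hz).1).2
    · exact fun z hz => (Finset.mem_filter.mp (Finset.mem_inter.mp hz).2).2
  have i23 : ((A2 ∩ A3).card : ℝ) ≤ 11 * T * (n : ℝ) ^ 4 := by
    apply wt_inter hn hT1 hT (show D4 0 2 3 1 by decide)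
    · exact fun z hz => (Finset.mem_filter.mp (Finset.mem_inter.mp hz).1).1
    · exact fun z hz => sb_swap34 (Finset.mem_filter.mp (Finset.mem_inter.mp hz).1).2
    · exact fun z hz => sb_swap34 (Finset.mem_filter.mp (Finset.mem_inter.mp hz).2).2
  have hup : ((CT m).card : ℝ) ≤ N.card + A1.card + A2.card + A3.card := by
    have : CT m ⊆ ((N ∪ A1) ∪ A2) ∪ A3 := by
      intro z hz
      simp only [hN, hA1, hA2, hA3, Finset.mem_union, Finset.mem_filter]
      tauto
    have h3 := Finset.card_le_card this
    have h4 := Finset.card_union_le ((N ∪ A1) ∪ A2) A3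
    have h5 := Finset.card_union_le (N ∪ A1) A2
    have h6 := Finset.card_union_le N A1
    exact_mod_cast (by omega : (CT m).card ≤ N.card + A1.card + A2.card + A3.card)
  have hlo : (A1.card : ℝ) + A2.card + A3.card ≤ (CT m).card + (A1 ∩ A2).card + (A1 ∩ A3).card + (A2 ∩ A3).card := by
    have : (A1 ∪ A2) ∪ A3 ⊆ CT m := by
      intro z hz
      simp only [hA1, hA2, hA3, Finset.mem_union, Finset.mem_filter] at hz
      tauto
    have h3 := Finset.card_le_card this
    have h4 := Finset.card_union_add_card_inter (A1 ∪ A2) A3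
    have h5 := Finset.card_union_add_card_inter A1 A2
    have h6 : ((A1 ∪ A2) ∩ A3).card ≤ (A1 ∩ A3).card + (A2 ∩ A3).card := by
      rw [Finset.union_inter_distrib_right]; exact Finset.card_union_le _ _
    exact_mod_cast (by omega : A1.card + A2.card + A3.card ≤ (CT m).card + (A1 ∩ A2).card + (A1 ∩ A3).card + (A2 ∩ A3).card)
  have hE0 : 0 < E := Real.rpow_pos_of_pos hn0 _
  have hC2E : 0 ≤ C2 * E := by positivity
  have hCE : 0 ≤ C1 * 4 ^ (ε / 4) * E := by positivity
  rw [abs_le]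
  constructor <;> nlinarith

/-! ### Counting four element subsets -/

open Classical in
noncomputable def FS (m : ℕ) : Finset (Finset GaussianInt) :=
  ((bx m).powersetCard 4).filter (fun s => ∃ cx cy R, ∀ z ∈ s, OnC cx cy R z)

lemma inj_fib (s : Finset 𝔾) (hs : s.card = 4) (F : Finset (Fin 4 → 𝔾))
    (hF : ∀ z, z ∈ F ↔ Function.Injective z ∧ ∀ i, z i ∈ s) : F.card = 24 := by
  have h1 : Fintype.card (Fin 4 ↪ s) = 24 := by
    rw [Fintype.card_embedding_eq]
    simp [hs, Nat.descFactorial]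
  rw [← h1, ← Finset.card_univ]
  symm
  apply Finset.card_nbij (fun e i => (e i : 𝔾))
  · intro e _
    exact (hF _).mpr ⟨fun i j h => e.injective (Subtype.ext h), fun i => (e i).2⟩
  · intro e _ e' _ h
    ext i : 2
    exact congrFun h i
  · intro z hz
    obtain ⟨h1, h2⟩ := (hF z).mp hz
    exact ⟨⟨fun i => ⟨z i, h2 i⟩, fun i j h => h1 (by simpa using h)⟩, by simp, rfl⟩

lemma CT_FS (m : ℕ) : (CT m).card = 24 * (FS m).card := by
  classical
  rw [Finset.card_eq_sum_card_fiberwise (f := fun z => Finset.univ.image z) (t := FS m)]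
  · rw [Finset.sum_congr rfl (g := fun _ => 24), Finset.sum_const, smul_eq_mul, mul_comm]
    intro s hs
    unfold FS at hs
    obtain ⟨hs, cx, cy, R, hC⟩ := Finset.mem_filter.mp hs
    obtain ⟨hsub, hs4⟩ := Finset.mem_powersetCard.mp hs
    apply inj_fib s hs4
    intro z
    rw [Finset.mem_filter]
    constructor
    · rintro ⟨h1, h2⟩
      unfold CT at h1
      refine ⟨(Finset.mem_filter.mp h1).2.1, fun i => ?_⟩
      rw [← h2]; exact Finset.mem_image_of_mem _ (Finset.mem_univ _)
    · rintro ⟨h1, h2⟩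
      constructor
      · unfold CT
        exact Finset.mem_filter.mpr ⟨mem_tup.mpr fun i => hsub (h2 i), h1, cx, cy, R, fun i => hC _ (h2 i)⟩
      · apply Finset.eq_of_subset_of_card_le
        · intro x hx
          obtain ⟨i, _, rfl⟩ := Finset.mem_image.mp hx
          exact h2 i
        · rw [Finset.card_image_of_injective _ h1, hs4]; simp
  · intro z hz
    unfold CT at hz
    obtain ⟨h1, h2, cx, cy, R, hC⟩ := Finset.mem_filter.mp hz
    unfold FS
    refine Finset.mem_filter.mpr ⟨Finset.mem_powersetCard.mpr ⟨?_, ?_⟩, cx, cy, R, ?_⟩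
    · intro x hx
      obtain ⟨i, _, rfl⟩ := Finset.mem_image.mp hx
      exact mem_tup.mp h1 i
    · rw [Finset.card_image_of_injective _ h2]; simp
    · intro x hx
      obtain ⟨i, _, rfl⟩ := Finset.mem_image.mp hx
      exact hC i

/-! ### The points of the grid -/

noncomputable def phi (z : GaussianInt) : EuclideanSpace ℝ (Fin 2) := !₂[(z.re : ℝ) + 1, (z.im : ℝ) + 1]

lemma phi_zero (z : 𝔾) : phi z 0 = (z.re : ℝ) + 1 := by simp [phi]
lemma phi_one (z : 𝔾) : phi z 1 = (z.im : ℝ) + 1 := by simp [phi]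

lemma phi_inj : Function.Injective phi := by
  intro z w h
  have h0 := congrArg (fun v : EuclideanSpace ℝ (Fin 2) => v 0) h
  have h1 := congrArg (fun v : EuclideanSpace ℝ (Fin 2) => v 1) h
  simp only [phi_zero, phi_one] at h0 h1
  have h0' : (z.re : ℝ) = w.re := by linarith
  have h1' : (z.im : ℝ) = w.im := by linarith
  exact Zsqrtd.ext (by exact_mod_cast h0') (by exact_mod_cast h1')

lemma grid_eq {m n : ℕ} (hn : m + 1 = n) : grid n = Set.image phi (bx m : Set GaussianInt) := by
  ext x
  unfold grid
  simp only [Set.mem_ofPred_eq, Set.mem_image, Finset.mem_coe, mem_bx]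
  constructor
  · intro h
    obtain ⟨a, a1, a2, a3⟩ := h 0
    obtain ⟨b, b1, b2, b3⟩ := h 1
    refine ⟨⟨(a : ℤ) - 1, (b : ℤ) - 1⟩, ⟨⟨?_, ?_⟩, ?_, ?_⟩, ?_⟩
    · dsimp only; omega
    · dsimp only; omega
    · dsimp only; omega
    · dsimp only; omega
    · ext i
      fin_cases i
      · change phi _ 0 = x 0
        rw [phi_zero, a3]; push_cast; ring
      · change phi _ 1 = x 1
        rw [phi_one, b3]; push_cast; ring
  · rintro ⟨z, ⟨⟨h1, h2⟩, h3, h4⟩, rfl⟩ i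
    fin_cases i
    · refine ⟨(z.re + 1).toNat, by omega, by omega, ?_⟩
      change phi z 0 = _
      rw [phi_zero]
      have : (((z.re + 1).toNat : ℤ) : ℝ) = ((z.re + 1 : ℤ) : ℝ) := by rw [Int.toNat_of_nonneg (by omega)]
      push_cast at this
      linarith
    · refine ⟨(z.im + 1).toNat, by omega, by omega, ?_⟩
      change phi z 1 = _
      rw [phi_one]
      have : (((z.im + 1).toNat : ℤ) : ℝ) = ((z.im + 1 : ℤ) : ℝ) := by rw [Int.toNat_of_nonneg (by omega)]
      push_cast at this
      linarith

lemma phi_sphere (c : EuclideanSpace ℝ (Fin 2)) (ρ : ℝ) (hρ : 0 < ρ) (z : GaussianInt) :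
    phi z ∈ Metric.sphere c ρ ↔ OnC (c 0 - 1) (c 1 - 1) (ρ ^ 2) z := by
  rw [Metric.mem_sphere, EuclideanSpace.dist_eq, Real.sqrt_eq_iff_eq_sq (by positivity) hρ.le, Fin.sum_univ_two,
    phi_zero, phi_one, Real.dist_eq, Real.dist_eq, sq_abs, sq_abs]
  unfold OnC
  rw [show (z.re : ℝ) - (c 0 - 1) = z.re + 1 - c 0 by ring, show (z.im : ℝ) - (c 1 - 1) = z.im + 1 - c 1 by ring]

lemma count_eq {m n : ℕ} (hn : m + 1 = n) : concyclicCount n = (FS m).card := by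
  classical
  unfold concyclicCount
  rw [← Set.ncard_coe_finset (FS m), ← Set.ncard_image_of_injective (f := fun s : Finset GaussianInt => Set.image phi (s : Set GaussianInt)) _ ?_]
  · congr 1
    ext Q
    simp only [Set.mem_ofPred_eq, Set.mem_image, Finset.mem_coe]
    constructor
    · rintro ⟨h1, h2, c, ρ, hρ, h3⟩
      rw [grid_eq hn] at h1
      obtain ⟨s, hs, rfl⟩ := Set.subset_image_iff.mp h1
      have hfin : s.Finite := (bx m).finite_toSet.subset hs
      rw [Set.ncard_image_of_injective _ phi_inj] at h2
      refine ⟨hfin.toFinset, ?_, by rw [Set.Finite.coe_toFinset]⟩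
      unfold FS
      refine Finset.mem_filter.mpr ⟨Finset.mem_powersetCard.mpr ⟨?_, ?_⟩, c 0 - 1, c 1 - 1, ρ ^ 2, ?_⟩
      · intro x hx
        exact_mod_cast hs (hfin.mem_toFinset.mp hx)
      · rw [← Set.ncard_eq_toFinset_card s hfin]; exact h2
      · intro z hz
        exact (phi_sphere c ρ hρ z).mp (h3 (Set.mem_image_of_mem _ (hfin.mem_toFinset.mp hz)))
    · rintro ⟨s, hs, rfl⟩
      unfold FS at hs
      obtain ⟨hs, cx, cy, R, hC⟩ := Finset.mem_filter.mp hs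
      obtain ⟨hsub, hs4⟩ := Finset.mem_powersetCard.mp hs
      obtain ⟨a, ha, b, hb, hab⟩ := Finset.one_lt_card.mp (by omega : 1 < s.card)
      have hR : 0 < R := onc_R (hC a ha) (hC b hb) hab
      refine ⟨?_, ?_, !₂[cx + 1, cy + 1], Real.sqrt R, Real.sqrt_pos.mpr hR, ?_⟩
      · rw [grid_eq hn]
        exact Set.image_mono (by exact_mod_cast hsub)
      · rw [Set.ncard_image_of_injective _ phi_inj, Set.ncard_coe_finset, hs4]
      · rintro _ ⟨z, hz, rfl⟩
        rw [phi_sphere _ _ (Real.sqrt_pos.mpr hR)]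
        simp only [Real.sq_sqrt hR.le]
        simpa using hC z hz
  · intro s t h
    have := Set.image_injective.mpr phi_inj h
    exact_mod_cast this

theorem final_est (ε : ℝ) (hε : 0 < ε) : ∃ C : ℝ, 0 < C ∧ ∃ N : ℕ, ∀ n ≥ N,
      |(concyclicCount n : ℝ) - gammaConst * (n : ℝ) ^ 5| ≤
        C * (n : ℝ) ^ ((4 : ℝ) + 18 / 29 + ε) := by
  obtain ⟨C, hC, h⟩ := CT_est ε hε
  refine ⟨C + 250 + 5 * |gammaConst|, by positivity, 2, ?_⟩
  intro n hn2
  obtain ⟨m, rfl⟩ : ∃ m, n = m + 1 := ⟨n - 1, by omega⟩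
  have hm : 1 ≤ m := by omega
  have h1 := h m (m + 1) rfl
  have h2 := Wall_est m hm
  rw [CT_FS] at h1
  rw [count_eq rfl]
  set n := m + 1 with hn
  have hmr : (m : ℝ) = n - 1 := by rw [hn]; push_cast; ring
  have hnr : (1 : ℝ) ≤ n := by exact_mod_cast (by omega : 1 ≤ n)
  have hn0 : (0 : ℝ) < n := by linarith
  have hm0 : (0 : ℝ) ≤ m := by positivity
  set E := (n : ℝ) ^ ((4 : ℝ) + 18 / 29 + ε) with hE
  have e1 : (m : ℝ) ^ 4 * Real.sqrt m ≤ E := by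
    have a1 : (m : ℝ) ^ 4 ≤ (n : ℝ) ^ 4 := pow_le_pow_left₀ hm0 (by linarith) 4
    have a2 : Real.sqrt m ≤ Real.sqrt n := Real.sqrt_le_sqrt (by linarith)
    calc (m : ℝ) ^ 4 * Real.sqrt m ≤ (n : ℝ) ^ 4 * Real.sqrt n := mul_le_mul a1 a2 (Real.sqrt_nonneg _) (by positivity)
      _ = (n : ℝ) ^ ((4 : ℝ) + 1 / 2) := by
        rw [Real.sqrt_eq_rpow, ← Real.rpow_natCast _ 4, ← Real.rpow_add hn0]; norm_num
      _ ≤ E := Real.rpow_le_rpow_of_exponent_le hnr (by linarith)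
  have e2 : (n : ℝ) ^ 4 ≤ E := by
    rw [hE, ← Real.rpow_natCast _ 4]
    apply Real.rpow_le_rpow_of_exponent_le hnr
    push_cast; linarith
  have e3 : |(n : ℝ) ^ 5 - (m : ℝ) ^ 5| ≤ 5 * (n : ℝ) ^ 4 := by
    rw [abs_of_nonneg (sub_nonneg.mpr (pow_le_pow_left₀ hm0 (by linarith) 5))]
    have hk : ∀ k : ℕ, (m : ℝ) ^ k ≤ (n : ℝ) ^ k := fun k => pow_le_pow_left₀ hm0 (by linarith) k
    have : (n : ℝ) ^ 5 - (m : ℝ) ^ 5 = (n : ℝ) ^ 4 + n ^ 3 * m + n ^ 2 * m ^ 2 + n * m ^ 3 + m ^ 4 := by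
      rw [hmr]; ring
    rw [this]
    have b1 := mul_le_mul_of_nonneg_left (hk 1) (by positivity : (0 : ℝ) ≤ (n : ℝ) ^ 3)
    have b2 := mul_le_mul_of_nonneg_left (hk 2) (by positivity : (0 : ℝ) ≤ (n : ℝ) ^ 2)
    have b3 := mul_le_mul_of_nonneg_left (hk 3) (by positivity : (0 : ℝ) ≤ (n : ℝ))
    have b4 := hk 4
    nlinarith
  have e4 : |gammaConst * (n : ℝ) ^ 5 - gammaConst * (m : ℝ) ^ 5| ≤ 5 * |gammaConst| * E := by
    rw [← mul_sub, abs_mul]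
    have := mul_le_mul_of_nonneg_left (e3.trans (mul_le_mul_of_nonneg_left e2 (by norm_num))) (abs_nonneg gammaConst)
    linarith
  have hE0 : 0 < E := Real.rpow_pos_of_pos hn0 _
  have e5 : |((FS m).card : ℝ) - (Wall m : ℝ) / 8| ≤ C * E := by
    have hCE : 0 ≤ C * E := by positivity
    push_cast at h1
    rw [abs_le] at h1 ⊢
    constructor <;> linarith [h1.1, h1.2]
  have e6 : 250 * (m : ℝ) ^ 4 * Real.sqrt m ≤ 250 * E := by
    rw [mul_assoc]; linarith
  rw [abs_le] at e4 e5 h2 ⊢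
  constructor <;> linarith [e4.1, e4.2, e5.1, e5.2, h2.1, h2.2]

end Proof

theorem cyclic_quadrilateral_count :
    ∀ ε : ℝ, 0 < ε → ∃ C : ℝ, 0 < C ∧ ∃ N : ℕ, ∀ n ≥ N,
      |(concyclicCount n : ℝ) - gammaConst * (n : ℝ) ^ 5| ≤
        C * (n : ℝ) ^ ((4 : ℝ) + 18 / 29 + ε) := by
  intro ε hε
  exact final_est ε hε
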